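/- Let F be a totally real number field with ring of integers 𝓞_F. The group SL₂(𝓞_F) is generated by the following three kinds of elements: the unipotent matrices (1 a; 0 1) with a ∈ 𝓞_F, the diagonal matrices (u 0; 0 u⁻¹) with u a unit of 𝓞_F, and the matrix S = (0 1; −1 0). -/

import Mathlib

open NumberField

set_option linter.unusedSectionVars false

namespace NumberField.TotallyRealSL2

section LogShape
variable {F : Type*} [Field F] [NumberField F]

/-- The logarithms of the archimedean absolute values of `x`, projected to the
trace-zero hyperplane. -/
noncomputable def logShape (x : F) : InfinitePlace F → ℝ := fun v =>
  Real.log (v x) - (∑ w : InfinitePlace F, Real.log (w x)) / Fintype.card (InfinitePlace F)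

lemma logShape_mul {x y : F} (hx : x ≠ 0) (hy : y ≠ 0) :
    logShape (x * y) = logShape x + logShape y := by
  ext v
  have h : ∀ w : InfinitePlace F, Real.log (w (x * y)) = Real.log (w x) + Real.log (w y) :=
    fun w => by
      rw [map_mul, Real.log_mul ((map_ne_zero w).2 hx) ((map_ne_zero w).2 hy)]
  simp only [logShape, h, Finset.sum_add_distrib, Pi.add_apply]
  ring

lemma sum_logShape (x : F) : ∑ v, logShape x v = 0 := by
  have : (Fintype.card (InfinitePlace F) : ℝ) ≠ 0 := by
    simp
  simp only [logShape, Finset.sum_sub_distrib, Finset.sum_const, Finset.card_univ, nsmul_eq_mul]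
  field_simp
  ring

lemma abs_logShape_sub_le {x y : F} {δ : ℝ}
    (h : ∀ v : InfinitePlace F, |Real.log (v x) - Real.log (v y)| ≤ δ) :
    ‖logShape x - logShape y‖ ≤ 2 * δ := by
  have hδ : 0 ≤ δ := (abs_nonneg _).trans (h (Classical.arbitrary _))
  have hc : (0 : ℝ) < Fintype.card (InfinitePlace F) := by exact_mod_cast Fintype.card_pos
  refine (pi_norm_le_iff_of_nonneg (by positivity)).2 fun v => ?_
  have h1 : |∑ w : InfinitePlace F, (Real.log (w x) - Real.log (w y))| ≤
      Fintype.card (InfinitePlace F) * δ := by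
    refine (Finset.abs_sum_le_sum_abs _ _).trans ?_
    refine (Finset.sum_le_card_nsmul _ _ _ fun w _ => h w).trans ?_
    simp
  have h2 : (logShape x - logShape y) v = (Real.log (v x) - Real.log (v y)) -
      (∑ w : InfinitePlace F, (Real.log (w x) - Real.log (w y))) /
        Fintype.card (InfinitePlace F) := by
    simp only [logShape, Pi.sub_apply, Finset.sum_sub_distrib]
    ring
  rw [h2, Real.norm_eq_abs]
  refine (abs_sub _ _).trans ?_
  rw [abs_div, abs_of_pos hc]
  have := (div_le_iff₀' hc).2 h1
  linarith [h v]

variable [IsTotallyReal F]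

lemma sum_log_unit (u : (𝓞 F)ˣ) :
    ∑ w : InfinitePlace F, Real.log (w ((u : 𝓞 F) : F)) = 0 := by
  simpa using Units.sum_mult_mul_log u

lemma logShape_unit (u : (𝓞 F)ˣ) (v : InfinitePlace F) :
    logShape ((u : 𝓞 F) : F) v = Real.log (v ((u : 𝓞 F) : F)) := by
  simp [logShape, sum_log_unit]

lemma exists_unit_logShape_le : ∃ R : ℝ, 0 < R ∧ ∀ x : F, x ≠ 0 →
    ∃ u : (𝓞 F)ˣ, ‖logShape (((u : 𝓞 F) : F) * x)‖ ≤ R := by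
  classical
  let w₀ := Units.dirichletUnitTheorem.w₀ (K := F)
  have : IsZLattice ℝ (Units.unitLattice F) := ⟨Units.dirichletUnitTheorem.unitLattice_span_eq_top F⟩
  let b0 := Module.Free.chooseBasis ℤ (Units.unitLattice F)
  let b := b0.ofZLatticeBasis ℝ (Units.unitLattice F)
  let C := ∑ i, ‖b i‖
  have hC : 0 ≤ C := Finset.sum_nonneg fun _ _ => norm_nonneg _
  refine ⟨(Fintype.card (InfinitePlace F) : ℝ) * C + C + 1, by positivity, fun x hx => ?_⟩
  let p : Units.dirichletUnitTheorem.logSpace F := fun w => logShape x w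
  have hmem : (ZSpan.floor b p : Units.dirichletUnitTheorem.logSpace F) ∈ Units.unitLattice F := by
    have h := (ZSpan.floor b p).2
    exact (b0.ofZLatticeBasis_span ℝ (Units.unitLattice F)).le h
  obtain ⟨u, -, hu⟩ := hmem
  refine ⟨u.toMul⁻¹, ?_⟩
  have key : ∀ w : {w : InfinitePlace F // w ≠ w₀},
      logShape ((((u.toMul)⁻¹ : (𝓞 F)ˣ) : 𝓞 F) * x : F) w.1 = ZSpan.fract b p w := by
    intro w
    rw [logShape_mul (by simp) hx, Pi.add_apply, logShape_unit, ZSpan.fract_apply, ← hu]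
    simp only [Pi.sub_apply, p]
    have : ((Units.logEmbedding F).toIntLinearMap u) w = Real.log (w.1 ((u.toMul : 𝓞 F) : F)) := by
      have := Units.dirichletUnitTheorem.logEmbedding_component u.toMul w
      simpa using this
    rw [this]
    have h2 : (((u.toMul⁻¹ : (𝓞 F)ˣ) : 𝓞 F) : F) = (((u.toMul : 𝓞 F) : F))⁻¹ := by
      simp
    rw [h2, map_inv₀, Real.log_inv]
    ring
  have hfr : ‖ZSpan.fract b p‖ ≤ C := ZSpan.norm_fract_le b p
  have hle : ∀ w : {w : InfinitePlace F // w ≠ w₀},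
      |logShape ((((u.toMul)⁻¹ : (𝓞 F)ˣ) : 𝓞 F) * x : F) w.1| ≤ C := fun w => by
    rw [key w, ← Real.norm_eq_abs]
    exact (norm_le_pi_norm _ w).trans hfr
  refine (pi_norm_le_iff_of_nonneg (by positivity)).2 fun v => ?_
  rw [Real.norm_eq_abs]
  by_cases hv : v = w₀
  · have hs := sum_logShape ((((u.toMul)⁻¹ : (𝓞 F)ˣ) : 𝓞 F) * x : F)
    rw [Fintype.sum_eq_add_sum_subtype_ne _ w₀, ← hv, add_eq_zero_iff_eq_neg] at hs
    rw [hs, abs_neg]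
    refine (Finset.abs_sum_le_sum_abs _ _).trans ?_
    subst hv
    refine (Finset.sum_le_card_nsmul _ _ _ fun w _ => hle w).trans ?_
    rw [nsmul_eq_mul]
    have : ((Finset.univ : Finset {w : InfinitePlace F // w ≠ w₀}).card : ℝ) ≤
        Fintype.card (InfinitePlace F) := by
      rw [Finset.card_univ]; exact_mod_cast Fintype.card_subtype_le _
    nlinarith
  · have := hle ⟨v, hv⟩
    have h3 : 0 ≤ (Fintype.card (InfinitePlace F) : ℝ) * C := by positivity
    linarith

lemma finite_units_logShape_le (r : ℝ) :
    {u : (𝓞 F)ˣ | ‖logShape ((u : 𝓞 F) : F)‖ ≤ r}.Finite := by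
  have hfin := Embeddings.finite_of_norm_le F ℂ (Real.exp r)
  refine Set.Finite.of_finite_image (f := fun u : (𝓞 F)ˣ => ((u : 𝓞 F) : F))
    (hfin.subset ?_) ?_
  · rintro _ ⟨u, hu, rfl⟩
    refine ⟨RingOfIntegers.isIntegral_coe _, fun φ => ?_⟩
    have h1 := (norm_le_pi_norm (logShape ((u : 𝓞 F) : F)) (InfinitePlace.mk φ)).trans hu
    rw [logShape_unit, Real.norm_eq_abs] at h1
    have h2 := (le_abs_self _).trans h1
    rw [← InfinitePlace.apply φ]
    exact (Real.log_le_iff_le_exp (InfinitePlace.pos_iff.2 (by simp))).1 h2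
  · intro u _ v _ h
    exact Units.ext (RingOfIntegers.ext h)

lemma exists_card_units_le (r : ℝ) : ∃ M : ℕ, ∀ x : F, x ≠ 0 →
    {u : (𝓞 F)ˣ | ‖logShape (((u : 𝓞 F) : F) * x)‖ ≤ r}.Finite ∧
    {u : (𝓞 F)ˣ | ‖logShape (((u : 𝓞 F) : F) * x)‖ ≤ r}.ncard ≤ M := by
  have hfin := finite_units_logShape_le (F := F) (2 * r)
  refine ⟨{u : (𝓞 F)ˣ | ‖logShape ((u : 𝓞 F) : F)‖ ≤ 2 * r}.ncard, fun x hx => ?_⟩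
  rcases Set.eq_empty_or_nonempty {u : (𝓞 F)ˣ | ‖logShape (((u : 𝓞 F) : F) * x)‖ ≤ r} with h | ⟨u₀, h0⟩
  · rw [h]; simp
  have hmap : Set.MapsTo (fun u => u * u₀⁻¹)
      {u : (𝓞 F)ˣ | ‖logShape (((u : 𝓞 F) : F) * x)‖ ≤ r}
      {u : (𝓞 F)ˣ | ‖logShape ((u : 𝓞 F) : F)‖ ≤ 2 * r} := by
    intro u hu
    have e : logShape (((u * u₀⁻¹ : (𝓞 F)ˣ) : 𝓞 F) : F) =
        logShape (((u : 𝓞 F) : F) * x) - logShape (((u₀ : 𝓞 F) : F) * x) := by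
      rw [eq_sub_iff_add_eq, ← logShape_mul (by simp) (mul_ne_zero (by simp) hx)]
      congr 1
      rw [← mul_assoc, ← map_mul, ← Units.val_mul, inv_mul_cancel_right]
    simp only [Set.mem_ofPred_eq] at hu h0 ⊢
    rw [e]
    refine (norm_sub_le _ _).trans (by linarith)
  have hinj : Set.InjOn (fun u => u * u₀⁻¹)
      {u : (𝓞 F)ˣ | ‖logShape (((u : 𝓞 F) : F) * x)‖ ≤ r} :=
    fun a _ b _ h => mul_right_cancel h
  exact ⟨Set.Finite.of_injOn hmap hinj hfin, Set.ncard_le_ncard_of_injOn _ hmap hinj hfin⟩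

end LogShape

section UnitPartition
variable {F : Type*} [Field F] [NumberField F]

/-- A Lipschitz bump function on the logarithmic shape of `x`. -/
noncomputable def bump (R : ℝ) (x : F) : ℝ := max 0 (R + 1 - ‖logShape x‖)

/-- The sum of `bump` over the unit orbit of `x`. -/
noncomputable def bumpSum (R : ℝ) (x : F) : ℝ := ∑' u : (𝓞 F)ˣ, bump R (((u : 𝓞 F) : F) * x)

/-- The partition of unity for the action of the units obtained from `bump`. -/
noncomputable def unitWeight (R : ℝ) (x : F) : ℝ := bump R x / bumpSum R x

lemma bump_nonneg (R : ℝ) (x : F) : 0 ≤ bump R x := le_max_left _ _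

lemma bump_le {R : ℝ} (hR : 0 < R) (x : F) : bump R x ≤ R + 1 :=
  max_le (by linarith) (by linarith [norm_nonneg (logShape x)])

lemma logShape_le_of_bump_ne_zero {R : ℝ} {x : F} (h : bump R x ≠ 0) :
    ‖logShape x‖ ≤ R + 1 := by
  by_contra! h'
  exact h (max_eq_left (by linarith))

lemma abs_bump_sub_le (R : ℝ) (x y : F) :
    |bump R x - bump R y| ≤ ‖logShape x - logShape y‖ := by
  unfold bump
  refine (abs_max_sub_max_le_max _ _ _ _).trans ?_
  rw [sub_self, abs_zero]
  refine max_le (norm_nonneg _) ?_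
  rw [show R + 1 - ‖logShape x‖ - (R + 1 - ‖logShape y‖) = -(‖logShape x‖ - ‖logShape y‖) by ring,
    abs_neg]
  exact abs_norm_sub_norm_le _ _

lemma unit_mul_mul (u v : (𝓞 F)ˣ) (x : F) :
    ((v : 𝓞 F) : F) * (((u : 𝓞 F) : F) * x) = (((v * u : (𝓞 F)ˣ) : 𝓞 F) : F) * x := by
  rw [← mul_assoc, ← map_mul, ← Units.val_mul]

lemma bumpSum_unit_mul (R : ℝ) (u : (𝓞 F)ˣ) (x : F) :
    bumpSum R (((u : 𝓞 F) : F) * x) = bumpSum R x := by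
  unfold bumpSum
  simp_rw [unit_mul_mul]
  exact (Equiv.mulRight u).tsum_eq (fun v : (𝓞 F)ˣ => bump R (((v : 𝓞 F) : F) * x))

variable [IsTotallyReal F]

lemma summable_bump (R : ℝ) {x : F} (hx : x ≠ 0) :
    Summable fun u : (𝓞 F)ˣ => bump R (((u : 𝓞 F) : F) * x) := by
  obtain ⟨M, hM⟩ := exists_card_units_le (F := F) (R + 1)
  refine summable_of_ne_finset_zero (s := (hM x hx).1.toFinset) fun u hu => ?_
  by_contra h
  exact hu (by simpa using logShape_le_of_bump_ne_zero h)

lemma one_le_bumpSum {R : ℝ}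
    (hR : ∀ x : F, x ≠ 0 → ∃ u : (𝓞 F)ˣ, ‖logShape (((u : 𝓞 F) : F) * x)‖ ≤ R)
    {x : F} (hx : x ≠ 0) : 1 ≤ bumpSum R x := by
  obtain ⟨u, hu⟩ := hR x hx
  refine le_trans ?_ ((summable_bump R hx).le_tsum u fun _ _ => bump_nonneg _ _)
  exact le_trans (by linarith) (le_max_right _ _)

lemma unitWeight_nonneg (R : ℝ) (x : F) : 0 ≤ unitWeight R x :=
  div_nonneg (bump_nonneg _ _) (tsum_nonneg fun _ => bump_nonneg _ _)

lemma unitWeight_le_one {R : ℝ} {x : F} (hx : x ≠ 0) : unitWeight R x ≤ 1 := by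
  refine div_le_one_of_le₀ ?_ (tsum_nonneg fun _ => bump_nonneg _ _)
  have := (summable_bump R hx).le_tsum 1 fun _ _ => bump_nonneg _ _
  simpa [bumpSum] using this

lemma logShape_le_of_unitWeight_ne_zero {R : ℝ} {x : F} (h : unitWeight R x ≠ 0) :
    ‖logShape x‖ ≤ R + 1 :=
  logShape_le_of_bump_ne_zero fun h' => h (by simp [unitWeight, h'])

lemma hasSum_unitWeight {R : ℝ}
    (hR : ∀ x : F, x ≠ 0 → ∃ u : (𝓞 F)ˣ, ‖logShape (((u : 𝓞 F) : F) * x)‖ ≤ R)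
    {x : F} (hx : x ≠ 0) :
    HasSum (fun u : (𝓞 F)ˣ => unitWeight R (((u : 𝓞 F) : F) * x)) 1 := by
  have h := (summable_bump R hx).hasSum.div_const (bumpSum R x)
  have h1 : bumpSum R x ≠ 0 := (zero_lt_one.trans_le (one_le_bumpSum hR hx)).ne'
  rw [show (∑' u : (𝓞 F)ˣ, bump R (((u : 𝓞 F) : F) * x)) = bumpSum R x from rfl,
    div_self h1] at h
  simpa only [unitWeight, bumpSum_unit_mul] using h

lemma exists_abs_unitWeight_sub_le {R : ℝ} (hR0 : 0 < R)
    (hR : ∀ x : F, x ≠ 0 → ∃ u : (𝓞 F)ˣ, ‖logShape (((u : 𝓞 F) : F) * x)‖ ≤ R) :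
    ∃ K : ℝ, 0 < K ∧ ∀ x y : F, x ≠ 0 → y ≠ 0 → ∀ δ : ℝ,
      (∀ v : InfinitePlace F, |Real.log (v x) - Real.log (v y)| ≤ δ) →
      |unitWeight R x - unitWeight R y| ≤ K * δ := by
  obtain ⟨M, hM⟩ := exists_card_units_le (F := F) (R + 1)
  refine ⟨2 + (R + 1) * (4 * M), by positivity, fun x y hx hy δ hδ => ?_⟩
  have hδ0 : 0 ≤ δ := (abs_nonneg _).trans (hδ (Classical.arbitrary _))
  have hshape := abs_logShape_sub_le hδ
  have hb : |bump R x - bump R y| ≤ 2 * δ := (abs_bump_sub_le R x y).trans hshape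
  have hbu : ∀ u : (𝓞 F)ˣ,
      |bump R (((u : 𝓞 F) : F) * x) - bump R (((u : 𝓞 F) : F) * y)| ≤ 2 * δ := fun u => by
    refine (abs_bump_sub_le R _ _).trans ?_
    rw [logShape_mul (by simp) hx, logShape_mul (by simp) hy, add_sub_add_left_eq_sub]
    exact hshape
  have hD : |bumpSum R x - bumpSum R y| ≤ 4 * M * δ := by
    classical
    unfold bumpSum
    rw [← (summable_bump R hx).tsum_sub (summable_bump R hy)]
    set s := (hM x hx).1.toFinset ∪ (hM y hy).1.toFinset with hs
    have hcard : (s.card : ℝ) ≤ 2 * M := by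
      have h1 : s.card ≤ (hM x hx).1.toFinset.card + (hM y hy).1.toFinset.card :=
      Finset.card_union_le _ _
      rw [← Set.ncard_eq_toFinset_card _ (hM x hx).1,
      ← Set.ncard_eq_toFinset_card _ (hM y hy).1] at h1
      have := (hM x hx).2
      have := (hM y hy).2
      have : s.card ≤ 2 * M := by omega
      exact_mod_cast this
    rw [tsum_eq_sum (s := s)]
    · refine (Finset.abs_sum_le_sum_abs _ _).trans ?_
      refine (Finset.sum_le_card_nsmul _ _ _ fun u _ => hbu u).trans ?_
      rw [nsmul_eq_mul]
      nlinarith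
    · intro u hu
      simp only [hs, Finset.mem_union, Set.Finite.mem_toFinset, Set.mem_ofPred_eq, not_or] at hu
      have h1 : bump R (((u : 𝓞 F) : F) * x) = 0 := by
        by_contra h; exact hu.1 (logShape_le_of_bump_ne_zero h)
      have h2 : bump R (((u : 𝓞 F) : F) * y) = 0 := by
        by_contra h; exact hu.2 (logShape_le_of_bump_ne_zero h)
      rw [h1, h2, sub_zero]
  have hx1 := one_le_bumpSum hR hx
  have hy1 := one_le_bumpSum hR hy
  have e : unitWeight R x - unitWeight R y = (bump R x - bump R y) / bumpSum R x +
      bump R y * ((bumpSum R y - bumpSum R x) / (bumpSum R x * bumpSum R y)) := by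
    unfold unitWeight
    field_simp
    ring
  rw [e]
  refine (abs_add_le _ _).trans ?_
  have a1 : |(bump R x - bump R y) / bumpSum R x| ≤ 2 * δ := by
    rw [abs_div, abs_of_pos (by linarith : 0 < bumpSum R x)]
    exact (div_le_self (abs_nonneg _) hx1).trans hb
  have a2 : |bump R y * ((bumpSum R y - bumpSum R x) / (bumpSum R x * bumpSum R y))| ≤
      (R + 1) * (4 * M * δ) := by
    rw [abs_mul, abs_of_nonneg (bump_nonneg R y)]
    refine mul_le_mul (bump_le hR0 y) ?_ (abs_nonneg _) (by linarith)
    rw [abs_div, abs_of_pos (by nlinarith : 0 < bumpSum R x * bumpSum R y), abs_sub_comm]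
    refine (div_le_self (abs_nonneg _) (by nlinarith)).trans hD
  linarith

end UnitPartition

section ConeWeights
variable {F : Type*} [Field F] [NumberField F]

lemma place_le_house (v : InfinitePlace F) (x : F) : v x ≤ house x := by
  rw [← v.norm_embedding_eq]
  exact norm_embedding_le_house x _

lemma house_le_of_place_le {x : F} {C : ℝ} (h : ∀ v : InfinitePlace F, v x ≤ C) : house x ≤ C := by
  have hC : 0 ≤ C := (apply_nonneg _ _).trans (h (Classical.arbitrary _))
  refine (pi_norm_le_iff_of_nonneg hC).2 fun φ => ?_
  simpa using h (InfinitePlace.mk φ)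

lemma house_sub_comm (x y : F) : house (x - y) = house (y - x) := by
  simp only [house, map_sub]; exact norm_sub_rev _ _

/-- The product of the archimedean absolute values. -/
noncomputable def absProd (x : F) : ℝ := ∏ v : InfinitePlace F, v x

lemma absProd_mul (x y : F) : absProd (x * y) = absProd x * absProd y := by
  simp [absProd, Finset.prod_mul_distrib]

lemma absProd_pos {x : F} (hx : x ≠ 0) : 0 < absProd x :=
  Finset.prod_pos fun _ _ => InfinitePlace.pos_iff.2 hx

lemma absProd_nonneg (x : F) : 0 ≤ absProd x :=
  Finset.prod_nonneg fun _ _ => apply_nonneg _ _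

lemma log_absProd {x : F} (hx : x ≠ 0) :
    Real.log (absProd x) = ∑ v : InfinitePlace F, Real.log (v x) :=
  Real.log_prod fun _ _ => (InfinitePlace.pos_iff.2 hx).ne'

/-- A weight function whose sum over each orbit of units is `1`, supported in a cone and
Lipschitz in logarithmic coordinates. -/
structure IsUnitWeight (w : F → ℝ) : Prop where
  nonneg : ∀ x, 0 ≤ w x
  le_one : ∀ x, x ≠ 0 → w x ≤ 1
  hasSum : ∀ x, x ≠ 0 → HasSum (fun u : (𝓞 F)ˣ => w (((u : 𝓞 F) : F) * x)) 1
  bounded : ∃ r : ℝ, ∀ x, x ≠ 0 → w x ≠ 0 → ‖logShape x‖ ≤ r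
  lipschitz : ∃ K : ℝ, 0 < K ∧ ∀ x y : F, x ≠ 0 → y ≠ 0 → ∀ δ : ℝ,
      (∀ v : InfinitePlace F, |Real.log (v x) - Real.log (v y)| ≤ δ) →
      |w x - w y| ≤ K * δ

/-- A bounded function which is constant under small relative perturbations. -/
structure IsSignLike (ε : F → ℝ) : Prop where
  abs_le : ∀ x, |ε x| ≤ 1
  eq_of_lt : ∀ x y : F, x ≠ 0 → y ≠ 0 → (∀ v : InfinitePlace F, v (y - x) < v x) → ε x = ε y

lemma abs_log_sub_log_le {a b : ℝ} (ha : 0 < a) (hb : 0 < b) (h : |a - b| ≤ a / 2) :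
    |Real.log a - Real.log b| ≤ 2 * |a - b| / a := by
  have hb2 : a / 2 ≤ b := by linarith [(abs_le.1 h).2]
  rw [← Real.log_div ha.ne' hb.ne', abs_le]
  have h1 := Real.log_le_sub_one_of_pos (div_pos ha hb)
  have h2 := Real.log_le_sub_one_of_pos (div_pos hb ha)
  have h3 : Real.log (b / a) = - Real.log (a / b) := by rw [← Real.log_inv, inv_div]
  constructor
  · have : b / a - 1 ≤ 2 * |a - b| / a := by
      rw [div_sub_one ha.ne', div_le_div_iff_of_pos_right ha]
      linarith [neg_abs_le (a - b), abs_nonneg (a - b)]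
    linarith
  · refine h1.trans ?_
    rw [div_sub_one hb.ne', div_le_div_iff₀ hb ha]
    have h0 := le_abs_self (a - b)
    have h4 := abs_nonneg (a - b)
    nlinarith

variable [IsTotallyReal F]

lemma isUnitWeight_unitWeight : ∃ w : F → ℝ, IsUnitWeight w := by
  obtain ⟨R, hR0, hR⟩ := exists_unit_logShape_le (F := F)
  exact ⟨unitWeight R,
    { nonneg := unitWeight_nonneg R
      le_one := fun x hx => unitWeight_le_one hx
      hasSum := fun x hx => hasSum_unitWeight hR hx
      bounded := ⟨R + 1, fun x _ h => logShape_le_of_unitWeight_ne_zero h⟩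
      lipschitz := exists_abs_unitWeight_sub_le hR0 hR }⟩

lemma IsUnitWeight.average {w : F → ℝ} (hw : IsUnitWeight w) {a : F} (ha : a ≠ 0) :
    IsUnitWeight fun x => (w x + w (a * x)) / 2 where
  nonneg x := by have := hw.nonneg x; have := hw.nonneg (a * x); positivity
  le_one x hx := by
    have := hw.le_one x hx; have := hw.le_one (a * x) (mul_ne_zero ha hx); linarith
  hasSum x hx := by
    have h1 := hw.hasSum x hx
    have h2 := hw.hasSum (a * x) (mul_ne_zero ha hx)
    have h3 := (h1.add h2).div_const 2
    norm_num at h3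
    simpa only [mul_left_comm a] using h3
  bounded := by
    obtain ⟨r, hr⟩ := hw.bounded
    refine ⟨r + ‖logShape a‖, fun x hx h => ?_⟩
    by_cases h1 : w x = 0
    · have h2 : w (a * x) ≠ 0 := fun h2 => h (by simp [h1, h2])
      have := hr _ (mul_ne_zero ha hx) h2
      rw [logShape_mul ha hx] at this
      have h3 := norm_sub_le (logShape a + logShape x) (logShape a)
      rw [add_sub_cancel_left] at h3
      linarith
    · linarith [hr x hx h1, norm_nonneg (logShape a)]
  lipschitz := by
    obtain ⟨K, hK, h⟩ := hw.lipschitz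
    refine ⟨K, hK, fun x y hx hy δ hδ => ?_⟩
    have h1 := h x y hx hy δ hδ
    have h2 := h (a * x) (a * y) (mul_ne_zero ha hx) (mul_ne_zero ha hy) δ fun v => by
      rw [map_mul, map_mul, Real.log_mul, Real.log_mul, add_sub_add_left_eq_sub]
      · exact hδ v
      all_goals simpa
    rw [abs_le] at h1 h2 ⊢
    constructor <;> linarith [h1.1, h1.2, h2.1, h2.2]

lemma one_le_absProd {x : 𝓞 F} (hx : x ≠ 0) : 1 ≤ absProd (x : F) := by
  have h := InfinitePlace.prod_eq_abs_norm (x : F)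
  simp only [IsTotallyReal.mult_eq, pow_one] at h
  rw [absProd, h, ← Algebra.coe_norm_int]
  have h2 : Algebra.norm ℤ x ≠ 0 := Algebra.norm_ne_zero_iff.2 hx
  have := Int.one_le_abs h2
  exact_mod_cast this

lemma absProd_eq_absNorm (x : 𝓞 F) : absProd (x : F) = Ideal.absNorm (Ideal.span {x}) := by
  have h := InfinitePlace.prod_eq_abs_norm (x : F)
  simp only [IsTotallyReal.mult_eq, pow_one] at h
  rw [absProd, h, Ideal.absNorm_span_singleton, ← Algebra.coe_norm_int]
  simp [Nat.cast_natAbs]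

end ConeWeights

section SlowlyVarying
variable {F : Type*} [Field F] [NumberField F]

lemma house_le_of_logShape_le {x : F} (hx : x ≠ 0) {r : ℝ} (h : ‖logShape x‖ ≤ r)
    (v : InfinitePlace F) : house x ≤ Real.exp (2 * r) * v x := by
  refine house_le_of_place_le fun w => ?_
  have hv := (norm_le_pi_norm (logShape x) v).trans h
  have hw := (norm_le_pi_norm (logShape x) w).trans h
  rw [Real.norm_eq_abs, abs_le] at hv hw
  simp only [logShape] at hv hw
  have h1 : Real.log (w x) ≤ 2 * r + Real.log (v x) := by linarith [hv.1, hw.2]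
  have hwp : 0 < w x := InfinitePlace.pos_iff.2 hx
  have hvp : 0 < v x := InfinitePlace.pos_iff.2 hx
  rw [← Real.log_le_log_iff hwp (by positivity), Real.log_mul (by positivity) hvp.ne',
    Real.log_exp]
  exact h1

variable [IsTotallyReal F]

/-- The smoothed summand attached to the norm form. -/
noncomputable def smoothTerm (ε w : F → ℝ) (s : ℝ) (x : F) : ℝ :=
  ε x * (absProd x ^ (-s) * w x)

lemma abs_smoothTerm_le_one {ε w : F → ℝ} (hε : IsSignLike ε) (hw : IsUnitWeight w)
    {s : ℝ} (hs : 1 ≤ s) {x : 𝓞 F} (hx : x ≠ 0) : |smoothTerm ε w s x| ≤ 1 := by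
  have hx' : (x : F) ≠ 0 := by simpa using hx
  unfold smoothTerm
  have h0 := hw.nonneg x
  have h1 := hw.le_one x hx'
  have h2 : absProd (x : F) ^ (-s) ≤ 1 :=
    Real.rpow_le_one_of_one_le_of_nonpos (one_le_absProd hx) (by linarith)
  have h3 : 0 ≤ absProd (x : F) ^ (-s) := Real.rpow_nonneg (absProd_nonneg _) _
  rw [abs_mul, abs_mul, abs_of_nonneg h0, abs_of_nonneg h3]
  exact mul_le_one₀ (hε.abs_le _) (mul_nonneg h3 h0) (mul_le_one₀ h2 h0 h1)

lemma one_le_house {x : 𝓞 F} (hx : x ≠ 0) : 1 ≤ house (x : F) :=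
  one_le_house_of_isIntegral (RingOfIntegers.isIntegral_coe x) (by simpa using hx)

lemma exists_abs_smoothTerm_sub_le_of_ne_zero {ε w : F → ℝ} (hε : IsSignLike ε)
    (hw : IsUnitWeight w) {B : ℝ} (hB : 0 < B) : ∃ H K : ℝ, 0 < H ∧ 0 < K ∧
    ∀ x y : 𝓞 F, x ≠ 0 → y ≠ 0 → house ((x : F) - y) ≤ B → H ≤ house (x : F) → w x ≠ 0 →
      ∀ s : ℝ, 1 ≤ s → s ≤ 2 → |smoothTerm ε w s x - smoothTerm ε w s y| ≤
        K / house (x : F) ^ (Fintype.card (InfinitePlace F) + 1) := by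
  obtain ⟨r, hr⟩ := hw.bounded
  obtain ⟨L, hL0, hL⟩ := hw.lipschitz
  set n := Fintype.card (InfinitePlace F) with hn
  have hn0 : (1 : ℝ) ≤ n := by exact_mod_cast Fintype.card_pos
  set E := Real.exp (2 * r) with hE
  have hE0 : 0 < E := Real.exp_pos _
  refine ⟨4 * n * B * E + 2 * B * E, E ^ n * ((L + 4 * n) * (2 * B * E)), by positivity, by positivity,
    fun x y hx hy hxy hH hwx s hs1 hs2 => ?_⟩
  have hx' : (x : F) ≠ 0 := by simpa using hx
  have hy' : (y : F) ≠ 0 := by simpa using hy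
  set h := house (x : F) with hh
  have hh1 : 1 ≤ h := one_le_house hx
  have hvx : ∀ v : InfinitePlace F, h ≤ E * v x := house_le_of_logShape_le hx' (hr x hx' hwx)
  have hvB : ∀ v : InfinitePlace F, v (x - y : F) ≤ B := fun v => (place_le_house v _).trans hxy
  have hvp : ∀ v : InfinitePlace F, 0 < v (x : F) := fun v => InfinitePlace.pos_iff.2 hx'
  have hB2 : ∀ v : InfinitePlace F, B ≤ v (x : F) / 2 := fun v => by
    have h1 := hvx v
    have h3 : 2 * B * E ≤ E * v (x : F) := by
      have : 0 ≤ 4 * (n : ℝ) * B * E := by positivity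
      linarith
    nlinarith
  have habs : ∀ v : InfinitePlace F, |v (x : F) - v (y : F)| ≤ B := fun v => by
    refine le_trans ?_ (hvB v)
    simp only [← v.norm_embedding_eq, map_sub]
    exact abs_norm_sub_norm_le _ _
  set δ := 2 * B * E / h with hδ
  have hδ0 : 0 ≤ δ := by positivity
  have hlog : ∀ v : InfinitePlace F, |Real.log (v (x : F)) - Real.log (v (y : F))| ≤ δ := fun v => by
    refine (abs_log_sub_log_le (hvp v) (InfinitePlace.pos_iff.2 hy')
      ((habs v).trans (hB2 v))).trans ?_
    rw [hδ, div_le_div_iff₀ (hvp v) (by positivity)]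
    have := habs v
    have h1 := hvx v
    calc 2 * |v (x : F) - v (y : F)| * h ≤ 2 * B * h := by gcongr
      _ ≤ 2 * B * (E * v x) := by gcongr
      _ = _ := by ring
  have hεeq : ε x = ε y := hε.eq_of_lt x y hx' hy' fun v => by
    have hsymm : v ((y : F) - x) = v ((x : F) - y) := by
      rw [← v.norm_embedding_eq, ← v.norm_embedding_eq, map_sub, map_sub, norm_sub_rev]
    rw [hsymm]
    linarith [hvB v, hB2 v, hvp v]
  have hwd := hL x y hx' hy' δ hlog
  have hlogN : |Real.log (absProd (x : F)) - Real.log (absProd (y : F))| ≤ n * δ := by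
    rw [log_absProd hx', log_absProd hy', ← Finset.sum_sub_distrib]
    refine (Finset.abs_sum_le_sum_abs _ _).trans ?_
    refine (Finset.sum_le_card_nsmul _ _ _ fun w _ => hlog w).trans ?_
    simp [hn]
  have hpx := absProd_pos hx'
  have hpy := absProd_pos hy'
  set a := absProd (x : F) ^ (-s) with ha
  set b := absProd (y : F) ^ (-s) with hb
  have ha0 : 0 ≤ a := Real.rpow_nonneg hpx.le _
  have hab : |a - b| ≤ a * (4 * n * δ) := by
    set t := s * (Real.log (absProd (x : F)) - Real.log (absProd (y : F))) with ht
    have hbt : b = a * Real.exp t := by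
      rw [ha, hb, Real.rpow_def_of_pos hpx, Real.rpow_def_of_pos hpy, ← Real.exp_add, ht]
      congr 1; ring
    have htb : |t| ≤ 2 * n * δ := by
      rw [ht, abs_mul, abs_of_nonneg (by linarith)]
      calc _ ≤ 2 * (n * δ) := by gcongr
        _ = _ := by ring
    have ht1 : |t| ≤ 1 := by
      refine htb.trans ?_
      rw [hδ, ← mul_div_assoc, div_le_one (by positivity)]
      have : 0 ≤ 2 * B * E := by positivity
      linarith
    have := Real.abs_exp_sub_one_le ht1
    rw [hbt, show a - a * Real.exp t = -(a * (Real.exp t - 1)) by ring, abs_neg, abs_mul,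
      abs_of_nonneg ha0]
    gcongr
    linarith
  have hmain : |a * w x - b * w y| ≤ a * ((L + 4 * n) * δ) := by
    have e : a * w x - b * w y = a * (w x - w y) + (a - b) * w y := by ring
    rw [e]
    refine (abs_add_le _ _).trans ?_
    rw [abs_mul, abs_mul, abs_of_nonneg ha0, abs_of_nonneg (hw.nonneg y)]
    have h1 : a * |w x - w y| ≤ a * (L * δ) := by gcongr
    have h2 : |a - b| * w y ≤ a * (4 * n * δ) * 1 := by
      exact mul_le_mul hab (hw.le_one _ hy') (hw.nonneg _) (by positivity)
    linarith
  have haE : a ≤ E ^ n / h ^ n := by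
    have h1 : (h / E) ^ n ≤ absProd (x : F) := by
      rw [absProd, hn, ← Finset.card_univ, ← Finset.prod_const]
      refine Finset.prod_le_prod (fun _ _ => by positivity) fun v _ => ?_
      rw [div_le_iff₀' hE0]
      exact hvx v
    have h2 : a ≤ (absProd (x : F))⁻¹ := by
      rw [← Real.rpow_neg_one]
      exact Real.rpow_le_rpow_of_exponent_le (one_le_absProd hx) (by linarith)
    refine h2.trans ?_
    rw [inv_le_comm₀ hpx (by positivity), inv_div, ← div_pow]
    exact h1
  unfold smoothTerm
  rw [← hεeq, ← mul_sub, abs_mul]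
  calc |ε x| * |a * w x - b * w y| ≤ 1 * (a * ((L + 4 * n) * δ)) := by
        gcongr; exact hε.abs_le _
    _ ≤ 1 * (E ^ n / h ^ n * ((L + 4 * n) * δ)) := by gcongr
    _ = _ := by
        rw [hδ, pow_succ]
        field_simp

lemma exists_abs_smoothTerm_sub_le {ε w : F → ℝ} (hε : IsSignLike ε)
    (hw : IsUnitWeight w) (B : ℝ) : ∃ K : ℝ, 0 < K ∧
    ∀ x y : 𝓞 F, x ≠ 0 → y ≠ 0 → house ((x : F) - y) ≤ B →
      ∀ s : ℝ, 1 ≤ s → s ≤ 2 → |smoothTerm ε w s x - smoothTerm ε w s y| ≤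
        K / house (x : F) ^ (Fintype.card (InfinitePlace F) + 1) := by
  wlog hB : 0 < B
  · obtain ⟨K, hK, h⟩ := this hε hw (|B| + 1) (by positivity)
    exact ⟨K, hK, fun x y hx hy hxy => h x y hx hy (hxy.trans (by linarith [le_abs_self B]))⟩
  obtain ⟨H, K, hH, hK, h⟩ := exists_abs_smoothTerm_sub_le_of_ne_zero hε hw hB
  set n := Fintype.card (InfinitePlace F) with hn
  set H1 := H + 2 * B with hH1
  refine ⟨2 * H1 ^ (n + 1) + 2 * (K * 2 ^ (n + 1)), by positivity,
    fun x y hx hy hxy s hs1 hs2 => ?_⟩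
  have hx1 := one_le_house hx
  have hpx : 0 < house (x : F) ^ (n + 1) := by positivity
  by_cases hsmall : house (x : F) ≤ H1
  · have h1 := abs_smoothTerm_le_one hε hw hs1 hx
    have h2 := abs_smoothTerm_le_one hε hw hs1 hy
    rw [le_div_iff₀ hpx]
    have h3 : |smoothTerm ε w s x - smoothTerm ε w s y| ≤ 2 := by
      refine (abs_sub _ _).trans (by linarith)
    have h4 : house (x : F) ^ (n + 1) ≤ H1 ^ (n + 1) := by gcongr
    have h5 : 0 ≤ 2 * (K * 2 ^ (n + 1)) := by positivity
    calc _ ≤ 2 * H1 ^ (n + 1) := by gcongr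
      _ ≤ _ := by linarith
  push Not at hsmall
  have hxle : house (x : F) ≤ house (y : F) + B := by
    have := house_add_le (y : F) (x - y)
    rw [add_sub_cancel] at this
    linarith
  by_cases hwx : w x = 0
  · by_cases hwy : w y = 0
    · simp only [smoothTerm, hwx, hwy, mul_zero, sub_self, abs_zero]
      positivity
    · have h1 := h y x hy hx (by rwa [house_sub_comm]) (by linarith) hwy s hs1 hs2
      rw [abs_sub_comm]
      refine h1.trans ?_
      have hy1 := one_le_house hy
      rw [div_le_div_iff₀ (by positivity) hpx]
      have h2 : house (x : F) ^ (n + 1) ≤ 2 ^ (n + 1) * house (y : F) ^ (n + 1) := by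
        rw [← mul_pow]
        gcongr
        linarith
      calc K * house (x : F) ^ (n + 1) ≤ K * (2 ^ (n + 1) * house (y : F) ^ (n + 1)) := by gcongr
        _ = 1 * (K * 2 ^ (n + 1)) * house (y : F) ^ (n + 1) := by ring
        _ ≤ _ := by
          gcongr
          have : 0 ≤ 2 * H1 ^ (n + 1) := by positivity
          have : 0 ≤ K * 2 ^ (n + 1) := by positivity
          linarith
  · refine (h x y hx hy hxy (by linarith) hwx s hs1 hs2).trans ?_
    gcongr
    have : 0 ≤ 2 * H1 ^ (n + 1) := by positivity
    have : K * 1 ≤ K * 2 ^ (n + 1) := by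
      gcongr
      exact one_le_pow₀ (by norm_num)
    linarith [mul_pos hK (pow_pos (two_pos : (0:ℝ) < 2) (n + 1))]

end SlowlyVarying

section Zeta
variable {F : Type*} [Field F] [NumberField F]

open scoped Classical in
lemma mixedEmbedding_norm_eq_house (x : F) : ‖mixedEmbedding F x‖ = house x := by
  rw [mixedEmbedding.norm_eq_sup'_normAtPlace]
  refine le_antisymm (Finset.sup'_le _ _ fun v _ => ?_) (house_le_of_place_le fun v => ?_)
  · rw [mixedEmbedding.normAtPlace_apply]
    exact place_le_house v x
  · rw [← mixedEmbedding.normAtPlace_apply]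
    exact Finset.le_sup' (fun w => mixedEmbedding.normAtPlace w (mixedEmbedding F x))
      (Finset.mem_univ v)

open scoped Classical in
lemma summable_house_rpow [IsTotallyReal F] {r : ℝ} (hr : r < -Fintype.card (InfinitePlace F)) :
    Summable fun x : 𝓞 F => house (x : F) ^ r := by
  have hrk : Module.finrank ℤ (mixedEmbedding.integerLattice F) =
      Fintype.card (InfinitePlace F) := by
    rw [ZLattice.rank ℝ, mixedEmbedding.finrank, IsTotallyReal.finrank,
      InfinitePlace.card_eq_nrRealPlaces_add_nrComplexPlaces,
      IsTotallyReal.nrComplexPlaces_eq_zero, add_zero]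
  have h := ZLattice.summable_norm_rpow (mixedEmbedding.integerLattice F) r (by rwa [hrk])
  let f : 𝓞 F → mixedEmbedding.integerLattice F := fun x => ⟨mixedEmbedding F x, x, rfl⟩
  have hf : Function.Injective f := fun x y hxy => by
    have := congrArg Subtype.val hxy
    exact RingOfIntegers.coe_injective ((mixedEmbedding F).injective this)
  refine (h.comp_injective hf).congr fun x => ?_
  change ‖mixedEmbedding F x‖ ^ r = _
  rw [mixedEmbedding_norm_eq_house]

lemma summable_inv_house_pow [IsTotallyReal F] :
    Summable fun x : 𝓞 F => 1 / house (x : F) ^ (Fintype.card (InfinitePlace F) + 1) := by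
  refine (summable_house_rpow (r := -(Fintype.card (InfinitePlace F) + 1)) (by linarith)).congr
    fun x => ?_
  rw [Real.rpow_neg (house_nonneg _), one_div, ← Nat.cast_succ, Real.rpow_natCast]

open Filter Topology

lemma lSeriesSummable_card {s : ℝ} (hs : 1 < s) :
    LSeriesSummable (fun n ↦ Nat.card {I : Ideal (𝓞 F) // Ideal.absNorm I = n}) s := by
  by_contra hns
  have h := tendsto_sub_one_mul_dedekindZeta_nhdsGT F
  have h0 : (fun t : ℝ ↦ ((t : ℂ) - 1) * dedekindZeta F t) =ᶠ[𝓝[>] 1] fun _ => 0 := by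
    filter_upwards [Ioo_mem_nhdsGT hs] with t ht
    have : ¬ LSeriesSummable (fun n ↦ Nat.card {I : Ideal (𝓞 F) // Ideal.absNorm I = n}) t :=
      fun hh => hns (hh.of_re_le_re (by simpa using ht.2.le))
    rw [dedekindZeta, LSeries, tsum_eq_zero_of_not_summable this, mul_zero]
  have := tendsto_nhds_unique (h.congr' h0) tendsto_const_nhds
  exact dedekindZeta_residue_ne_zero F (by exact_mod_cast this)

/-- The term of the Dedekind zeta function at an ideal (zero for the zero ideal). -/
noncomputable def idealTerm (s : ℝ) (I : Ideal (𝓞 F)) : ℝ := (Ideal.absNorm I : ℝ) ^ (-s)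

lemma idealTerm_nonneg (s : ℝ) (I : Ideal (𝓞 F)) : 0 ≤ idealTerm s I :=
  Real.rpow_nonneg (Nat.cast_nonneg _) _

lemma hasSum_idealTerm {s : ℝ} (hs : 1 < s) :
    HasSum (idealTerm (F := F) s) (dedekindZeta F s).re := by
  have hS := lSeriesSummable_card (F := F) hs
  have hre := (Complex.hasSum_re (hS.hasSum))
  set g : ℕ → ℝ := fun n => Nat.card {I : Ideal (𝓞 F) // Ideal.absNorm I = n} * (n : ℝ) ^ (-s)
    with hg
  have hterm : ∀ n : ℕ, (LSeries.term (fun n ↦ (Nat.card {I : Ideal (𝓞 F) // Ideal.absNorm I = n} : ℂ)) s n).re = g n := by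
    intro n
    rcases eq_or_ne n 0 with rfl | hn
    · simp [hg, Real.zero_rpow (show -s ≠ 0 by linarith)]
    · rw [LSeries.term_of_ne_zero hn, hg]
      simp only
      rw [Real.rpow_neg (Nat.cast_nonneg _), ← div_eq_mul_inv]
      have : ((n : ℂ) ^ (s : ℂ)) = (((n : ℝ) ^ s : ℝ) : ℂ) := by
        rw [Complex.ofReal_cpow (Nat.cast_nonneg _)]; simp
      rw [this, ← Complex.ofReal_natCast, ← Complex.ofReal_div, Complex.ofReal_re]
  simp only [hterm] at hre
  change HasSum g (dedekindZeta F s).re at hre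
  let e := Equiv.sigmaFiberEquiv (fun I : Ideal (𝓞 F) => Ideal.absNorm I)
  have hfin : ∀ n : ℕ, Finite {I : Ideal (𝓞 F) // Ideal.absNorm I = n} := fun n =>
    Ideal.finite_setOfPred_absNorm_eq n
  have hfib : ∀ n : ℕ, HasSum (fun I : {I : Ideal (𝓞 F) // Ideal.absNorm I = n} =>
      idealTerm s (e ⟨n, I⟩)) (g n) := fun n => by
    have := Fintype.ofFinite {I : Ideal (𝓞 F) // Ideal.absNorm I = n}
    have h1 := hasSum_fintype (fun I : {I : Ideal (𝓞 F) // Ideal.absNorm I = n} =>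
      idealTerm s (e ⟨n, I⟩))
    convert h1 using 1
    rw [hg]
    simp only [idealTerm]
    rw [Finset.sum_congr rfl (g := fun _ => (n : ℝ) ^ (-s)) fun I _ => by
      change ((Ideal.absNorm I.1 : ℕ) : ℝ) ^ (-s) = _
      rw [I.2]]
    simp
  have hsum : Summable fun p => idealTerm s (e p) := by
    rw [summable_sigma_of_nonneg fun p => idealTerm_nonneg _ _]
    refine ⟨fun n => (hfib n).summable, ?_⟩
    exact hre.summable.congr fun n => ((hfib n).tsum_eq).symm
  have h2 := (hsum.hasSum.sigma hfib).unique hre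
  have h3 : HasSum (fun p => idealTerm s (e p)) (dedekindZeta F s).re := h2 ▸ hsum.hasSum
  exact (e.hasSum_iff).1 h3

lemma summable_idealTerm {s : ℝ} (hs : 1 < s) : Summable (idealTerm (F := F) s) :=
  (hasSum_idealTerm hs).summable

lemma tendsto_sub_one_mul_tsum_idealTerm :
    Tendsto (fun s : ℝ => (s - 1) * ∑' I : Ideal (𝓞 F), idealTerm s I) (𝓝[>] 1)
      (𝓝 (dedekindZeta_residue F)) := by
  have h := (Complex.continuous_re.tendsto _).comp (tendsto_sub_one_mul_dedekindZeta_nhdsGT F)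
  refine h.congr' ?_
  filter_upwards [self_mem_nhdsWithin] with s hs
  rw [(hasSum_idealTerm hs).tsum_eq]
  simp only [Function.comp_apply]
  rw [← Complex.ofReal_one, ← Complex.ofReal_sub, Complex.re_ofReal_mul]

lemma tendsto_tsum_idealTerm_atTop :
    Tendsto (fun s : ℝ => ∑' I : Ideal (𝓞 F), idealTerm s I) (𝓝[>] 1) atTop := by
  have h : Tendsto (fun s : ℝ => (s - 1)⁻¹) (𝓝[>] 1) atTop := by
    refine tendsto_inv_nhdsGT_zero.comp ?_
    refine tendsto_nhdsWithin_iff.2 ⟨?_, ?_⟩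
    · have : Tendsto (fun s : ℝ => s - 1) (𝓝 1) (𝓝 (1 - 1)) := tendsto_id.sub_const 1
      rw [sub_self] at this
      exact this.mono_left nhdsWithin_le_nhds
    · filter_upwards [self_mem_nhdsWithin] with s hs
      simpa using hs
  refine (h.atTop_mul_pos (dedekindZeta_residue_pos F)
    (tendsto_sub_one_mul_tsum_idealTerm (F := F))).congr' ?_
  filter_upwards [self_mem_nhdsWithin] with s hs
  have : s - 1 ≠ 0 := by simpa [sub_eq_zero] using (ne_of_gt hs)
  rw [inv_mul_cancel_left₀ this]

lemma idealTerm_anti {s t : ℝ} (h0 : 0 < s) (h : s ≤ t) (I : Ideal (𝓞 F)) :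
    idealTerm t I ≤ idealTerm s I := by
  unfold idealTerm
  rcases Nat.eq_zero_or_pos (Ideal.absNorm I) with h1 | h1
  · rw [h1, Nat.cast_zero, Real.zero_rpow (by linarith), Real.zero_rpow (by linarith)]
  · exact Real.rpow_le_rpow_of_exponent_le (by exact_mod_cast h1) (by linarith)

lemma exists_tsum_idealTerm_le : ∃ C : ℝ, 0 < C ∧ ∀ s : ℝ, 1 < s → s ≤ 2 →
    ∑' I : Ideal (𝓞 F), idealTerm s I ≤ C / (s - 1) := by
  have h := (tendsto_sub_one_mul_tsum_idealTerm (F := F)).eventually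
    (ge_mem_nhds (lt_add_one _))
  obtain ⟨b, hb1, hb⟩ := (mem_nhdsGT_iff_exists_Ioo_subset (a := (1:ℝ))).1 h
  have hb1 : 1 < b := hb1
  set c := min 2 ((1 + b) / 2) with hc
  have hc1 : 1 < c := lt_min (by norm_num) (by linarith)
  set Z := ∑' I : Ideal (𝓞 F), idealTerm c I
  have hZ : 0 ≤ Z := tsum_nonneg fun I => idealTerm_nonneg _ _
  have hr := dedekindZeta_residue_pos F
  refine ⟨dedekindZeta_residue F + 1 + Z, by positivity, fun s hs1 hs2 => ?_⟩
  rw [le_div_iff₀ (by linarith), mul_comm]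
  rcases lt_or_ge s c with h1 | h1
  · have : s ∈ Set.Ioo 1 b := ⟨hs1, h1.trans_le ((min_le_right _ _).trans (by linarith))⟩
    have := hb this
    simp only [Set.mem_ofPred_eq] at this
    linarith
  · have h2 : ∑' I : Ideal (𝓞 F), idealTerm s I ≤ Z :=
      (summable_idealTerm hs1).tsum_le_tsum (idealTerm_anti (by linarith) h1)
        (summable_idealTerm hc1)
    have h3 : (0:ℝ) ≤ ∑' I : Ideal (𝓞 F), idealTerm s I := tsum_nonneg fun I => idealTerm_nonneg _ _
    nlinarith

end Zeta

section Unfolding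
variable {F : Type*} [Field F] [NumberField F]

lemma hasSum_span_mul_weight_subtype {w : F → ℝ} (hw : IsUnitWeight w) {g : Ideal (𝓞 F) → ℂ}
    (hg : Summable fun I => ‖g I‖) :
    HasSum (fun x : {x : 𝓞 F // x ≠ 0} => g (Ideal.span {x.1}) * (w x.1 : ℂ))
      (∑' I : {I : Ideal (𝓞 F) // I ≠ ⊥ ∧ Submodule.IsPrincipal I}, g I) := by
  set P := {I : Ideal (𝓞 F) // I ≠ ⊥ ∧ Submodule.IsPrincipal I}
  have hgen : ∀ I : P, ∃ x : 𝓞 F, x ≠ 0 ∧ I.1 = Ideal.span {x} := fun I => by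
    obtain ⟨x, hx⟩ := I.2.2
    refine ⟨x, ?_, hx⟩
    rintro rfl
    exact I.2.1 (by simpa using hx)
  choose γ hγ0 hγ using hgen
  let e : P × (𝓞 F)ˣ → {x : 𝓞 F // x ≠ 0} := fun p => ⟨p.2 * γ p.1, mul_ne_zero p.2.ne_zero (hγ0 _)⟩
  have hspan : ∀ p, Ideal.span {(e p).1} = p.1.1 := fun p => by
    rw [hγ p.1]
    exact Ideal.span_singleton_mul_left_unit p.2.isUnit _
  have he : Function.Bijective e := by
    constructor
    · intro p q h
      have h1 : p.1 = q.1 := Subtype.ext (by rw [← hspan p, ← hspan q, h])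
      have h2 := congrArg Subtype.val h
      simp only [e] at h2
      rw [h1] at h2
      exact Prod.ext h1 (Units.ext (mul_right_cancel₀ (hγ0 _) h2))
    · rintro ⟨x, hx⟩
      let I : P := ⟨Ideal.span {x}, by simpa using hx, ⟨x, rfl⟩⟩
      obtain ⟨u, hu⟩ := Ideal.span_singleton_eq_span_singleton.1 (hγ I)
      refine ⟨(I, u⁻¹), Subtype.ext ?_⟩
      simp only [e]
      rw [← hu, mul_comm x, Units.inv_mul_cancel_left]
  rw [← (Equiv.ofBijective e he).hasSum_iff]
  have hcomp : (fun x : {x : 𝓞 F // x ≠ 0} => g (Ideal.span {x.1}) * (w x.1 : ℂ)) ∘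
      (Equiv.ofBijective e he) = fun p : P × (𝓞 F)ˣ =>
        g p.1.1 * (w (((p.2 : 𝓞 F) : F) * (γ p.1 : F)) : ℂ) := by
    funext p
    simp only [Function.comp_apply, Equiv.ofBijective_apply, hspan p]
    simp [e]
  rw [hcomp]
  have hγF : ∀ I, ((γ I : 𝓞 F) : F) ≠ 0 := fun I => by simpa using hγ0 I
  have hfib : ∀ I : P, HasSum (fun u : (𝓞 F)ˣ => g I.1 * (w (((u : 𝓞 F) : F) * (γ I : F)) : ℂ))
      (g I.1) := fun I => by
    have := (Complex.hasSum_ofReal.2 (hw.hasSum _ (hγF I))).mul_left (g I.1)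
    simpa using this
  have hfibn : ∀ I : P, HasSum (fun u : (𝓞 F)ˣ => ‖g I.1 * (w (((u : 𝓞 F) : F) * (γ I : F)) : ℂ)‖)
      ‖g I.1‖ := fun I => by
    have := ((hw.hasSum _ (hγF I))).mul_left ‖g I.1‖
    rw [mul_one] at this
    refine this.congr_fun ?_
    intro u
    rw [norm_mul, Complex.norm_real, Real.norm_of_nonneg (hw.nonneg _)]
  have hsum : Summable fun p : P × (𝓞 F)ˣ =>
        g p.1.1 * (w (((p.2 : 𝓞 F) : F) * (γ p.1 : F)) : ℂ) := by
    refine Summable.of_norm ?_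
    rw [summable_prod_of_nonneg fun p => norm_nonneg _]
    refine ⟨fun I => (hfibn I).summable, ?_⟩
    refine (hg.comp_injective (i := fun I : P => I.1) Subtype.val_injective).congr fun I => ?_
    exact (hfibn I).tsum_eq.symm
  have h2 := (hsum.hasSum.prod_fiberwise hfib).tsum_eq
  rw [h2]
  exact hsum.hasSum

open scoped Classical in
/-- Unfolding a sum over principal ideals into a weighted sum over elements. -/
lemma hasSum_span_mul_weight {w : F → ℝ} (hw : IsUnitWeight w) {g : Ideal (𝓞 F) → ℂ}
    (hg : Summable fun I => ‖g I‖) (hg0 : g ⊥ = 0) :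
    HasSum (fun x : 𝓞 F => g (Ideal.span {x}) * (w x : ℂ))
      (∑' I : Ideal (𝓞 F), if Submodule.IsPrincipal I then g I else 0) := by
  have h := hasSum_span_mul_weight_subtype hw hg
  have h1 : HasSum (fun x : 𝓞 F => g (Ideal.span {x}) * (w x : ℂ)) 
      (∑' I : {I : Ideal (𝓞 F) // I ≠ ⊥ ∧ Submodule.IsPrincipal I}, g I) := by
    refine (hasSum_subtype_iff_of_support_subset (s := {x : 𝓞 F | x ≠ 0}) ?_).1 h
    intro x hx hx0
    have : x = 0 := by simpa using hx0
    subst this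
    simp [hg0] at hx
  convert h1 using 1
  have h2 : (∑' I : {I : Ideal (𝓞 F) // I ≠ ⊥ ∧ Submodule.IsPrincipal I}, g I) =
    ∑' I : {I : Ideal (𝓞 F) | I ≠ ⊥ ∧ Submodule.IsPrincipal I}, 
      (fun I : Ideal (𝓞 F) => if Submodule.IsPrincipal I then g I else 0) I :=
    tsum_congr fun I => by simp only; rw [if_pos I.2.2]
  rw [h2]
  refine (tsum_subtype_eq_of_support_subset ?_).symm
  intro I hI
  simp only [Function.mem_support, ne_eq, ite_eq_right_iff, not_forall] at hI
  obtain ⟨h3, h4⟩ := hI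
  exact ⟨fun h5 => h4 (h5 ▸ hg0), h3⟩

variable [IsTotallyReal F]

lemma smoothTerm_eq (ε w : F → ℝ) (s : ℝ) (x : 𝓞 F) :
    smoothTerm ε w s x = ε x * (idealTerm s (Ideal.span {x}) * w x) := by
  rw [smoothTerm, idealTerm, absProd_eq_absNorm]

lemma idealTerm_bot {s : ℝ} (hs : s ≠ 0) : idealTerm s (⊥ : Ideal (𝓞 F)) = 0 := by
  simp [idealTerm, hs]

lemma smoothTerm_zero (ε w : F → ℝ) {s : ℝ} (hs : s ≠ 0) : smoothTerm ε w s 0 = 0 := by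
  have := smoothTerm_eq ε w s (0 : 𝓞 F)
  simpa [idealTerm_bot hs] using this

lemma exists_tsum_abs_smoothTerm_le {ε w : F → ℝ} (hε : IsSignLike ε) (hw : IsUnitWeight w) :
    (∀ s : ℝ, 1 < s → Summable fun x : 𝓞 F => |smoothTerm ε w s x|) ∧
    ∃ C : ℝ, 0 < C ∧ ∀ s : ℝ, 1 < s → s ≤ 2 → ∑' x : 𝓞 F, |smoothTerm ε w s x| ≤ C / (s - 1) := by
  classical
  have hle : ∀ s (x : 𝓞 F), |smoothTerm ε w s x| ≤ idealTerm s (Ideal.span {x}) * w x := fun s x => by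
    have h1 : 0 ≤ idealTerm s (Ideal.span {x}) * w x :=
      mul_nonneg (idealTerm_nonneg _ _) (hw.nonneg _)
    rw [smoothTerm_eq, abs_mul, abs_of_nonneg h1]
    exact mul_le_of_le_one_left h1 (hε.abs_le _)
  have hsum : ∀ s : ℝ, 1 < s → HasSum (fun x : 𝓞 F => idealTerm s (Ideal.span {x}) * w x)
      (∑' I : Ideal (𝓞 F), if Submodule.IsPrincipal I then idealTerm s I else 0) := fun s hs => by
    have h := hasSum_span_mul_weight hw (g := fun I => (idealTerm s I : ℂ))
      (by simpa using (summable_idealTerm hs).norm) (by rw [idealTerm_bot (by linarith)]; simp)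
    rw [← Complex.hasSum_ofReal, Complex.ofReal_tsum]
    convert h using 1
    · funext x; simp
    · congr 1; funext I; split_ifs <;> simp
  refine ⟨fun s hs => Summable.of_nonneg_of_le (fun _ => abs_nonneg _) (hle s) (hsum s hs).summable, ?_⟩
  obtain ⟨C, hC, h⟩ := exists_tsum_idealTerm_le (F := F)
  refine ⟨C, hC, fun s hs1 hs2 => le_trans ?_ (h s hs1 hs2)⟩
  have h1 : ∑' x : 𝓞 F, |smoothTerm ε w s x| ≤ ∑' x : 𝓞 F, idealTerm s (Ideal.span {x}) * w x :=
    Summable.tsum_le_tsum (hle s)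
      (Summable.of_nonneg_of_le (fun _ => abs_nonneg _) (hle s) (hsum s hs1).summable)
      (hsum s hs1).summable
  refine h1.trans ?_
  rw [(hsum s hs1).tsum_eq]
  have h0 : ∀ I : Ideal (𝓞 F), (if Submodule.IsPrincipal I then idealTerm s I else 0) ≤ idealTerm s I :=
    fun I => by split_ifs; exacts [le_rfl, idealTerm_nonneg _ _]
  refine Summable.tsum_le_tsum h0 (Summable.of_nonneg_of_le (fun I => ?_) h0 (summable_idealTerm hs1))
    (summable_idealTerm hs1)
  split_ifs; exacts [idealTerm_nonneg _ _, le_rfl]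

lemma summable_smoothTerm {ε w : F → ℝ} (hε : IsSignLike ε) (hw : IsUnitWeight w) {s : ℝ}
    (hs : 1 < s) : Summable fun x : 𝓞 F => smoothTerm ε w s x :=
  ((exists_tsum_abs_smoothTerm_le hε hw).1 s hs).of_abs

end Unfolding

section Cosets
variable {F : Type*} [Field F] [NumberField F] [IsTotallyReal F]

lemma exists_tsum_smoothTerm_shift_le {ε w : F → ℝ} (hε : IsSignLike ε) (hw : IsUnitWeight w)
    (d : 𝓞 F) : ∃ C : ℝ, 0 < C ∧ ∀ s : ℝ, 1 < s → s ≤ 2 → ∀ c : 𝓞 F → ℝ, (∀ x, |c x| ≤ 1) →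
      |∑' x : 𝓞 F, c x * (smoothTerm ε w s x - smoothTerm ε w s (x + d : 𝓞 F))| ≤ C := by
  classical
  obtain ⟨K, hK, h⟩ := exists_abs_smoothTerm_sub_le hε hw (house (d : F))
  set n := Fintype.card (InfinitePlace F)
  let b : 𝓞 F → ℝ := fun x => K * (1 / house (x : F) ^ (n + 1)) +
    ((if x = 0 then 1 else 0) + (if x = -d then 1 else 0))
  have hb : Summable b := by
    refine (summable_inv_house_pow.mul_left K).add (Summable.add ?_ ?_)
    · exact (hasSum_ite_eq (0 : 𝓞 F) (1 : ℝ)).summable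
    · exact (hasSum_ite_eq (-d : 𝓞 F) (1 : ℝ)).summable
  have hb0 : ∀ x, 0 ≤ b x := fun x => by
    have : 0 ≤ house (x : F) := house_nonneg _
    simp only [b]
    positivity
  have hb1 : 0 ≤ ∑' x, b x := tsum_nonneg hb0
  refine ⟨∑' x, b x + 1, by linarith, fun s hs1 hs2 c hc => ?_⟩
  have hle1 : ∀ x : 𝓞 F, |smoothTerm ε w s x| ≤ 1 := fun x => by
    rcases eq_or_ne x 0 with rfl | hx
    · have := smoothTerm_zero ε w (s := s) (by linarith)
      simp [this]
    · exact abs_smoothTerm_le_one hε hw hs1.le hx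
  have key : ∀ x : 𝓞 F, |smoothTerm ε w s x - smoothTerm ε w s (x + d : 𝓞 F)| ≤ b x := fun x => by
    have hz := smoothTerm_zero ε w (s := s) (by linarith)
    have h4 : 0 ≤ K * (1 / house (x : F) ^ (n + 1)) := by
      have : 0 ≤ house (x : F) := house_nonneg _
      positivity
    rcases eq_or_ne x 0 with rfl | hx
    · have h3 := hle1 (0 + d)
      simp only [b, if_true]
      rw [show (((0 : 𝓞 F)) : F) = 0 by simp, hz, zero_sub, abs_neg]
      have : (0:ℝ) ≤ if (0 : 𝓞 F) = -d then 1 else 0 := by split_ifs <;> norm_num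
      simp only [map_zero] at h4
      linarith
    rcases eq_or_ne x (-d) with hxd | hxd
    · have h3 := hle1 x
      simp only [b, if_pos hxd]
      rw [show ((x + d : 𝓞 F) : F) = 0 by rw [hxd]; simp, hz, sub_zero]
      have : (0:ℝ) ≤ if x = 0 then 1 else 0 := by split_ifs <;> norm_num
      linarith
    · have hxd' : x + d ≠ 0 := fun h0 => hxd (eq_neg_of_add_eq_zero_left h0)
      have := h x (x + d) hx hxd' (by
        rw [house_sub_comm]; simp) s hs1.le hs2
      refine this.trans ?_
      simp only [b, if_neg hx, if_neg hxd]
      rw [mul_one_div]; simp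
  have key2 : ∀ x : 𝓞 F,
      ‖c x * (smoothTerm ε w s x - smoothTerm ε w s (x + d : 𝓞 F))‖ ≤ b x := fun x => by
    rw [Real.norm_eq_abs, abs_mul]
    exact (mul_le_of_le_one_left (abs_nonneg _) (hc x)).trans (key x)
  have := tsum_of_norm_bounded hb.hasSum key2
  rw [Real.norm_eq_abs] at this
  linarith

open scoped Classical in
/-- The sum of the smooth terms over a residue class. -/
noncomputable def cosetSum (ε w : F → ℝ) (s : ℝ) (𝔫 : Ideal (𝓞 F)) (q : 𝓞 F ⧸ 𝔫) : ℝ :=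
  ∑' x : 𝓞 F, if Ideal.Quotient.mk 𝔫 x = q then smoothTerm ε w s x else 0

lemma summable_ite_smoothTerm {ε w : F → ℝ} (hε : IsSignLike ε) (hw : IsUnitWeight w) {s : ℝ}
    (hs : 1 < s) (p : 𝓞 F → Prop) [DecidablePred p] :
    Summable fun x : 𝓞 F => if p x then smoothTerm ε w s x else 0 := by
  refine Summable.of_norm_bounded (summable_smoothTerm hε hw hs).norm fun x => ?_
  split_ifs <;> simp

lemma tsum_mul_smoothTerm {ε w : F → ℝ} (hε : IsSignLike ε) (hw : IsUnitWeight w) {s : ℝ}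
    (hs : 1 < s) (𝔫 : Ideal (𝓞 F)) [Fintype (𝓞 F ⧸ 𝔫)] (g : 𝓞 F ⧸ 𝔫 → ℂ) :
    HasSum (fun x : 𝓞 F => g (Ideal.Quotient.mk 𝔫 x) * (smoothTerm ε w s x : ℂ))
      (∑ q, g q * (cosetSum ε w s 𝔫 q : ℂ)) := by
  classical
  have h : ∀ q, HasSum (fun x : 𝓞 F => g q *
      ((if Ideal.Quotient.mk 𝔫 x = q then smoothTerm ε w s x else 0 : ℝ) : ℂ))
      (g q * (cosetSum ε w s 𝔫 q : ℂ)) := fun q => by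
    refine HasSum.mul_left _ (Complex.hasSum_ofReal.2 ?_)
    convert (summable_ite_smoothTerm hε hw hs (fun x => Ideal.Quotient.mk 𝔫 x = q)).hasSum
    rw [cosetSum]
  refine (hasSum_sum fun q (_ : q ∈ Finset.univ) => h q).congr_fun fun x => ?_
  rw [Finset.sum_eq_single (Ideal.Quotient.mk 𝔫 x)]
  · simp
  · intro q _ hq; simp [hq.symm]
  · simp

lemma exists_abs_cosetSum_sub_le {ε w : F → ℝ} (hε : IsSignLike ε) (hw : IsUnitWeight w)
    {𝔫 : Ideal (𝓞 F)} (h𝔫 : 𝔫 ≠ ⊥) : ∃ C : ℝ, 0 < C ∧ ∀ s : ℝ, 1 < s → s ≤ 2 → ∀ q,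
      |cosetSum ε w s 𝔫 q - (∑' x : 𝓞 F, smoothTerm ε w s x) / Ideal.absNorm 𝔫| ≤ C := by
  classical
  have hfin : Finite (𝓞 F ⧸ 𝔫) := Ideal.finiteQuotientOfFreeOfNeBot 𝔫 h𝔫
  have := Fintype.ofFinite (𝓞 F ⧸ 𝔫)
  choose C hC0 hC using fun r : 𝓞 F ⧸ 𝔫 => exists_tsum_smoothTerm_shift_le hε hw (Quotient.out r : 𝓞 F)
  have hN : (1 : ℝ) ≤ Ideal.absNorm 𝔫 := by
    have : Ideal.absNorm 𝔫 ≠ 0 := by rwa [Ne, Ideal.absNorm_eq_zero_iff]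
    exact_mod_cast Nat.one_le_iff_ne_zero.2 this
  have hcard : (Ideal.absNorm 𝔫 : ℝ) = Fintype.card (𝓞 F ⧸ 𝔫) := by
    rw [Ideal.absNorm_apply, Submodule.cardQuot_apply, Nat.card_eq_fintype_card]
  refine ⟨∑ r, C r, Finset.sum_pos (fun r _ => hC0 r) Finset.univ_nonempty, fun s hs1 hs2 q => ?_⟩
  have hT : (∑' x : 𝓞 F, smoothTerm ε w s x) = ∑ r, cosetSum ε w s 𝔫 r := by
    have h1 := tsum_mul_smoothTerm hε hw hs1 𝔫 (fun _ => 1)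
    simp only [one_mul] at h1
    have h2 := Complex.hasSum_ofReal.2 (summable_smoothTerm hε hw hs1).hasSum
    have := h2.unique h1
    exact_mod_cast this
  have hdiff : ∀ r, |cosetSum ε w s 𝔫 q - cosetSum ε w s 𝔫 (q + r)| ≤ C r := fun r => by
    have h1 := hC r s hs1 hs2 (fun x => if Ideal.Quotient.mk 𝔫 x = q then 1 else 0) (fun x => by
      split_ifs <;> simp)
    convert h1 using 2
    have h2 : cosetSum ε w s 𝔫 (q + r) = ∑' x : 𝓞 F,
        if Ideal.Quotient.mk 𝔫 x = q then smoothTerm ε w s (x + (Quotient.out r : 𝓞 F) : 𝓞 F) else 0 := by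
      rw [cosetSum, ← (Equiv.addRight (Quotient.out r : 𝓞 F)).tsum_eq]
      refine tsum_congr fun x => ?_
      have h3 : Ideal.Quotient.mk 𝔫 (Quotient.out r : 𝓞 F) = r := Ideal.Quotient.mk_out r
      simp only [Equiv.coe_addRight, map_add, h3, add_left_inj]
    have hs3 : Summable fun x : 𝓞 F => if Ideal.Quotient.mk 𝔫 x = q then
        smoothTerm ε w s (x + (Quotient.out r : 𝓞 F) : 𝓞 F) else 0 := by
      have h4 : Summable fun x : 𝓞 F => smoothTerm ε w s (x + (Quotient.out r : 𝓞 F) : 𝓞 F) :=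
        (Equiv.addRight (Quotient.out r : 𝓞 F)).summable_iff.2 (summable_smoothTerm hε hw hs1)
      refine Summable.of_norm_bounded h4.norm fun x => ?_
      split_ifs <;> simp
    rw [h2, cosetSum]
    have h5 := summable_ite_smoothTerm hε hw hs1 (fun x : 𝓞 F => Ideal.Quotient.mk 𝔫 x = q)
    have h6 := h5.tsum_sub hs3
    simp only [ite_mul, one_mul, zero_mul]
    refine Eq.trans ?_ (h6.symm.trans ?_)
    · congr!
    · refine tsum_congr fun x => ?_
      split_ifs <;> simp
  have hshift : ∑ r, cosetSum ε w s 𝔫 (q + r) = ∑ r, cosetSum ε w s 𝔫 r :=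
    Equiv.sum_comp (Equiv.addLeft q) (cosetSum ε w s 𝔫)
  have hmain : cosetSum ε w s 𝔫 q - (∑' x : 𝓞 F, smoothTerm ε w s x) / Ideal.absNorm 𝔫 =
      (∑ r, (cosetSum ε w s 𝔫 q - cosetSum ε w s 𝔫 (q + r))) / Ideal.absNorm 𝔫 := by
    rw [hT, Finset.sum_sub_distrib, hshift, sub_div, Finset.sum_const, Finset.card_univ,
      nsmul_eq_mul, ← hcard, mul_div_cancel_left₀ _ (by linarith)]
  rw [hmain, abs_div, abs_of_pos (by linarith : (0:ℝ) < Ideal.absNorm 𝔫)]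
  refine (div_le_self (abs_nonneg _) hN).trans ?_
  exact (Finset.abs_sum_le_sum_abs _ _).trans (Finset.sum_le_sum fun r _ => hdiff r)

end Cosets

section NormSign
variable {F : Type*} [Field F] [NumberField F] 

lemma coe_mul_ringOfIntegers (x y : 𝓞 F) : ((x * y : 𝓞 F) : F) = (x : F) * (y : F) := rfl

/-- The sign of the norm. -/
noncomputable def normSign (x : F) : ℝ := ((SignType.sign (Algebra.norm ℚ x) : SignType) : ℝ)

lemma normSign_mul (x y : F) : normSign (x * y) = normSign x * normSign y := by
  simp [normSign, sign_mul]

lemma normSign_eq_neg_one_of_neg {x : F} (h : Algebra.norm ℚ x < 0) : normSign x = -1 := by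
  simp [normSign, sign_neg h]

lemma normSign_of_pos {x : F} (h : 0 < Algebra.norm ℚ x) : normSign x = 1 := by
  simp [normSign, sign_pos h]

lemma abs_normSign_le (x : F) : |normSign x| ≤ 1 := by
  rcases lt_trichotomy (Algebra.norm ℚ x) 0 with h | h | h
  · simp [normSign_eq_neg_one_of_neg h]
  · simp [normSign, h]
  · simp [normSign_of_pos h]

variable [IsTotallyReal F]

lemma norm_eq_prod_re (x : F) : ((Algebra.norm ℚ x : ℚ) : ℝ) = ∏ φ : F →ₐ[ℚ] ℂ, (φ x).re := by
  have h := Algebra.norm_eq_prod_embeddings ℚ ℂ x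
  have hre : ∀ φ : F →ₐ[ℚ] ℂ, φ x = (((φ x).re : ℝ) : ℂ) := fun φ => by
    have hr : ComplexEmbedding.IsReal (φ : F →+* ℂ) := IsTotallyReal.complexEmbedding_isReal _
    have h1 := hr.coe_embedding_apply x
    change _ = φ x at h1
    rw [← h1, Complex.ofReal_re]
  rw [Finset.prod_congr rfl fun φ _ => hre φ, ← Complex.ofReal_prod] at h
  have h2 : (((Algebra.norm ℚ x : ℚ) : ℝ) : ℂ) = algebraMap ℚ ℂ (Algebra.norm ℚ x) := by simp
  rw [← h2] at h
  exact_mod_cast h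

lemma re_pos_of_place_lt {x : F} {φ : F →ₐ[ℚ] ℂ} (h : InfinitePlace.mk (φ : F →+* ℂ) (x - 1) < 1) :
    0 < (φ x).re := by
  rw [InfinitePlace.apply] at h
  simp only [map_sub, map_one] at h
  have h1 := (Complex.abs_re_le_norm _).trans_lt h
  have h2 := (abs_lt.1 h1).1
  simp only [Complex.sub_re, Complex.one_re] at h2
  change _ < (φ x).re - 1 at h2
  linarith

lemma isSignLike_normSign : IsSignLike (normSign : F → ℝ) where
  abs_le := abs_normSign_le
  eq_of_lt x y hx hy h := by
    have h1 : 0 < Algebra.norm ℚ (y / x) := by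
      have : (0 : ℝ) < ((Algebra.norm ℚ (y / x) : ℚ) : ℝ) := by
        rw [norm_eq_prod_re]
        refine Finset.prod_pos fun φ _ => re_pos_of_place_lt ?_
        rw [div_sub_one hx, map_div₀, div_lt_one (InfinitePlace.pos_iff.2 hx)]
        exact h _
      exact_mod_cast this
    rw [← div_mul_cancel₀ y hx, normSign_mul, normSign_of_pos h1, one_mul]

lemma exists_norm_neg : ∃ α : 𝓞 F, Algebra.norm ℚ (α : F) < 0 := by
  classical
  obtain ⟨v₀⟩ := (inferInstance : Nonempty (InfinitePlace F))
  let z : InfinitePlace F → F := fun v => if v = v₀ then -1 else 1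
  have hx : ∃ x : F, ∀ v : InfinitePlace F, v (x - z v) < 1 := by
    let z' : (v : InfinitePlace F) → WithAbs v.1 := fun v => WithAbs.toAbs v.1 (z v)
    obtain ⟨x, hx⟩ := Metric.denseRange_iff.1 (InfinitePlace.denseRange_algebraMap_pi F) z' 1 one_pos
    refine ⟨x, fun v => ?_⟩
    have h2 := (dist_le_pi_dist _ _ v).trans_lt hx
    rw [dist_eq_norm, norm_sub_rev] at h2
    exact h2
  obtain ⟨x, hx⟩ := hx
  have hneg : Algebra.norm ℚ x < 0 := by
    have : ((Algebra.norm ℚ x : ℚ) : ℝ) < 0 := by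
      rw [norm_eq_prod_re]
      let φ₀ : F →ₐ[ℚ] ℂ := RingHom.toRatAlgHom v₀.embedding
      rw [← Finset.mul_prod_erase _ _ (Finset.mem_univ φ₀)]
      refine mul_neg_of_neg_of_pos ?_ (Finset.prod_pos fun φ hφ => re_pos_of_place_lt ?_)
      · have h1 := hx v₀
        have h2 : 0 < (φ₀ (-x)).re := by
          refine re_pos_of_place_lt ?_
          have : InfinitePlace.mk (φ₀ : F →+* ℂ) = v₀ := InfinitePlace.mk_embedding v₀
          rw [this]
          simp only [z, if_true] at h1
          rw [← v₀.norm_embedding_eq] at h1 ⊢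
          rw [show (-x - 1 : F) = -(x - -1) by ring, map_neg, norm_neg]
          exact h1
        simpa using h2
      · have hne : InfinitePlace.mk (φ : F →+* ℂ) ≠ v₀ := by
          intro h
          have h3 : InfinitePlace.mk (φ : F →+* ℂ) = InfinitePlace.mk (v₀.embedding) := by
            rw [h, InfinitePlace.mk_embedding]
          rw [InfinitePlace.mk_eq_iff] at h3
          have hr : ComplexEmbedding.IsReal (φ : F →+* ℂ) := IsTotallyReal.complexEmbedding_isReal _
          rw [ComplexEmbedding.isReal_iff] at hr
          rw [hr, or_self] at h3
          refine Finset.ne_of_mem_erase hφ (AlgHom.ext fun y => ?_)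
          exact congrArg (fun f : F →+* ℂ => f y) h3
        have := hx (InfinitePlace.mk (φ : F →+* ℂ))
        simpa only [z, if_neg hne] using this
    exact_mod_cast this
  obtain ⟨a, b, hb, rfl⟩ := IsFractionRing.div_surjective (A := 𝓞 F) x
  have hb0 : (algebraMap (𝓞 F) F b) ≠ 0 := by
    simpa using nonZeroDivisors.ne_zero hb
  refine ⟨a * b, ?_⟩
  have h1 : ((a * b : 𝓞 F) : F) = algebraMap (𝓞 F) F a / algebraMap (𝓞 F) F b * (algebraMap (𝓞 F) F b * algebraMap (𝓞 F) F b) := by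
    rw [coe_mul_ringOfIntegers]; field_simp
  rw [h1, map_mul, map_mul]
  exact mul_neg_of_neg_of_pos hneg (mul_self_pos.2 (Algebra.norm_ne_zero_iff.2 hb0))

/-- After averaging a weight over an element of negative norm, the sum of the smooth terms twisted
by the sign of the norm stays bounded. -/
lemma exists_weight_abs_tsum_smoothTerm_normSign_le : ∃ w : F → ℝ, IsUnitWeight w ∧
    ∃ C : ℝ, 0 < C ∧ ∀ s : ℝ, 1 < s → s ≤ 2 → |∑' x : 𝓞 F, smoothTerm normSign w s x| ≤ C := by
  classical
  obtain ⟨w, hw⟩ := isUnitWeight_unitWeight (F := F)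
  obtain ⟨α, hα⟩ := exists_norm_neg (F := F)
  have hα0 : (α : F) ≠ 0 := by rintro h; rw [h, Algebra.norm_zero] at hα; exact lt_irrefl _ hα
  have hα1 : α ≠ 0 := by rintro rfl; simp at hα0
  have hε := isSignLike_normSign (F := F)
  refine ⟨_, hw.average hα0, ?_⟩
  obtain ⟨hS, C₁, hC₁, hT⟩ := exists_tsum_abs_smoothTerm_le hε hw
  have h𝔫 : Ideal.span {α} ≠ ⊥ := by simpa using hα1
  obtain ⟨C₂, hC₂, hcos⟩ := exists_abs_cosetSum_sub_le hε hw h𝔫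
  set a := absProd (α : F) with ha
  have haN : (Ideal.absNorm (Ideal.span {α}) : ℝ) = a := (absProd_eq_absNorm α).symm
  have ha1 : 1 ≤ a := one_le_absProd hα1
  have ha0 : 0 < a := by linarith
  refine ⟨C₁ * (a * Real.log a) + a ^ 2 * C₂ + 1, by have := Real.log_nonneg ha1; positivity,
    fun s hs1 hs2 => ?_⟩
  set T := ∑' x : 𝓞 F, smoothTerm normSign w s x with hTdef
  have hsumS := summable_smoothTerm hε hw hs1
  have hinj : Function.Injective fun x : 𝓞 F => α * x := fun x y h => mul_left_cancel₀ hα1 h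
  have hcs : cosetSum normSign w s (Ideal.span {α}) 0 = ∑' x : 𝓞 F, smoothTerm normSign w s (α * x : 𝓞 F) := by
    rw [cosetSum]
    rw [← hinj.tsum_eq]
    · refine tsum_congr fun x => ?_
      rw [if_pos]
      rw [Ideal.Quotient.eq_zero_iff_mem]
      exact Ideal.mem_span_singleton.2 (dvd_mul_right _ _)
    · intro x hx
      simp only [Function.mem_support, ne_eq, ite_eq_right_iff, not_forall] at hx
      obtain ⟨h1, -⟩ := hx
      rw [Ideal.Quotient.eq_zero_iff_mem, Ideal.mem_span_singleton] at h1
      obtain ⟨y, rfl⟩ := h1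
      exact ⟨y, rfl⟩
  have hterm : ∀ x : 𝓞 F, smoothTerm normSign (fun x => (w x + w (α * x)) / 2) s x =
      (smoothTerm normSign w s x + (-(a ^ s)) * smoothTerm normSign w s (α * x : 𝓞 F)) / 2 := fun x => by
    have h2 : a ^ s * a ^ (-s) = 1 := by rw [← Real.rpow_add ha0]; simp
    have h3 : absProd ((α * x : 𝓞 F) : F) ^ (-s) = a ^ (-s) * absProd (x : F) ^ (-s) := by
      rw [coe_mul_ringOfIntegers, absProd_mul, Real.mul_rpow ha0.le (absProd_nonneg _)]
    simp only [smoothTerm]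
    rw [h3, coe_mul_ringOfIntegers, normSign_mul, normSign_eq_neg_one_of_neg hα]
    linear_combination (-1/2) * (normSign (x : F) * absProd (x : F) ^ (-s) * w (α * x)) * h2
  have htot : ∑' x : 𝓞 F, smoothTerm normSign (fun x => (w x + w (α * x)) / 2) s x =
      (T + (-(a ^ s)) * cosetSum normSign w s (Ideal.span {α}) 0) / 2 := by
    rw [tsum_congr hterm, tsum_div_const, hcs, hTdef, ← tsum_mul_left, Summable.tsum_add hsumS]
    exact (hsumS.comp_injective hinj).mul_left _
  rw [htot]
  have h4 := hcos s hs1 hs2 0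
  rw [haN] at h4
  set S := cosetSum normSign w s (Ideal.span {α}) 0
  have h5 : |T| ≤ C₁ / (s - 1) := by
    refine le_trans ?_ (hT s hs1 hs2)
    have := norm_tsum_le_tsum_norm (f := fun x : 𝓞 F => smoothTerm normSign w s x) (hS s hs1)
    exact this
  have h6 : |1 - a ^ (s - 1)| ≤ (s - 1) * (a * Real.log a) := by
    have h7 : 1 ≤ a ^ (s - 1) := Real.one_le_rpow ha1 (by linarith)
    rw [abs_sub_comm, abs_of_nonneg (by linarith)]
    have h8 : a ^ (s - 1) ≤ a := by
      conv_rhs => rw [← Real.rpow_one a]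
      exact Real.rpow_le_rpow_of_exponent_le ha1 (by linarith)
    have h9 := Real.add_one_le_exp (-((s - 1) * Real.log a))
    have h10 : Real.exp (-((s - 1) * Real.log a)) * a ^ (s - 1) = 1 := by
      rw [Real.rpow_def_of_pos ha0, ← Real.exp_add]
      ring_nf; simp
    have hl := Real.log_nonneg ha1
    have h11 : (-((s - 1) * Real.log a) + 1) * a ^ (s - 1) ≤ 1 := by
      calc _ ≤ Real.exp (-((s - 1) * Real.log a)) * a ^ (s - 1) := by gcongr
        _ = 1 := h10
    have h12 : (s - 1) * Real.log a * a ^ (s - 1) ≤ (s - 1) * Real.log a * a := by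
      have : 0 ≤ s - 1 := by linarith
      gcongr
    nlinarith
  have h7 : a ^ s = a * a ^ (s - 1) := by
    rw [← Real.rpow_one_add' ha0.le (by linarith)]; ring_nf
  have h8 : T + -(a ^ s) * S = T * (1 - a ^ (s - 1)) - a ^ s * (S - T / a) := by
    rw [h7]; field_simp; ring
  have h9 : |T * (1 - a ^ (s - 1))| ≤ C₁ * (a * Real.log a) := by
    rw [abs_mul]
    have : 0 < s - 1 := by linarith
    calc |T| * |1 - a ^ (s - 1)| ≤ C₁ / (s - 1) * ((s - 1) * (a * Real.log a)) := by gcongr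
      _ = _ := by field_simp
  have h10 : |a ^ s * (S - T / a)| ≤ a ^ 2 * C₂ := by
    have h13 : a ^ s ≤ a ^ 2 := by
      rw [← Real.rpow_natCast]
      exact Real.rpow_le_rpow_of_exponent_le ha1 (by exact_mod_cast hs2)
    rw [abs_mul, abs_of_pos (by positivity)]
    gcongr
  rw [h8, abs_div, abs_two]
  have := abs_sub (T * (1 - a ^ (s - 1))) (a ^ s * (S - T / a))
  have := Real.log_nonneg ha1
  have : 0 ≤ C₁ * (a * Real.log a) := by positivity
  have : 0 ≤ a ^ 2 * C₂ := by positivity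
  linarith

lemma isSignLike_one : IsSignLike (fun _ : F => (1 : ℝ)) where
  abs_le _ := by simp
  eq_of_lt _ _ _ _ _ := rfl

end NormSign

section RayChar
variable {F : Type*} [Field F] [NumberField F]

/-- A ray class character modulo `𝔪`, with prescribed behaviour `ε` at infinity, given as a function
on ideals. -/
structure IsRayChar (χ : Ideal (𝓞 F) →*₀ ℂ) (ε : F → ℝ) (𝔪 : Ideal (𝓞 F)) : Prop where
  ne_bot : 𝔪 ≠ ⊥
  sign : IsSignLike ε
  sq : ∀ x, x ≠ 0 → ε x * ε x = 1
  norm_le : ∀ I, ‖χ I‖ ≤ 1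
  ne_zero : ∀ I, I ≠ ⊥ → I ⊔ 𝔪 = ⊤ → χ I ≠ 0
  eq_zero : ∀ I, I ⊔ 𝔪 ≠ ⊤ → χ I = 0
  periodic : ∀ α β : 𝓞 F, α ≠ 0 → β ≠ 0 → α - β ∈ 𝔪 →
    χ (Ideal.span {α}) * ε α = χ (Ideal.span {β}) * ε β

lemma exists_ne_zero_mk_eq {𝔪 : Ideal (𝓞 F)} (h : 𝔪 ≠ ⊥) (r : 𝓞 F ⧸ 𝔪) :
    ∃ x : 𝓞 F, x ≠ 0 ∧ Ideal.Quotient.mk 𝔪 x = r := by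
  obtain ⟨x, rfl⟩ := Ideal.Quotient.mk_surjective r
  rcases eq_or_ne x 0 with rfl | hx
  · obtain ⟨m, hm, hm0⟩ := Submodule.exists_mem_ne_zero_of_ne_bot h
    exact ⟨m, hm0, by rw [map_zero, Ideal.Quotient.eq_zero_iff_mem.2 hm]⟩
  · exact ⟨x, hx, rfl⟩

open scoped Classical in
/-- The function on residue classes attached to a function on ideals. -/
noncomputable def residueChar (χ : Ideal (𝓞 F) → ℂ) (ε : F → ℝ) (𝔪 : Ideal (𝓞 F))
    (r : 𝓞 F ⧸ 𝔪) : ℂ :=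
  if h : 𝔪 ≠ ⊥ then χ (Ideal.span {(exists_ne_zero_mk_eq h r).choose}) *
    ε (exists_ne_zero_mk_eq h r).choose else 0

lemma IsRayChar.residueChar_mk {χ : Ideal (𝓞 F) →*₀ ℂ} {ε : F → ℝ} {𝔪 : Ideal (𝓞 F)}
    (hχ : IsRayChar χ ε 𝔪) {x : 𝓞 F} (hx : x ≠ 0) :
    residueChar χ ε 𝔪 (Ideal.Quotient.mk 𝔪 x) = χ (Ideal.span {x}) * ε x := by
  have h := (exists_ne_zero_mk_eq hχ.ne_bot (Ideal.Quotient.mk 𝔪 x)).choose_spec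
  rw [residueChar, dif_pos hχ.ne_bot]
  exact hχ.periodic _ _ h.1 hx (Ideal.Quotient.eq.1 h.2)

lemma abs_one_sub_rpow_le {a s : ℝ} (ha1 : 1 ≤ a) (hs1 : 1 < s) (hs2 : s ≤ 2) :
    |1 - a ^ (s - 1)| ≤ (s - 1) * (a * Real.log a) := by
  have ha0 : 0 < a := by linarith
  have h7 : 1 ≤ a ^ (s - 1) := Real.one_le_rpow ha1 (by linarith)
  rw [abs_sub_comm, abs_of_nonneg (by linarith)]
  have h8 : a ^ (s - 1) ≤ a := by
    conv_rhs => rw [← Real.rpow_one a]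
    exact Real.rpow_le_rpow_of_exponent_le ha1 (by linarith)
  have h9 := Real.add_one_le_exp (-((s - 1) * Real.log a))
  have h10 : Real.exp (-((s - 1) * Real.log a)) * a ^ (s - 1) = 1 := by
    rw [Real.rpow_def_of_pos ha0, ← Real.exp_add]
    ring_nf; simp
  have hl := Real.log_nonneg ha1
  have h11 : (-((s - 1) * Real.log a) + 1) * a ^ (s - 1) ≤ 1 := by
    calc _ ≤ Real.exp (-((s - 1) * Real.log a)) * a ^ (s - 1) := by gcongr
      _ = 1 := h10
  have h12 : (s - 1) * Real.log a * a ^ (s - 1) ≤ (s - 1) * Real.log a * a := by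
    have : 0 ≤ s - 1 := by linarith
    gcongr
  nlinarith

lemma ideal_mul_ne_bot {I J : Ideal (𝓞 F)} (hI : I ≠ ⊥) (hJ : J ≠ ⊥) : I * J ≠ ⊥ := by
  rw [← Submodule.zero_eq_bot] at *
  exact mul_ne_zero hI hJ

lemma mul_eq_inf_of_sup_eq_top {I J : Ideal (𝓞 F)} (h : I ⊔ J = ⊤) : I * J = I ⊓ J :=
  Ideal.mul_eq_inf_of_coprime h

lemma exists_crt {I J : Ideal (𝓞 F)} (h : I ⊔ J = ⊤) (a b : 𝓞 F) : ∃ x, x - a ∈ I ∧ x - b ∈ J := by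
  obtain ⟨i, hi, j, hj, hij⟩ := Submodule.mem_sup.1 (h ▸ Submodule.mem_top : (1 : 𝓞 F) ∈ I ⊔ J)
  refine ⟨i * b + j * a, ?_, ?_⟩
  · have : i * b + j * a - a = i * (b - a) := by linear_combination a * hij
    rw [this]; exact I.mul_mem_right _ hi
  · have : i * b + j * a - b = j * (a - b) := by linear_combination b * hij
    rw [this]; exact J.mul_mem_right _ hj

variable [IsTotallyReal F]

lemma summable_mul_idealTerm {χ : Ideal (𝓞 F) → ℂ} (h : ∀ I, ‖χ I‖ ≤ 1) {s : ℝ} (hs : 1 < s) :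
    Summable fun I => ‖χ I * (idealTerm s I : ℂ)‖ := by
  refine (summable_idealTerm hs).of_nonneg_of_le (fun _ => norm_nonneg _) fun I => ?_
  rw [norm_mul, Complex.norm_real, Real.norm_of_nonneg (idealTerm_nonneg s I)]
  exact mul_le_of_le_one_left (idealTerm_nonneg s I) (h I)

lemma idealTerm_mul (s : ℝ) (I J : Ideal (𝓞 F)) :
    idealTerm s (I * J) = idealTerm s I * idealTerm s J := by
  rw [idealTerm, map_mul, Nat.cast_mul, Real.mul_rpow (by positivity) (by positivity)]
  rfl

lemma mul_right_injective_ideal {J : Ideal (𝓞 F)} (hJ : J ≠ ⊥) :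
    Function.Injective fun I : Ideal (𝓞 F) => I * J :=
  fun _ _ h => mul_right_cancel₀ (by simpa using hJ) h

open scoped Classical in
lemma IsRayChar.tsum_principal_mul {χ : Ideal (𝓞 F) →*₀ ℂ} {ε w : F → ℝ} {𝔪 : Ideal (𝓞 F)}
    (hχ : IsRayChar χ ε 𝔪) (hw : IsUnitWeight w) {J : Ideal (𝓞 F)} (hJ : J ≠ ⊥) {s : ℝ} (hs : 1 < s) :
    HasSum (fun x : 𝓞 F => (if x ∈ J then residueChar χ ε 𝔪 (Ideal.Quotient.mk 𝔪 x) else 0) *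
      (smoothTerm ε w s x : ℂ))
      ((∑' I : Ideal (𝓞 F), if Submodule.IsPrincipal (I * J) then χ I * (idealTerm s I : ℂ) else 0) *
        (χ J * (idealTerm s J : ℂ))) := by
  have h1 : Summable fun I : Ideal (𝓞 F) => ‖if I ≤ J then χ I * (idealTerm s I : ℂ) else 0‖ := by
    refine (summable_mul_idealTerm hχ.norm_le hs).of_nonneg_of_le (fun _ => norm_nonneg _) fun I => ?_
    split_ifs
    · exact le_rfl
    · rw [norm_zero]; exact norm_nonneg _
  have h2 := hasSum_span_mul_weight hw h1 (by
    have : idealTerm s (⊥ : Ideal (𝓞 F)) = 0 := idealTerm_bot (by linarith)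
    simp [this])
  have h3 : (∑' I : Ideal (𝓞 F), if Submodule.IsPrincipal (I * J) then χ I * (idealTerm s I : ℂ) else 0) *
        (χ J * (idealTerm s J : ℂ)) = ∑' I : Ideal (𝓞 F), if Submodule.IsPrincipal I then
          (if I ≤ J then χ I * (idealTerm s I : ℂ) else 0) else 0 := by
    rw [← tsum_mul_right, ← (mul_right_injective_ideal hJ).tsum_eq (f := fun I : Ideal (𝓞 F) =>
      if Submodule.IsPrincipal I then (if I ≤ J then χ I * (idealTerm s I : ℂ) else 0) else 0)]
    · refine tsum_congr fun I => ?_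
      simp only [if_pos (Ideal.mul_le_right : I * J ≤ J)]
      rw [map_mul, idealTerm_mul]
      split_ifs
      · push_cast; ring
      · simp
    · intro I hI
      have : I ≤ J := by
        by_contra h
        simp [h] at hI
      obtain ⟨K, rfl⟩ := Ideal.dvd_iff_le.2 this
      exact ⟨K, mul_comm _ _⟩
  rw [h3]
  convert h2 using 2 with x
  rw [Ideal.span_singleton_le_iff_mem]
  rcases eq_or_ne x 0 with rfl | hx
  · have hz : smoothTerm ε w s ((0 : 𝓞 F) : F) = 0 := by
      simpa using smoothTerm_zero ε w (s := s) (by linarith)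
    rw [hz]
    have : idealTerm s (⊥ : Ideal (𝓞 F)) = 0 := idealTerm_bot (by linarith)
    simp [this]
  · split_ifs
    · have h4 : ((ε x : ℝ) : ℂ) * (ε x : ℝ) = 1 := by
        exact_mod_cast hχ.sq x (by simpa using hx)
      rw [hχ.residueChar_mk hx, smoothTerm_eq]
      push_cast
      linear_combination (χ (Ideal.span {x}) * (idealTerm s (Ideal.span {x}) : ℂ) * (w x : ℂ)) * h4
    · simp

/-- The sum of the values of a ray class character over residue classes. -/
noncomputable def residueTotal (χ : Ideal (𝓞 F) → ℂ) (ε : F → ℝ) (𝔪 : Ideal (𝓞 F)) : ℂ :=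
  ∑' r, residueChar χ ε 𝔪 r

open scoped Classical in
lemma exists_residue_lift (χ : Ideal (𝓞 F) → ℂ) (ε : F → ℝ) {J 𝔪 : Ideal (𝓞 F)} (h𝔪 : 𝔪 ≠ ⊥)
    (h : J ⊔ 𝔪 = ⊤) [Fintype (𝓞 F ⧸ (J * 𝔪))] : ∃ g : 𝓞 F ⧸ (J * 𝔪) → ℂ,
    (∀ x : 𝓞 F, g (Ideal.Quotient.mk _ x) =
      if x ∈ J then residueChar χ ε 𝔪 (Ideal.Quotient.mk 𝔪 x) else 0) ∧
    ∑ q, g q = residueTotal χ ε 𝔪 := by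
  let o : 𝓞 F ⧸ (J * 𝔪) → 𝓞 F := Function.surjInv Ideal.Quotient.mk_surjective
  have ho : ∀ q, Ideal.Quotient.mk _ (o q) = q := Function.surjInv_eq _
  have hdiff : ∀ x, o (Ideal.Quotient.mk _ x) - x ∈ J * 𝔪 := fun x => Ideal.Quotient.eq.1 (ho _)
  have hJm : ∀ x y : 𝓞 F, y - x ∈ J → (y ∈ J ↔ x ∈ J) := fun x y hxy =>
    ⟨fun hy => by simpa using J.sub_mem hy hxy, fun hx => by simpa using J.add_mem hxy hx⟩
  refine ⟨fun q => if o q ∈ J then residueChar χ ε 𝔪 (Ideal.Quotient.mk 𝔪 (o q)) else 0, fun x => ?_, ?_⟩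
  · have h1 := hdiff x
    simp only [hJm _ _ (Ideal.mul_le_left h1)]
    rw [Ideal.Quotient.eq.2 (Ideal.mul_le_right h1)]
  · have := Ideal.finiteQuotientOfFreeOfNeBot 𝔪 h𝔪
    have := Fintype.ofFinite (𝓞 F ⧸ 𝔪)
    rw [residueTotal, tsum_fintype, ← Finset.sum_filter]
    refine Finset.sum_bij (fun q _ => Ideal.Quotient.mk 𝔪 (o q)) (fun _ _ => Finset.mem_univ _) ?_ ?_
      fun _ _ => rfl
    · intro p hp q hq hpq
      rw [← ho p, ← ho q, Ideal.Quotient.eq, mul_eq_inf_of_sup_eq_top h]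
      exact ⟨J.sub_mem (Finset.mem_filter.1 hp).2 (Finset.mem_filter.1 hq).2, Ideal.Quotient.eq.1 hpq⟩
    · intro r _
      obtain ⟨y, rfl⟩ := Ideal.Quotient.mk_surjective r
      obtain ⟨x, hx, hxy⟩ := exists_crt h 0 y
      rw [sub_zero] at hx
      refine ⟨Ideal.Quotient.mk _ x, Finset.mem_filter.2 ⟨Finset.mem_univ _, ?_⟩, ?_⟩
      · exact (hJm _ _ (Ideal.mul_le_left (hdiff x))).2 hx
      · rw [Ideal.Quotient.eq.2 (Ideal.mul_le_right (hdiff x)), Ideal.Quotient.eq]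
        exact hxy

open scoped Classical in
lemma IsRayChar.exists_norm_tsum_principal_sub_le {χ : Ideal (𝓞 F) →*₀ ℂ} {ε w : F → ℝ}
    {𝔪 : Ideal (𝓞 F)} (hχ : IsRayChar χ ε 𝔪) (hw : IsUnitWeight w) {J : Ideal (𝓞 F)} (hJ : J ≠ ⊥)
    (hJm : J ⊔ 𝔪 = ⊤) : ∃ C : ℝ, ∀ s : ℝ, 1 < s → s ≤ 2 →
    ‖(∑' I : Ideal (𝓞 F), if Submodule.IsPrincipal (I * J) then χ I * (idealTerm s I : ℂ) else 0) -
      (χ J)⁻¹ * (residueTotal χ ε 𝔪 * ((∑' x : 𝓞 F, smoothTerm ε w s x : ℝ) : ℂ) /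
        Ideal.absNorm 𝔪)‖ ≤ C := by
  have hn : J * 𝔪 ≠ ⊥ := ideal_mul_ne_bot hJ hχ.ne_bot
  have := Ideal.finiteQuotientOfFreeOfNeBot (J * 𝔪) hn
  have := Fintype.ofFinite (𝓞 F ⧸ (J * 𝔪))
  obtain ⟨g, hg1, hg2⟩ := exists_residue_lift χ ε hχ.ne_bot hJm
  obtain ⟨C₂, hC₂, hcos⟩ := exists_abs_cosetSum_sub_le hχ.sign hw hn
  obtain ⟨hS, C₁, hC₁, hT⟩ := exists_tsum_abs_smoothTerm_le hχ.sign hw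
  set a : ℝ := (Ideal.absNorm J : ℝ) with ha
  set b : ℝ := (Ideal.absNorm 𝔪 : ℝ) with hb
  set G := residueTotal χ ε 𝔪
  have ha1 : 1 ≤ a := by
    have : Ideal.absNorm J ≠ 0 := Ideal.absNorm_eq_zero_iff.not.2 hJ
    rw [ha]; exact_mod_cast Nat.one_le_iff_ne_zero.2 this
  have hb1 : 1 ≤ b := by
    have : Ideal.absNorm 𝔪 ≠ 0 := Ideal.absNorm_eq_zero_iff.not.2 hχ.ne_bot
    rw [hb]; exact_mod_cast Nat.one_le_iff_ne_zero.2 this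
  have ha0 : 0 < a := by linarith
  have hb0 : 0 < b := by linarith
  have hN : (Ideal.absNorm (J * 𝔪) : ℝ) = a * b := by rw [map_mul]; push_cast; rfl
  have hχJ : χ J ≠ 0 := hχ.ne_zero J hJ hJm
  refine ⟨‖(χ J)⁻¹‖ * (‖G‖ / b * (C₁ * (a * Real.log a)) + a ^ 2 * ∑ q, ‖g q‖ * C₂),
    fun s hs1 hs2 => ?_⟩
  set T := ∑' x : 𝓞 F, smoothTerm ε w s x
  set A := ∑' I : Ideal (𝓞 F), if Submodule.IsPrincipal (I * J) then χ I * (idealTerm s I : ℂ) else 0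
    with hA
  have h1 : A * (χ J * (idealTerm s J : ℂ)) = ∑ q, g q * (cosetSum ε w s (J * 𝔪) q : ℂ) := by
    refine HasSum.unique (hχ.tsum_principal_mul hw hJ hs1) ?_
    have := tsum_mul_smoothTerm hχ.sign hw hs1 (J * 𝔪) g
    simpa only [hg1] using this
  set E := ∑ q, g q * ((cosetSum ε w s (J * 𝔪) q - T / (a * b) : ℝ) : ℂ) with hE
  have h2 : A * (χ J * (idealTerm s J : ℂ)) = G * (T / (a * b) : ℝ) + E := by
    rw [h1, ← hg2, hE, Finset.sum_mul, ← Finset.sum_add_distrib]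
    refine Finset.sum_congr rfl fun q _ => ?_
    push_cast; ring
  have hEle : ‖E‖ ≤ ∑ q, ‖g q‖ * C₂ := by
    refine (norm_sum_le _ _).trans (Finset.sum_le_sum fun q _ => ?_)
    rw [norm_mul, Complex.norm_real]
    have := hcos s hs1 hs2 q
    rw [hN] at this
    gcongr
    exact this
  have h3 : ((a ^ s : ℝ) : ℂ) * (idealTerm s J : ℂ) = 1 := by
    rw [idealTerm, ← ha, ← Complex.ofReal_mul, ← Real.rpow_add ha0]; simp
  have h4 : a ^ s = a * a ^ (s - 1) := by
    rw [← Real.rpow_one_add' ha0.le (by linarith)]; ring_nf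
  have ha0' : (a : ℂ) ≠ 0 := by exact_mod_cast ha0.ne'
  have hb0' : (b : ℂ) ≠ 0 := by exact_mod_cast hb0.ne'
  have hbc : ((Ideal.absNorm 𝔪 : ℕ) : ℂ) = (b : ℂ) := by rw [hb]; simp
  have h5 : A - (χ J)⁻¹ * (G * (T : ℂ) / (b : ℂ)) =
      (χ J)⁻¹ * (-(G / b * ((T * (1 - a ^ (s - 1)) : ℝ) : ℂ)) + ((a ^ s : ℝ) : ℂ) * E) := by
    have h6 : A = (χ J)⁻¹ * ((a ^ s : ℝ) : ℂ) * (A * (χ J * (idealTerm s J : ℂ))) := by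
      have : (χ J)⁻¹ * χ J = 1 := inv_mul_cancel₀ hχJ
      linear_combination (-A) * (((a ^ s : ℝ) : ℂ) * (idealTerm s J : ℂ)) * this - A * h3
    rw [h6, h2, h4]
    push_cast
    field_simp
    ring
  rw [hbc, h5, norm_mul]
  refine mul_le_mul_of_nonneg_left ((norm_add_le _ _).trans (add_le_add ?_ ?_)) (norm_nonneg _)
  · rw [norm_neg, norm_mul, norm_div, Complex.norm_real, Complex.norm_real, Real.norm_of_nonneg hb0.le,
      Real.norm_eq_abs, abs_mul]
    have h5 : |T| ≤ C₁ / (s - 1) := by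
      refine le_trans ?_ (hT s hs1 hs2)
      have := norm_tsum_le_tsum_norm (f := fun x : 𝓞 F => smoothTerm ε w s x) (hS s hs1)
      exact this
    have h6 := abs_one_sub_rpow_le ha1 hs1 hs2
    have : 0 < s - 1 := by linarith
    refine mul_le_mul_of_nonneg_left ?_ (by positivity)
    calc |T| * |1 - a ^ (s - 1)| ≤ C₁ / (s - 1) * ((s - 1) * (a * Real.log a)) := by gcongr
      _ = _ := by field_simp
  · rw [norm_mul, Complex.norm_real, Real.norm_of_nonneg (by positivity)]
    have h13 : a ^ s ≤ a ^ 2 := by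
      rw [← Real.rpow_natCast]
      exact Real.rpow_le_rpow_of_exponent_le ha1 (by exact_mod_cast hs2)
    gcongr

end RayChar

section LBound
variable {F : Type*} [Field F] [NumberField F]

open nonZeroDivisors

lemma isPrincipal_mul_iff {I J : (Ideal (𝓞 F))⁰} :
    Submodule.IsPrincipal ((I : Ideal (𝓞 F)) * (J : Ideal (𝓞 F))) ↔
      ClassGroup.mk0 I = (ClassGroup.mk0 J)⁻¹ := by
  rw [eq_inv_iff_mul_eq_one, ← map_mul]
  exact (ClassGroup.mk0_eq_one_iff (I * J : (Ideal (𝓞 F))⁰).2).symm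

/-- Every ideal class has a representative coprime to a given ideal. -/
lemma exists_mk0_eq_sup_eq_top (c : ClassGroup (𝓞 F)) {𝔪 : Ideal (𝓞 F)} (h𝔪 : 𝔪 ≠ ⊥) :
    ∃ J : (Ideal (𝓞 F))⁰, ClassGroup.mk0 J = c ∧ (J : Ideal (𝓞 F)) ⊔ 𝔪 = ⊤ := by
  obtain ⟨K, hK⟩ := ClassGroup.mk0_surjective c⁻¹
  have hK0 : (K : Ideal (𝓞 F)) ≠ ⊥ := mem_nonZeroDivisors_iff_ne_zero.1 K.2
  obtain ⟨a, ha⟩ := IsDedekindDomain.exists_sup_span_eq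
    (Ideal.mul_le_right : 𝔪 * (K : Ideal (𝓞 F)) ≤ K) (ideal_mul_ne_bot h𝔪 hK0)
  obtain ⟨a, ha, ha0⟩ : ∃ a, 𝔪 * (K : Ideal (𝓞 F)) ⊔ Ideal.span {a} = K ∧ a ≠ 0 := by
    by_cases h : a = 0
    · subst h
      obtain ⟨b, hb, hb0⟩ := Submodule.exists_mem_ne_zero_of_ne_bot (ideal_mul_ne_bot h𝔪 hK0)
      refine ⟨b, ?_, hb0⟩
      rw [sup_eq_left.2 ((Ideal.span_singleton_le_iff_mem _).2 hb)]
      simpa using ha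
    · exact ⟨a, ha, h⟩
  have haK : Ideal.span {a} ≤ (K : Ideal (𝓞 F)) := ha ▸ le_sup_right
  obtain ⟨J, hJ⟩ := Ideal.dvd_iff_le.2 haK
  have hJ0 : J ≠ 0 := by
    rintro rfl
    rw [mul_zero, Ideal.zero_eq_bot, Ideal.span_singleton_eq_bot] at hJ
    exact ha0 hJ
  obtain ⟨J, rfl⟩ : ∃ J' : (Ideal (𝓞 F))⁰, (J' : Ideal (𝓞 F)) = J :=
    ⟨⟨J, mem_nonZeroDivisors_of_ne_zero hJ0⟩, rfl⟩
  refine ⟨J, ?_, ?_⟩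
  · rw [← inv_inv c, ← hK, ← isPrincipal_mul_iff, mul_comm, ← hJ]
    exact ⟨a, rfl⟩
  · have h2 : (K : Ideal (𝓞 F)) * ((J : Ideal (𝓞 F)) ⊔ 𝔪) = K * ⊤ := by
      rw [Ideal.mul_sup, ← hJ, sup_comm, mul_comm, ha, Ideal.mul_top]
    exact mul_left_cancel₀ hK0 h2

variable [IsTotallyReal F]

open scoped Classical in
lemma tsum_eq_sum_class {χ : Ideal (𝓞 F) →*₀ ℂ} (h : ∀ I, ‖χ I‖ ≤ 1)
    (J : ClassGroup (𝓞 F) → (Ideal (𝓞 F))⁰) (hJ : ∀ c, ClassGroup.mk0 (J c) = c) 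
    {s : ℝ} (hs : 1 < s) : ∑' I : Ideal (𝓞 F), χ I * (idealTerm s I : ℂ) =
      ∑ c, ∑' I : Ideal (𝓞 F), if Submodule.IsPrincipal (I * (J c : Ideal (𝓞 F))) then
        χ I * (idealTerm s I : ℂ) else 0 := by
  rw [← Summable.tsum_finsetSum]
  · refine tsum_congr fun I => ?_
    rcases eq_or_ne I 0 with rfl | hI
    · have h0 : idealTerm s (0 : Ideal (𝓞 F)) = 0 := idealTerm_bot (by linarith)
      simp only [h0, Complex.ofReal_zero, mul_zero, ite_self, Finset.sum_const_zero]
    · have h1 : ∀ c, Submodule.IsPrincipal (I * (J c : Ideal (𝓞 F))) ↔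
          (ClassGroup.mk0 ⟨I, mem_nonZeroDivisors_of_ne_zero hI⟩)⁻¹ = c := fun c => by
        conv_rhs => rw [← hJ c, inv_eq_iff_eq_inv, ← isPrincipal_mul_iff]
      simp [h1]
  · intro c _
    refine Summable.of_norm_bounded (summable_mul_idealTerm h hs) fun I => ?_
    split_ifs
    · exact le_rfl
    · rw [norm_zero]; exact norm_nonneg _

lemma IsRayChar.exists_norm_tsum_sub_le {χ : Ideal (𝓞 F) →*₀ ℂ} {ε w : F → ℝ}
    {𝔪 : Ideal (𝓞 F)} (hχ : IsRayChar χ ε 𝔪) (hw : IsUnitWeight w)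
    (J : ClassGroup (𝓞 F) → (Ideal (𝓞 F))⁰) (hJ : ∀ c, ClassGroup.mk0 (J c) = c)
    (hJm : ∀ c, (J c : Ideal (𝓞 F)) ⊔ 𝔪 = ⊤) : ∃ C : ℝ, ∀ s : ℝ, 1 < s → s ≤ 2 →
    ‖(∑' I : Ideal (𝓞 F), χ I * (idealTerm s I : ℂ)) -
      (∑ c, (χ (J c))⁻¹) * residueTotal χ ε 𝔪 * ((∑' x : 𝓞 F, smoothTerm ε w s x : ℝ) : ℂ) /
        Ideal.absNorm 𝔪‖ ≤ C := by
  classical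
  choose C hC using fun c => hχ.exists_norm_tsum_principal_sub_le hw
    (mem_nonZeroDivisors_iff_ne_zero.1 (J c).2) (hJm c)
  refine ⟨∑ c, C c, fun s hs1 hs2 => ?_⟩
  rw [tsum_eq_sum_class hχ.norm_le J hJ hs1, mul_assoc, mul_div_assoc, Finset.sum_mul,
    ← Finset.sum_sub_distrib]
  exact (norm_sum_le _ _).trans (Finset.sum_le_sum fun c _ => hC c s hs1 hs2)

omit [IsTotallyReal F] in
lemma mul_sup_eq_top {I K 𝔪 : Ideal (𝓞 F)} (hI : I ⊔ 𝔪 = ⊤) (hK : K ⊔ 𝔪 = ⊤) : I * K ⊔ 𝔪 = ⊤ := by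
  rw [← Ideal.isCoprime_iff_sup_eq] at *
  exact hI.mul_left hK

omit [IsTotallyReal F] in
lemma IsRayChar.apply_span_eq_one {χ : Ideal (𝓞 F) →*₀ ℂ} {𝔪 : Ideal (𝓞 F)}
    (hχ : IsRayChar χ (fun _ => 1) 𝔪) (h : residueTotal χ (fun _ => 1) 𝔪 ≠ 0) {α : 𝓞 F}
    (hα : α ≠ 0) (hα1 : Ideal.span {α} ⊔ 𝔪 = ⊤) : χ (Ideal.span {α}) = 1 := by
  classical
  have := Ideal.finiteQuotientOfFreeOfNeBot 𝔪 hχ.ne_bot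
  have := Fintype.ofFinite (𝓞 F ⧸ 𝔪)
  have hinj : Function.Injective fun r : 𝓞 F ⧸ 𝔪 => Ideal.Quotient.mk 𝔪 α * r := by
    obtain ⟨a, ha, m, hm, ham⟩ := Submodule.mem_sup.1 (hα1 ▸ Submodule.mem_top : (1 : 𝓞 F) ∈ _)
    obtain ⟨c, rfl⟩ := Ideal.mem_span_singleton.1 ha
    have h1 : Ideal.Quotient.mk 𝔪 c * Ideal.Quotient.mk 𝔪 α = 1 := by
      rw [← map_mul, ← map_one (Ideal.Quotient.mk 𝔪), eq_comm, Ideal.Quotient.eq, ← ham]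
      ring_nf; exact hm
    intro r r' hr
    simp only at hr
    rw [← one_mul r, ← one_mul r', ← h1, mul_assoc, hr, mul_assoc]
  have h2 := (Finite.injective_iff_bijective.1 hinj).sum_comp (residueChar χ (fun _ => 1) 𝔪)
  have h3 : ∀ r, residueChar χ (fun _ => 1) 𝔪 (Ideal.Quotient.mk 𝔪 α * r) =
      χ (Ideal.span {α}) * residueChar χ (fun _ => 1) 𝔪 r := fun r => by
    obtain ⟨x, hx, rfl⟩ := exists_ne_zero_mk_eq hχ.ne_bot r
    rw [← map_mul, hχ.residueChar_mk hx, hχ.residueChar_mk (mul_ne_zero hα hx),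
      ← Ideal.span_singleton_mul_span_singleton, map_mul]
    simp
  simp only [h3] at h2
  rw [residueTotal, tsum_fintype] at h
  rw [← Finset.mul_sum] at h2
  exact mul_right_cancel₀ h (by rw [h2, one_mul])

omit [IsTotallyReal F] in
lemma IsRayChar.sum_inv_mul_residueTotal_eq_zero {χ : Ideal (𝓞 F) →*₀ ℂ} {𝔪 : Ideal (𝓞 F)}
    (hχ : IsRayChar χ (fun _ => 1) 𝔪) {I₀ : Ideal (𝓞 F)} (hI₀ : I₀ ≠ ⊥) (hI₀m : I₀ ⊔ 𝔪 = ⊤)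
    (hI₀1 : χ I₀ ≠ 1)
    (J : ClassGroup (𝓞 F) → (Ideal (𝓞 F))⁰) (hJ : ∀ c, ClassGroup.mk0 (J c) = c)
    (hJm : ∀ c, (J c : Ideal (𝓞 F)) ⊔ 𝔪 = ⊤) :
    (∑ c, (χ (J c))⁻¹) * residueTotal χ (fun _ => 1) 𝔪 = 0 := by
  by_cases h : residueTotal χ (fun _ => 1) 𝔪 = 0
  · rw [h, mul_zero]
  have h1 : ∀ I K : (Ideal (𝓞 F))⁰, (I : Ideal (𝓞 F)) ⊔ 𝔪 = ⊤ → (K : Ideal (𝓞 F)) ⊔ 𝔪 = ⊤ →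
      ClassGroup.mk0 I = (ClassGroup.mk0 K)⁻¹ → χ I * χ K = 1 := fun I K hI hK hIK => by
    rw [← isPrincipal_mul_iff] at hIK
    obtain ⟨a, ha⟩ := hIK
    have ha0 : a ≠ 0 := by
      rintro rfl
      refine ideal_mul_ne_bot (mem_nonZeroDivisors_iff_ne_zero.1 I.2)
        (mem_nonZeroDivisors_iff_ne_zero.1 K.2) ?_
      rw [ha]; simp
    have ha' : (I : Ideal (𝓞 F)) * K = Ideal.span {a} := ha
    rw [← map_mul, ha']
    exact hχ.apply_span_eq_one h ha0 (ha' ▸ mul_sup_eq_top hI hK)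
  obtain ⟨I₀, rfl⟩ : ∃ J' : (Ideal (𝓞 F))⁰, (J' : Ideal (𝓞 F)) = I₀ :=
    ⟨⟨I₀, mem_nonZeroDivisors_of_ne_zero hI₀⟩, rfl⟩
  have h2 : ∀ c, (χ (J (ClassGroup.mk0 I₀ * c)))⁻¹ = (χ I₀)⁻¹ * (χ (J c))⁻¹ := fun c => by
    set K := J (ClassGroup.mk0 I₀ * c)⁻¹ with hK
    have h3 := h1 (J (ClassGroup.mk0 I₀ * c)) K (hJm _) (hJm _) (by rw [hJ, hJ, inv_inv])
    have h4 := h1 (I₀ * J c) K (mul_sup_eq_top hI₀m (hJm c)) (hJm _)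
      (by rw [map_mul, hJ, hJ, inv_inv])
    rw [Submonoid.coe_mul, map_mul] at h4
    rw [← mul_inv, eq_inv_of_mul_eq_one_left h3, eq_inv_of_mul_eq_one_left h4]
  have h5 := Equiv.sum_comp (Equiv.mulLeft (ClassGroup.mk0 I₀)) fun c => (χ (J c))⁻¹
  simp only [Equiv.coe_mulLeft, h2] at h5
  rw [← Finset.mul_sum] at h5
  have h6 : (∑ c, (χ (J c))⁻¹) = 0 := by
    by_contra h7
    have h8 : (χ I₀)⁻¹ = 1 := mul_right_cancel₀ h7 (by rw [h5, one_mul])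
    exact hI₀1 (inv_eq_one.1 h8)
  rw [h6, zero_mul]

/-- Boundedness near `1` of the L-function of a nontrivial ray class character, or of one which is
the sign of the norm at infinity. -/
theorem IsRayChar.exists_norm_tsum_le {χ : Ideal (𝓞 F) →*₀ ℂ} {ε : F → ℝ} {𝔪 : Ideal (𝓞 F)}
    (hχ : IsRayChar χ ε 𝔪)
    (h : ε = normSign ∨ (ε = fun _ => 1) ∧ ∃ I, I ≠ ⊥ ∧ I ⊔ 𝔪 = ⊤ ∧ χ I ≠ 1) :
    ∃ C : ℝ, ∀ s : ℝ, 1 < s → s ≤ 2 → ‖∑' I : Ideal (𝓞 F), χ I * (idealTerm s I : ℂ)‖ ≤ C := by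
  choose J hJ hJm using fun c => exists_mk0_eq_sup_eq_top (F := F) c hχ.ne_bot
  rcases h with rfl | ⟨rfl, I₀, hI₀, hI₀m, hI₀1⟩
  · obtain ⟨w, hw, C, hC, hT⟩ := exists_weight_abs_tsum_smoothTerm_normSign_le (F := F)
    obtain ⟨C', h'⟩ := hχ.exists_norm_tsum_sub_le hw J hJ hJm
    refine ⟨C' + ‖(∑ c, (χ (J c))⁻¹) * residueTotal χ normSign 𝔪‖ * C / ‖((Ideal.absNorm 𝔪 : ℕ) : ℂ)‖,
      fun s hs1 hs2 => ?_⟩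
    refine (norm_le_norm_sub_add _ _).trans (add_le_add (h' s hs1 hs2) ?_)
    rw [norm_div, norm_mul _ (Complex.ofReal _), Complex.norm_real]
    have := hT s hs1 hs2
    gcongr
    exact this
  · obtain ⟨w, hw⟩ := isUnitWeight_unitWeight (F := F)
    obtain ⟨C', h'⟩ := hχ.exists_norm_tsum_sub_le hw J hJ hJm
    refine ⟨C', fun s hs1 hs2 => ?_⟩
    have := h' s hs1 hs2
    rw [hχ.sum_inv_mul_residueTotal_eq_zero hI₀ hI₀m hI₀1 J hJ hJm, zero_mul, zero_div, sub_zero] at this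
    exact this

end LBound

section Euler
variable {F : Type*} [Field F] [NumberField F] 

open IsDedekindDomain Filter Topology

open scoped Classical in
lemma tsum_coprime_eq {f : Ideal (𝓞 F) →*₀ ℂ} (hf : Summable fun I => ‖f I‖)
    (Q : Finset (HeightOneSpectrum (𝓞 F))) :
    (∑' I : Ideal (𝓞 F), if ∀ q ∈ Q, ¬ q.asIdeal ∣ I then f I else 0) =
      (∑' I : Ideal (𝓞 F), f I) * ∏ q ∈ Q, (1 - f q.asIdeal) := by
  induction Q using Finset.induction_on with
  | empty => simp
  | insert p Q hp ih =>
    rw [Finset.prod_insert hp, mul_left_comm, ← ih, sub_mul, one_mul, ← tsum_mul_left]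
    have hsum : ∀ (P : Ideal (𝓞 F) → Prop) [DecidablePred P], Summable fun I => if P I then f I else 0 := fun P _ => by
      refine Summable.of_norm_bounded hf fun I => ?_
      split_ifs
      · exact le_rfl
      · rw [norm_zero]; exact norm_nonneg _
    have h1 : ∑' I : Ideal (𝓞 F), f p.asIdeal * (if ∀ q ∈ Q, ¬ q.asIdeal ∣ I then f I else 0) =
        ∑' I : Ideal (𝓞 F), if (∀ q ∈ Q, ¬ q.asIdeal ∣ I) ∧ p.asIdeal ∣ I then f I else 0 := by
      have hinj : Function.Injective fun I : Ideal (𝓞 F) => p.asIdeal * I :=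
        fun _ _ h => mul_left_cancel₀ p.ne_bot h
      rw [← hinj.tsum_eq (f := fun I : Ideal (𝓞 F) =>
        if (∀ q ∈ Q, ¬ q.asIdeal ∣ I) ∧ p.asIdeal ∣ I then f I else 0)]
      · refine tsum_congr fun I => ?_
        have h2 : (∀ q ∈ Q, ¬ q.asIdeal ∣ p.asIdeal * I) ↔ ∀ q ∈ Q, ¬ q.asIdeal ∣ I := by
          refine forall₂_congr fun q hq => not_congr ?_
          rw [q.prime.dvd_mul, or_iff_right]
          intro hd
          have h3 : q.asIdeal = p.asIdeal :=
            associated_iff_eq.1 ((Prime.dvd_prime_iff_associated q.prime p.prime).1 hd)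
          exact hp (HeightOneSpectrum.ext h3 ▸ hq)
        simp only [h2, dvd_mul_right, and_true, map_mul, mul_ite, mul_zero]
      · intro I hI
        have : p.asIdeal ∣ I := by
          by_contra h
          simp [h] at hI
        obtain ⟨K, rfl⟩ := this
        exact ⟨K, rfl⟩
    rw [h1, ← (hsum fun I => ∀ q ∈ Q, ¬ q.asIdeal ∣ I).tsum_sub
      (hsum fun I => (∀ q ∈ Q, ¬ q.asIdeal ∣ I) ∧ p.asIdeal ∣ I)]
    refine tsum_congr fun I => ?_
    simp only [Finset.forall_mem_insert]
    by_cases h2 : p.asIdeal ∣ I <;> by_cases h3 : ∀ q ∈ Q, ¬ q.asIdeal ∣ I <;> simp [h2, h3]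

/-- The Euler product of a completely multiplicative function on ideals. -/
lemma tendsto_mul_prod_one_sub {f : Ideal (𝓞 F) →*₀ ℂ} (hf : Summable fun I => ‖f I‖) :
    Tendsto (fun Q : Finset (HeightOneSpectrum (𝓞 F)) =>
      (∑' I : Ideal (𝓞 F), f I) * ∏ q ∈ Q, (1 - f q.asIdeal)) atTop (𝓝 1) := by
  classical
  simp_rw [← tsum_coprime_eq hf]
  have h1 : ∑' I : Ideal (𝓞 F), (if I = 1 then (1 : ℂ) else 0) = 1 := tsum_ite_eq _ _
  rw [← h1]
  refine tendsto_tsum_of_dominated_convergence hf (fun I => ?_) (Eventually.of_forall fun Q I => ?_)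
  · rcases eq_or_ne I 1 with rfl | hI
    · refine tendsto_const_nhds.congr fun Q => ?_
      rw [if_pos rfl, if_pos, map_one]
      intro q _ h
      exact q.prime.not_isUnit (isUnit_of_dvd_one h)
    · rw [if_neg hI]
      rcases eq_or_ne I 0 with rfl | hI0
      · refine tendsto_const_nhds.congr fun Q => ?_
        rw [map_zero, ite_self]
      · obtain ⟨P, hP, hIP⟩ := Ideal.exists_le_maximal I (by rwa [Ideal.one_eq_top] at hI)
        have hP0 : P ≠ ⊥ := by
          rintro rfl
          exact hI0 (le_bot_iff.1 hIP)
        let p : HeightOneSpectrum (𝓞 F) := ⟨P, hP.isPrime, hP0⟩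
        refine tendsto_const_nhds.congr' ?_
        filter_upwards [eventually_ge_atTop {p}] with Q hQ
        rw [if_neg]
        intro h
        exact h p (Finset.singleton_subset_iff.1 hQ) (Ideal.dvd_iff_le.2 hIP)
  · split_ifs
    · exact le_rfl
    · rw [norm_zero]; exact norm_nonneg _

lemma norm_one_sub_le_exp (z : ℂ) : ‖1 - z‖ ≤ Real.exp (-z.re + ‖z‖ ^ 2 / 2) := by
  have h1 : ‖1 - z‖ ^ 2 = 1 - 2 * z.re + ‖z‖ ^ 2 := by
    rw [Complex.sq_norm, Complex.sq_norm, Complex.normSq_apply, Complex.normSq_apply]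
    simp; ring
  have h2 := Real.add_one_le_exp (2 * (-z.re + ‖z‖ ^ 2 / 2))
  rw [two_mul, Real.exp_add, ← sq] at h2
  exact le_of_sq_le_sq (by linarith) (Real.exp_nonneg _)

lemma exp_le_one_sub {z : ℝ} (h0 : 0 ≤ z) (h : z ≤ 1 / 2) : Real.exp (-2 * z) ≤ 1 - z := by
  have h1 : 0 < 1 - z := by linarith
  rw [← Real.le_log_iff_exp_le h1]
  have := Real.one_sub_inv_le_log_of_pos h1
  refine le_trans ?_ this
  have h3 : (1 - z)⁻¹ ≤ 1 + 2 * z := by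
    rw [inv_le_iff_one_le_mul₀ h1]
    nlinarith
  linarith

end Euler
section PrimeSums
variable {F : Type*} [Field F] [NumberField F] [IsTotallyReal F]
open IsDedekindDomain Filter Topology

lemma summable_idealTerm_prime {s : ℝ} (hs : 1 < s) :
    Summable fun q : HeightOneSpectrum (𝓞 F) => idealTerm s q.asIdeal :=
  (summable_idealTerm hs).comp_injective (f := idealTerm s) fun _ _ h => HeightOneSpectrum.ext h

lemma summable_mul_idealTerm_prime {g : HeightOneSpectrum (𝓞 F) → ℝ} {K : ℝ} (hg : ∀ q, |g q| ≤ K)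
    {s : ℝ} (hs : 1 < s) : Summable fun q : HeightOneSpectrum (𝓞 F) => g q * idealTerm s q.asIdeal := by
  refine Summable.of_norm_bounded ((summable_idealTerm_prime hs).mul_left K) fun q => ?_
  rw [norm_mul, Real.norm_eq_abs, Real.norm_of_nonneg (idealTerm_nonneg _ _)]
  exact mul_le_mul_of_nonneg_right (hg q) (idealTerm_nonneg _ _)

/-- A bounded function on primes whose Dirichlet series is bounded above near `1`. -/
def PrimeBdd (g : HeightOneSpectrum (𝓞 F) → ℝ) : Prop :=
  (∃ K, ∀ q, |g q| ≤ K) ∧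
    ∃ C : ℝ, ∀ s : ℝ, 1 < s → s ≤ 2 → ∑' q, g q * idealTerm s q.asIdeal ≤ C

lemma PrimeBdd.add {g h : HeightOneSpectrum (𝓞 F) → ℝ} (hg : PrimeBdd g) (hh : PrimeBdd h) :
    PrimeBdd (fun q => g q + h q) := by
  obtain ⟨⟨K, hK⟩, C, hC⟩ := hg
  obtain ⟨⟨K', hK'⟩, C', hC'⟩ := hh
  refine ⟨⟨K + K', fun q => (abs_add_le _ _).trans (add_le_add (hK q) (hK' q))⟩, C + C', fun s hs hs2 => ?_⟩
  simp_rw [add_mul]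
  rw [Summable.tsum_add (summable_mul_idealTerm_prime hK hs) (summable_mul_idealTerm_prime hK' hs)]
  exact add_le_add (hC s hs hs2) (hC' s hs hs2)

lemma PrimeBdd.const_mul {g : HeightOneSpectrum (𝓞 F) → ℝ} (hg : PrimeBdd g) {c : ℝ} (hc : 0 ≤ c) :
    PrimeBdd (fun q => c * g q) := by
  obtain ⟨⟨K, hK⟩, C, hC⟩ := hg
  refine ⟨⟨c * K, fun q => ?_⟩, c * C, fun s hs hs2 => ?_⟩
  · rw [abs_mul, abs_of_nonneg hc]
    exact mul_le_mul_of_nonneg_left (hK q) hc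
  · simp_rw [mul_assoc]
    rw [tsum_mul_left]
    exact mul_le_mul_of_nonneg_left (hC s hs hs2) hc

lemma idealTerm_prime_le_one {s : ℝ} (hs : 1 < s) (I : Ideal (𝓞 F)) : idealTerm s I ≤ 1 := by
  rcases eq_or_ne I ⊥ with rfl | h
  · rw [idealTerm_bot (by linarith)]; exact zero_le_one
  · refine Real.rpow_le_one_of_one_le_of_nonpos ?_ (by linarith)
    have : Ideal.absNorm I ≠ 0 := Ideal.absNorm_eq_zero_iff.not.2 h
    exact_mod_cast Nat.one_le_iff_ne_zero.2 this

lemma PrimeBdd.of_le {g h : HeightOneSpectrum (𝓞 F) → ℝ} (hh : PrimeBdd h)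
    (hg : ∃ K, ∀ q, |g q| ≤ K) (S : Set (HeightOneSpectrum (𝓞 F))) (hS : S.Finite)
    (hle : ∀ q ∉ S, g q ≤ h q) : PrimeBdd g := by
  classical
  obtain ⟨K, hK⟩ := hg
  obtain ⟨⟨K', hK'⟩, C, hC⟩ := hh
  refine ⟨⟨K, hK⟩, C + hS.toFinset.card * (K + K'), fun s hs hs2 => ?_⟩
  have h1 := summable_mul_idealTerm_prime hK hs
  have h2 := summable_mul_idealTerm_prime hK' hs
  have h3 : ∑' q, g q * idealTerm s q.asIdeal ≤
      ∑' q, (h q * idealTerm s q.asIdeal + if q ∈ S then K + K' else 0) := by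
    refine Summable.tsum_le_tsum (fun q => ?_) h1 (h2.add ?_)
    · have hi0 := idealTerm_nonneg s q.asIdeal
      split_ifs with hq
      · have hi1 := idealTerm_prime_le_one hs q.asIdeal
        have h4 := (abs_le.1 (hK q)).2
        have h5 := (abs_le.1 (hK' q)).1
        have h6 := (abs_nonneg _).trans (hK q)
        have h7 := (abs_nonneg _).trans (hK' q)
        nlinarith
      · rw [add_zero]; exact mul_le_mul_of_nonneg_right (hle q hq) hi0
    · exact summable_of_ne_finset_zero (s := hS.toFinset) fun q hq => by
        rw [if_neg]; simpa using hq
  refine h3.trans ?_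
  rw [Summable.tsum_add h2]
  · refine add_le_add (hC s hs hs2) (le_of_eq ?_)
    rw [tsum_eq_sum (s := hS.toFinset) fun q hq => by rw [if_neg]; simpa using hq]
    rw [Finset.sum_congr rfl (g := fun _ => K + K') fun q hq => by rw [if_pos]; simpa using hq]
    simp; ring
  · exact summable_of_ne_finset_zero (s := hS.toFinset) fun q hq => by
        rw [if_neg]; simpa using hq

/-- The completely multiplicative function `I ↦ χ(I) N(I)⁻ˢ`. -/
noncomputable def twist (χ : Ideal (𝓞 F) →*₀ ℂ) {s : ℝ} (_hs : 1 < s) : Ideal (𝓞 F) →*₀ ℂ where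
  toFun I := χ I * (idealTerm s I : ℂ)
  map_zero' := by rw [map_zero, zero_mul]
  map_one' := by rw [map_one, idealTerm, map_one]; simp
  map_mul' I J := by rw [map_mul, idealTerm_mul]; push_cast; ring

lemma two_le_absNorm_prime (q : HeightOneSpectrum (𝓞 F)) : 2 ≤ Ideal.absNorm q.asIdeal := by
  have h1 : Ideal.absNorm q.asIdeal ≠ 0 := Ideal.absNorm_eq_zero_iff.not.2 q.ne_bot
  have h2 : Ideal.absNorm q.asIdeal ≠ 1 := fun h => q.isPrime.ne_top (Ideal.absNorm_eq_one_iff.1 h)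
  omega

lemma idealTerm_prime_le_half {s : ℝ} (hs : 1 < s) (q : HeightOneSpectrum (𝓞 F)) :
    idealTerm s q.asIdeal ≤ 1 / 2 := by
  refine (idealTerm_anti one_pos hs.le _).trans ?_
  have : (2 : ℝ) ≤ Ideal.absNorm q.asIdeal := by exact_mod_cast two_le_absNorm_prime q
  rw [idealTerm, Real.rpow_neg_one, one_div]
  exact inv_anti₀ two_pos this

lemma summable_twist {χ : Ideal (𝓞 F) →*₀ ℂ} (hχ : ∀ I, ‖χ I‖ ≤ 1) {s : ℝ} (hs : 1 < s) :
    Summable fun I => ‖twist χ hs I‖ := summable_mul_idealTerm hχ hs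

/-- If the L-function is bounded near `1` then the sum over primes is bounded above. -/
lemma primeBdd_re {χ : Ideal (𝓞 F) →*₀ ℂ} (hχ : ∀ I, ‖χ I‖ ≤ 1) (h : ∃ C : ℝ, ∀ s : ℝ, 1 < s →
    s ≤ 2 → ‖∑' I : Ideal (𝓞 F), χ I * (idealTerm s I : ℂ)‖ ≤ C) :
    PrimeBdd fun q => (χ q.asIdeal).re := by
  obtain ⟨C, hC⟩ := h
  refine ⟨⟨1, fun q => (Complex.abs_re_le_norm _).trans (hχ _)⟩,
    Real.log C + ∑' q : HeightOneSpectrum (𝓞 F), idealTerm 2 q.asIdeal, fun s hs hs2 => ?_⟩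
  have hK : ∀ q : HeightOneSpectrum (𝓞 F), |(χ q.asIdeal).re| ≤ 1 :=
    fun q => (Complex.abs_re_le_norm _).trans (hχ _)
  have h1 := summable_mul_idealTerm_prime hK hs
  have h2 : Summable fun q : HeightOneSpectrum (𝓞 F) => idealTerm 2 q.asIdeal :=
    summable_idealTerm_prime one_lt_two
  set L := ∑' I : Ideal (𝓞 F), χ I * (idealTerm s I : ℂ) with hL
  set P := ∑' q : HeightOneSpectrum (𝓞 F), (χ q.asIdeal).re * idealTerm s q.asIdeal
  set B := ∑' q : HeightOneSpectrum (𝓞 F), idealTerm 2 q.asIdeal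
  have h3 := (tendsto_mul_prod_one_sub (summable_twist hχ hs)).norm
  rw [norm_one] at h3
  have h4 : Tendsto (fun Q : Finset (HeightOneSpectrum (𝓞 F)) =>
      ‖L‖ * Real.exp (-(∑ q ∈ Q, (χ q.asIdeal).re * idealTerm s q.asIdeal) +
        ∑ q ∈ Q, idealTerm 2 q.asIdeal)) atTop (𝓝 (‖L‖ * Real.exp (-P + B))) := by
    refine Tendsto.const_mul _ ((Real.continuous_exp.tendsto _).comp ?_)
    exact Tendsto.add (Tendsto.neg h1.hasSum) h2.hasSum
  have h5 : (1 : ℝ) ≤ ‖L‖ * Real.exp (-P + B) := by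
    refine le_of_tendsto_of_tendsto' h3 h4 fun Q => ?_
    rw [norm_mul, norm_prod, ← Finset.sum_neg_distrib, ← Finset.sum_add_distrib, Real.exp_sum]
    refine mul_le_mul_of_nonneg_left (Finset.prod_le_prod (fun _ _ => norm_nonneg _) fun q _ => ?_)
      (norm_nonneg _)
    refine (norm_one_sub_le_exp _).trans (Real.exp_le_exp.2 ?_)
    have h6 : (twist χ hs q.asIdeal).re = (χ q.asIdeal).re * idealTerm s q.asIdeal :=
      Complex.re_mul_ofReal _ _
    have h7 : ‖twist χ hs q.asIdeal‖ ≤ idealTerm s q.asIdeal := by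
      change ‖χ q.asIdeal * _‖ ≤ _
      rw [norm_mul, Complex.norm_real, Real.norm_of_nonneg (idealTerm_nonneg _ _)]
      exact mul_le_of_le_one_left (idealTerm_nonneg s _) (hχ _)
    have h8 : idealTerm s q.asIdeal ^ 2 ≤ idealTerm 2 q.asIdeal := by
      refine (pow_le_pow_left₀ (idealTerm_nonneg _ _) (idealTerm_anti one_pos hs.le _) 2).trans
        (le_of_eq ?_)
      rw [idealTerm, idealTerm, ← Real.rpow_natCast, ← Real.rpow_mul (by positivity)]
      norm_num
    have h9 := pow_le_pow_left₀ (norm_nonneg _) h7 2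
    have := sq_nonneg (idealTerm s q.asIdeal)
    rw [h6]; linarith
  have hL0 : 0 < ‖L‖ := by
    by_contra h
    rw [le_antisymm (not_lt.1 h) (norm_nonneg _), zero_mul] at h5
    linarith
  have h6 := Real.log_nonneg h5
  rw [Real.log_mul hL0.ne' (Real.exp_ne_zero _), Real.log_exp] at h6
  have h7 := Real.log_le_log hL0 (hC s hs hs2)
  linarith

lemma tsum_idealTerm_le_exp {s : ℝ} (hs : 1 < s) : ∑' I : Ideal (𝓞 F), idealTerm s I ≤
    Real.exp (2 * ∑' q : HeightOneSpectrum (𝓞 F), idealTerm s q.asIdeal) := by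
  classical
  let χ : Ideal (𝓞 F) →*₀ ℂ :=
    { toFun := fun I => if I = 0 then 0 else 1
      map_zero' := by simp
      map_one' := by simp
      map_mul' := fun I J => by simp only [mul_eq_zero]; split_ifs <;> simp_all }
  have hχ : ∀ I, ‖χ I‖ ≤ 1 := fun I => by
    change ‖(if I = 0 then (0:ℂ) else 1)‖ ≤ 1
    split_ifs <;> simp
  have hval : ∀ I, twist χ hs I = (idealTerm s I : ℂ) := fun I => by
    change (if I = 0 then (0:ℂ) else 1) * _ = _
    split_ifs with h
    · rw [h, Submodule.zero_eq_bot, idealTerm_bot (by linarith)]; simp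
    · simp
  have h3 := (tendsto_mul_prod_one_sub (summable_twist hχ hs)).norm
  simp_rw [hval] at h3
  rw [← Complex.ofReal_tsum] at h3
  set Z := ∑' I : Ideal (𝓞 F), idealTerm s I
  have hZ : 0 ≤ Z := tsum_nonneg (idealTerm_nonneg s)
  have h4 : Tendsto (fun Q : Finset (HeightOneSpectrum (𝓞 F)) =>
      Z * Real.exp (-2 * ∑ q ∈ Q, idealTerm s q.asIdeal)) atTop
      (𝓝 (Z * Real.exp (-2 * ∑' q : HeightOneSpectrum (𝓞 F), idealTerm s q.asIdeal))) := by
    refine Tendsto.const_mul _ ((Real.continuous_exp.tendsto _).comp ?_)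
    exact Tendsto.const_mul (-2 : ℝ) (summable_idealTerm_prime (F := F) hs).hasSum
  have h5 : Z * Real.exp (-2 * ∑' q : HeightOneSpectrum (𝓞 F), idealTerm s q.asIdeal) ≤ 1 := by
    rw [norm_one] at h3
    refine le_of_tendsto_of_tendsto' h4 h3 fun Q => ?_
    rw [norm_mul, Complex.norm_real, Real.norm_of_nonneg hZ, norm_prod, Finset.mul_sum, Real.exp_sum]
    refine mul_le_mul_of_nonneg_left (Finset.prod_le_prod (fun _ _ => (Real.exp_pos _).le) fun q _ => ?_) hZ
    refine (exp_le_one_sub (idealTerm_nonneg _ _) (idealTerm_prime_le_half hs q)).trans ?_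
    rw [← Complex.ofReal_one, ← Complex.ofReal_sub, Complex.norm_real]
    exact le_abs_self _
  rw [neg_mul, Real.exp_neg, ← div_eq_mul_inv, div_le_one (Real.exp_pos _)] at h5
  exact h5

lemma not_primeBdd_one : ¬ PrimeBdd fun _ : HeightOneSpectrum (𝓞 F) => 1 := by
  rintro ⟨-, C, hC⟩
  have h1 := tendsto_tsum_idealTerm_atTop (F := F)
  have h2 := h1.eventually_gt_atTop (Real.exp (2 * C))
  have h3 : ∀ᶠ s : ℝ in 𝓝[>] 1, s ∈ Set.Ioc (1:ℝ) 2 :=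
    Ioc_mem_nhdsGT one_lt_two
  obtain ⟨s, hs, hs1, hs2⟩ := (h2.and h3).exists
  have h4 := tsum_idealTerm_le_exp (F := F) hs1
  have h5 := hC s hs1 hs2
  simp only [one_mul] at h5
  have : Real.exp (2 * ∑' q : HeightOneSpectrum (𝓞 F), idealTerm s q.asIdeal) ≤ Real.exp (2 * C) := by
    gcongr
  linarith

/-- The prime sum of a nontrivial ray class character is bounded above near `1`. -/
theorem IsRayChar.primeBdd {χ : Ideal (𝓞 F) →*₀ ℂ} {ε : F → ℝ} {𝔪 : Ideal (𝓞 F)}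
    (hχ : IsRayChar χ ε 𝔪)
    (h : ε = normSign ∨ (ε = fun _ => 1) ∧ ∃ I, I ≠ ⊥ ∧ I ⊔ 𝔪 = ⊤ ∧ χ I ≠ 1) :
    PrimeBdd fun q => (χ q.asIdeal).re :=
  primeBdd_re hχ.norm_le (hχ.exists_norm_tsum_le h)

end PrimeSums

section RayCharTools
variable {F : Type*} [Field F] [NumberField F]

open IsDedekindDomain

lemma exists_rayChar {𝔪 : Ideal (𝓞 F)} (h𝔪 : 𝔪 ≠ ⊥) (f : Ideal (𝓞 F) → ℂ) {ε : F → ℝ}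
    (hmul : ∀ I K, I ≠ ⊥ → K ≠ ⊥ → I ⊔ 𝔪 = ⊤ → K ⊔ 𝔪 = ⊤ → f (I * K) = f I * f K)
    (hnorm : ∀ I, I ≠ ⊥ → I ⊔ 𝔪 = ⊤ → ‖f I‖ = 1) (hsign : IsSignLike ε)
    (hsq : ∀ x, x ≠ 0 → ε x * ε x = 1)
    (hper : ∀ α β : 𝓞 F, α ≠ 0 → β ≠ 0 → Ideal.span {α} ⊔ 𝔪 = ⊤ → Ideal.span {β} ⊔ 𝔪 = ⊤ →
      α - β ∈ 𝔪 → f (Ideal.span {α}) * ε α = f (Ideal.span {β}) * ε β) :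
    ∃ χ : Ideal (𝓞 F) →*₀ ℂ, IsRayChar χ ε 𝔪 ∧ ∀ I, I ≠ ⊥ → I ⊔ 𝔪 = ⊤ → χ I = f I := by
  classical
  have hiff : ∀ I K : Ideal (𝓞 F), (I * K ≠ ⊥ ∧ I * K ⊔ 𝔪 = ⊤) ↔
      (I ≠ ⊥ ∧ I ⊔ 𝔪 = ⊤) ∧ (K ≠ ⊥ ∧ K ⊔ 𝔪 = ⊤) := fun I K => by
    constructor
    · rintro ⟨h0, h1⟩
      refine ⟨⟨?_, ?_⟩, ?_, ?_⟩
      · rintro rfl; simp at h0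
      · exact top_le_iff.1 (h1 ▸ sup_le_sup_right Ideal.mul_le_left _)
      · rintro rfl; simp at h0
      · exact top_le_iff.1 (h1 ▸ sup_le_sup_right Ideal.mul_le_right _)
    · rintro ⟨⟨h0, h1⟩, h2, h3⟩
      exact ⟨ideal_mul_ne_bot h0 h2, mul_sup_eq_top h1 h3⟩
  have hone : f ⊤ = 1 := by
    have h1 := hmul ⊤ ⊤ top_ne_bot top_ne_bot (by simp) (by simp)
    have h2 := hnorm ⊤ top_ne_bot (by simp)
    rw [Ideal.mul_top] at h1
    have h3 : f ⊤ ≠ 0 := by rw [← norm_pos_iff, h2]; exact one_pos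
    exact mul_left_cancel₀ h3 (by rw [← h1, mul_one])
  let χ : Ideal (𝓞 F) →*₀ ℂ :=
    { toFun := fun I => if I ≠ ⊥ ∧ I ⊔ 𝔪 = ⊤ then f I else 0
      map_zero' := by rw [if_neg]; simp
      map_one' := by rw [if_pos]; · rw [Ideal.one_eq_top, hone]
                     · simp
      map_mul' := fun I K => by
        simp only [hiff]
        by_cases h1 : I ≠ ⊥ ∧ I ⊔ 𝔪 = ⊤ <;> by_cases h2 : K ≠ ⊥ ∧ K ⊔ 𝔪 = ⊤
        · rw [if_pos ⟨h1, h2⟩, if_pos h1, if_pos h2, hmul I K h1.1 h2.1 h1.2 h2.2]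
        · rw [if_neg (fun h => h2 h.2), if_neg h2, mul_zero]
        · rw [if_neg (fun h => h1 h.1), if_neg h1, zero_mul]
        · rw [if_neg (fun h => h1 h.1), if_neg h1, zero_mul] }
  have hχ : ∀ I, χ I = if I ≠ ⊥ ∧ I ⊔ 𝔪 = ⊤ then f I else 0 := fun I => rfl
  refine ⟨χ, ⟨h𝔪, hsign, hsq, fun I => ?_, fun I h0 h1 => ?_, fun I h1 => ?_, ?_⟩, fun I h0 h1 => ?_⟩
  · rw [hχ]; split_ifs with h
    · exact (hnorm I h.1 h.2).le
    · simp
  · rw [hχ, if_pos ⟨h0, h1⟩, ← norm_pos_iff, hnorm I h0 h1]; exact one_pos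
  · rw [hχ, if_neg fun h => h1 h.2]
  · intro α β hα hβ hαβ
    have hα' : Ideal.span {α} ≠ ⊥ := by simpa using hα
    have hβ' : Ideal.span {β} ≠ ⊥ := by simpa using hβ
    have h1 : Ideal.span {α} ⊔ 𝔪 = Ideal.span {β} ⊔ 𝔪 := by
      refine le_antisymm (sup_le ?_ le_sup_right) (sup_le ?_ le_sup_right) <;>
        rw [Ideal.span_singleton_le_iff_mem]
      · rw [show α = β + (α - β) by ring]
        exact Submodule.add_mem_sup (Ideal.mem_span_singleton_self β) hαβ
      · rw [show β = α + -(α - β) by ring]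
        exact Submodule.add_mem_sup (Ideal.mem_span_singleton_self α) (neg_mem hαβ)
    rw [hχ, hχ, h1]
    by_cases h2 : Ideal.span {β} ⊔ 𝔪 = ⊤
    · rw [if_pos ⟨hα', h2⟩, if_pos ⟨hβ', h2⟩]
      exact hper α β hα hβ (h1.trans h2) h2 hαβ
    · rw [if_neg fun h => h2 h.2, if_neg fun h => h2 h.2]; simp
  · rw [hχ, if_pos ⟨h0, h1⟩]

lemma sup_mul_eq_top_iff {I 𝔪 𝔫 : Ideal (𝓞 F)} : I ⊔ 𝔪 * 𝔫 = ⊤ ↔ I ⊔ 𝔪 = ⊤ ∧ I ⊔ 𝔫 = ⊤ := by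
  constructor
  · intro h
    exact ⟨top_le_iff.1 (h ▸ sup_le_sup_left Ideal.mul_le_left _),
      top_le_iff.1 (h ▸ sup_le_sup_left Ideal.mul_le_right _)⟩
  · rintro ⟨h1, h2⟩
    rw [sup_comm] at *
    exact mul_sup_eq_top h1 h2

lemma IsSignLike.mul {ε ε' : F → ℝ} (h : IsSignLike ε) (h' : IsSignLike ε') :
    IsSignLike fun x => ε x * ε' x where
  abs_le x := by
    rw [abs_mul]; exact mul_le_one₀ (h.abs_le x) (abs_nonneg _) (h'.abs_le x)
  eq_of_lt x y hx hy hxy := by rw [h.eq_of_lt x y hx hy hxy, h'.eq_of_lt x y hx hy hxy]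

lemma IsRayChar.mul {χ χ' : Ideal (𝓞 F) →*₀ ℂ} {ε ε' : F → ℝ} {𝔪 𝔪' : Ideal (𝓞 F)}
    (h : IsRayChar χ ε 𝔪) (h' : IsRayChar χ' ε' 𝔪') :
    IsRayChar (χ * χ') (fun x => ε x * ε' x) (𝔪 * 𝔪') where
  ne_bot := ideal_mul_ne_bot h.ne_bot h'.ne_bot
  sign := h.sign.mul h'.sign
  sq x hx := by rw [mul_mul_mul_comm, h.sq x hx, h'.sq x hx, one_mul]
  norm_le I := by
    change ‖χ I * χ' I‖ ≤ 1
    rw [norm_mul]; exact mul_le_one₀ (h.norm_le I) (norm_nonneg _) (h'.norm_le I)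
  ne_zero I hI hIm := mul_ne_zero (h.ne_zero I hI (sup_mul_eq_top_iff.1 hIm).1)
    (h'.ne_zero I hI (sup_mul_eq_top_iff.1 hIm).2)
  eq_zero I hI := by
    change χ I * χ' I = 0
    rw [ne_eq, sup_mul_eq_top_iff, not_and_or] at hI
    rcases hI with hI | hI
    · rw [h.eq_zero I hI, zero_mul]
    · rw [h'.eq_zero I hI, mul_zero]
  periodic α β hα hβ hαβ := by
    have h1 := h.periodic α β hα hβ (Ideal.mul_le_left hαβ)
    have h2 := h'.periodic α β hα hβ (Ideal.mul_le_right hαβ)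
    change χ _ * χ' _ * ((_ * _ : ℝ) : ℂ) = χ _ * χ' _ * ((_ * _ : ℝ) : ℂ)
    push_cast
    linear_combination h1 * (χ' (Ideal.span {α}) * ε' α) + (χ (Ideal.span {β}) * ε β) * h2

/-- The complex conjugate of a function on ideals. -/
noncomputable def conjChar (χ : Ideal (𝓞 F) →*₀ ℂ) : Ideal (𝓞 F) →*₀ ℂ :=
  (starRingEnd ℂ).toMonoidWithZeroHom.comp χ

lemma conjChar_apply (χ : Ideal (𝓞 F) →*₀ ℂ) (I) : conjChar χ I = starRingEnd ℂ (χ I) := rfl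

lemma IsRayChar.conj {χ : Ideal (𝓞 F) →*₀ ℂ} {ε : F → ℝ} {𝔪 : Ideal (𝓞 F)}
    (h : IsRayChar χ ε 𝔪) : IsRayChar (conjChar χ) ε 𝔪 where
  ne_bot := h.ne_bot
  sign := h.sign
  sq := h.sq
  norm_le I := by rw [conjChar_apply, RCLike.norm_conj]; exact h.norm_le I
  ne_zero I hI hIm := by rw [conjChar_apply]; simpa using h.ne_zero I hI hIm
  eq_zero I hI := by rw [conjChar_apply, h.eq_zero I hI, map_zero]
  periodic α β hα hβ hαβ := by
    have h1 := congrArg (starRingEnd ℂ) (h.periodic α β hα hβ hαβ)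
    simpa [conjChar_apply] using h1

lemma coprime_absNorm_of_sup {N : ℕ} {I : Ideal (𝓞 F)} (hI : I ≠ ⊥)
    (h : I ⊔ Ideal.span {(N : 𝓞 F)} = ⊤) : (Ideal.absNorm I).Coprime N := by
  by_contra hc
  obtain ⟨p, hp, hpI, hpN⟩ := Nat.Prime.not_coprime_iff_dvd.1 hc
  have := Ideal.finiteQuotientOfFreeOfNeBot I hI
  have := Fact.mk hp
  rw [Ideal.absNorm_apply, Submodule.cardQuot_apply] at hpI
  obtain ⟨x, hx⟩ := exists_prime_addOrderOf_dvd_card' (G := 𝓞 F ⧸ I) p hpI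
  obtain ⟨y, rfl⟩ := Ideal.Quotient.mk_surjective x
  have h1 : (p : 𝓞 F) * y ∈ I := by
    rw [← Ideal.Quotient.eq_zero_iff_mem, map_mul, map_natCast, ← nsmul_eq_mul, ← hx]
    exact addOrderOf_nsmul_eq_zero _
  obtain ⟨i, hi, n, hn, hin⟩ := Submodule.mem_sup.1 (h ▸ Submodule.mem_top : (1 : 𝓞 F) ∈ _)
  obtain ⟨c, rfl⟩ := Ideal.mem_span_singleton.1 hn
  obtain ⟨k, rfl⟩ := hpN
  have h2 : y ∈ I := by
    have : y = i * y + (p * y) * (k * c) := by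
      push_cast at hin
      linear_combination (-y) * hin
    rw [this]
    exact I.add_mem (I.mul_mem_right _ hi) (I.mul_mem_right _ h1)
  rw [Ideal.Quotient.eq_zero_iff_mem.2 h2, addOrderOf_zero] at hx
  exact hp.one_lt.ne hx

lemma norm_int_congr {N : ℕ} {α β : 𝓞 F} (h : α - β ∈ Ideal.span {(N : 𝓞 F)}) :
    ((Algebra.norm ℤ α : ℤ) : ZMod N) = (Algebra.norm ℤ β : ℤ) := by
  classical
  obtain ⟨γ, hγ⟩ := Ideal.mem_span_singleton.1 h
  have hα : α = β + (N : ℤ) • γ := by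
    rw [← sub_eq_iff_eq_add', hγ]; simp
  let b := RingOfIntegers.basis F
  rw [Algebra.norm_eq_matrix_det b, Algebra.norm_eq_matrix_det b]
  have h1 : ∀ M : Matrix (Module.Free.ChooseBasisIndex ℤ (𝓞 F)) (Module.Free.ChooseBasisIndex ℤ (𝓞 F)) ℤ, ((M.det : ℤ) : ZMod N) = (M.map (Int.castRingHom (ZMod N))).det :=
    fun M => by
      have := RingHom.map_det (Int.castRingHom (ZMod N)) M
      simpa using this
  rw [h1, h1, hα, map_add, map_zsmul]
  congr 1
  ext i j
  rw [Matrix.map_apply, Matrix.map_apply, Matrix.add_apply, Matrix.smul_apply, smul_eq_mul]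
  simp

lemma absNorm_span_eq_ite (α : 𝓞 F) : ((Ideal.absNorm (Ideal.span {α}) : ℕ) : ℤ) =
    (SignType.sign (Algebra.norm ℚ (α : F)) : ℤ) * Algebra.norm ℤ α := by
  rw [Ideal.absNorm_span_singleton, Int.natCast_natAbs]
  have h1 : Algebra.norm ℚ (α : F) = ((Algebra.norm ℤ α : ℤ) : ℚ) := (Algebra.coe_norm_int α).symm
  rw [h1]
  rcases lt_trichotomy (Algebra.norm ℤ α) 0 with h | h | h
  · rw [sign_neg (by exact_mod_cast h), abs_of_neg h]; simp
  · rw [h]; simp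
  · rw [sign_pos (by exact_mod_cast h), abs_of_pos h]; simp

lemma sign_mul_absNorm_span (α : 𝓞 F) (h : α ≠ 0) :
    normSign (α : F) * normSign (α : F) = 1 ∧
    ((normSign (α : F) = 1 ∧ ((Ideal.absNorm (Ideal.span {α}) : ℕ) : ℤ) = Algebra.norm ℤ α) ∨
    (normSign (α : F) = -1 ∧ ((Ideal.absNorm (Ideal.span {α}) : ℕ) : ℤ) = -Algebra.norm ℤ α)) := by
  rw [absNorm_span_eq_ite, normSign]
  have h1 : Algebra.norm ℚ (α : F) ≠ 0 := by
    rw [Algebra.norm_ne_zero_iff]; exact fun h0 => h (by exact_mod_cast h0)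
  rcases lt_or_gt_of_ne h1 with h1 | h1
  · rw [sign_neg h1]; simp
  · rw [sign_pos h1]; simp

lemma exists_normChar [IsTotallyReal F] {N : ℕ} (hN : N ≠ 0) (ω : DirichletCharacter ℂ N) {ε : F → ℝ}
    (hε : (ω.Even ∧ ε = fun _ => 1) ∨ (ω.Odd ∧ ε = normSign)) :
    ∃ χ : Ideal (𝓞 F) →*₀ ℂ, IsRayChar χ ε (Ideal.span {(N : 𝓞 F)}) ∧
      ∀ I, I ≠ ⊥ → I ⊔ Ideal.span {(N : 𝓞 F)} = ⊤ → χ I = ω (Ideal.absNorm I : ℕ) := by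
  have hkey : ∀ α : 𝓞 F, α ≠ 0 → ω (Ideal.absNorm (Ideal.span {α}) : ℕ) * ε α =
      ω (Algebra.norm ℤ α : ℤ) := by
    intro α hα
    have h0 : ((Ideal.absNorm (Ideal.span {α}) : ℕ) : ZMod N) =
      (((Ideal.absNorm (Ideal.span {α}) : ℕ) : ℤ) : ZMod N) := by simp
    have hneg : ∀ x : ZMod N, ω (-x) = ω (-1) * ω x := fun x => by rw [← map_mul, neg_one_mul]
    obtain ⟨-, ⟨h1, h2⟩ | ⟨h1, h2⟩⟩ := sign_mul_absNorm_span α hα <;> rw [h0, h2] <;>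
      rcases hε with ⟨ho, rfl⟩ | ⟨ho, rfl⟩
    · simp
    · simp [h1]
    · push_cast; rw [hneg, ho]; simp
    · push_cast; rw [hneg, ho, h1]; simp
  refine exists_rayChar (by simpa using hN) (fun I => ω (Ideal.absNorm I : ℕ)) (fun I K _ _ _ _ => ?_)
    (fun I h0 h1 => ?_) ?_ ?_ fun α β hα hβ _ _ hαβ => ?_
  · rw [map_mul, Nat.cast_mul, map_mul]
  · have := (coprime_absNorm_of_sup h0 h1)
    have h2 := DirichletCharacter.unit_norm_eq_one ω (ZMod.unitOfCoprime _ this)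
    simpa using h2
  · rcases hε with ⟨-, rfl⟩ | ⟨-, rfl⟩
    · exact isSignLike_one
    · exact isSignLike_normSign
  · rcases hε with ⟨-, rfl⟩ | ⟨-, rfl⟩
    · simp
    · intro x hx
      rw [← normSign_mul]
      exact normSign_of_pos (by rw [map_mul]; exact mul_self_pos.2 (by rwa [Algebra.norm_ne_zero_iff]))
  · rw [hkey α hα, hkey β hβ, norm_int_congr hαβ]

end RayCharTools

section RayClass
variable {F : Type*} [Field F] [NumberField F]

open nonZeroDivisors

/-- The monoid of nonzero ideals coprime to `𝔪`. -/
def coprimeIdeals (𝔪 : Ideal (𝓞 F)) : Submonoid (Ideal (𝓞 F)) where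
  carrier := {I | I ≠ ⊥ ∧ I ⊔ 𝔪 = ⊤}
  one_mem' := ⟨by simp, by simp⟩
  mul_mem' := fun ⟨h1, h2⟩ ⟨h3, h4⟩ => ⟨ideal_mul_ne_bot h1 h3, mul_sup_eq_top h2 h4⟩

lemma exists_mul_sub_one_mem {𝔪 : Ideal (𝓞 F)} {α : 𝓞 F}
    (h : Ideal.span {α} ⊔ 𝔪 = ⊤) : ∃ γ, γ * α - 1 ∈ 𝔪 := by
  obtain ⟨i, hi, j, hj, hij⟩ := Submodule.mem_sup.1 (h ▸ Submodule.mem_top : (1 : 𝓞 F) ∈ _)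
  obtain ⟨c, rfl⟩ := Ideal.mem_span_singleton.1 hi
  exact ⟨c, by rw [← hij]; convert neg_mem hj using 1; ring⟩

lemma span_sup_eq_top {𝔪 : Ideal (𝓞 F)} {α γ : 𝓞 F} (h : γ * α - 1 ∈ 𝔪) :
    Ideal.span {α} ⊔ 𝔪 = ⊤ := by
  rw [Ideal.eq_top_iff_one, show (1 : 𝓞 F) = γ * α + -(γ * α - 1) by ring]
  exact Submodule.add_mem_sup (Ideal.mul_mem_left _ _ (Ideal.mem_span_singleton_self α)) (neg_mem h)

lemma exists_ne_zero_mul_sub_one_mem {𝔪 : Ideal (𝓞 F)} (h𝔪 : 𝔪 ≠ ⊥) {α : 𝓞 F}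
    (h : Ideal.span {α} ⊔ 𝔪 = ⊤) : ∃ γ, γ ≠ 0 ∧ γ * α - 1 ∈ 𝔪 := by
  obtain ⟨γ, hγ⟩ := exists_mul_sub_one_mem h
  by_cases h0 : γ = 0
  · obtain ⟨m, hm, hm0⟩ := Submodule.exists_mem_ne_zero_of_ne_bot h𝔪
    refine ⟨m, hm0, ?_⟩
    subst h0
    rw [zero_mul] at hγ
    rw [sub_eq_add_neg, ← zero_sub]
    exact add_mem (𝔪.mul_mem_right _ hm) hγ
  · exact ⟨γ, h0, hγ⟩

/-- Two ideals are equivalent modulo `𝔪` if they differ by elements congruent to one. -/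
def RayEquiv (𝔪 : Ideal (𝓞 F)) (I I' : Ideal (𝓞 F)) : Prop :=
  ∃ α β : 𝓞 F, α ≠ 0 ∧ β ≠ 0 ∧ α - 1 ∈ 𝔪 ∧ β - 1 ∈ 𝔪 ∧ Ideal.span {α} * I = Ideal.span {β} * I'

lemma mul_sub_one_mem {𝔪 : Ideal (𝓞 F)} {α β : 𝓞 F} (hα : α - 1 ∈ 𝔪) (hβ : β - 1 ∈ 𝔪) :
    α * β - 1 ∈ 𝔪 := by
  rw [show α * β - 1 = (α - 1) * β + (β - 1) by ring]
  exact add_mem (𝔪.mul_mem_right _ hα) hβ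

/-- Ray equivalence as a congruence. -/
def rayCon (𝔪 : Ideal (𝓞 F)) : Con (coprimeIdeals 𝔪) where
  r I I' := RayEquiv 𝔪 (I : Ideal (𝓞 F)) I'
  iseqv :=
    { refl := fun I => ⟨1, 1, one_ne_zero, one_ne_zero, by simp, by simp, rfl⟩
      symm := fun ⟨α, β, h1, h2, h3, h4, h5⟩ => ⟨β, α, h2, h1, h4, h3, h5.symm⟩
      trans := fun ⟨α, β, h1, h2, h3, h4, h5⟩ ⟨α', β', h1', h2', h3', h4', h5'⟩ => by
        refine ⟨α * α', β * β', mul_ne_zero h1 h1', mul_ne_zero h2 h2', mul_sub_one_mem h3 h3',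
          mul_sub_one_mem h4 h4', ?_⟩
        rw [← Ideal.span_singleton_mul_span_singleton, ← Ideal.span_singleton_mul_span_singleton,
          mul_assoc, mul_left_comm, h5, mul_left_comm, h5', mul_assoc] }
  mul' := fun ⟨α, β, h1, h2, h3, h4, h5⟩ ⟨α', β', h1', h2', h3', h4', h5'⟩ => by
    refine ⟨α * α', β * β', mul_ne_zero h1 h1', mul_ne_zero h2 h2', mul_sub_one_mem h3 h3',
      mul_sub_one_mem h4 h4', ?_⟩
    rw [← Ideal.span_singleton_mul_span_singleton, ← Ideal.span_singleton_mul_span_singleton]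
    change _ * _ * (_ * _) = _ * _ * (_ * _)
    rw [mul_mul_mul_comm, h5, h5', mul_mul_mul_comm]

lemma rayEquiv_span {𝔪 : Ideal (𝓞 F)} (h𝔪 : 𝔪 ≠ ⊥) {α β : 𝓞 F} (hα : α ≠ 0) (hβ : β ≠ 0)
    (hα1 : Ideal.span {α} ⊔ 𝔪 = ⊤) (h : α - β ∈ 𝔪) {I I' : Ideal (𝓞 F)}
    (hI : Ideal.span {β} * I = Ideal.span {α} * I') : RayEquiv 𝔪 I I' := by
  obtain ⟨γ, hγ0, hγ⟩ := exists_ne_zero_mul_sub_one_mem h𝔪 hα1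
  refine ⟨γ * β, γ * α, mul_ne_zero hγ0 hβ, mul_ne_zero hγ0 hα, ?_, hγ, ?_⟩
  · rw [show γ * β - 1 = (γ * α - 1) - γ * (α - β) by ring]
    exact sub_mem hγ (𝔪.mul_mem_left _ h)
  · rw [← Ideal.span_singleton_mul_span_singleton, ← Ideal.span_singleton_mul_span_singleton,
      mul_assoc, hI, mul_assoc]

lemma exists_mul_eq_span {𝔪 : Ideal (𝓞 F)} (h𝔪 : 𝔪 ≠ ⊥) (c : ClassGroup (𝓞 F)) :
    ∃ K ∈ coprimeIdeals 𝔪, ∀ I, (hI : I ≠ ⊥) →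
      ClassGroup.mk0 ⟨I, mem_nonZeroDivisors_of_ne_zero hI⟩ = c → ∃ α, I * K = Ideal.span {α} := by
  obtain ⟨J, hJ, hJ1⟩ := exists_mk0_eq_sup_eq_top c⁻¹ h𝔪
  refine ⟨J, ⟨mem_nonZeroDivisors_iff_ne_zero.1 J.2, hJ1⟩, fun I hI hc => ?_⟩
  have := (isPrincipal_mul_iff (I := ⟨I, mem_nonZeroDivisors_of_ne_zero hI⟩) (J := J)).2
    (by rw [hc, hJ, inv_inv])
  exact this.principal

lemma finite_rayCon {𝔪 : Ideal (𝓞 F)} (h𝔪 : 𝔪 ≠ ⊥) : Finite (rayCon 𝔪).Quotient := by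
  choose K hK hgen using exists_mul_eq_span (F := F) h𝔪
  have hg : ∀ I : coprimeIdeals 𝔪, ∃ α, (I : Ideal (𝓞 F)) *
      K (ClassGroup.mk0 ⟨I, mem_nonZeroDivisors_of_ne_zero I.2.1⟩) = Ideal.span {α} :=
    fun I => hgen _ I I.2.1 rfl
  choose g hg using hg
  have : Finite (𝓞 F ⧸ 𝔪) := Ideal.finiteQuotientOfFreeOfNeBot 𝔪 h𝔪
  let G : coprimeIdeals 𝔪 → ClassGroup (𝓞 F) × (𝓞 F ⧸ 𝔪) := fun I =>
    (ClassGroup.mk0 ⟨I, mem_nonZeroDivisors_of_ne_zero I.2.1⟩, Ideal.Quotient.mk 𝔪 (g I))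
  have hG : ∀ I I', G I = G I' → rayCon 𝔪 I I' := by
    intro I I' h
    obtain ⟨h1, h2⟩ := Prod.mk.inj h
    have e1 := hg I
    have e2 := hg I'
    rw [← h1] at e2
    set L := K (ClassGroup.mk0 ⟨I, mem_nonZeroDivisors_of_ne_zero I.2.1⟩) with hL
    have hL1 : L ∈ coprimeIdeals 𝔪 := hK _
    have m1 := (coprimeIdeals 𝔪).mul_mem I.2 hL1
    have m2 := (coprimeIdeals 𝔪).mul_mem I'.2 hL1
    rw [e1] at m1
    rw [e2] at m2
    refine rayEquiv_span h𝔪 (α := g I) (β := g I') (by simpa using m1.1) (by simpa using m2.1) m1.2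
      (Ideal.Quotient.eq.1 h2) ?_
    rw [← e1, ← e2]; ring
  refine Finite.of_injective (fun q : (rayCon 𝔪).Quotient => G q.out) fun q q' h => ?_
  rw [← Quotient.out_eq q, ← Quotient.out_eq q']
  exact Quotient.sound (hG _ _ h)

lemma isUnit_rayCon {𝔪 : Ideal (𝓞 F)} (h𝔪 : 𝔪 ≠ ⊥) (q : (rayCon 𝔪).Quotient) : IsUnit q := by
  induction q using Con.induction_on with
  | H I =>
  obtain ⟨K, hK, hgen⟩ := exists_mul_eq_span (F := F) h𝔪
    (ClassGroup.mk0 ⟨I, mem_nonZeroDivisors_of_ne_zero I.2.1⟩)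
  obtain ⟨α, hα⟩ := hgen I I.2.1 rfl
  have m1 := (coprimeIdeals 𝔪).mul_mem I.2 hK
  rw [hα] at m1
  have hα0 : α ≠ 0 := by simpa using m1.1
  obtain ⟨γ, hγ0, hγ⟩ := exists_ne_zero_mul_sub_one_mem h𝔪 m1.2
  refine IsUnit.of_mul_eq_one (((⟨K, hK⟩ * ⟨Ideal.span {γ}, by simpa using hγ0,
    span_sup_eq_top (γ := α) (by rwa [mul_comm])⟩ : coprimeIdeals 𝔪)) : (rayCon 𝔪).Quotient) ?_
  rw [← Con.coe_mul, ← Con.coe_one]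
  refine (Con.eq _).2 ⟨1, γ * α, one_ne_zero, mul_ne_zero hγ0 hα0, by simp, hγ, ?_⟩
  change _ * ((I : Ideal (𝓞 F)) * (K * Ideal.span {γ})) = _ * 1
  rw [Ideal.span_singleton_one, ← Ideal.one_eq_top, one_mul, mul_one, ← mul_assoc, hα,
    Ideal.span_singleton_mul_span_singleton, mul_comm]

/-- The ray class group, existentially packaged. -/
lemma exists_rayClassGroup.{u} {F : Type u} [Field F] [NumberField F] {𝔪 : Ideal (𝓞 F)} (h𝔪 : 𝔪 ≠ ⊥) :
    ∃ (Q : Type u) (_ : CommGroup Q) (_ : Finite Q) (π : coprimeIdeals 𝔪 →* Q),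
      Function.Surjective π ∧
        ∀ I I' : coprimeIdeals 𝔪, π I = π I' ↔ RayEquiv 𝔪 (I : Ideal (𝓞 F)) I' := by
  refine ⟨(rayCon 𝔪).Quotient, commGroupOfIsUnit (isUnit_rayCon h𝔪), finite_rayCon h𝔪,
    (rayCon 𝔪).mk', Con.mk'_surjective, fun I I' => ?_⟩
  exact Con.eq _

end RayClass

section GoodPrimes
variable {F : Type*} [Field F] [NumberField F]

open IsDedekindDomain

lemma HeightOneSpectrum.sup_eq_top (q : HeightOneSpectrum (𝓞 F)) {X : Ideal (𝓞 F)}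
    (h : ¬ q.asIdeal ∣ X) : q.asIdeal ⊔ X = ⊤ := by
  rw [Ideal.dvd_iff_le] at h
  exact (q.isPrime.isMaximal q.ne_bot).out.2 _ (left_lt_sup.2 h)

variable [IsTotallyReal F]

lemma false_of_three_le {χ₁ χ₂ χ₃ : Ideal (𝓞 F) →*₀ ℂ}
    (h₁ : PrimeBdd fun q : HeightOneSpectrum (𝓞 F) => (χ₁ q.asIdeal).re)
    (h₂ : PrimeBdd fun q : HeightOneSpectrum (𝓞 F) => (χ₂ q.asIdeal).re)
    (h₃ : PrimeBdd fun q : HeightOneSpectrum (𝓞 F) => (χ₃ q.asIdeal).re)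
    {X : Ideal (𝓞 F)} (hX : X ≠ ⊥)
    (hle : ∀ q : HeightOneSpectrum (𝓞 F), ¬ q.asIdeal ∣ X →
      3 ≤ 9 * (χ₁ q.asIdeal).re + (8 * (χ₂ q.asIdeal).re + 4 * (χ₃ q.asIdeal).re)) : False := by
  refine not_primeBdd_one (F := F) (PrimeBdd.of_le
    ((h₁.const_mul (by norm_num : (0 : ℝ) ≤ 9)).add ((h₂.const_mul (by norm_num : (0 : ℝ) ≤ 8)).add
      (h₃.const_mul (by norm_num : (0 : ℝ) ≤ 4)))) ⟨1, fun q => by simp⟩ _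
        (Ideal.finite_factors (I := X) hX) fun q hq => ?_)
  have := hle q hq
  linarith

/-- There are even Dirichlet characters of prime power modulus that are nontrivial on a norm. -/
lemma exists_even_dirichletCharacter {p : ℕ} (hp : p.Prime) {n : ℕ} (hn : n ≠ 0) :
    ∃ R : ℕ, ∃ ω : DirichletCharacter ℂ (p ^ R), ω.Even ∧
      ω (((p + 1) ^ n : ℕ) : ZMod (p ^ R)) ≠ 1 ∧ (ω ^ 2) (((p + 1) ^ n : ℕ) : ZMod (p ^ R)) ≠ 1 := by
  obtain ⟨R, hR⟩ : ∃ R, (p + 1) ^ (4 * n) < p ^ R := ⟨_, Nat.lt_pow_self hp.one_lt⟩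
  have : NeZero (p ^ R) := ⟨pow_ne_zero _ hp.ne_zero⟩
  have h1 : (((p + 1) ^ (4 * n) : ℕ) : ZMod (p ^ R)) ≠ 1 := by
    intro h
    have h2 : (((p + 1) ^ (4 * n) : ℕ) : ZMod (p ^ R)) = ((1 : ℕ) : ZMod (p ^ R)) := by
      rw [h, Nat.cast_one]
    rw [ZMod.natCast_eq_natCast_iff] at h2
    have h3 : 1 < (p + 1) ^ (4 * n) := Nat.one_lt_pow (by omega) (by have := hp.one_lt; omega)
    have h4 := Nat.ModEq.eq_of_lt_of_lt h2 hR (h3.trans hR)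
    omega
  obtain ⟨ω, hω⟩ := MulChar.exists_apply_ne_one_of_hasEnoughRootsOfUnity (ZMod (p ^ R)) ℂ h1
  have h5 : (ω ^ 2) (((p + 1) ^ n : ℕ) : ZMod (p ^ R)) = ω (((p + 1) ^ n : ℕ) : ZMod (p ^ R)) ^ 2 :=
    MulChar.pow_apply' _ two_ne_zero _
  have h6 : ((ω ^ 2) ^ 2) (((p + 1) ^ n : ℕ) : ZMod (p ^ R)) =
      ω (((p + 1) ^ n : ℕ) : ZMod (p ^ R)) ^ 4 := by
    rw [MulChar.pow_apply' _ two_ne_zero, h5, ← pow_mul]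
  have h7 : ω (((p + 1) ^ n : ℕ) : ZMod (p ^ R)) ^ 4 ≠ 1 := by
    rw [← map_pow, ← Nat.cast_pow, ← pow_mul, mul_comm n]; exact hω
  refine ⟨R, ω ^ 2, ?_, ?_, ?_⟩
  · rw [DirichletCharacter.Even, MulChar.pow_apply' _ two_ne_zero, ← map_pow]; simp
  · rw [h5]; intro h; apply h7
    rw [show 4 = 2 * 2 from rfl, pow_mul, h, one_pow]
  · rw [h6]; exact h7

lemma exists_subgroup_of_submonoid {Q : Type*} [Group Q] [Finite Q] (M : Submonoid Q) :
    ∃ H : Subgroup Q, ∀ g, g ∈ H ↔ g ∈ M := by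
  refine ⟨{ M with inv_mem' := fun {g} hg => ?_ }, fun g => Iff.rfl⟩
  have : g⁻¹ = g ^ (Nat.card Q - 1) := by
    refine inv_eq_of_mul_eq_one_left ?_
    rw [← pow_succ, Nat.sub_add_cancel Nat.card_pos, pow_card_eq_one']
  rw [this]
  exact M.pow_mem hg _

lemma exists_rayChar_of_subgroup {𝔪 : Ideal (𝓞 F)} (h𝔪 : 𝔪 ≠ ⊥) {Q : Type*} [CommGroup Q] [Finite Q]
    {π : coprimeIdeals 𝔪 →* Q}
    (hker : ∀ I I' : coprimeIdeals 𝔪, π I = π I' ↔ RayEquiv 𝔪 (I : Ideal (𝓞 F)) I')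
    (hπ : Function.Surjective π) {H : Subgroup Q} (hH : H ≠ ⊤) :
    ∃ χ : Ideal (𝓞 F) →*₀ ℂ, IsRayChar χ (fun _ => 1) 𝔪 ∧
      (∀ I : coprimeIdeals 𝔪, π I ∈ H → χ I = 1) ∧ ∃ I : coprimeIdeals 𝔪, χ I ≠ 1 := by
  classical
  obtain ⟨g0, hg0⟩ : ∃ g, g ∉ H := by
    by_contra h; push Not at h; exact hH (Subgroup.eq_top_iff' H |>.2 h)
  have hg0' : (QuotientGroup.mk g0 : Q ⧸ H) ≠ 1 := by
    rwa [ne_eq, QuotientGroup.eq_one_iff]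
  obtain ⟨φ, hφ⟩ := CommGroup.exists_apply_ne_one_of_hasEnoughRootsOfUnity (Q ⧸ H) ℂ hg0'
  let f : Ideal (𝓞 F) → ℂ := fun I => if h : I ∈ coprimeIdeals 𝔪 then
    ((φ (QuotientGroup.mk (π ⟨I, h⟩)) : ℂˣ) : ℂ) else 0
  have hf : ∀ I : coprimeIdeals 𝔪, f I = ((φ (QuotientGroup.mk (π I)) : ℂˣ) : ℂ) :=
    fun I => dif_pos I.2
  obtain ⟨χ, hχ, hχ'⟩ := exists_rayChar (ε := fun _ => 1) h𝔪 f
    (fun I K h1 h2 h3 h4 => by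
      have := hf (⟨I, h1, h3⟩ * ⟨K, h2, h4⟩)
      rw [map_mul, QuotientGroup.mk_mul, map_mul, Units.val_mul, ← hf, ← hf] at this
      exact this)
    (fun I h1 h2 => by
      rw [hf ⟨I, h1, h2⟩]
      exact Complex.norm_eq_one_of_mem_rootsOfUnity (n := Nat.card (Q ⧸ H)) (by
        rw [mem_rootsOfUnity, ← map_pow, pow_card_eq_one', map_one]))
    isSignLike_one (fun _ _ => one_mul 1) (fun α β hα hβ h1 h2 h3 => by
      have h4 : π ⟨Ideal.span {α}, by simpa using hα, h1⟩ =
          π ⟨Ideal.span {β}, by simpa using hβ, h2⟩ :=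
        (hker _ _).2 (rayEquiv_span h𝔪 hα hβ h1 h3 (by simp [mul_comm]))
      rw [hf ⟨Ideal.span {α}, by simpa using hα, h1⟩, hf ⟨Ideal.span {β}, by simpa using hβ, h2⟩,
        h4])
  obtain ⟨I0, hI0⟩ := hπ g0
  refine ⟨χ, hχ, fun I hI => ?_, I0, ?_⟩
  · rw [hχ' _ I.2.1 I.2.2, hf, (QuotientGroup.eq_one_iff _).2 hI, map_one, Units.val_one]
  · rw [hχ' _ I0.2.1 I0.2.2, hf, hI0]
    exact fun h => hφ (Units.ext h)

/-- The products of distinct primes with a property `T` represent every ray class, if no nontrivial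
ray class character is trivial on almost all primes satisfying `T`. -/
lemma exists_rayEquiv_of_separating {T : Ideal (𝓞 F) → Prop} {𝔪 : Ideal (𝓞 F)} (h𝔪 : 𝔪 ≠ ⊥)
    (hT : ∀ χ : Ideal (𝓞 F) →*₀ ℂ, IsRayChar χ (fun _ => 1) 𝔪 →
      (∃ I, I ≠ ⊥ ∧ I ⊔ 𝔪 = ⊤ ∧ χ I ≠ 1) → ∀ X : Ideal (𝓞 F), X ≠ ⊥ →
      ∃ q : HeightOneSpectrum (𝓞 F), ¬ q.asIdeal ∣ X ∧ q.asIdeal ⊔ 𝔪 = ⊤ ∧ T q.asIdeal ∧ χ q.asIdeal ≠ 1)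
    {𝔵 I : Ideal (𝓞 F)} (h𝔵 : 𝔵 ≠ ⊥) (hI : I ∈ coprimeIdeals 𝔪) :
    ∃ J ∈ coprimeIdeals 𝔪, RayEquiv 𝔪 J I ∧ Squarefree J ∧ J ⊔ 𝔵 = ⊤ ∧
      ∀ P : Ideal (𝓞 F), P.IsPrime → J ≤ P → T P := by
  classical
  obtain ⟨Q, _, _, π, hπ, hker⟩ := exists_rayClassGroup h𝔪
  let M : Submonoid Q :=
    { carrier := {g | ∀ 𝔵 : Ideal (𝓞 F), 𝔵 ≠ ⊥ → ∃ J : coprimeIdeals 𝔪, π J = g ∧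
        (J : Ideal (𝓞 F)) ⊔ 𝔵 = ⊤ ∧ Squarefree (J : Ideal (𝓞 F)) ∧
          ∀ P : Ideal (𝓞 F), P.IsPrime → J ≤ P → T P}
      one_mem' := fun 𝔵 h𝔵 => ⟨1, map_one π, by simp, squarefree_one, fun P hP h1 =>
        absurd (top_le_iff.1 (Ideal.one_eq_top (R := 𝓞 F) ▸ h1)) hP.ne_top⟩
      mul_mem' := fun {g g'} h h' 𝔵 h𝔵 => by
        obtain ⟨J, h1, h2, h3, h4⟩ := h 𝔵 h𝔵
        obtain ⟨J', h1', h2', h3', h4'⟩ := h' (𝔵 * J) (ideal_mul_ne_bot h𝔵 J.2.1)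
        obtain ⟨h5, h6⟩ := sup_mul_eq_top_iff.1 h2'
        refine ⟨J * J', by rw [map_mul, h1, h1'], mul_sup_eq_top h2 h5, ?_, fun P hP hle => ?_⟩
        · refine squarefree_mul_iff.2 ⟨?_, h3, h3'⟩
          exact (Ideal.isCoprime_iff_sup_eq.2 (by rw [sup_comm]; exact h6)).isRelPrime
        · rcases hP.mul_le.1 hle with h | h
          · exact h4 P hP h
          · exact h4' P hP h }
  have hM : ∀ g, g ∈ M ↔ ∀ 𝔵 : Ideal (𝓞 F), 𝔵 ≠ ⊥ → ∃ J : coprimeIdeals 𝔪, π J = g ∧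
        (J : Ideal (𝓞 F)) ⊔ 𝔵 = ⊤ ∧ Squarefree (J : Ideal (𝓞 F)) ∧
          ∀ P : Ideal (𝓞 F), P.IsPrime → J ≤ P → T P := fun g => Iff.rfl
  clear_value M
  obtain ⟨H, hH⟩ := exists_subgroup_of_submonoid M
  simp only [hM] at hH
  clear hM
  have key : H = ⊤ := by
    by_contra hne
    obtain ⟨χ, hχ, hχ', I0, hI0⟩ := exists_rayChar_of_subgroup h𝔪 hker hπ hne
    have hex : ∀ g : Q, ∃ 𝔶 : Ideal (𝓞 F), 𝔶 ≠ ⊥ ∧ (g ∉ H → ∀ J : coprimeIdeals 𝔪, π J = g →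
        (J : Ideal (𝓞 F)) ⊔ 𝔶 = ⊤ → ¬ (Squarefree (J : Ideal (𝓞 F)) ∧
          ∀ P : Ideal (𝓞 F), P.IsPrime → J ≤ P → T P)) := by
      intro g
      by_cases hg : g ∈ H
      · exact ⟨⊤, top_ne_bot, fun h => absurd hg h⟩
      · have hg' := hg
        rw [hH] at hg'
        push Not at hg'
        obtain ⟨𝔶, h1, h2⟩ := hg'
        refine ⟨𝔶, h1, fun _ J h3 h4 ⟨h5, h6⟩ => ?_⟩
        obtain ⟨P, h7, h8, h9⟩ := h2 J h3 h4 h5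
        exact h9 (h6 P h7 h8)
    choose 𝔶 h𝔶 hbad using hex
    have := Fintype.ofFinite Q
    obtain ⟨q, hq, hq4, hqT, hqχ⟩ := hT χ hχ ⟨I0, I0.2.1, I0.2.2, hI0⟩ (∏ g, 𝔶 g) (by
      rw [← Submodule.zero_eq_bot]
      exact Finset.prod_ne_zero_iff.2 fun g _ => h𝔶 g)
    have hq3 := HeightOneSpectrum.sup_eq_top q hq
    refine hqχ (hχ' ⟨q.asIdeal, q.ne_bot, hq4⟩ ?_)
    by_contra hn
    refine hbad _ hn ⟨q.asIdeal, q.ne_bot, hq4⟩ rfl ?_ ⟨?_, fun P hP hle => ?_⟩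
    · refine top_le_iff.1 (hq3.symm.le.trans (sup_le_sup_left ?_ _))
      exact Ideal.dvd_iff_le.1 (Finset.dvd_prod_of_mem _ (Finset.mem_univ _))
    · exact q.irreducible.squarefree
    · rwa [← (q.isPrime.isMaximal q.ne_bot).eq_of_le hP.ne_top hle]
  have hmem : π ⟨I, hI⟩ ∈ H := by rw [key]; exact Subgroup.mem_top _
  obtain ⟨J, h1, h2, h3, h4⟩ := (hH _).1 hmem 𝔵 h𝔵
  have h5 := (hker J ⟨I, hI⟩).1 h1
  exact ⟨J, J.2, h5, h3, h2, h4⟩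

/-- The prime ideals whose norm is not congruent to one modulo a high power of `p` separate ray class
characters. -/
lemma exists_good_prime {p : ℕ} (hp : p.Prime) : ∃ R : ℕ, ∀ (𝔪 : Ideal (𝓞 F)) (χ : Ideal (𝓞 F) →*₀ ℂ),
    IsRayChar χ (fun _ => 1) 𝔪 → (∃ I, I ≠ ⊥ ∧ I ⊔ 𝔪 = ⊤ ∧ χ I ≠ 1) → ∀ X : Ideal (𝓞 F), X ≠ ⊥ →
      ∃ q : HeightOneSpectrum (𝓞 F), ¬ q.asIdeal ∣ X ∧ q.asIdeal ⊔ 𝔪 = ⊤ ∧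
        ¬ (p ^ R : ℕ) ∣ Ideal.absNorm q.asIdeal - 1 ∧ χ q.asIdeal ≠ 1 := by
  obtain ⟨R, ω, hev, hω1, hω2⟩ := exists_even_dirichletCharacter hp
    (n := Module.finrank ℚ F) Module.finrank_pos.ne'
  refine ⟨R, ?_⟩
  have hN0 : p ^ R ≠ 0 := pow_ne_zero _ hp.ne_zero
  have hpN : (p + 1).Coprime (p ^ R) := Nat.Coprime.pow_right _ (by simp)
  generalize p ^ R = N at *
  have hev2 : (ω ^ 2).Even := by
    rw [DirichletCharacter.Even, MulChar.pow_apply' _ two_ne_zero, hev, one_pow]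
  obtain ⟨χ₂, hχ₂, hχ₂'⟩ := exists_normChar (F := F) hN0 ω (Or.inl ⟨hev, rfl⟩)
  obtain ⟨χ₃, hχ₃, hχ₃'⟩ := exists_normChar (F := F) hN0 (ω ^ 2) (Or.inl ⟨hev2, rfl⟩)
  have hu0 : Ideal.span {((p + 1 : ℕ) : 𝓞 F)} ≠ ⊥ := by
    rw [ne_eq, Ideal.span_singleton_eq_bot]; exact_mod_cast Nat.succ_ne_zero p
  have hu1 : Ideal.span {((p + 1 : ℕ) : 𝓞 F)} ⊔ Ideal.span {(N : 𝓞 F)} = ⊤ := by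
    rw [← Ideal.isCoprime_iff_sup_eq, Ideal.isCoprime_span_singleton_iff]
    simpa using (Nat.isCoprime_iff_coprime.2 hpN).map (Int.castRingHom (𝓞 F))
  have hu2 : Ideal.absNorm (Ideal.span {((p + 1 : ℕ) : 𝓞 F)}) = (p + 1) ^ Module.finrank ℚ F := by
    rw [Ideal.absNorm_span_natCast, RingOfIntegers.rank]
  have b₂ := hχ₂.primeBdd (Or.inr ⟨rfl, _, hu0, hu1, by rw [hχ₂' _ hu0 hu1, hu2]; exact hω1⟩)
  have b₃ := hχ₃.primeBdd (Or.inr ⟨rfl, _, hu0, hu1, by rw [hχ₃' _ hu0 hu1, hu2]; exact hω2⟩)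
  intro 𝔪 χ hχ hχ1 X hX
  have b₁ := hχ.primeBdd (Or.inr ⟨rfl, hχ1⟩)
  by_contra! hcon
  refine false_of_three_le b₁ b₂ b₃ (X := X * (𝔪 * Ideal.span {(N : 𝓞 F)}))
    (ideal_mul_ne_bot hX (ideal_mul_ne_bot hχ.ne_bot hχ₂.ne_bot)) fun q hq => ?_
  have hqX : ¬ q.asIdeal ∣ X := fun h => hq (h.mul_right _)
  obtain ⟨hq4, hq5⟩ := sup_mul_eq_top_iff.1
    (sup_mul_eq_top_iff.1 (HeightOneSpectrum.sup_eq_top q hq)).2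
  have e2 : χ₂ q.asIdeal = ω (Ideal.absNorm q.asIdeal : ℕ) := hχ₂' _ q.ne_bot hq5
  have e3 : χ₃ q.asIdeal = ω (Ideal.absNorm q.asIdeal : ℕ) ^ 2 := by
    rw [hχ₃' _ q.ne_bot hq5, MulChar.pow_apply' _ two_ne_zero]
  have hz0 : ‖ω (Ideal.absNorm q.asIdeal : ℕ)‖ = 1 := by
    have := DirichletCharacter.unit_norm_eq_one ω
      (ZMod.unitOfCoprime _ (coprime_absNorm_of_sup q.ne_bot hq5))
    simpa using this
  have hz3 : N ∣ Ideal.absNorm q.asIdeal - 1 → ω (Ideal.absNorm q.asIdeal : ℕ) = 1 := by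
    intro hgood
    have h1 : 1 ≤ Ideal.absNorm q.asIdeal := (two_le_absNorm_prime q).trans' one_le_two
    have h2 : ((Ideal.absNorm q.asIdeal : ℕ) : ZMod N) = 1 := by
      rw [← Nat.sub_add_cancel h1, Nat.cast_add, (ZMod.natCast_eq_zero_iff _ _).2 hgood]; simp
    rw [h2, map_one]
  rw [e2, e3]
  generalize ω (Ideal.absNorm q.asIdeal : ℕ) = z at *
  have hz2 : z.re * z.re + z.im * z.im = 1 := by
    rw [← Complex.normSq_apply, Complex.normSq_eq_norm_sq, hz0, one_pow]
  by_cases hgood : N ∣ Ideal.absNorm q.asIdeal - 1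
  · have h3 : -1 ≤ (χ q.asIdeal).re :=
      (abs_le.1 ((Complex.abs_re_le_norm _).trans (hχ.norm_le q.asIdeal))).1
    rw [hz3 hgood]; norm_num; linarith
  · rw [hcon q hqX hq4 hgood, pow_two, Complex.mul_re]
    norm_num
    nlinarith [sq_nonneg (2 * z.re + 1)]

lemma exists_mem_ne_zero_sub {𝔪 : Ideal (𝓞 F)} (h𝔪 : 𝔪 ≠ ⊥) (a : 𝓞 F) :
    ∃ a', a' ≠ 0 ∧ a' - a ∈ 𝔪 := by
  obtain ⟨m, hm, hm0⟩ := Submodule.exists_mem_ne_zero_of_ne_bot h𝔪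
  by_cases h : a = 0
  · exact ⟨m, hm0, by simpa [h] using hm⟩
  · exact ⟨a, h, by simp⟩

/-- A residue class modulo `𝔡𝔪` generating `𝔡` contains an element generating `𝔡I` with `I` a product
of distinct prime ideals with norm not congruent to one modulo a high power of `p`. -/
lemma exists_good_generator {p : ℕ} (hp : p.Prime) : ∃ R : ℕ, ∀ (𝔡 𝔪 𝔵 : Ideal (𝓞 F)) (a : 𝓞 F),
    𝔡 ≠ ⊥ → 𝔪 ≠ ⊥ → 𝔵 ≠ ⊥ → Ideal.span {a} ⊔ 𝔡 * 𝔪 = 𝔡 → ∃ (a' : 𝓞 F) (I : Ideal (𝓞 F)),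
      a' - a ∈ 𝔡 * 𝔪 ∧ Ideal.span {a'} = 𝔡 * I ∧ I ≠ ⊥ ∧ I ⊔ 𝔵 = ⊤ ∧ Squarefree I ∧
        ∀ P : Ideal (𝓞 F), P.IsPrime → I ≤ P → ¬ (p ^ R : ℕ) ∣ Ideal.absNorm P - 1 := by
  obtain ⟨R, hR⟩ := exists_good_prime (F := F) hp
  refine ⟨R, fun 𝔡 𝔪 𝔵 b h𝔡 h𝔪 h𝔵 hb => ?_⟩
  have hd0 : 𝔡 ≠ 0 := h𝔡
  obtain ⟨a, ha0, hab⟩ := exists_mem_ne_zero_sub (ideal_mul_ne_bot h𝔡 h𝔪) b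
  have ha : Ideal.span {a} ⊔ 𝔡 * 𝔪 = 𝔡 := by
    refine le_antisymm (sup_le ?_ Ideal.mul_le_left) ?_
    · rw [Ideal.span_singleton_le_iff_mem, ← sub_add_cancel a b]
      exact add_mem (Ideal.mul_le_left hab) (hb ▸ Ideal.mem_sup_left (Ideal.mem_span_singleton_self b))
    · conv_lhs => rw [← hb]
      refine sup_le ?_ le_sup_right
      rw [Ideal.span_singleton_le_iff_mem, show b = a + -(a - b) by ring]
      exact Submodule.add_mem_sup (Ideal.mem_span_singleton_self a) (neg_mem hab)
  obtain ⟨I0, hI0⟩ := Ideal.dvd_iff_le.2 (show Ideal.span {a} ≤ 𝔡 from le_sup_left.trans_eq ha)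
  have hI0' : I0 ∈ coprimeIdeals 𝔪 := by
    refine ⟨?_, ?_⟩
    · rintro rfl; rw [Ideal.mul_bot, Ideal.span_singleton_eq_bot] at hI0; exact ha0 hI0
    · refine mul_left_cancel₀ hd0 ?_
      rw [Ideal.mul_sup, ← hI0, ha, Ideal.mul_top]
  obtain ⟨J, hJ, ⟨α, β, hα, hβ, hα1, hβ1, hJI⟩, hsq, hJ𝔵, hgood⟩ :=
    exists_rayEquiv_of_separating (T := fun P => ¬ (p ^ R : ℕ) ∣ Ideal.absNorm P - 1) h𝔪 (hR 𝔪) h𝔵 hI0'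
  have e1 : Ideal.span {α} * (𝔡 * J) = Ideal.span {β * a} := by
    rw [mul_left_comm, hJI, ← Ideal.span_singleton_mul_span_singleton, hI0, mul_left_comm]
  have e2 : β * a ∈ Ideal.span {α} := by
    rw [← Ideal.span_singleton_le_iff_mem, ← e1]; exact Ideal.mul_le_left
  obtain ⟨a', ha'⟩ := Ideal.mem_span_singleton.1 e2
  have e3 : Ideal.span {a'} = 𝔡 * J := by
    rw [ha', ← Ideal.span_singleton_mul_span_singleton] at e1
    exact (mul_left_cancel₀ (by simpa using hα) e1).symm
  have ha'𝔡 : a' ∈ 𝔡 := Ideal.mul_le_left (e3 ▸ Ideal.mem_span_singleton_self a')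
  have ha𝔡 : a ∈ 𝔡 := ha ▸ Ideal.mem_sup_left (Ideal.mem_span_singleton_self a)
  refine ⟨a', J, ?_, e3, hJ.1, hJ𝔵, hsq, hgood⟩
  have : a' - b = a * ((β - 1) - (α - 1)) - (a' - a) * (α - 1) + (a - b) := by
    linear_combination -ha'
  rw [this]
  exact add_mem (sub_mem (Ideal.mul_mem_mul ha𝔡 (sub_mem hβ1 hα1))
    (Ideal.mul_mem_mul (sub_mem ha'𝔡 ha𝔡) hα1)) hab

end GoodPrimes

section Master
variable {F : Type*} [Field F] [NumberField F]

open IsDedekindDomain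

lemma ideal_mul_le_mul_iff {I J K : Ideal (𝓞 F)} (hI : I ≠ 0) : I * J ≤ I * K ↔ J ≤ K := by
  rw [← Ideal.dvd_iff_le, ← Ideal.dvd_iff_le, mul_dvd_mul_iff_left hI]

lemma exists_factor_coprime {K : Ideal (𝓞 F)} (hK : K ≠ ⊥) (C : Ideal (𝓞 F)) :
    ∃ K₁ K₂ : Ideal (𝓞 F), ∃ m : ℕ, K = K₁ * K₂ ∧ K₂ ⊔ C = ⊤ ∧ C ^ m ≤ K₁ := by
  induction K using WellFoundedGT.induction with
  | ind K ih =>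
  by_cases h : K ⊔ C = ⊤
  · exact ⟨⊤, K, 0, by simp, h, le_top⟩
  · obtain ⟨K', hK'⟩ := Ideal.dvd_iff_le.2 (le_sup_left : K ≤ K ⊔ C)
    have hK'0 : K' ≠ ⊥ := by rintro rfl; exact hK (by rw [hK', Ideal.mul_bot])
    have hlt : K < K' := by
      refine lt_of_le_of_ne (by rw [hK']; exact Ideal.mul_le_right) fun heq => h ?_
      rw [← heq] at hK'
      have : (1 : Ideal (𝓞 F)) * K = (K ⊔ C) * K := by rw [one_mul]; exact hK'
      rw [← Ideal.one_eq_top]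
      exact (mul_right_cancel₀ hK this).symm
    obtain ⟨K₁, K₂, m, h1, h2, h3⟩ := ih K' hlt hK'0
    refine ⟨(K ⊔ C) * K₁, K₂, m + 1, by rw [mul_assoc, ← h1]; exact hK', h2, ?_⟩
    rw [pow_succ']
    exact Ideal.mul_mono le_sup_right h3

lemma sup_pow_eq_top {I C : Ideal (𝓞 F)} (h : I ⊔ C = ⊤) (m : ℕ) : I ⊔ C ^ m = ⊤ :=
  Ideal.sup_pow_eq_top h

lemma eq_top_of_forall_prime {I J : Ideal (𝓞 F)} (h : ∀ P : Ideal (𝓞 F), P.IsPrime → I ≤ P → ¬ J ≤ P) :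
    I ⊔ J = ⊤ := by
  by_contra hne
  obtain ⟨P, hP, hle⟩ := Ideal.exists_le_maximal _ hne
  exact h P hP.isPrime (le_sup_left.trans hle) (le_sup_right.trans hle)

lemma not_le_of_sup_eq_top {I J P : Ideal (𝓞 F)} (hP : P.IsPrime) (h : I ⊔ J = ⊤) (hI : I ≤ P) :
    ¬ J ≤ P := fun hJ => hP.ne_top (top_le_iff.1 (h ▸ sup_le hI hJ))

/-- The stable range property of the ring of integers. -/
lemma exists_add_mul_sup {a c : 𝓞 F} {𝔤 K : Ideal (𝓞 F)} (h𝔤 : 𝔤 = Ideal.span {a} ⊔ Ideal.span {c})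
    (h𝔤0 : 𝔤 ≠ ⊥) (hK : K ≠ ⊥) : ∃ s, Ideal.span {c + s * a} ⊔ 𝔤 * K = 𝔤 := by
  have ha : a ∈ 𝔤 := h𝔤 ▸ Ideal.mem_sup_left (Ideal.mem_span_singleton_self a)
  have hc : c ∈ 𝔤 := h𝔤 ▸ Ideal.mem_sup_right (Ideal.mem_span_singleton_self c)
  have hg0 : 𝔤 ≠ 0 := h𝔤0
  obtain ⟨C, hC⟩ := Ideal.dvd_iff_le.2 ((Ideal.span_singleton_le_iff_mem _).2 hc)
  obtain ⟨K₁, K₂, m, h1, h2, h3⟩ := exists_factor_coprime hK C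
  have h12 : K₁ ⊔ K₂ = ⊤ := top_le_iff.1 ((sup_comm K₂ _ ▸ sup_pow_eq_top h2 m).symm.le.trans
    (sup_le_sup_right h3 _))
  obtain ⟨s, hs1, hs2⟩ := exists_crt h12 1 0
  rw [sub_zero] at hs2
  refine ⟨s, ?_⟩
  have hc1 : c + s * a ∈ 𝔤 := add_mem hc (𝔤.mul_mem_left _ ha)
  obtain ⟨J, hJ⟩ := Ideal.dvd_iff_le.2 ((Ideal.span_singleton_le_iff_mem _).2 hc1)
  rw [hJ, ← Ideal.mul_sup, eq_top_of_forall_prime, Ideal.mul_top]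
  intro P hP hJP hKP
  have hmem : c + s * a ∈ 𝔤 * P := by
    rw [← Ideal.span_singleton_le_iff_mem, hJ]; exact Ideal.mul_mono_right hJP
  have hCP : C ≤ P ↔ c ∈ 𝔤 * P := by
    rw [← Ideal.span_singleton_le_iff_mem, hC]
    exact (ideal_mul_le_mul_iff hg0).symm
  rw [h1] at hKP
  rcases hP.mul_le.1 hKP with h | h
  · have hcP := hCP.1 (hP.le_of_pow_le (h3.trans h))
    have haP : a ∈ 𝔤 * P := by
      have : a = (c + s * a) - c - a * (s - 1) := by ring
      rw [this]
      exact sub_mem (sub_mem hmem hcP) (Ideal.mul_mem_mul ha (h hs1))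
    have : 𝔤 * ⊤ ≤ 𝔤 * P := by
      rw [Ideal.mul_top]
      conv_lhs => rw [h𝔤]
      exact sup_le ((Ideal.span_singleton_le_iff_mem _).2 haP) ((Ideal.span_singleton_le_iff_mem _).2 hcP)
    exact hP.ne_top (top_le_iff.1 ((ideal_mul_le_mul_iff hg0).1 this))
  · refine not_le_of_sup_eq_top hP h2 h (hCP.2 ?_)
    have : c = (c + s * a) - a * s := by ring
    rw [this]
    exact sub_mem hmem (Ideal.mul_mem_mul ha (h hs2))

end Master

section Approximation
variable {F : Type*} [Field F] [NumberField F]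

lemma pow_absNorm_sub_one_sub_one_mem {P : Ideal (𝓞 F)} (hP : P.IsPrime) (hP0 : P ≠ ⊥) {u : 𝓞 F}
    (hu : u ∉ P) : u ^ (Ideal.absNorm P - 1) - 1 ∈ P := by
  have hmax := hP.isMaximal hP0
  let _ := Ideal.Quotient.field P
  have : Finite (𝓞 F ⧸ P) := Ring.HasFiniteQuotients.finiteQuotient hP0
  have : Fintype (𝓞 F ⧸ P) := Fintype.ofFinite _
  rw [← Ideal.Quotient.eq_zero_iff_mem, map_sub, map_pow, map_one, sub_eq_zero,
    Ideal.absNorm_apply, Submodule.cardQuot_apply, Nat.card_eq_fintype_card]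
  refine FiniteField.pow_card_sub_one_eq_one _ ?_
  rwa [Ne, Ideal.Quotient.eq_zero_iff_mem]

lemma pow_sub_one_mem_of_dvd {I : Ideal (𝓞 F)} {x : 𝓞 F} {m n : ℕ} (h : x ^ m - 1 ∈ I)
    (hmn : m ∣ n) : x ^ n - 1 ∈ I := by
  obtain ⟨k, rfl⟩ := hmn
  refine I.mem_of_dvd ?_ h
  rw [pow_mul]
  exact sub_one_dvd_pow_sub_one _ _

lemma span_unit_sup (u : (𝓞 F)ˣ) (I : Ideal (𝓞 F)) : Ideal.span {(u : 𝓞 F)} ⊔ I = ⊤ := by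
  rw [Ideal.span_singleton_eq_top.2 u.isUnit, top_sup_eq]

lemma exists_pow_sub_one_mem {p R : ℕ} (hp : p.Prime) {u : 𝓞 F} {I : Ideal (𝓞 F)}
    (hu : Ideal.span {u} ⊔ I = ⊤) (hI : I ≠ ⊥)
    (hsq : Squarefree I)
    (hgood : ∀ P : Ideal (𝓞 F), P.IsPrime → I ≤ P → ¬ (p ^ R : ℕ) ∣ Ideal.absNorm P - 1) :
    ∃ M : ℕ, ¬ p ∣ M ∧ u ^ (p ^ R * M) - 1 ∈ I := by
  induction I using WellFoundedGT.induction with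
  | ind I ih =>
  by_cases h : I = ⊤
  · exact ⟨1, hp.one_lt.ne' ∘ Nat.dvd_one.1, by simp [h]⟩
  obtain ⟨P, hP, hIP⟩ := Ideal.exists_le_maximal _ h
  have hP0 : P ≠ ⊥ := fun h0 => hI (le_bot_iff.1 (h0 ▸ hIP))
  obtain ⟨I', rfl⟩ := Ideal.dvd_iff_le.2 hIP
  have hI'0 : I' ≠ ⊥ := by rintro rfl; exact hI (by rw [Ideal.mul_bot])
  have hPI' : P ⊔ I' = ⊤ := by
    by_contra hne
    have hle : I' ≤ P := by
      by_contra hle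
      exact hne (hP.out.2 _ (left_lt_sup.2 hle))
    have := hsq P (mul_dvd_mul_left P (Ideal.dvd_iff_le.2 hle))
    exact hP.ne_top (Ideal.isUnit_iff.1 this)
  have hlt : P * I' < I' := by
    refine lt_of_le_of_ne Ideal.mul_le_right fun heq => hP.ne_top ?_
    have : P * I' = 1 * I' := by rw [one_mul]; exact heq
    exact (mul_right_cancel₀ hI'0 this).trans Ideal.one_eq_top
  obtain ⟨M', hM', hmem'⟩ := ih I' hlt
    (top_unique (hu.ge.trans (sup_le_sup_left Ideal.mul_le_right _))) hI'0 (hsq.squarefree_of_dvd (dvd_mul_left _ _))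
    (fun Q hQ hle => hgood Q hQ (Ideal.mul_le_right.trans hle))
  have hg := hgood P hP.isPrime hIP
  have hn0 : Ideal.absNorm P - 1 ≠ 0 := fun h0 => hg (h0 ▸ dvd_zero _)
  obtain ⟨r, m, hm, hrm⟩ := Nat.exists_eq_pow_mul_and_not_dvd hn0 p hp.ne_one
  have hrR : r ≤ R := by
    by_contra hlt
    exact hg (hrm ▸ Dvd.dvd.mul_right (pow_dvd_pow p (not_le.1 hlt).le) _)
  refine ⟨m * M', hp.prime.not_dvd_mul hm hM', ?_⟩
  rw [mul_eq_inf_of_sup_eq_top hPI']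
  refine ⟨pow_sub_one_mem_of_dvd (pow_absNorm_sub_one_sub_one_mem hP.isPrime hP0
    fun huP => hP.ne_top (top_unique (hu.ge.trans (sup_le ((Ideal.span_singleton_le_iff_mem P).2 huP) Ideal.mul_le_left))))  ?_,
    pow_sub_one_mem_of_dvd hmem' ⟨m, by ring⟩⟩
  rw [hrm, ← mul_assoc]
  exact Dvd.dvd.mul_right (mul_dvd_mul_right (pow_dvd_pow p hrR) m) _

lemma le_of_mul_le_of_sup {A B C : Ideal (𝓞 F)} (h : A ⊔ B = ⊤) (hle : A * C ≤ B) : C ≤ B := by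
  calc C = (A ⊔ B) * C := by rw [h, Ideal.top_mul]
    _ = A * C ⊔ B * C := Ideal.sup_mul _ _ _
    _ ≤ B := sup_le hle Ideal.mul_le_left

lemma le_span_sup_pow_mul {c : 𝓞 F} {𝔤 𝔮 : Ideal (𝓞 F)} (h : 𝔤 ≤ Ideal.span {c} ⊔ 𝔮 * 𝔤) (m : ℕ) :
    𝔤 ≤ Ideal.span {c} ⊔ 𝔮 ^ m * 𝔤 := by
  induction m with
  | zero => simp
  | succ m ih =>
    refine ih.trans (sup_le le_sup_left ?_)
    calc 𝔮 ^ m * 𝔤 ≤ 𝔮 ^ m * (Ideal.span {c} ⊔ 𝔮 * 𝔤) := Ideal.mul_mono_right h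
      _ = 𝔮 ^ m * Ideal.span {c} ⊔ 𝔮 ^ (m + 1) * 𝔤 := by rw [Ideal.mul_sup, ← mul_assoc, pow_succ]
      _ ≤ _ := sup_le_sup_right Ideal.mul_le_right _

/-- One can move `a` by a multiple of `c` so that it is close to a given `κ` near `𝔮`. -/
lemma exists_add_mul_close {a c κ : 𝓞 F} {𝔤 𝔮 𝔯 : Ideal (𝓞 F)} (h𝔮𝔯 : 𝔮 ⊔ 𝔯 = ⊤)
    (ha𝔮 : a ∈ 𝔮 * 𝔤) (hκ0 : κ ≠ 0) (hκ𝔯 : κ ∈ 𝔯) (haκ : a ^ 2 ∣ κ)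
    (hc𝔮 : 𝔤 ≤ Ideal.span {c} ⊔ 𝔮 * 𝔤) :
    ∃ (𝔔 𝔬 𝔞 : Ideal (𝓞 F)) (t : 𝓞 F), Ideal.span {κ} = 𝔔 * 𝔬 ∧ 𝔬 ⊔ 𝔮 = ⊤ ∧ 𝔬 ≤ 𝔞 ∧
      t ∈ 𝔮 * 𝔯 ∧ a + t * c - κ ∈ 𝔔 * 𝔮 ∧
      Ideal.span {a + t * c} ⊔ 𝔔 * 𝔞 * Ideal.span {c * κ} = 𝔔 * 𝔞 := by
  have hκs : Ideal.span {κ} ≠ (⊥ : Ideal (𝓞 F)) := by simpa using hκ0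
  obtain ⟨𝔔, 𝔬, k, h1, h2, h3⟩ := exists_factor_coprime hκs 𝔮
  have h𝔔0 : 𝔔 ≠ 0 := by rintro rfl; exact hκs (by rw [h1, zero_mul]; rfl)
  have hκ𝔔𝔬 : κ ∈ 𝔔 * 𝔬 := h1 ▸ Ideal.mem_span_singleton_self κ
  have hκ𝔔 : κ ∈ 𝔔 := Ideal.mul_le_left hκ𝔔𝔬
  have h𝔔sup : ∀ X : Ideal (𝓞 F), 𝔮 ⊔ X = ⊤ → 𝔔 ⊔ X = ⊤ := fun X hX => by
    have := sup_pow_eq_top (sup_comm 𝔮 X ▸ hX) k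
    exact top_le_iff.1 (this.symm.le.trans (sup_le le_sup_right (h3.trans le_sup_left)))
  have h𝔬𝔯 : 𝔬 ≤ 𝔯 := le_of_mul_le_of_sup (h𝔔sup _ h𝔮𝔯)
    (h1 ▸ (Ideal.span_singleton_le_iff_mem _).2 hκ𝔯)
  have h𝔔𝔬 : 𝔔 ⊔ 𝔬 = ⊤ := h𝔔sup _ (sup_comm 𝔬 𝔮 ▸ h2)
  obtain ⟨𝔞, h𝔞⟩ : ∃ 𝔞, 𝔞 = Ideal.span {a} ⊔ 𝔬 := ⟨_, rfl⟩
  have h𝔬𝔞 : 𝔬 ≤ 𝔞 := h𝔞 ▸ le_sup_right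
  have ha𝔞 : a ∈ 𝔞 := h𝔞 ▸ Ideal.mem_sup_left (Ideal.mem_span_singleton_self a)
  have h𝔔𝔞 : 𝔔 ⊔ 𝔞 = ⊤ := top_le_iff.1 (h𝔔𝔬.symm.le.trans (sup_le_sup_left h𝔬𝔞 _))
  have h𝔬𝔞2 : 𝔬 ≤ 𝔞 * 𝔞 := by
    refine le_of_mul_le_of_sup (pow_two 𝔞 ▸ sup_pow_eq_top h𝔔𝔞 2) ?_
    rw [← h1, Ideal.span_singleton_le_iff_mem]
    exact Ideal.mem_of_dvd _ haκ (pow_two a ▸ Ideal.mul_mem_mul ha𝔞 ha𝔞)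
  have h𝔬0 : 𝔬 ≠ ⊥ := by rintro rfl; exact hκs (by rw [h1, Ideal.mul_bot])
  have h𝔞0 : 𝔞 ≠ 0 := fun h0 => h𝔬0 (le_bot_iff.1 (h𝔬𝔞.trans h0.le))
  obtain ⟨𝔬', h𝔬'⟩ := Ideal.dvd_iff_le.2 h𝔬𝔞
  obtain ⟨J, hJ⟩ := Ideal.dvd_iff_le.2 ((Ideal.span_singleton_le_iff_mem _).2 ha𝔞)
  have h𝔬'𝔞 : 𝔬' ≤ 𝔞 := (ideal_mul_le_mul_iff h𝔞0).1 (h𝔬' ▸ h𝔬𝔞2)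
  have hJ𝔬' : J ⊔ 𝔬' = ⊤ := by
    refine mul_left_cancel₀ h𝔞0 ?_
    rw [Ideal.mul_sup, ← hJ, ← h𝔬', Ideal.mul_top, h𝔞]
  obtain ⟨t₁, ht₁, hmem₁⟩ : ∃ t₁ ∈ 𝔮, t₁ * c - (κ - a) ∈ 𝔔 * 𝔮 := by
    have hκa : κ - a ∈ 𝔮 * 𝔤 :=
      sub_mem (Ideal.mem_of_dvd _ ((dvd_pow_self a two_ne_zero).trans haκ) ha𝔮) ha𝔮
    have hle : 𝔮 * 𝔤 ≤ 𝔮 * Ideal.span {c} ⊔ 𝔔 * 𝔮 := by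
      refine (Ideal.mul_mono_right (le_span_sup_pow_mul hc𝔮 k)).trans ?_
      rw [Ideal.mul_sup]
      refine sup_le_sup_left ?_ _
      rw [mul_comm 𝔔]
      exact Ideal.mul_mono_right (Ideal.mul_le_left.trans h3)
    obtain ⟨x, hx, y, hy, hxy⟩ := Submodule.mem_sup.1 (hle hκa)
    obtain ⟨t₁, ht₁, rfl⟩ := Ideal.mem_mul_span_singleton.1 hx
    refine ⟨t₁, ht₁, ?_⟩
    rw [← hxy, sub_add_cancel_left]
    exact neg_mem hy
  have hcop : 𝔔 * 𝔮 ⊔ 𝔬 * 𝔬 = ⊤ := by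
    rw [← pow_two]
    exact sup_pow_eq_top (mul_sup_eq_top h𝔔𝔬 (sup_comm 𝔬 𝔮 ▸ h2)) 2
  obtain ⟨t, ht1, ht2⟩ := exists_crt hcop t₁ 0
  rw [sub_zero] at ht2
  have ht𝔬 : t ∈ 𝔬 := Ideal.mul_le_left ht2
  have ht𝔮 : t ∈ 𝔮 := by
    rw [← sub_add_cancel t t₁]
    exact add_mem (Ideal.mul_le_right ht1) ht₁
  have ht𝔮𝔯 : t ∈ 𝔮 * 𝔯 := by
    rw [mul_eq_inf_of_sup_eq_top h𝔮𝔯]; exact ⟨ht𝔮, h𝔬𝔯 ht𝔬⟩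
  have hclose : a + t * c - κ ∈ 𝔔 * 𝔮 := by
    have : a + t * c - κ = (t₁ * c - (κ - a)) + (t - t₁) * c := by ring
    rw [this]
    exact add_mem hmem₁ (Ideal.mul_mem_right _ _ ht1)
  have hmem𝔔 : a + t * c ∈ 𝔔 := by
    rw [← sub_add_cancel (a + t * c) κ]
    exact add_mem (Ideal.mul_le_left hclose) hκ𝔔
  have hmem𝔞 : a + t * c ∈ 𝔞 := add_mem ha𝔞 (Ideal.mul_mem_right _ _ (h𝔬𝔞 ht𝔬))
  have hmem : a + t * c ∈ 𝔔 * 𝔞 := by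
    rw [mul_eq_inf_of_sup_eq_top h𝔔𝔞]; exact ⟨hmem𝔔, hmem𝔞⟩
  refine ⟨𝔔, 𝔬, 𝔞, t, h1, h2, h𝔬𝔞, ht𝔮𝔯, hclose, ?_⟩
  obtain ⟨I, hI⟩ := Ideal.dvd_iff_le.2 ((Ideal.span_singleton_le_iff_mem _).2 hmem)
  rw [hI, ← Ideal.mul_sup, eq_top_of_forall_prime, Ideal.mul_top]
  intro P hP hIP hcκ
  have hmemP : a + t * c ∈ 𝔔 * 𝔞 * P := by
    rw [← Ideal.span_singleton_le_iff_mem, hI]; exact Ideal.mul_mono_right hIP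
  rw [Ideal.span_singleton_le_iff_mem] at hcκ
  by_cases hκP : κ ∈ P
  · have : 𝔔 * 𝔬 ≤ P := h1 ▸ (Ideal.span_singleton_le_iff_mem _).2 hκP
    rcases hP.mul_le.1 this with h | h
    · have h𝔮P : 𝔮 ≤ P := hP.le_of_pow_le (h3.trans h)
      have hκ𝔔P : 𝔔 * 𝔬 ≤ 𝔔 * P := by
        rw [← h1, Ideal.span_singleton_le_iff_mem, ← sub_sub_cancel (a + t * c) κ]
        refine sub_mem (?_ : _ ∈ _) (Ideal.mul_mono_right h𝔮P hclose)
        rw [mul_assoc] at hmemP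
        exact Ideal.mul_mono_right Ideal.mul_le_right hmemP
      exact not_le_of_sup_eq_top hP (sup_comm 𝔬 𝔮 ▸ h2) h𝔮P ((ideal_mul_le_mul_iff h𝔔0).1 hκ𝔔P)
    · have haP : 𝔞 * J ≤ 𝔞 * P := by
        rw [← hJ, Ideal.span_singleton_le_iff_mem, ← add_sub_cancel_right a (t * c)]
        refine sub_mem ?_ (Ideal.mul_mem_right _ _ (Ideal.mul_mono h𝔬𝔞 h ht2))
        rw [mul_assoc] at hmemP
        exact Ideal.mul_le_right hmemP
      have hJP := (ideal_mul_le_mul_iff h𝔞0).1 haP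
      refine not_le_of_sup_eq_top hP hJ𝔬' hJP ?_
      rcases hP.mul_le.1 (h𝔬' ▸ h) with h | h
      · exact h𝔬'𝔞.trans h
      · exact h
  · have hcP : c ∈ P := (hP.mem_or_mem hcκ).resolve_right hκP
    refine hκP (Ideal.mem_of_dvd _ ((dvd_pow_self a two_ne_zero).trans haκ) ?_)
    rw [← add_sub_cancel_right a (t * c)]
    exact sub_mem (Ideal.mul_le_right hmemP) (Ideal.mul_mem_left _ _ hcP)

end Approximation

section Master
variable {F : Type*} [Field F] [NumberField F]

lemma span_sup_span_add_mul (a c t : 𝓞 F) :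
    Ideal.span {a + t * c} ⊔ Ideal.span {c} = Ideal.span {a} ⊔ Ideal.span {c} := by
  refine le_antisymm (sup_le ?_ le_sup_right) (sup_le ?_ le_sup_right)
  · rw [Ideal.span_singleton_le_iff_mem]
    exact add_mem (Ideal.mem_sup_left (Ideal.mem_span_singleton_self a))
      (Ideal.mem_sup_right (Ideal.mul_mem_left _ _ (Ideal.mem_span_singleton_self c)))
  · rw [Ideal.span_singleton_le_iff_mem]
    have h : a + t * c - t * c ∈ Ideal.span {a + t * c} ⊔ Ideal.span {c} :=
      sub_mem (Ideal.mem_sup_left (Ideal.mem_span_singleton_self _))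
        (Ideal.mem_sup_right (Ideal.mul_mem_left _ _ (Ideal.mem_span_singleton_self c)))
    rwa [add_sub_cancel_right] at h

/-- The exponent producing a unit close to `1`. -/
lemma exists_exponent {p R : ℕ} (hp : p.Prime) (u : (𝓞 F)ˣ) {I₁ I₂ 𝔮 : Ideal (𝓞 F)} (j₀ : ℕ)
    (hI₁ : I₁ ≠ ⊥) (hI₂ : I₂ ≠ ⊥) (hsq₁ : Squarefree I₁) (hsq₂ : Squarefree I₂) (h𝔮 : (p : 𝓞 F) ∈ 𝔮)
    (hgood₁ : ∀ P : Ideal (𝓞 F), P.IsPrime → I₁ ≤ P → ¬ (p ^ R : ℕ) ∣ Ideal.absNorm P - 1)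
    (hgood₂ : ∀ P : Ideal (𝓞 F), P.IsPrime → I₂ ≤ P → ¬ (p ^ R : ℕ) ∣ Ideal.absNorm P - 1)
    (h12 : I₂ ⊔ I₁ = ⊤) (hΩ : (u : 𝓞 F) ^ (p ^ R * j₀) - 1 ∈ 𝔮)
    (hI₁Ω : I₁ ⊔ Ideal.span {1 - (u : 𝓞 F) ^ (p ^ R * j₀)} = ⊤)
    (hI₂Ω : I₂ ⊔ Ideal.span {1 - (u : 𝓞 F) ^ (p ^ R * j₀)} = ⊤) :
    ∃ (ε : (𝓞 F)ˣ) (m : 𝓞 F), 1 - (ε : 𝓞 F) = (1 - (u : 𝓞 F) ^ (p ^ R * j₀)) * m ∧ m - 1 ∈ 𝔮 ∧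
      m ∈ I₁ * I₂ := by
  obtain ⟨M₁, hM₁, hm₁⟩ := exists_pow_sub_one_mem hp (span_unit_sup u _) hI₁ hsq₁ hgood₁
  obtain ⟨M₂, hM₂, hm₂⟩ := exists_pow_sub_one_mem hp (span_unit_sup u _) hI₂ hsq₂ hgood₂
  set Ω : 𝓞 F := (u : 𝓞 F) ^ (p ^ R * j₀) with hΩdef
  obtain ⟨M, hM⟩ : ∃ M, M = (M₁ * M₂) ^ (p - 1) := ⟨_, rfl⟩
  have hp1 : p - 1 ≠ 0 := (Nat.sub_pos_of_lt hp.one_lt).ne'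
  have hMp : ((M : ℕ) : 𝓞 F) - 1 ∈ 𝔮 := by
    have hcop : IsCoprime ((M₁ * M₂ : ℕ) : ℤ) p := by
      rw [Nat.isCoprime_iff_coprime]
      exact ((Nat.Prime.coprime_iff_not_dvd hp).2 (hp.prime.not_dvd_mul hM₁ hM₂)).symm
    have := (Int.ModEq.pow_card_sub_one_eq_one hp hcop).symm.dvd
    obtain ⟨k, hk⟩ := this
    have hk' : ((M : ℕ) : 𝓞 F) - 1 = p * (k : 𝓞 F) := by
      rw [hM]; exact_mod_cast congrArg (Int.cast : ℤ → 𝓞 F) hk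
    rw [hk']; exact Ideal.mul_mem_right _ _ h𝔮
  refine ⟨u ^ (p ^ R * j₀ * M), ∑ i ∈ Finset.range M, Ω ^ i, ?_, ?_, ?_⟩
  · rw [mul_neg_geom_sum, Units.val_pow_eq_pow_val, pow_mul]
  · have : ∑ i ∈ Finset.range M, Ω ^ i - 1 = ∑ i ∈ Finset.range M, (Ω ^ i - 1) + ((M : 𝓞 F) - 1) := by
      rw [Finset.sum_sub_distrib]; simp
    rw [this]
    refine add_mem (Ideal.sum_mem _ fun i _ => 𝔮.mem_of_dvd (sub_one_dvd_pow_sub_one _ _) hΩ) hMp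
  · have key : ∀ {I : Ideal (𝓞 F)} {M' : ℕ}, (u : 𝓞 F) ^ (p ^ R * M') - 1 ∈ I → M' ∣ M →
        I ⊔ Ideal.span {1 - Ω} = ⊤ → ∑ i ∈ Finset.range M, Ω ^ i ∈ I := by
      intro I M' h hd hI
      have h1 : (1 - Ω) * ∑ i ∈ Finset.range M, Ω ^ i ∈ I := by
        rw [mul_neg_geom_sum, ← neg_sub, hΩdef, ← pow_mul]
        refine neg_mem (pow_sub_one_mem_of_dvd h ?_)
        rw [mul_assoc]
        exact mul_dvd_mul_left _ (hd.mul_left _)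
      rw [← Ideal.span_singleton_le_iff_mem] at h1 ⊢
      rw [← Ideal.span_singleton_mul_span_singleton] at h1
      exact le_of_mul_le_of_sup (sup_comm I _ ▸ hI) h1
    rw [mul_eq_inf_of_sup_eq_top (sup_comm I₂ I₁ ▸ h12)]
    refine ⟨key hm₁ ?_ hI₁Ω, key hm₂ ?_ hI₂Ω⟩
    · rw [hM]; exact (dvd_mul_right _ _).trans (dvd_pow_self _ hp1)
    · rw [hM]; exact (dvd_mul_left _ _).trans (dvd_pow_self _ hp1)

/-- The final congruence computation. -/
lemma sub_mem_of_close {a c a' c' κ y y₀ m : 𝓞 F} {𝔤 𝔮 𝔔 𝔬 : Ideal (𝓞 F)} (h𝔤0 : 𝔤 ≠ ⊥)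
    (h𝔤 : 𝔤 = Ideal.span {a} ⊔ Ideal.span {c}) (hκ : Ideal.span {κ} = 𝔔 * 𝔬) (hκ0 : κ ≠ 0)
    (h𝔬𝔮 : 𝔬 ⊔ 𝔮 = ⊤) (ha : a ∈ 𝔮 * 𝔤) (hc' : c' ∈ 𝔤) (ha' : a' - κ ∈ 𝔔 * 𝔮)
    (hcc' : c' - c ∈ 𝔮 * 𝔤) (hm : m - 1 ∈ 𝔮) (hy : y * (a' * c') = y₀ * c * κ * m) : y - y₀ ∈ 𝔮 := by
  have hκ𝔔 : κ ∈ 𝔔 := Ideal.mul_le_left (hκ ▸ Ideal.mem_span_singleton_self κ)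
  have hc : c ∈ 𝔤 := h𝔤 ▸ Ideal.mem_sup_right (Ideal.mem_span_singleton_self c)
  have h𝔔0 : 𝔔 ≠ 0 := by
    rintro rfl
    rw [zero_mul] at hκ
    exact hκ0 (Ideal.span_singleton_eq_bot.1 hκ)
  have h1 : (y - y₀) * c * κ ∈ 𝔔 * (𝔮 * 𝔤) := by
    have : (y - y₀) * c * κ = -(y * (κ * (c' - c))) - y * ((a' - κ) * c') + κ * ((m - 1) * c) * y₀ := by
      linear_combination hy
    rw [this]
    refine add_mem (sub_mem (neg_mem (Ideal.mul_mem_left _ _ (Ideal.mul_mem_mul hκ𝔔 hcc')))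
      (Ideal.mul_mem_left _ _ ?_))
      (Ideal.mul_mem_right _ _ (Ideal.mul_mem_mul hκ𝔔 (Ideal.mul_mem_mul hm hc)))
    rw [← mul_assoc]
    exact Ideal.mul_mem_mul ha' hc'
  have h2 : Ideal.span {(y - y₀) * c} * 𝔬 ≤ 𝔮 * 𝔤 := by
    rw [← ideal_mul_le_mul_iff h𝔔0, mul_left_comm, ← hκ, Ideal.span_singleton_mul_span_singleton,
      Ideal.span_singleton_le_iff_mem]
    exact h1
  have h3 : (y - y₀) * c ∈ 𝔮 * 𝔤 := by
    have : Ideal.span {(y - y₀) * c} ≤ 𝔮 * 𝔤 := by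
      calc Ideal.span {(y - y₀) * c} = Ideal.span {(y - y₀) * c} * (𝔬 ⊔ 𝔮) := by
            rw [h𝔬𝔮, Ideal.mul_top]
        _ = Ideal.span {(y - y₀) * c} * 𝔬 ⊔ Ideal.span {(y - y₀) * c} * 𝔮 := Ideal.mul_sup _ _ _
        _ ≤ 𝔮 * 𝔤 := sup_le h2 (by
            rw [mul_comm]
            exact Ideal.mul_mono_right ((Ideal.span_singleton_le_iff_mem _).2 (𝔤.mul_mem_left _ hc)))
    exact (Ideal.span_singleton_le_iff_mem _).1 this
  have h4 : Ideal.span {y - y₀} * 𝔤 ≤ 𝔮 * 𝔤 := by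
    conv_lhs => rw [h𝔤]
    rw [Ideal.mul_sup, Ideal.span_singleton_mul_span_singleton, Ideal.span_singleton_mul_span_singleton]
    exact sup_le ((Ideal.span_singleton_le_iff_mem _).2 (Ideal.mul_mem_left _ _ ha))
      ((Ideal.span_singleton_le_iff_mem _).2 h3)
  rw [mul_comm, mul_comm 𝔮, ideal_mul_le_mul_iff h𝔤0, Ideal.span_singleton_le_iff_mem] at h4
  exact h4

end Master

section Master
variable {F : Type*} [Field F] [NumberField F]

lemma exists_pow_sub_one_mem_span {u : 𝓞 F} {I : Ideal (𝓞 F)} (hu : Ideal.span {u} ⊔ I = ⊤)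
    (hI : I ≠ ⊥) : ∃ j, 1 ≤ j ∧ u ^ j - 1 ∈ I := by
  have : Finite (𝓞 F ⧸ I) := Ring.HasFiniteQuotients.finiteQuotient hI
  refine ⟨Nat.card (𝓞 F ⧸ I)ˣ, Nat.card_pos, ?_⟩
  rw [← Ideal.Quotient.eq_zero_iff_mem, map_sub, map_pow, map_one, sub_eq_zero]
  have hunit : IsUnit (Ideal.Quotient.mk I u) := by
    obtain ⟨x, hx, y, hy, h⟩ := Submodule.mem_sup.1 (hu.ge (Submodule.mem_top (x := (1 : 𝓞 F))))
    obtain ⟨v, rfl⟩ := Ideal.mem_span_singleton'.1 hx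
    refine IsUnit.of_mul_eq_one (Ideal.Quotient.mk I v) ?_
    rw [← map_mul, ← map_one (Ideal.Quotient.mk I), Ideal.Quotient.eq, ← h]
    have : u * v - (v * u + y) = -y := by ring
    rw [this]; exact neg_mem hy
  obtain ⟨v, hv⟩ := hunit
  have := congrArg Units.val (pow_card_eq_one' (x := v))
  rw [← hv]; exact this

variable [IsTotallyReal F]

lemma exists_moves_of_ne_zero {p : ℕ} (hp : p.Prime) {u : (𝓞 F)ˣ} (hu : ∀ j, 1 ≤ j → u ^ j ≠ 1)
    {𝔮 𝔯 : Ideal (𝓞 F)} (h𝔮p : (p : 𝓞 F) ∈ 𝔮) (h𝔮 : 𝔮 ≠ ⊥) (h𝔮' : 𝔮 ≠ ⊤) (h𝔯 : 𝔯 ≠ ⊥)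
    (h𝔮𝔯 : 𝔮 ⊔ 𝔯 = ⊤)
    {a c y₀ : 𝓞 F} (ha0 : a ≠ 0) (hc0 : c ≠ 0) (hy0 : y₀ ≠ 0) (hy𝔯 : y₀ ∈ 𝔯)
    (ha : a ∈ 𝔮 * (Ideal.span {a} ⊔ Ideal.span {c})) :
    ∃ (s t s' y : 𝓞 F) (ε : (𝓞 F)ˣ), t ∈ 𝔮 * 𝔯 ∧ y ∈ 𝔯 ∧ y - y₀ ∈ 𝔮 ∧ (ε : 𝓞 F) - 1 ∈ 𝔮 * 𝔯 ∧
      1 - (ε : 𝓞 F) = y * ((a + t * (c + s * a)) * (c + s * a + s' * (a + t * (c + s * a)))) := by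
  obtain ⟨R, hR⟩ := exists_good_generator (F := F) hp
  obtain ⟨𝔤, h𝔤⟩ : ∃ 𝔤, 𝔤 = Ideal.span {a} ⊔ Ideal.span {c} := ⟨_, rfl⟩
  rw [← h𝔤] at ha
  have ha𝔤 : a ∈ 𝔤 := h𝔤 ▸ Ideal.mem_sup_left (Ideal.mem_span_singleton_self a)
  have hc𝔤 : c ∈ 𝔤 := h𝔤 ▸ Ideal.mem_sup_right (Ideal.mem_span_singleton_self c)
  have h𝔤0 : 𝔤 ≠ ⊥ := by rintro rfl; exact ha0 (by simpa using ha𝔤)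
  obtain ⟨N, hN, hN0⟩ := Submodule.exists_mem_ne_zero_of_ne_bot (ideal_mul_ne_bot h𝔮 h𝔯)
  have hD0 : y₀ * c * (a ^ 2 * N) ≠ 0 := by positivity
  obtain ⟨j₀, hj₀, hj⟩ := exists_pow_sub_one_mem_span (span_unit_sup u _)
    (I := Ideal.span {y₀ * c * (a ^ 2 * N)}) (by simpa using hD0)
  obtain ⟨w, hw⟩ := Ideal.mem_span_singleton.1
    (pow_sub_one_mem_of_dvd hj (Dvd.intro_left (p ^ R) rfl))
  obtain ⟨κ, hκ⟩ : ∃ κ, κ = a ^ 2 * N * -w := ⟨_, rfl⟩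
  have hΩκ : 1 - (u : 𝓞 F) ^ (p ^ R * j₀) = y₀ * c * κ := by
    rw [hκ]; linear_combination -hw
  have hκ𝔮𝔯 : κ ∈ 𝔮 * 𝔯 := by
    rw [hκ]; exact Ideal.mul_mem_right _ _ (Ideal.mul_mem_left _ _ hN)
  have hκ0 : κ ≠ 0 := by
    rintro rfl
    rw [mul_zero, sub_eq_zero] at hΩκ
    refine hu _ (Nat.mul_pos (pow_pos hp.pos R) hj₀) (Units.ext ?_)
    rw [Units.val_pow_eq_pow_val, ← hΩκ, Units.val_one]
  have hΩ0 : Ideal.span {1 - (u : 𝓞 F) ^ (p ^ R * j₀)} ≠ ⊥ := by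
    rw [hΩκ]; simp [hy0, hc0, hκ0]
  have hκs : Ideal.span {κ} ≠ (⊥ : Ideal (𝓞 F)) := by simpa using hκ0
  obtain ⟨s, hs⟩ := exists_add_mul_sup h𝔤 h𝔤0 hκs
  obtain ⟨c₁, hc₁⟩ : ∃ c₁, c₁ = c + s * a := ⟨_, rfl⟩
  rw [← hc₁] at hs
  have hc₁𝔤 : c₁ ∈ 𝔤 := hs ▸ Ideal.mem_sup_left (Ideal.mem_span_singleton_self c₁)
  have hκ𝔮 : κ ∈ 𝔮 := Ideal.mul_le_left hκ𝔮𝔯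
  have hκ𝔯 : κ ∈ 𝔯 := Ideal.mul_le_right hκ𝔮𝔯
  have hc₁0 : c₁ ≠ 0 := by
    rintro h0
    rw [h0, Ideal.span_singleton_eq_bot.2 rfl, bot_sup_eq] at hs
    have h1 : 𝔤 * Ideal.span {κ} = 𝔤 * ⊤ := by rw [Ideal.mul_top]; exact hs
    have h2 : Ideal.span {κ} = ⊤ := mul_left_cancel₀ (show 𝔤 ≠ 0 from h𝔤0) h1
    exact h𝔮' (top_le_iff.1 (h2.symm.le.trans ((Ideal.span_singleton_le_iff_mem _).2 hκ𝔮)))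
  have hc₁𝔮 : 𝔤 ≤ Ideal.span {c₁} ⊔ 𝔮 * 𝔤 := by
    conv_lhs => rw [← hs]
    rw [mul_comm]
    exact sup_le_sup_left (Ideal.mul_mono_left ((Ideal.span_singleton_le_iff_mem _).2 hκ𝔮)) _
  obtain ⟨𝔔, 𝔬, 𝔞, t₀, hκ𝔔𝔬, h𝔬𝔮, h𝔬𝔞, ht₀, hclose, hgen⟩ := exists_add_mul_close h𝔮𝔯 ha hκ0 hκ𝔯
    (hκ ▸ Dvd.dvd.mul_right (Dvd.intro _ rfl) _) hc₁𝔮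
  have h𝔔𝔬0 : 𝔔 * 𝔬 ≠ ⊥ := hκ𝔔𝔬 ▸ hκs
  have h𝔔0 : 𝔔 ≠ ⊥ := by rintro rfl; exact h𝔔𝔬0 (Ideal.bot_mul _)
  have h𝔬0 : 𝔬 ≠ ⊥ := by rintro rfl; exact h𝔔𝔬0 (Ideal.mul_bot _)
  have h𝔞0 : 𝔞 ≠ ⊥ := fun h0 => h𝔬0 (le_bot_iff.1 (h𝔬𝔞.trans h0.le))
  have hκ𝔔 : κ ∈ 𝔔 := Ideal.mul_le_left (hκ𝔔𝔬 ▸ Ideal.mem_span_singleton_self κ)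
  obtain ⟨a₂, I₁, ha₂, hI₁, hI₁0, hI₁Ω, hI₁sq, hI₁good⟩ := hR (𝔔 * 𝔞) (Ideal.span {c₁ * κ}) _
    (a + t₀ * c₁) (ideal_mul_ne_bot h𝔔0 h𝔞0) (by simp [hc₁0, hκ0]) hΩ0 hgen
  obtain ⟨d, hd, hda⟩ := Ideal.mem_mul_span_singleton.1 ha₂
  obtain ⟨t, ht⟩ : ∃ t, t = t₀ + κ * d := ⟨_, rfl⟩
  have hta : a + t * c₁ = a₂ := by rw [ht]; linear_combination hda
  have ht𝔮𝔯 : t ∈ 𝔮 * 𝔯 := ht ▸ add_mem ht₀ (Ideal.mul_mem_right _ _ hκ𝔮𝔯)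
  have ha₂κ : a₂ - κ ∈ 𝔔 * 𝔮 := by
    have : a₂ - κ = (a + t₀ * c₁ - κ) + d * c₁ * κ := by linear_combination -hda
    rw [this, mul_assoc]
    refine add_mem hclose (Ideal.mul_mem_mul (Ideal.mul_le_left hd) (Ideal.mul_mem_left _ _ hκ𝔮))
  have ha₂𝔤 : a₂ ∈ 𝔤 := hta ▸ add_mem ha𝔤 (Ideal.mul_mem_left _ _ hc₁𝔤)
  have ha₂0 : a₂ ≠ 0 := by
    rintro rfl
    rw [Ideal.span_singleton_eq_bot.2 rfl] at hI₁
    exact ideal_mul_ne_bot (ideal_mul_ne_bot h𝔔0 h𝔞0) hI₁0 hI₁.symm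
  have h𝔤2 : 𝔤 = Ideal.span {a₂} ⊔ Ideal.span {c₁} := by
    rw [← hta, span_sup_span_add_mul, sup_comm, hc₁, span_sup_span_add_mul, sup_comm, h𝔤]
  obtain ⟨𝔪, h𝔪⟩ := Ideal.dvd_iff_le.2 ((Ideal.span_singleton_le_iff_mem _).2
    (𝔤.mul_mem_right κ ha₂𝔤))
  have h𝔪0 : 𝔪 ≠ ⊥ := by
    rintro rfl
    rw [Ideal.mul_bot, Ideal.span_singleton_eq_bot] at h𝔪
    exact mul_ne_zero ha₂0 hκ0 h𝔪
  have hgen₂ : Ideal.span {c₁} ⊔ 𝔤 * 𝔪 = 𝔤 := by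
    refine le_antisymm (sup_le ((Ideal.span_singleton_le_iff_mem _).2 hc₁𝔤) Ideal.mul_le_left) ?_
    conv_lhs => rw [← hs, h𝔤2]
    rw [Ideal.sup_mul, Ideal.span_singleton_mul_span_singleton, h𝔪]
    exact sup_le le_sup_left (sup_le le_sup_right (Ideal.mul_le_left.trans le_sup_left))
  obtain ⟨c₂, I₂, hc₂, hI₂, hI₂0, hI₂Ω, hI₂sq, hI₂good⟩ := hR 𝔤 𝔪 _ c₁ h𝔤0 h𝔪0
    (ideal_mul_ne_bot hΩ0 hI₁0) hgen₂
  rw [sup_mul_eq_top_iff] at hI₂Ω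
  rw [← h𝔪] at hc₂
  obtain ⟨v, hv⟩ := Ideal.mem_span_singleton.1 hc₂
  have hc₂' : c₁ + κ * v * a₂ = c₂ := by linear_combination -hv
  have hΩ𝔮 : (u : 𝓞 F) ^ (p ^ R * j₀) - 1 ∈ 𝔮 := by
    rw [← neg_sub, hΩκ]; exact neg_mem (Ideal.mul_mem_left _ _ hκ𝔮)
  obtain ⟨ε, m, hε, hm𝔮, hm⟩ := exists_exponent hp u j₀ hI₁0 hI₂0 hI₁sq hI₂sq h𝔮p hI₁good hI₂good
    hI₂Ω.2 hΩ𝔮 hI₁Ω hI₂Ω.1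
  rw [hΩκ] at hε
  have hmem : y₀ * c * κ * m ∈ Ideal.span {a₂ * c₂} * 𝔯 := by
    rw [← Ideal.span_singleton_mul_span_singleton, hI₁, hI₂]
    have h1 : κ ∈ 𝔔 * 𝔞 := Ideal.mul_mono_right h𝔬𝔞 (hκ𝔔𝔬 ▸ Ideal.mem_span_singleton_self κ)
    have h2 := Ideal.mul_mem_mul (Ideal.mul_mem_mul (Ideal.mul_mem_mul h1 hm) hc𝔤) hy𝔯
    have h3 : 𝔔 * 𝔞 * I₁ * (𝔤 * I₂) * 𝔯 = 𝔔 * 𝔞 * (I₁ * I₂) * 𝔤 * 𝔯 := by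
      simp only [mul_left_comm, mul_comm]
    rw [h3]
    convert h2 using 1
    ring
  obtain ⟨y, hy, hyac⟩ := Ideal.mem_span_singleton_mul.1 hmem
  refine ⟨s, t, κ * v, y, ε, ht𝔮𝔯, hy, ?_, ?_, ?_⟩
  · have hc₂𝔤 : c₂ ∈ 𝔤 := Ideal.mul_le_left (hI₂ ▸ Ideal.mem_span_singleton_self c₂)
    refine sub_mem_of_close (a' := a₂) (c' := c₂) h𝔤0 h𝔤 hκ𝔔𝔬 hκ0 h𝔬𝔮 ha hc₂𝔤 ha₂κ ?_ hm𝔮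
      (by rw [mul_comm y]; exact hyac)
    have : c₂ - c = s * a + κ * (v * a₂) := by
      linear_combination -hc₂' + hc₁
    rw [this]
    exact add_mem (Ideal.mul_mem_left _ _ ha) (Ideal.mul_mem_mul hκ𝔮 (Ideal.mul_mem_left _ _ ha₂𝔤))
  · have : (ε : 𝓞 F) - 1 = -(y₀ * c * κ * m) := by linear_combination -hε
    rw [this]
    exact neg_mem (Ideal.mul_mem_right _ _ (Ideal.mul_mem_left _ _ hκ𝔮𝔯))
  · rw [← hc₁, hε, hta, hc₂', mul_comm y]
    exact hyac.symm

end Master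

section Master
variable {F : Type*} [Field F] [NumberField F] [IsTotallyReal F]

/-- A ternary relation stable under the moves `c ↦ c + s a` and `a ↦ a + t c` with `t ∈ 𝔮𝔯`, which
holds whenever `1 - y a c` is a unit, is solvable in `y` in each residue class modulo `𝔮`. -/
lemma exists_of_moves {p : ℕ} (hp : p.Prime) {u : (𝓞 F)ˣ} (hu : ∀ j, 1 ≤ j → u ^ j ≠ 1)
    {𝔮 𝔯 : Ideal (𝓞 F)} (h𝔮p : (p : 𝓞 F) ∈ 𝔮) (h𝔮 : 𝔮 ≠ ⊥) (h𝔮' : 𝔮 ≠ ⊤) (h𝔯 : 𝔯 ≠ ⊥)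
    (h𝔮𝔯 : 𝔮 ⊔ 𝔯 = ⊤) (Pr : 𝓞 F → 𝓞 F → 𝓞 F → Prop)
    (h₁ : ∀ a c y s, Pr a (c + s * a) y → Pr a c y)
    (h₂ : ∀ a c y t, t ∈ 𝔮 * 𝔯 → Pr (a + t * c) c y → Pr a c y)
    (h₃ : ∀ (a c y : 𝓞 F) (ε : (𝓞 F)ˣ), y ∈ 𝔯 → (ε : 𝓞 F) - 1 ∈ 𝔮 * 𝔯 →
      1 - (ε : 𝓞 F) = y * (a * c) → Pr a c y)
    {a c y₀ : 𝓞 F} (hac : a ≠ 0 ∨ c ≠ 0) (hy𝔯 : y₀ ∈ 𝔯)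
    (ha : a ∈ 𝔮 * (Ideal.span {a} ⊔ Ideal.span {c})) :
    ∃ y ∈ 𝔯, y - y₀ ∈ 𝔮 ∧ Pr a c y := by
  have hmain : ∀ {a c y₀ : 𝓞 F}, a ≠ 0 → c ≠ 0 → y₀ ≠ 0 → y₀ ∈ 𝔯 →
      a ∈ 𝔮 * (Ideal.span {a} ⊔ Ideal.span {c}) → ∃ y ∈ 𝔯, y - y₀ ∈ 𝔮 ∧ Pr a c y := by
    intro a c y₀ ha0 hc0 hy0 hy𝔯 ha
    obtain ⟨s, t, s', y, ε, ht, hy, hyy, hε, h⟩ :=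
      exists_moves_of_ne_zero hp hu h𝔮p h𝔮 h𝔮' h𝔯 h𝔮𝔯 ha0 hc0 hy0 hy𝔯 ha
    exact ⟨y, hy, hyy, h₁ _ _ _ s (h₂ _ _ _ t ht (h₁ _ _ _ s' (h₃ _ _ _ ε hy hε h)))⟩
  obtain ⟨N, hN, hN0⟩ := Submodule.exists_mem_ne_zero_of_ne_bot (ideal_mul_ne_bot h𝔮 h𝔯)
  have hy : ∀ {a c y₀ : 𝓞 F}, a ≠ 0 → c ≠ 0 → y₀ ∈ 𝔯 →
      a ∈ 𝔮 * (Ideal.span {a} ⊔ Ideal.span {c}) → ∃ y ∈ 𝔯, y - y₀ ∈ 𝔮 ∧ Pr a c y := by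
    intro a c y₀ ha0 hc0 hy𝔯 ha
    obtain rfl | hy0 := eq_or_ne y₀ 0
    · obtain ⟨y, hy, hyN, h⟩ := hmain ha0 hc0 hN0 (Ideal.mul_le_right hN) ha
      refine ⟨y, hy, ?_, h⟩
      rw [sub_zero, ← sub_add_cancel y N]
      exact add_mem hyN (Ideal.mul_le_left hN)
    · exact hmain ha0 hc0 hy0 hy𝔯 ha
  have hc : ∀ {a c y₀ : 𝓞 F}, a ≠ 0 → y₀ ∈ 𝔯 →
      a ∈ 𝔮 * (Ideal.span {a} ⊔ Ideal.span {c}) → ∃ y ∈ 𝔯, y - y₀ ∈ 𝔮 ∧ Pr a c y := by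
    intro a c y₀ ha0 hy𝔯 ha
    obtain rfl | hc0 := eq_or_ne c 0
    · rw [sup_comm, ← span_sup_span_add_mul 0 a 1, sup_comm] at ha
      obtain ⟨y, hy', hyy, h⟩ := hy (c := 0 + 1 * a) ha0 (by simpa using ha0) hy𝔯 ha
      exact ⟨y, hy', hyy, h₁ _ _ _ 1 h⟩
    · exact hy ha0 hc0 hy𝔯 ha
  obtain rfl | ha0 := eq_or_ne a 0
  · have hc0 : c ≠ 0 := hac.resolve_left (by simp)
    have : 0 + N * c ≠ 0 := by rw [zero_add]; exact mul_ne_zero hN0 hc0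
    obtain ⟨y, hy, hyy, h⟩ := hc (a := 0 + N * c) (c := c) this hy𝔯 (by
      rw [span_sup_span_add_mul, zero_add]
      exact Ideal.mul_mem_mul (Ideal.mul_le_left hN)
        (Ideal.mem_sup_right (Ideal.mem_span_singleton_self c)))
    exact ⟨y, hy, hyy, h₂ _ _ _ N hN h⟩
  · exact hc ha0 hy𝔯 ha

end Master

section Matrices
variable {R : Type*} [CommRing R]

open Matrix

/-- Upper unipotent matrices. -/
def upper (x : R) : SpecialLinearGroup (Fin 2) R := ⟨!![1, x; 0, 1], by simp⟩

/-- Lower unipotent matrices. -/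
def lower (x : R) : SpecialLinearGroup (Fin 2) R := ⟨!![1, 0; x, 1], by simp⟩

/-- Diagonal matrices of determinant one. -/
def torus (u : Rˣ) : SpecialLinearGroup (Fin 2) R := ⟨!![(u : R), 0; 0, ((u⁻¹ : Rˣ) : R)], by simp⟩

/-- The Weyl element. -/
def weyl : SpecialLinearGroup (Fin 2) R := ⟨!![0, 1; -1, 0], by simp⟩

/-- The transvection `w ↦ w + y ⟨v, w⟩ v` with `v = (a, c)`. -/
def transv (a c y : R) : SpecialLinearGroup (Fin 2) R :=
  ⟨!![1 - y * a * c, y * a ^ 2; -(y * c ^ 2), 1 + y * a * c], by simp; ring⟩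

lemma sl2_ext {g h : SpecialLinearGroup (Fin 2) R} (h00 : g 0 0 = h 0 0) (h01 : g 0 1 = h 0 1)
    (h10 : g 1 0 = h 1 0) (h11 : g 1 1 = h 1 1) : g = h := by
  ext i j
  fin_cases i <;> fin_cases j <;> assumption

lemma mul00 (g h : SpecialLinearGroup (Fin 2) R) : (g * h) 0 0 = g 0 0 * h 0 0 + g 0 1 * h 1 0 := by
  simp [Matrix.mul_apply, Fin.sum_univ_two]
lemma mul01 (g h : SpecialLinearGroup (Fin 2) R) : (g * h) 0 1 = g 0 0 * h 0 1 + g 0 1 * h 1 1 := by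
  simp [Matrix.mul_apply, Fin.sum_univ_two]
lemma mul10 (g h : SpecialLinearGroup (Fin 2) R) : (g * h) 1 0 = g 1 0 * h 0 0 + g 1 1 * h 1 0 := by
  simp [Matrix.mul_apply, Fin.sum_univ_two]
lemma mul11 (g h : SpecialLinearGroup (Fin 2) R) : (g * h) 1 1 = g 1 0 * h 0 1 + g 1 1 * h 1 1 := by
  simp [Matrix.mul_apply, Fin.sum_univ_two]

lemma inv_entries (g : SpecialLinearGroup (Fin 2) R) :
    g⁻¹ 0 0 = g 1 1 ∧ g⁻¹ 0 1 = - g 0 1 ∧ g⁻¹ 1 0 = - g 1 0 ∧ g⁻¹ 1 1 = g 0 0 := by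
  rw [SpecialLinearGroup.SL2_inv_expl]
  simp

lemma det_eq_one (g : SpecialLinearGroup (Fin 2) R) : g 0 0 * g 1 1 - g 0 1 * g 1 0 = 1 := by
  have := g.det_coe
  rwa [Matrix.det_fin_two] at this

@[simp] lemma upper00 (x : R) : upper x 0 0 = 1 := rfl
@[simp] lemma upper01 (x : R) : upper x 0 1 = x := rfl
@[simp] lemma upper10 (x : R) : upper x 1 0 = 0 := rfl
@[simp] lemma upper11 (x : R) : upper x 1 1 = 1 := rfl
@[simp] lemma lower00 (x : R) : lower x 0 0 = 1 := rfl
@[simp] lemma lower01 (x : R) : lower x 0 1 = 0 := rfl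
@[simp] lemma lower10 (x : R) : lower x 1 0 = x := rfl
@[simp] lemma lower11 (x : R) : lower x 1 1 = 1 := rfl
@[simp] lemma torus00 (u : Rˣ) : torus u 0 0 = u := rfl
@[simp] lemma torus01 (u : Rˣ) : torus u 0 1 = 0 := rfl
@[simp] lemma torus10 (u : Rˣ) : torus u 1 0 = 0 := rfl
@[simp] lemma torus11 (u : Rˣ) : torus u 1 1 = ((u⁻¹ : Rˣ) : R) := rfl
@[simp] lemma weyl00 : (weyl : SpecialLinearGroup (Fin 2) R) 0 0 = 0 := rfl
@[simp] lemma weyl01 : (weyl : SpecialLinearGroup (Fin 2) R) 0 1 = 1 := rfl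
@[simp] lemma weyl10 : (weyl : SpecialLinearGroup (Fin 2) R) 1 0 = -1 := rfl
@[simp] lemma weyl11 : (weyl : SpecialLinearGroup (Fin 2) R) 1 1 = 0 := rfl
@[simp] lemma transv00 (a c y : R) : transv a c y 0 0 = 1 - y * a * c := rfl
@[simp] lemma transv01 (a c y : R) : transv a c y 0 1 = y * a ^ 2 := rfl
@[simp] lemma transv10 (a c y : R) : transv a c y 1 0 = -(y * c ^ 2) := rfl
@[simp] lemma transv11 (a c y : R) : transv a c y 1 1 = 1 + y * a * c := rfl

lemma upper_mul (x y : R) : upper x * upper y = upper (x + y) := by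
  apply sl2_ext <;> simp only [mul00, mul01, mul10, mul11, upper00, upper01, upper10, upper11] <;> ring

lemma lower_mul (x y : R) : lower x * lower y = lower (x + y) := by
  apply sl2_ext <;> simp only [mul00, mul01, mul10, mul11, lower00, lower01, lower10, lower11] <;> ring

lemma transv_mul (a c x y : R) : transv a c x * transv a c y = transv a c (x + y) := by
  apply sl2_ext <;> simp only [mul00, mul01, mul10, mul11, transv00, transv01, transv10, transv11] <;> ring

lemma mul_transv (g : SpecialLinearGroup (Fin 2) R) (a c y : R) :
    g * transv a c y * g⁻¹ = transv (g 0 0 * a + g 0 1 * c) (g 1 0 * a + g 1 1 * c) y := by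
  obtain ⟨h1, h2, h3, h4⟩ := inv_entries g
  have hd := det_eq_one g
  apply sl2_ext <;> simp only [mul00, mul01, mul10, mul11, h1, h2, h3, h4, transv00, transv01, transv10, transv11]
  · linear_combination hd
  · ring
  · ring
  · linear_combination hd

end Matrices

section Elementary
variable {R : Type*} [CommRing R]

open Matrix

variable (R) in
/-- The subgroup generated by unipotent upper triangular matrices, diagonal matrices and the Weyl
element. -/
def elem : Subgroup (SpecialLinearGroup (Fin 2) R) :=
  Subgroup.closure (Set.range upper ∪ Set.range torus ∪ {weyl})

lemma upper_mem (x : R) : upper x ∈ elem R :=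
  Subgroup.subset_closure (Or.inl (Or.inl ⟨x, rfl⟩))

lemma torus_mem (u : Rˣ) : torus u ∈ elem R :=
  Subgroup.subset_closure (Or.inl (Or.inr ⟨u, rfl⟩))

lemma weyl_mem : (weyl : SpecialLinearGroup (Fin 2) R) ∈ elem R :=
  Subgroup.subset_closure (Or.inr rfl)

lemma transv_one_zero (x : R) : transv 1 0 x = upper x := by
  apply sl2_ext <;> simp

lemma transv_zero_one (x : R) : transv 0 1 x = lower (-x) := by
  apply sl2_ext <;> simp

lemma transv_zero_zero (x : R) : transv 0 0 x = 1 := by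
  apply sl2_ext <;> simp

lemma upper_zero : upper (0 : R) = 1 := by apply sl2_ext <;> simp
lemma lower_zero : lower (0 : R) = 1 := by apply sl2_ext <;> simp
lemma transv_zero (a c : R) : transv a c 0 = 1 := by apply sl2_ext <;> simp

lemma upper_inv (x : R) : (upper x)⁻¹ = upper (-x) := by
  rw [inv_eq_iff_mul_eq_one, upper_mul, add_neg_cancel, upper_zero]
lemma lower_inv (x : R) : (lower x)⁻¹ = lower (-x) := by
  rw [inv_eq_iff_mul_eq_one, lower_mul, add_neg_cancel, lower_zero]
lemma transv_inv (a c x : R) : (transv a c x)⁻¹ = transv a c (-x) := by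
  rw [inv_eq_iff_mul_eq_one, transv_mul, add_neg_cancel, transv_zero]

lemma weyl_eq : (weyl : SpecialLinearGroup (Fin 2) R) = upper 1 * lower (-1) * upper 1 := by
  apply sl2_ext <;> simp [mul00, mul01, mul10, mul11]

lemma conj_upper (g : SpecialLinearGroup (Fin 2) R) (x : R) :
    g * upper x * g⁻¹ = transv (g 0 0) (g 1 0) x := by
  rw [← transv_one_zero, mul_transv]; simp

lemma conj_lower (g : SpecialLinearGroup (Fin 2) R) (x : R) :
    g * lower x * g⁻¹ = transv (g 0 1) (g 1 1) (-x) := by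
  rw [← neg_neg x, ← transv_zero_one, mul_transv]; simp

lemma lower_mem (x : R) : lower x ∈ elem R := by
  have : lower x = weyl * upper (-x) * weyl⁻¹ := by
    rw [conj_upper]; apply sl2_ext <;> simp
  rw [this]
  exact mul_mem (mul_mem weyl_mem (upper_mem _)) (inv_mem weyl_mem)

lemma torus_eq (u : Rˣ) : torus u = upper (u : R) * lower (-((u⁻¹ : Rˣ) : R)) * upper (u : R) *
    (upper (-1) * lower 1 * upper (-1)) := by
  apply sl2_ext <;> simp [mul00, mul01, mul10, mul11]

/-- The elementary group is generated by unipotent matrices. -/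
lemma elem_le {H : Subgroup (SpecialLinearGroup (Fin 2) R)} (hU : ∀ x, upper x ∈ H)
    (hL : ∀ x, lower x ∈ H) : elem R ≤ H := by
  refine (Subgroup.closure_le _).2 ?_
  rintro g ((⟨x, rfl⟩ | ⟨u, rfl⟩) | rfl)
  · exact hU x
  · rw [torus_eq]
    exact mul_mem (mul_mem (mul_mem (hU _) (hL _)) (hU _)) (mul_mem (mul_mem (hU _) (hL _)) (hU _))
  · rw [weyl_eq]; exact mul_mem (mul_mem (hU _) (hL _)) (hU _)

lemma transv_eq (a c y : R) (ε : Rˣ) (h : 1 - (ε : R) = y * (a * c)) :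
    transv a c y = lower (-(y * c ^ 2 * (ε⁻¹ : Rˣ))) * torus ε * upper (y * a ^ 2 * (ε⁻¹ : Rˣ)) := by
  have he : ((ε⁻¹ : Rˣ) : R) * ε = 1 := by simp
  apply sl2_ext <;> simp only [mul00, mul01, mul10, mul11, upper00, upper01, upper10, upper11,
    lower00, lower01, lower10, lower11, torus00, torus01, torus10, torus11, transv00, transv01,
    transv10, transv11]
  · linear_combination h
  · linear_combination (-(y * a ^ 2)) * he
  · linear_combination (y * c ^ 2) * he
  · linear_combination (y ^ 2 * a ^ 2 * c ^ 2 * ((ε⁻¹ : Rˣ) : R) - (1 + y * a * c)) * he -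
      (1 + y * a * c) * ((ε⁻¹ : Rˣ) : R) * h

end Elementary

section Normality

open Matrix

lemma addSubgroup_eq_top_of_forall_prime {M : Type*} [AddCommGroup M] [Module.Finite ℤ M]
    (H : AddSubgroup M) (h : ∀ p : ℕ, p.Prime → ∀ x : M, ∃ y ∈ H, ∃ z, y - x = p • z) : H = ⊤ := by
  have hdiv : ∀ n : ℕ, n ≠ 0 → ∀ x : M, ∃ y ∈ H, ∃ z, y - x = n • z := by
    intro n hn
    induction n using Nat.recOnMul with
    | zero => exact absurd rfl hn
    | one => exact fun x => ⟨0, zero_mem _, -x, by simp⟩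
    | prime p hp => exact h p hp
    | mul m n hm hn' =>
      intro x
      obtain ⟨y, hy, z, hz⟩ := hm (left_ne_zero_of_mul hn) x
      obtain ⟨y', hy', z', hz'⟩ := hn' (right_ne_zero_of_mul hn) (-z)
      refine ⟨y + m • y', add_mem hy (nsmul_mem hy' m), z', ?_⟩
      rw [mul_smul, ← hz', sub_neg_eq_add, nsmul_add, ← hz]
      abel
  let N : Submodule ℤ M := AddSubgroup.toIntSubmodule H
  have htop : (⊤ : Submodule ℤ (M ⧸ N)) ≤ (Ideal.span {(2 : ℤ)} : Ideal ℤ) • (⊤ : Submodule ℤ (M ⧸ N)) := by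
    rintro x -
    obtain ⟨x, rfl⟩ := N.mkQ_surjective x
    obtain ⟨y, hy, z, hz⟩ := hdiv 2 two_ne_zero x
    have : N.mkQ x = (2 : ℤ) • N.mkQ (-z) := by
      rw [← map_smul, ← sub_eq_zero, ← map_sub, Submodule.mkQ_apply, Submodule.Quotient.mk_eq_zero]
      have : x - (2 : ℤ) • (-z) = y := by
        rw [smul_neg, sub_neg_eq_add, ← sub_eq_iff_eq_add'.1 hz |>.symm]
        module
      rw [this]; exact hy
    rw [this]
    exact Submodule.smul_mem_smul (Ideal.mem_span_singleton_self _) trivial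
  obtain ⟨r, hr1, hr⟩ := Submodule.exists_sub_one_mem_and_smul_eq_zero_of_fg_of_le_smul
    (Ideal.span {(2 : ℤ)}) (⊤ : Submodule ℤ (M ⧸ N)) Module.Finite.fg_top htop
  have hr0 : r ≠ 0 := by
    rintro rfl
    rw [Ideal.mem_span_singleton] at hr1
    norm_num at hr1
  rw [eq_top_iff]
  rintro x -
  obtain ⟨y, hy, z, hz⟩ := hdiv r.natAbs (Int.natAbs_ne_zero.2 hr0) x
  have h1 : r • N.mkQ z = 0 := hr _ trivial
  have h2 : N.mkQ (r • z) = 0 := by rw [map_smul, h1]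
  rw [Submodule.mkQ_apply, Submodule.Quotient.mk_eq_zero] at h2
  have h3 : r • z ∈ H := h2
  have h4 : r.natAbs • z ∈ H := by
    rw [← natCast_zsmul, Int.natCast_natAbs]
    rcases abs_choice r with h | h <;> rw [h]
    · exact h3
    · rw [neg_smul]; exact neg_mem h3
  have : x = y - r.natAbs • z := by rw [← hz]; abel
  rw [this]
  exact sub_mem hy h4

variable {F : Type*} [Field F] [NumberField F]

lemma mul_transv_mem_iff {R : Type*} [CommRing R] {g : SpecialLinearGroup (Fin 2) R} (hg : g ∈ elem R) (a c y : R) :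
    transv (g 0 0 * a + g 0 1 * c) (g 1 0 * a + g 1 1 * c) y ∈ elem R ↔ transv a c y ∈ elem R := by
  rw [← mul_transv, Subgroup.mul_mem_cancel_right _ (inv_mem hg), Subgroup.mul_mem_cancel_left _ hg]

lemma transv_add_mul_left {R : Type*} [CommRing R] (a c y t : R) :
    transv (a + t * c) c y ∈ elem R ↔ transv a c y ∈ elem R := by
  have := mul_transv_mem_iff (upper_mem t) a c y
  simpa using this

lemma transv_add_mul_right {R : Type*} [CommRing R] (a c y t : R) :
    transv a (c + t * a) y ∈ elem R ↔ transv a c y ∈ elem R := by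
  have := mul_transv_mem_iff (lower_mem t) a c y
  simpa [add_comm] using this

variable [IsTotallyReal F]

lemma transv_mem {u : (𝓞 F)ˣ} (hu : ∀ j, 1 ≤ j → u ^ j ≠ 1) (a c y : 𝓞 F) :
    transv a c y ∈ elem (𝓞 F) := by
  let Y : AddSubgroup (𝓞 F) :=
    { carrier := {y | transv a c y ∈ elem (𝓞 F)}
      add_mem' := fun {x y} hx hy => by
        change transv a c (x + y) ∈ elem (𝓞 F)
        rw [← transv_mul]; exact mul_mem hx hy
      zero_mem' := by
        change transv a c 0 ∈ elem (𝓞 F)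
        rw [transv_zero]; exact one_mem _
      neg_mem' := fun {x} hx => by
        change transv a c (-x) ∈ elem (𝓞 F)
        rw [← transv_inv]; exact inv_mem hx }
  suffices h : Y = ⊤ by
    have : y ∈ Y := h.symm ▸ AddSubgroup.mem_top y
    exact this
  by_cases hac : a = 0 ∧ c = 0
  · refine (AddSubgroup.eq_top_iff' _).2 fun x => ?_
    change transv a c x ∈ elem (𝓞 F)
    rw [hac.1, hac.2, transv_zero_zero]; exact one_mem _
  have hac' : a ≠ 0 ∨ c ≠ 0 := by tauto
  refine addSubgroup_eq_top_of_forall_prime Y fun p hp y₀ => ?_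
  have hp0 : (p : 𝓞 F) ≠ 0 := by exact_mod_cast hp.ne_zero
  have h𝔤0 : Ideal.span {a} ⊔ Ideal.span {c} ≠ (⊥ : Ideal (𝓞 F)) := by
    rw [Ne, sup_eq_bot_iff, Ideal.span_singleton_eq_bot, Ideal.span_singleton_eq_bot]
    exact hac
  obtain ⟨s, hs⟩ := exists_add_mul_sup (rfl : Ideal.span {a} ⊔ Ideal.span {c} = _) h𝔤0
    (K := Ideal.span {(p : 𝓞 F)}) (by simpa using hp0)
  have ha : a ∈ Ideal.span {c + s * a} ⊔ (Ideal.span {a} ⊔ Ideal.span {c}) * Ideal.span {(p : 𝓞 F)} := by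
    rw [hs]; exact Ideal.mem_sup_left (Ideal.mem_span_singleton_self a)
  obtain ⟨x, hx, a', ha', hxa⟩ := Submodule.mem_sup.1 ha
  obtain ⟨t, rfl⟩ := Ideal.mem_span_singleton'.1 hx
  have haa : a + -t * (c + s * a) = a' := by linear_combination -hxa
  have hsp : Ideal.span {a'} ⊔ Ideal.span {c + s * a} = Ideal.span {a} ⊔ Ideal.span {c} := by
    rw [← haa, span_sup_span_add_mul, sup_comm, span_sup_span_add_mul, sup_comm]
  have hpt : Ideal.span {(p : 𝓞 F)} ≠ ⊤ := by
    rw [Ne, Ideal.span_singleton_eq_top]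
    intro h
    have h1 := h.map (Algebra.norm ℤ)
    rw [← map_natCast (algebraMap ℤ (𝓞 F)), Algebra.norm_algebraMap] at h1
    exact hp.not_isUnit (by exact_mod_cast (isUnit_pow_iff Module.finrank_pos.ne').1 h1)
  obtain ⟨y, -, hy, h⟩ := exists_of_moves hp hu (𝔮 := Ideal.span {(p : 𝓞 F)}) (𝔯 := ⊤)
    (Ideal.mem_span_singleton_self _) (by simpa using hp0) hpt top_ne_bot (by simp)
    (fun a c y => transv a c y ∈ elem (𝓞 F)) (fun a c y s => (transv_add_mul_right a c y s).1)
    (fun a c y t _ => (transv_add_mul_left a c y t).1)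
    (fun a c y ε _ _ h => by
      rw [transv_eq _ _ _ _ h]
      exact mul_mem (mul_mem (lower_mem _) (torus_mem _)) (upper_mem _))
    (a := a') (c := c + s * a) (y₀ := y₀) (by
      by_contra hcon
      push Not at hcon
      rw [hcon.1, hcon.2] at hsp
      exact h𝔤0 (by rw [← hsp]; simp)) trivial (by rw [hsp, mul_comm]; exact ha')
  obtain ⟨z, hz⟩ := Ideal.mem_span_singleton.1 hy
  refine ⟨y, ?_, z, by rw [hz, nsmul_eq_mul]⟩
  change transv a c y ∈ elem (𝓞 F)
  rwa [← transv_add_mul_right a c y s, ← transv_add_mul_left _ _ y (-t), haa]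

lemma elem_normal {u : (𝓞 F)ˣ} (hu : ∀ j, 1 ≤ j → u ^ j ≠ 1) : (elem (𝓞 F)).Normal := by
  refine ⟨fun n hn g => ?_⟩
  have : elem (𝓞 F) ≤ (elem (𝓞 F)).comap (MulAut.conj g).toMonoidHom := by
    refine elem_le (fun x => ?_) fun x => ?_
    · change g * upper x * g⁻¹ ∈ elem (𝓞 F)
      rw [conj_upper]; exact transv_mem hu _ _ _
    · change g * lower x * g⁻¹ ∈ elem (𝓞 F)
      rw [conj_lower]; exact transv_mem hu _ _ _
  exact this hn

end Normality

section Steinberg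

/-- A pair of opposite root subgroups satisfying the Steinberg relations. -/
structure SteinbergPair (k Q : Type*) [Field k] [Group Q] where
  /-- the upper root subgroup -/
  u : k → Q
  /-- the lower root subgroup -/
  l : k → Q
  u_add : ∀ x y, u (x + y) = u x * u y
  l_add : ∀ x y, l (x + y) = l x * l y
  conj_u' : ∀ x y, x ≠ 0 → (u x * l (-x⁻¹) * u x) * u y * (u x * l (-x⁻¹) * u x)⁻¹ = l (-y / x ^ 2)

namespace SteinbergPair

variable {k Q : Type*} [Field k] [Group Q] (P : SteinbergPair k Q)

/-- Lifts of Weyl elements. -/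
def w (x : k) : Q := P.u x * P.l (-x⁻¹) * P.u x

/-- Lifts of diagonal elements. -/
def h (x : k) : Q := P.w x * (P.w 1)⁻¹

lemma u_zero : P.u 0 = 1 := by
  have := P.u_add 0 0
  simpa using this

lemma l_zero : P.l 0 = 1 := by
  have := P.l_add 0 0
  simpa using this

lemma u_neg (x : k) : P.u (-x) = (P.u x)⁻¹ := by
  rw [eq_inv_iff_mul_eq_one, ← P.u_add, neg_add_cancel, P.u_zero]

lemma l_neg (x : k) : P.l (-x) = (P.l x)⁻¹ := by
  rw [eq_inv_iff_mul_eq_one, ← P.l_add, neg_add_cancel, P.l_zero]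

lemma w_neg (x : k) : P.w (-x) = (P.w x)⁻¹ := by
  simp only [w, inv_neg, neg_neg, u_neg, l_neg]
  group

lemma conj_u {x : k} (hx : x ≠ 0) (y : k) : P.w x * P.u y * (P.w x)⁻¹ = P.l (-y / x ^ 2) :=
  P.conj_u' x y hx

lemma conj_l {x : k} (hx : x ≠ 0) (z : k) : P.w x * P.l z * (P.w x)⁻¹ = P.u (-(x ^ 2 * z)) := by
  have := P.conj_u (neg_ne_zero.2 hx) (-(x ^ 2 * z))
  rw [P.w_neg, neg_neg, neg_sq, mul_div_cancel_left₀ _ (pow_ne_zero 2 hx)] at this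
  rw [← this]; group

lemma w_eq {x : k} (hx : x ≠ 0) : P.w x = P.l (-x⁻¹) * P.u x * P.l (-x⁻¹) := by
  have h1 := P.conj_u hx x
  have h2 := P.conj_l hx (-x⁻¹)
  have e1 : -x / x ^ 2 = -x⁻¹ := by field_simp
  have e2 : -(x ^ 2 * -x⁻¹) = x := by field_simp
  rw [e1] at h1
  rw [e2] at h2
  calc P.w x = (P.w x * P.u x * (P.w x)⁻¹) * (P.w x * P.l (-x⁻¹) * (P.w x)⁻¹) *
      (P.w x * P.u x * (P.w x)⁻¹) := by
        conv_lhs => rw [← mul_inv_cancel_right (P.w x) (P.w x)]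
        nth_rewrite 2 [w]
        group
    _ = _ := by rw [h1, h2]

lemma conj_w {x y : k} (hx : x ≠ 0) (hy : y ≠ 0) : P.w x * P.w y * (P.w x)⁻¹ = P.w (x ^ 2 / y) := by
  have hxy : x ^ 2 / y ≠ 0 := div_ne_zero (pow_ne_zero 2 hx) hy
  have h1 := P.conj_u hx y
  have h2 := P.conj_l hx (-y⁻¹)
  have e1 : -y / x ^ 2 = -(x ^ 2 / y)⁻¹ := by field_simp
  have e2 : -(x ^ 2 * -y⁻¹) = x ^ 2 / y := by field_simp
  rw [e1] at h1
  rw [e2] at h2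
  have e3 : P.w y = P.u y * P.l (-y⁻¹) * P.u y := rfl
  rw [P.w_eq hxy, ← h1, ← h2, e3]
  group

lemma h_one : P.h 1 = 1 := by simp [h]

lemma w_eq_h (x : k) : P.w x = P.h x * P.w 1 := by simp [h]

lemma h_conj_u {x : k} (hx : x ≠ 0) (y : k) : P.h x * P.u y * (P.h x)⁻¹ = P.u (x ^ 2 * y) := by
  have h1 := P.conj_u (neg_ne_zero.2 one_ne_zero) y
  rw [P.w_neg] at h1
  have h2 := P.conj_l hx (-y)
  have e1 : -y / (-1) ^ 2 = -y := by ring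
  rw [e1] at h1
  rw [mul_neg, neg_neg] at h2
  rw [← h2, ← h1, h]
  group

lemma h_conj_l {x : k} (hx : x ≠ 0) (z : k) : P.h x * P.l z * (P.h x)⁻¹ = P.l (z / x ^ 2) := by
  have h1 := P.conj_l (neg_ne_zero.2 one_ne_zero) z
  rw [P.w_neg] at h1
  have h2 := P.conj_u hx (-z)
  have e1 : -((-1) ^ 2 * z) = -z := by ring
  rw [e1] at h1
  rw [neg_neg] at h2
  rw [← h2, ← h1, h]
  group

lemma h_conj_w {x y : k} (hx : x ≠ 0) (hy : y ≠ 0) : P.h x * P.w y * (P.h x)⁻¹ = P.w (x ^ 2 * y) := by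
  have h1 := P.conj_w (neg_ne_zero.2 one_ne_zero) hy
  have h2 := P.conj_w hx (inv_ne_zero hy)
  rw [P.w_neg, neg_sq, one_pow, one_div] at h1
  rw [div_inv_eq_mul] at h2
  rw [← h2, ← h1, h]
  group

lemma h_conj_h {x y : k} (hx : x ≠ 0) (hy : y ≠ 0) :
    P.h x * P.h y * (P.h x)⁻¹ = P.h (x ^ 2 * y) * (P.h (x ^ 2))⁻¹ := by
  have h1 := P.h_conj_w hx hy
  have h2 := P.h_conj_w hx one_ne_zero
  rw [mul_one] at h2
  have e1 : P.h (x ^ 2 * y) = P.w (x ^ 2 * y) * (P.w 1)⁻¹ := rfl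
  have e2 : P.h (x ^ 2) = P.w (x ^ 2) * (P.w 1)⁻¹ := rfl
  have e3 : P.h y = P.w y * (P.w 1)⁻¹ := rfl
  rw [e1, e2, e3, ← h1, ← h2]
  group

lemma commute_w {c : Q} (hu : ∀ x, Commute c (P.u x)) (hl : ∀ x, Commute c (P.l x)) (x : k) :
    Commute c (P.w x) := ((hu _).mul_right (hl _)).mul_right (hu _)

lemma commute_h {c : Q} (hu : ∀ x, Commute c (P.u x)) (hl : ∀ x, Commute c (P.l x)) (x : k) :
    Commute c (P.h x) := (P.commute_w hu hl x).mul_right (P.commute_w hu hl 1).inv_right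

lemma symbol_commute_u {x y : k} (hx : x ≠ 0) (hy : y ≠ 0) (z : k) :
    Commute (P.h x * P.h y * (P.h (x * y))⁻¹) (P.u z) := by
  have h1 := P.h_conj_u (mul_ne_zero hx hy) (z / (x * y) ^ 2)
  have h2 := P.h_conj_u hy (z / (x * y) ^ 2)
  have h3 := P.h_conj_u hx (y ^ 2 * (z / (x * y) ^ 2))
  have e1 : (x * y) ^ 2 * (z / (x * y) ^ 2) = z := by field_simp
  have e2 : x ^ 2 * (y ^ 2 * (z / (x * y) ^ 2)) = z := by field_simp
  rw [e1] at h1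
  rw [e2, ← h2] at h3
  rw [Commute, SemiconjBy, ← mul_inv_eq_iff_eq_mul]
  conv_rhs => rw [← h3]
  rw [← h1]
  group

lemma symbol_commute_l {x y : k} (hx : x ≠ 0) (hy : y ≠ 0) (z : k) :
    Commute (P.h x * P.h y * (P.h (x * y))⁻¹) (P.l z) := by
  have h1 := P.h_conj_l (mul_ne_zero hx hy) (z * (x * y) ^ 2)
  have h2 := P.h_conj_l hy (z * (x * y) ^ 2)
  have h3 := P.h_conj_l hx (z * (x * y) ^ 2 / y ^ 2)
  have e1 : z * (x * y) ^ 2 / (x * y) ^ 2 = z := by field_simp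
  have e2 : z * (x * y) ^ 2 / y ^ 2 / x ^ 2 = z := by field_simp
  rw [e1] at h1
  rw [e2, ← h2] at h3
  rw [Commute, SemiconjBy, ← mul_inv_eq_iff_eq_mul]
  conv_rhs => rw [← h3]
  rw [← h1]
  group

lemma commute_h_mul {c x y : k} (hx : x ≠ 0) (hy : y ≠ 0) (h1 : Commute (P.h c) (P.h x))
    (h2 : Commute (P.h c) (P.h y)) : Commute (P.h c) (P.h (x * y)) := by
  have h3 := P.commute_h (P.symbol_commute_u hx hy) (P.symbol_commute_l hx hy) c
  have : P.h (x * y) = (P.h x * P.h y * (P.h (x * y))⁻¹)⁻¹ * (P.h x * P.h y) := by group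
  rw [this]
  exact h3.symm.inv_right.mul_right (h1.mul_right h2)

lemma commute_h_h [Finite k] {x y : k} (hx : x ≠ 0) (hy : y ≠ 0) : Commute (P.h x) (P.h y) := by
  obtain ⟨g, hg⟩ := IsCyclic.exists_monoid_generator (α := kˣ)
  have key : ∀ (c : k), Commute (P.h c) (P.h g) → ∀ z : k, z ≠ 0 → Commute (P.h c) (P.h z) := by
    intro c hc z hz
    obtain ⟨n, hn⟩ := Submonoid.mem_powers_iff _ _ |>.1 (hg (Units.mk0 z hz))
    have : z = (g : k) ^ n := by
      have := congrArg Units.val hn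
      simpa using this.symm
    rw [this]
    clear this hn
    induction n with
    | zero => rw [pow_zero, P.h_one]; exact Commute.one_right _
    | succ n ih => rw [pow_succ]; exact P.commute_h_mul (pow_ne_zero _ g.ne_zero) g.ne_zero ih hc
  exact key x ((key g (Commute.refl _) x hx).symm) y hy

variable [Finite k]

lemma h_sq_mul {x y : k} (hx : x ≠ 0) (hy : y ≠ 0) : P.h (x ^ 2 * y) = P.h (x ^ 2) * P.h y := by
  have h1 := P.h_conj_h hx hy
  rw [(P.commute_h_h hx hy).eq, mul_inv_cancel_right, eq_mul_inv_iff_mul_eq] at h1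
  rw [← h1]
  exact (P.commute_h_h hy (pow_ne_zero 2 hx)).eq

lemma h_steinberg {x y : k} (hx : x ≠ 0) (hy : y ≠ 0) (hxy : x + y = 1) :
    P.h x⁻¹ * P.h y = P.h (x⁻¹ * y) := by
  have hyx : y / x ≠ 0 := div_ne_zero hy hx
  have hu : ∀ b : k, b ≠ 0 → P.u b = P.l b⁻¹ * P.w b * P.l b⁻¹ := fun b hb => by
    rw [P.w_eq hb, P.l_neg]; group
  have h0 := P.u_add x y
  rw [hxy, hu x hx, hu y hy, hu 1 one_ne_zero, inv_one] at h0
  have e0 : x⁻¹ + y⁻¹ = (x * y)⁻¹ := by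
    field_simp; linear_combination hxy
  have h1 : P.w x * P.l (x * y)⁻¹ * P.w y = P.l (-(y / x)) * P.w 1 * P.l (-(x / y)) := by
    have e1 : P.l (-(y / x)) = P.l (-x⁻¹) * P.l 1 := by
      rw [← P.l_add]; congr 1; field_simp; linear_combination -hxy
    have e2 : P.l (-(x / y)) = P.l 1 * P.l (-y⁻¹) := by
      rw [← P.l_add]; congr 1; field_simp; linear_combination -hxy
    rw [e1, e2, ← e0, P.l_add, P.l_neg, P.l_neg]
    calc _ = (P.l x⁻¹)⁻¹ * (P.l x⁻¹ * P.w x * P.l x⁻¹ * (P.l y⁻¹ * P.w y * P.l y⁻¹)) * (P.l y⁻¹)⁻¹ := by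
          group
      _ = _ := by rw [← h0]; group
  have h2 : P.w x * P.l (x * y)⁻¹ * P.w y = P.w x * P.w y * P.u (-(y / x)) := by
    have := P.conj_l (neg_ne_zero.2 hy) (x * y)⁻¹
    rw [P.w_neg, inv_inv] at this
    have e : -((-y) ^ 2 * (x * y)⁻¹) = -(y / x) := by field_simp
    rw [e] at this
    rw [← this]; group
  have h3 : P.l (-(y / x)) * P.w 1 = P.w 1 * P.u (y / x) := by
    have := P.conj_u one_ne_zero (y / x)
    have e : -(y / x) / 1 ^ 2 = -(y / x) := by ring
    rw [e] at this
    rw [← this]; group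
  have h4 : P.u (y / x) * P.l (-(x / y)) = P.w (y / x) * P.u (-(y / x)) := by
    rw [w, P.u_neg, inv_div]; group
  have h5 : P.w x * P.w y = P.w 1 * P.w (y / x) := by
    rw [h2, h3, mul_assoc (P.w 1), h4, ← mul_assoc] at h1
    exact mul_right_cancel h1
  have h6 := P.conj_w (neg_ne_zero.2 one_ne_zero) hx
  rw [P.w_neg, neg_sq, one_pow, one_div, inv_inv] at h6
  have e : x⁻¹ * y = y / x := by field_simp
  rw [e, h, h, h, ← h6]
  calc _ = (P.w 1)⁻¹ * (P.w x * P.w y) * (P.w 1)⁻¹ := by group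
    _ = _ := by rw [h5]; group

end SteinbergPair
end Steinberg

section Steinberg

lemma exists_nonsquare_add {k : Type*} [Field k] [Finite k] (h : ∃ x : k, ¬ IsSquare x) :
    ∃ x y : k, x + y = 1 ∧ ¬ IsSquare x ∧ ¬ IsSquare y := by
  by_contra! hcon
  obtain ⟨n, hn⟩ := h
  have hn0 : n ≠ 0 := by rintro rfl; exact hn (by simp)
  have hmem : ∀ x : {x : k // ¬ IsSquare x}, ¬ IsSquare (n * (1 - x.1)) := by
    rintro ⟨x, hx⟩ hsq
    have h1 : IsSquare (1 - x) := hcon x (1 - x) (by ring) hx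
    have h2 : 1 - x ≠ 0 := fun h0 => hx (by rw [← sub_eq_zero.1 h0]; exact IsSquare.one)
    apply hn
    have := hsq.div h1
    rwa [mul_div_cancel_right₀ _ h2] at this
  let f : {x : k // ¬ IsSquare x} → {x : k // ¬ IsSquare x} := fun x => ⟨n * (1 - x.1), hmem x⟩
  have hf : Function.Injective f := by
    intro x y hxy
    have h1 : n * (1 - x.1) = n * (1 - y.1) := congrArg Subtype.val hxy
    exact Subtype.ext (sub_right_injective (mul_left_cancel₀ hn0 h1))
  obtain ⟨⟨x, hx⟩, hxn⟩ := Finite.surjective_of_injective hf ⟨n, hn⟩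
  have h1 : n * (1 - x) = n * 1 := by rw [mul_one]; exact congrArg Subtype.val hxn
  have h2 : x = 0 := by linear_combination -(mul_left_cancel₀ hn0 h1)
  exact hx (h2 ▸ IsSquare.zero)

namespace SteinbergPair

variable {k Q : Type*} [Field k] [Finite k] [Group Q] (P : SteinbergPair k Q)

lemma isSquare_mul_of_not {x y : k} (hx : ¬ IsSquare x) (hy : ¬ IsSquare y) : ∃ s, s ≠ 0 ∧ x = s ^ 2 * y := by
  classical
  have := Fintype.ofFinite k
  have hx0 : x ≠ 0 := by rintro rfl; exact hx IsSquare.zero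
  have hy0 : y ≠ 0 := by rintro rfl; exact hy IsSquare.zero
  have h1 : quadraticChar k (x * y) = 1 := by
    rw [map_mul, quadraticChar_neg_one_iff_not_isSquare.2 hx, quadraticChar_neg_one_iff_not_isSquare.2 hy]
    norm_num
  obtain ⟨t, ht⟩ := (quadraticChar_one_iff_isSquare (mul_ne_zero hx0 hy0)).1 h1
  have ht0 : t ≠ 0 := by rintro rfl; exact mul_ne_zero hx0 hy0 (by simpa using ht)
  refine ⟨t / y, div_ne_zero ht0 hy0, ?_⟩
  field_simp
  rw [ht, pow_two]

lemma h_mul {x y : k} (hx : x ≠ 0) (hy : y ≠ 0) : P.h (x * y) = P.h x * P.h y := by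
  by_cases hxs : IsSquare x
  · obtain ⟨s, rfl⟩ := hxs
    rw [← pow_two]
    exact P.h_sq_mul (by rintro rfl; simp at hx) hy
  by_cases hys : IsSquare y
  · obtain ⟨s, rfl⟩ := hys
    rw [← pow_two, mul_comm x, P.h_sq_mul (by rintro rfl; simp at hy) hx]
    exact (P.commute_h_h (pow_ne_zero 2 (by rintro rfl; simp at hy)) hx).eq
  obtain ⟨a, b, hab, ha, hb⟩ := exists_nonsquare_add ⟨x, hxs⟩
  have ha0 : a ≠ 0 := by rintro rfl; exact ha (by simp)
  have hb0 : b ≠ 0 := by rintro rfl; exact hb (by simp)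
  have ha' : ¬ IsSquare a⁻¹ := by rwa [isSquare_inv]
  have ha0' := inv_ne_zero ha0
  have hst := P.h_steinberg ha0 hb0 hab
  obtain ⟨s, hs, rfl⟩ := isSquare_mul_of_not hxs ha'
  obtain ⟨t, ht, rfl⟩ := isSquare_mul_of_not hys hb
  have hs2 := pow_ne_zero 2 hs
  have ht2 := pow_ne_zero 2 ht
  have e : s ^ 2 * a⁻¹ * (t ^ 2 * b) = s ^ 2 * (t ^ 2 * (a⁻¹ * b)) := by ring
  rw [e, P.h_sq_mul hs (mul_ne_zero ht2 (mul_ne_zero ha0' hb0)), P.h_sq_mul ht (mul_ne_zero ha0' hb0),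
    P.h_sq_mul hs ha0', P.h_sq_mul ht hb0, ← hst, mul_assoc (P.h (s ^ 2)), ← mul_assoc (P.h a⁻¹),
    (P.commute_h_h ha0' ht2).eq]
  group

/-- The subgroup generated by the root subgroups. -/
def gen : Subgroup Q := Subgroup.closure (Set.range P.u ∪ Set.range P.l)

/-- Bruhat normal form. -/
def IsNormal (z : Q) : Prop :=
  (∃ a x, x ≠ 0 ∧ z = P.u a * P.h x) ∨ ∃ a x b, x ≠ 0 ∧ z = P.u a * P.h x * P.w 1 * P.u b

lemma h_mul_u {x : k} (hx : x ≠ 0) (y : k) : P.h x * P.u y = P.u (x ^ 2 * y) * P.h x := by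
  rw [← P.h_conj_u hx]; group

lemma u_mul_h {x : k} (hx : x ≠ 0) (y : k) : P.u y * P.h x = P.h x * P.u (y / x ^ 2) := by
  rw [P.h_mul_u hx, mul_div_cancel₀]
  exact pow_ne_zero 2 hx

lemma w_mul_h {x : k} (hx : x ≠ 0) : P.w 1 * P.h x = P.h x⁻¹ * P.w 1 := by
  have h1 := P.conj_w one_ne_zero hx
  rw [one_pow, one_div] at h1
  rw [h, h, ← h1]; group

lemma w_mul_w : P.w 1 * P.w 1 = P.h (-1) := by
  have h1 := P.h_mul (x := -1) (y := -1) (by simp) (by simp)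
  rw [neg_mul_neg, one_mul, P.h_one] at h1
  rw [← mul_right_inj (P.h (-1)), ← h1, h, P.w_neg]; group

lemma l_eq (c : k) : P.l c = P.u c⁻¹ * P.h (-c⁻¹) * P.w 1 * P.u c⁻¹ := by
  have h1 : P.w (-c⁻¹) = P.u (-c⁻¹) * P.l (-(-c⁻¹)⁻¹) * P.u (-c⁻¹) := rfl
  rw [mul_assoc (P.u c⁻¹), ← P.w_eq_h, h1, P.u_neg, inv_neg, inv_inv, neg_neg]
  group

lemma isNormal_u_mul (c : k) {z : Q} (hz : P.IsNormal z) : P.IsNormal (P.u c * z) := by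
  rcases hz with ⟨a, x, hx, rfl⟩ | ⟨a, x, b, hx, rfl⟩
  · exact Or.inl ⟨c + a, x, hx, by rw [P.u_add]; group⟩
  · exact Or.inr ⟨c + a, x, b, hx, by rw [P.u_add]; group⟩

lemma isNormal_h_mul {y : k} (hy : y ≠ 0) {z : Q} (hz : P.IsNormal z) : P.IsNormal (P.h y * z) := by
  rcases hz with ⟨a, x, hx, rfl⟩ | ⟨a, x, b, hx, rfl⟩
  · exact Or.inl ⟨y ^ 2 * a, y * x, mul_ne_zero hy hx, by
      rw [P.h_mul hy hx, ← mul_assoc, P.h_mul_u hy]; group⟩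
  · exact Or.inr ⟨y ^ 2 * a, y * x, b, mul_ne_zero hy hx, by
      rw [P.h_mul hy hx, ← mul_assoc, ← mul_assoc, ← mul_assoc, P.h_mul_u hy]; group⟩

lemma isNormal_w_mul_u (a : k) : P.IsNormal (P.w 1 * P.u a) :=
  Or.inr ⟨0, 1, a, one_ne_zero, by rw [P.u_zero, P.h_one]; group⟩

lemma isNormal_w_mul {z : Q} (hz : P.IsNormal z) : P.IsNormal (P.w 1 * z) := by
  rcases hz with ⟨a, x, hx, rfl⟩ | ⟨a, x, b, hx, rfl⟩
  · rw [P.u_mul_h hx, ← mul_assoc, P.w_mul_h hx, mul_assoc]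
    exact P.isNormal_h_mul (inv_ne_zero hx) (P.isNormal_w_mul_u _)
  · rw [P.u_mul_h hx]
    obtain ⟨d, hd⟩ : ∃ d, d = a / x ^ 2 := ⟨_, rfl⟩
    rw [← hd]
    have e : P.w 1 * (P.h x * P.u d * P.w 1 * P.u b) = P.h x⁻¹ * (P.w 1 * P.u d * P.w 1 * P.u b) := by
      simp only [← mul_assoc]
      rw [P.w_mul_h hx]
    rw [e]
    refine P.isNormal_h_mul (inv_ne_zero hx) ?_
    by_cases hd0 : d = 0
    · refine Or.inl ⟨b, -1, by simp, ?_⟩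
      have := P.h_mul_u (x := -1) (by simp) b
      rw [neg_sq, one_pow, one_mul] at this
      rw [hd0, P.u_zero, mul_one, P.w_mul_w, this]
    · have h1 := P.conj_u one_ne_zero d
      rw [one_pow, div_one] at h1
      have h2 : P.w 1 * P.u d * P.w 1 * P.u b = P.l (-d) * (P.h (-1) * P.u b) := by
        rw [← P.w_mul_w, ← h1]; group
      have h3 := P.h_mul_u (x := -1) (by simp) b
      rw [neg_sq, one_pow, one_mul] at h3
      have h4 := P.u_mul_h (x := -1) (by simp) ((-d)⁻¹ + b)
      rw [neg_sq, one_pow, div_one] at h4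
      have h5 := P.w_mul_h (x := -1) (by simp)
      rw [h2, P.l_eq (-d), h3, mul_assoc _ (P.u _) (_ * _), ← mul_assoc (P.u _) (P.u b),
        ← P.u_add, h4, mul_assoc, ← mul_assoc (P.w 1), h5, mul_assoc, mul_assoc]
      refine P.isNormal_u_mul _ (P.isNormal_h_mul (by simpa using hd0) (P.isNormal_h_mul (by simp) 
        (P.isNormal_w_mul_u _)))

lemma isNormal_of_mem {z : Q} (hz : z ∈ P.gen) : P.IsNormal z := by
  suffices h : ∀ y, P.IsNormal y → P.IsNormal (z * y) by
    have := h 1 (Or.inl ⟨0, 1, one_ne_zero, by rw [P.u_zero, P.h_one, one_mul]⟩)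
    rwa [mul_one] at this
  have hl : ∀ c y, P.IsNormal y → P.IsNormal (P.l c * y) := by
    intro c y hy
    by_cases hc : c = 0
    · rwa [hc, P.l_zero, one_mul]
    · rw [P.l_eq c, mul_assoc, mul_assoc, mul_assoc]
      exact P.isNormal_u_mul _ (P.isNormal_h_mul (by simpa using hc) (P.isNormal_w_mul
        (P.isNormal_u_mul _ hy)))
  induction hz using Subgroup.closure_induction_left with
  | one => intro y hy; rwa [one_mul]
  | mul_left x hx z _ ih =>
    intro y hy
    rw [mul_assoc]
    rcases hx with ⟨c, rfl⟩ | ⟨c, rfl⟩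
    · exact P.isNormal_u_mul _ (ih y hy)
    · exact hl _ _ (ih y hy)
  | inv_mul_cancel x hx z _ ih =>
    intro y hy
    rw [mul_assoc]
    rcases hx with ⟨c, rfl⟩ | ⟨c, rfl⟩
    · rw [← P.u_neg]; exact P.isNormal_u_mul _ (ih y hy)
    · rw [← P.l_neg]; exact hl _ _ (ih y hy)

/-- The Steinberg presentation of `SL₂` of a finite field. -/
lemma eq_one_of_map_eq_one (f : Q →* Matrix.SpecialLinearGroup (Fin 2) k) (hu : ∀ x, f (P.u x) = upper x)
    (hl : ∀ x, f (P.l x) = lower x) {z : Q} (hz : z ∈ P.gen) (hf : f z = 1) : z = 1 := by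
  have hw : ∀ x, x ≠ 0 → f (P.w x) 0 0 = 0 ∧ f (P.w x) 0 1 = x ∧ f (P.w x) 1 0 = -x⁻¹ ∧
      f (P.w x) 1 1 = 0 := by
    intro x hx
    rw [w, map_mul, map_mul, hu, hl]
    simp [mul00, mul01, mul10, mul11, hx]
  have hh : ∀ x, x ≠ 0 → f (P.h x) 0 0 = x ∧ f (P.h x) 0 1 = 0 ∧ f (P.h x) 1 0 = 0 ∧
      f (P.h x) 1 1 = x⁻¹ := by
    intro x hx
    obtain ⟨a1, a2, a3, a4⟩ := hw x hx
    obtain ⟨b1, b2, b3, b4⟩ := hw 1 one_ne_zero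
    obtain ⟨c1, c2, c3, c4⟩ := inv_entries (f (P.w 1))
    rw [h, map_mul, map_inv]
    simp [mul00, mul01, mul10, mul11, a1, a2, a3, a4, b1, b2, b3, b4, c1, c2, c3, c4]
  obtain ⟨b1, b2, b3, b4⟩ := hw 1 one_ne_zero
  rcases P.isNormal_of_mem hz with ⟨a, x, hx, rfl⟩ | ⟨a, x, b, hx, rfl⟩
  · obtain ⟨a1, a2, a3, a4⟩ := hh x hx
    have h00 := congrArg (fun g : Matrix.SpecialLinearGroup (Fin 2) k => g 0 0) hf
    have h01 := congrArg (fun g : Matrix.SpecialLinearGroup (Fin 2) k => g 0 1) hf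
    simp only [map_mul, mul00, mul01, hu, upper00, upper01, a1, a2, a3, a4] at h00 h01
    simp at h00 h01
    subst h00
    simp at h01
    subst h01
    rw [P.u_zero, P.h_one, one_mul]
  · obtain ⟨a1, a2, a3, a4⟩ := hh x hx
    have h10 := congrArg (fun g : Matrix.SpecialLinearGroup (Fin 2) k => g 1 0) hf
    simp only [map_mul, mul10, mul11, hu, upper00, upper10, upper11, a1, a2, a3, a4, b1, b2, b3, b4] at h10
    simp at h10
    exact absurd h10 hx

end SteinbergPair
end Steinberg

section Relative

open Matrix

section Ring
variable {R : Type*} [CommRing R]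

/-- The normal subgroup generated by unipotent matrices with entries in `I`. -/
def relElem (I : Ideal R) : Subgroup (SpecialLinearGroup (Fin 2) R) :=
  Subgroup.normalClosure (upper '' I)

instance (I : Ideal R) : (relElem I).Normal := Subgroup.normalClosure_normal

/-- Reduction modulo `I`. -/
def red (I : Ideal R) : SpecialLinearGroup (Fin 2) R →* SpecialLinearGroup (Fin 2) (R ⧸ I) :=
  SpecialLinearGroup.map (Ideal.Quotient.mk I)

lemma red_apply (I : Ideal R) (g : SpecialLinearGroup (Fin 2) R) (i j : Fin 2) :
    red I g i j = Ideal.Quotient.mk I (g i j) := rfl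

lemma red_upper (I : Ideal R) (x : R) : red I (upper x) = upper (Ideal.Quotient.mk I x) := by
  apply sl2_ext <;> simp [red_apply]

lemma red_lower (I : Ideal R) (x : R) : red I (lower x) = lower (Ideal.Quotient.mk I x) := by
  apply sl2_ext <;> simp [red_apply]

lemma red_eq_one_iff {I : Ideal R} {g : SpecialLinearGroup (Fin 2) R} :
    red I g = 1 ↔ g 0 0 - 1 ∈ I ∧ g 0 1 ∈ I ∧ g 1 0 ∈ I ∧ g 1 1 - 1 ∈ I := by
  constructor
  · intro h
    have h' : ∀ i j, Ideal.Quotient.mk I (g i j) = (1 : SpecialLinearGroup (Fin 2) (R ⧸ I)) i j :=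
      fun i j => by rw [← red_apply, h]
    refine ⟨?_, ?_, ?_, ?_⟩ <;> rw [← Ideal.Quotient.eq_zero_iff_mem]
    · rw [map_sub, h' 0 0]; simp
    · rw [h' 0 1]; simp
    · rw [h' 1 0]; simp
    · rw [map_sub, h' 1 1]; simp
  · rintro ⟨h0, h1, h2, h3⟩
    rw [← Ideal.Quotient.eq_zero_iff_mem] at h0 h1 h2 h3
    rw [map_sub, map_one, sub_eq_zero] at h0 h3
    apply sl2_ext <;> simp [red_apply, h0, h1, h2, h3]

variable {I : Ideal R}

lemma upper_mem_relElem {x : R} (hx : x ∈ I) : upper x ∈ relElem I :=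
  Subgroup.subset_normalClosure ⟨x, hx, rfl⟩

lemma lower_mem_relElem {x : R} (hx : x ∈ I) : lower x ∈ relElem I := by
  have : lower x = weyl * upper (-x) * weyl⁻¹ := by
    rw [conj_upper]; apply sl2_ext <;> simp
  rw [this]
  exact Subgroup.Normal.conj_mem inferInstance _ (upper_mem_relElem (neg_mem hx)) _

lemma transv_mem_relElem {a c x : R} (hac : Ideal.span {a} ⊔ Ideal.span {c} = ⊤) (hx : x ∈ I) :
    transv a c x ∈ relElem I := by
  obtain ⟨r, s, h⟩ := Ideal.mem_span_pair.1 (show (1 : R) ∈ Ideal.span {a, c} by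
    rw [Ideal.span_insert, hac]; trivial)
  let g : SpecialLinearGroup (Fin 2) R := ⟨!![a, -s; c, r], by rw [det_fin_two_of]; linear_combination h⟩
  have : transv a c x = g * upper x * g⁻¹ := by rw [conj_upper]; rfl
  rw [this]
  exact Subgroup.Normal.conj_mem inferInstance _ (upper_mem_relElem hx) _

lemma mk_upper_eq {x y : R} (h : x - y ∈ I) :
    (upper x : SpecialLinearGroup (Fin 2) R ⧸ relElem I) = (upper y : SpecialLinearGroup (Fin 2) R ⧸ relElem I) := by
  rw [eq_comm, QuotientGroup.eq, upper_inv, upper_mul, neg_add_eq_sub]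
  exact upper_mem_relElem h

lemma mk_lower_eq {x y : R} (h : x - y ∈ I) :
    (lower x : SpecialLinearGroup (Fin 2) R ⧸ relElem I) = (lower y : SpecialLinearGroup (Fin 2) R ⧸ relElem I) := by
  rw [eq_comm, QuotientGroup.eq, lower_inv, lower_mul, neg_add_eq_sub]
  exact lower_mem_relElem h

lemma unit_inv_sub_one_mem {ε : Rˣ} (h : (ε : R) - 1 ∈ I) : ((ε⁻¹ : Rˣ) : R) - 1 ∈ I := by
  have : ((ε⁻¹ : Rˣ) : R) - 1 = -((ε⁻¹ : Rˣ) : R) * ((ε : R) - 1) := by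
    rw [mul_sub, neg_mul, Units.inv_mul]; ring
  rw [this]
  exact I.mul_mem_left _ h

lemma torus_mem_relElem {ε : Rˣ} (h : (ε : R) - 1 ∈ I) : torus ε ∈ relElem I := by
  rw [← QuotientGroup.eq_one_iff, torus_eq]
  simp only [QuotientGroup.mk_mul]
  rw [mk_upper_eq h, mk_lower_eq (y := -1) (by
    rw [← neg_mem_iff, neg_sub, sub_neg_eq_add, neg_add_eq_sub]; exact unit_inv_sub_one_mem h)]
  simp only [← QuotientGroup.mk_mul]
  rw [QuotientGroup.eq_one_iff]
  have : upper (1 : R) * lower (-1) * upper 1 * (upper (-1) * lower 1 * upper (-1)) = 1 := by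
    apply sl2_ext <;> simp [mul00, mul01, mul10, mul11]
  rw [this]; exact one_mem _

lemma relElem_le_ker : relElem I ≤ (red I).ker := by
  refine Subgroup.normalClosure_le_normal ?_
  rintro _ ⟨x, hx, rfl⟩
  rw [SetLike.mem_coe, MonoidHom.mem_ker, red_upper, Ideal.Quotient.eq_zero_iff_mem.2 hx, upper_zero]

lemma elem_le_relElem_top : elem R ≤ relElem ⊤ :=
  elem_le (fun _ => upper_mem_relElem trivial) fun _ => lower_mem_relElem trivial

end Ring

variable {F : Type*} [Field F] [NumberField F] [IsTotallyReal F]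

omit [IsTotallyReal F] in
lemma exists_natPrime_mem {𝔮 : Ideal (𝓞 F)} [h𝔮 : 𝔮.IsPrime] (h𝔮0 : 𝔮 ≠ ⊥) :
    ∃ p : ℕ, p.Prime ∧ (p : 𝓞 F) ∈ 𝔮 := by
  have h : ∀ n : ℕ, n ≠ 0 → (n : 𝓞 F) ∈ 𝔮 → ∃ p : ℕ, p.Prime ∧ (p : 𝓞 F) ∈ 𝔮 := by
    intro n
    induction n using Nat.recOnMul with
    | zero => exact fun h => absurd rfl h
    | one => exact fun _ h => absurd ((Ideal.eq_top_iff_one _).2 (by simpa using h)) h𝔮.ne_top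
    | prime p hp => exact fun _ h => ⟨p, hp, h⟩
    | mul m n hm hn =>
      intro h0 h
      rw [Nat.cast_mul] at h
      exact (h𝔮.mem_or_mem h).elim (hm (left_ne_zero_of_mul h0)) (hn (right_ne_zero_of_mul h0))
  exact h _ (Ideal.absNorm_eq_zero_iff.not.2 h𝔮0) (Ideal.absNorm_mem 𝔮)

lemma transv_mul_lower_mem {u : (𝓞 F)ˣ} (hu : ∀ j, 1 ≤ j → u ^ j ≠ 1) {𝔮 𝔯 : Ideal (𝓞 F)}
    [h𝔮 : 𝔮.IsPrime] (h𝔮0 : 𝔮 ≠ ⊥) (h𝔯 : 𝔯 ≠ ⊥) (h𝔮𝔯 : 𝔮 ⊔ 𝔯 = ⊤) {a c y : 𝓞 F}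
    (hac : Ideal.span {a} ⊔ Ideal.span {c} = ⊤) (ha : a ∈ 𝔮) (hy : y ∈ 𝔯) :
    transv a c y * lower (y * c ^ 2) ∈ relElem (𝔮 * 𝔯) := by
  set N := relElem (𝔮 * 𝔯) with hN
  obtain ⟨p, hp, h𝔮p⟩ : ∃ p : ℕ, p.Prime ∧ (p : 𝓞 F) ∈ 𝔮 :=
    exists_natPrime_mem h𝔮0
  obtain ⟨y', hy', hyy, h⟩ := exists_of_moves hp hu h𝔮p h𝔮0 h𝔮.ne_top h𝔯 h𝔮𝔯
    (fun a c y => a ∈ 𝔮 → y ∈ 𝔯 → transv a c y * lower (y * c ^ 2) ∈ N)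
    (fun a c y s h ha hy => by
      have h1 := h ha hy
      have h2 := mul_transv (lower s) a c y
      simp only [lower00, lower01, lower10, lower11, one_mul, zero_mul, add_zero] at h2
      rw [add_comm (s * a)] at h2
      rw [← h2] at h1
      have h3 := Subgroup.Normal.conj_mem inferInstance _ h1 (lower s)⁻¹
      have h4 : (lower s)⁻¹ * (lower s * transv a c y * (lower s)⁻¹ * lower (y * (c + s * a) ^ 2)) * (lower s)⁻¹⁻¹ =
          transv a c y * lower (y * c ^ 2) * lower (y * (a * (2 * c * s + s ^ 2 * a))) := by
        rw [inv_inv, mul_assoc (transv _ _ _), lower_mul]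
        have : lower (y * c ^ 2 + y * (a * (2 * c * s + s ^ 2 * a))) = (lower s)⁻¹ * lower (y * (c + s * a) ^ 2) * lower s := by
          rw [lower_inv, lower_mul, lower_mul]; congr 1; ring
        rw [this]; group
      rw [h4, Subgroup.mul_mem_cancel_right] at h3
      · exact h3
      · refine lower_mem_relElem ?_
        rw [mul_comm y]
        exact Ideal.mul_mem_mul (𝔮.mul_mem_right _ ha) hy)
    (fun a c y t ht h ha hy => by
      have h1 := h (add_mem ha (𝔮.mul_mem_right _ (Ideal.mul_le_left ht))) hy
      have h2 := mul_transv (upper t) a c y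
      simp only [upper00, upper01, upper10, upper11, one_mul, zero_mul, zero_add] at h2
      have hU : upper t ∈ N := upper_mem_relElem ht
      rw [← h2, mul_assoc, mul_assoc, Subgroup.mul_mem_cancel_left _ hU] at h1
      have h3 := N.mul_mem h1 (Subgroup.Normal.conj_mem inferInstance _ hU (lower (y * c ^ 2))⁻¹)
      convert h3 using 1
      group)
    (fun a c y ε _ hε h ha hy => by
      rw [transv_eq _ _ _ _ h]
      rw [hN, ← QuotientGroup.eq_one_iff]
      simp only [QuotientGroup.mk_mul]
      rw [(QuotientGroup.eq_one_iff _).2 (torus_mem_relElem hε), (QuotientGroup.eq_one_iff (upper _)).2, mul_one,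
        mul_one, ← QuotientGroup.mk_mul, lower_mul, QuotientGroup.eq_one_iff]
      · refine lower_mem_relElem ?_
        have := neg_mem (unit_inv_sub_one_mem hε)
        have h1 := (𝔮 * 𝔯).mul_mem_left (y * c ^ 2) this
        convert h1 using 1
        ring
      · refine upper_mem_relElem ?_
        have := Ideal.mul_mem_mul (𝔮.mul_mem_right (a * ((ε⁻¹ : (𝓞 F)ˣ) : 𝓞 F)) ha) hy
        convert this using 1
        ring)
    (a := a) (c := c) (y₀ := y) (by
      by_contra hcon
      push Not at hcon
      rw [hcon.1, hcon.2] at hac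
      simp at hac) hy (by rw [hac, Ideal.mul_top]; exact ha)
  have h1 := h ha hy'
  have hd : y - y' ∈ 𝔮 * 𝔯 := by
    rw [mul_eq_inf_of_sup_eq_top h𝔮𝔯]
    exact ⟨by have := 𝔮.neg_mem hyy; rwa [neg_sub] at this, sub_mem hy hy'⟩
  have h2 : transv a c y * lower (y * c ^ 2) = transv a c (y - y') *
      (transv a c y' * lower (y' * c ^ 2)) * lower ((y - y') * c ^ 2) := by
    rw [mul_assoc, mul_assoc (transv a c y'), lower_mul, ← mul_assoc, transv_mul, sub_add_cancel]
    congr 2; ring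
  rw [h2]
  exact mul_mem (mul_mem (transv_mem_relElem hac hd) h1) (lower_mem_relElem ((𝔮 * 𝔯).mul_mem_right _ hd))

lemma transv_mul_upper_mem {u : (𝓞 F)ˣ} (hu : ∀ j, 1 ≤ j → u ^ j ≠ 1) {𝔮 𝔯 : Ideal (𝓞 F)}
    [h𝔮 : 𝔮.IsPrime] (h𝔮0 : 𝔮 ≠ ⊥) (h𝔯 : 𝔯 ≠ ⊥) (h𝔮𝔯 : 𝔮 ⊔ 𝔯 = ⊤) {a c y : 𝓞 F}
    (hac : Ideal.span {a} ⊔ Ideal.span {c} = ⊤) (hc : c ∈ 𝔮) (hy : y ∈ 𝔯) :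
    transv a c y * upper (-(y * a ^ 2)) ∈ relElem (𝔮 * 𝔯) := by
  have h1 := transv_mul_lower_mem hu h𝔮0 h𝔯 h𝔮𝔯 (a := c) (c := -a) (y := y)
    (by rw [Ideal.span_singleton_neg, sup_comm]; exact hac) hc hy
  have h2 := mul_transv weyl a c y
  simp only [weyl00, weyl01, weyl10, weyl11, one_mul, zero_mul, zero_add, add_zero, neg_one_mul] at h2
  have h3 := Subgroup.Normal.conj_mem inferInstance _ h1 weyl⁻¹
  have h4 : upper (-(y * a ^ 2)) = weyl⁻¹ * lower (y * (-a) ^ 2) * weyl := by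
    rw [← mul_right_inj weyl, ← mul_assoc, ← mul_assoc, mul_inv_cancel, one_mul]
    apply sl2_ext <;> simp [mul00, mul01, mul10, mul11]
  rw [h4]
  rw [← h2] at h3
  convert h3 using 1
  group

end Relative

section Congruence

open Matrix

variable {F : Type*} [Field F] [NumberField F] [IsTotallyReal F]

lemma relElem_mul_of_red_eq_one {u : (𝓞 F)ˣ} (hu : ∀ j, 1 ≤ j → u ^ j ≠ 1) {𝔮 𝔯 : Ideal (𝓞 F)}
    (h𝔮 : 𝔮.IsPrime) (h𝔮0 : 𝔮 ≠ ⊥) (h𝔯 : 𝔯 ≠ ⊥) (h𝔮𝔯 : 𝔮 ⊔ 𝔯 = ⊤)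
    {z : SpecialLinearGroup (Fin 2) (𝓞 F)} (hz : z ∈ relElem 𝔯) (hz1 : red 𝔮 z = 1) :
    z ∈ relElem (𝔮 * 𝔯) := by
  have hmax : 𝔮.IsMaximal := h𝔮.isMaximal h𝔮0
  let _ : Field (𝓞 F ⧸ 𝔮) := Ideal.Quotient.field 𝔮
  have hfin : Finite (𝓞 F ⧸ 𝔮) := Ideal.finiteQuotientOfFreeOfNeBot 𝔮 h𝔮0
  let π : SpecialLinearGroup (Fin 2) (𝓞 F) →* SpecialLinearGroup (Fin 2) (𝓞 F) ⧸ relElem (𝔮 * 𝔯) :=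
    QuotientGroup.mk' _
  have hlift : ∀ x : 𝓞 F ⧸ 𝔮, ∃ y : 𝓞 F, y ∈ 𝔯 ∧ Ideal.Quotient.mk 𝔮 y = x := by
    intro x
    obtain ⟨x, rfl⟩ := Ideal.Quotient.mk_surjective x
    obtain ⟨y, h1, h2⟩ := exists_crt h𝔮𝔯 x 0
    exact ⟨y, by simpa using h2, Ideal.Quotient.eq.2 h1⟩
  choose s hs𝔯 hs using hlift
  have hdiff : ∀ x y, x ∈ 𝔯 → y ∈ 𝔯 → Ideal.Quotient.mk 𝔮 x = Ideal.Quotient.mk 𝔮 y → x - y ∈ 𝔮 * 𝔯 := by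
    intro x y hx hy h
    rw [mul_eq_inf_of_sup_eq_top h𝔮𝔯]
    exact ⟨Ideal.Quotient.eq.1 h, sub_mem hx hy⟩
  have hU : ∀ x y, x ∈ 𝔯 → y ∈ 𝔯 → Ideal.Quotient.mk 𝔮 x = Ideal.Quotient.mk 𝔮 y →
      π (upper x) = π (upper y) := fun x y hx hy h => mk_upper_eq (hdiff x y hx hy h)
  have hL : ∀ x y, x ∈ 𝔯 → y ∈ 𝔯 → Ideal.Quotient.mk 𝔮 x = Ideal.Quotient.mk 𝔮 y →
      π (lower x) = π (lower y) := fun x y hx hy h => mk_lower_eq (hdiff x y hx hy h)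
  have hTL : ∀ a c y, Ideal.span {a} ⊔ Ideal.span {c} = ⊤ → a ∈ 𝔮 → y ∈ 𝔯 →
      π (transv a c y) = π (lower (-(y * c ^ 2))) := by
    intro a c y h ha hy
    have := (QuotientGroup.eq_one_iff _).2 (transv_mul_lower_mem hu h𝔮0 h𝔯 h𝔮𝔯 h ha hy)
    rw [QuotientGroup.mk_mul, mul_eq_one_iff_eq_inv] at this
    rw [← lower_inv, map_inv]
    exact this
  have hTU : ∀ a c y, Ideal.span {a} ⊔ Ideal.span {c} = ⊤ → c ∈ 𝔮 → y ∈ 𝔯 →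
      π (transv a c y) = π (upper (y * a ^ 2)) := by
    intro a c y h ha hy
    have := (QuotientGroup.eq_one_iff _).2 (transv_mul_upper_mem hu h𝔮0 h𝔯 h𝔮𝔯 h ha hy)
    rw [QuotientGroup.mk_mul, mul_eq_one_iff_eq_inv] at this
    rw [← neg_neg (y * a ^ 2), ← upper_inv, map_inv]
    exact this
  have hcol : ∀ g : SpecialLinearGroup (Fin 2) (𝓞 F),
      Ideal.span {g 0 0} ⊔ Ideal.span {g 1 0} = (⊤ : Ideal (𝓞 F)) := by
    intro g
    rw [← Ideal.span_insert, Ideal.eq_top_iff_one, Ideal.mem_span_pair]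
    exact ⟨g 1 1, -g 0 1, by linear_combination det_eq_one g⟩
  let P : SteinbergPair (𝓞 F ⧸ 𝔮) (SpecialLinearGroup (Fin 2) (𝓞 F) ⧸ relElem (𝔮 * 𝔯)) :=
    { u := fun x => π (upper (s x))
      l := fun x => π (lower (s x))
      u_add := fun x y => by
        rw [← map_mul, upper_mul]
        exact hU _ _ (hs𝔯 _) (add_mem (hs𝔯 _) (hs𝔯 _)) (by simp [hs])
      l_add := fun x y => by
        rw [← map_mul, lower_mul]
        exact hL _ _ (hs𝔯 _) (add_mem (hs𝔯 _) (hs𝔯 _)) (by simp [hs])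
      conj_u' := fun x y hx => by
        simp only [← map_mul, ← map_inv]
        rw [conj_upper, hTL _ _ _ (hcol _) _ (hs𝔯 _)]
        · refine hL _ _ (neg_mem (𝔯.mul_mem_right _ (hs𝔯 _))) (hs𝔯 _) ?_
          simp only [mul10, mul11, upper00, upper10, lower00, lower10, lower11, upper11]
          simp [hs]
          field_simp
        · rw [← Ideal.Quotient.eq_zero_iff_mem]
          simp only [mul00, mul01, upper00, upper10, upper01, lower00, lower10, lower11, lower01]
          simp [hs, hx] }
  have hPu : ∀ x ∈ 𝔯, π (upper x) = P.u (Ideal.Quotient.mk 𝔮 x) := fun x hx =>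
    hU _ _ hx (hs𝔯 _) (hs _).symm
  have hPl : ∀ x ∈ 𝔯, π (lower x) = P.l (Ideal.Quotient.mk 𝔮 x) := fun x hx =>
    hL _ _ hx (hs𝔯 _) (hs _).symm
  have hgu : ∀ x ∈ 𝔯, π (upper x) ∈ P.gen := fun x hx =>
    Subgroup.subset_closure (Or.inl ⟨_, (hPu x hx).symm⟩)
  have hgl : ∀ x ∈ 𝔯, π (lower x) ∈ P.gen := fun x hx =>
    Subgroup.subset_closure (Or.inr ⟨_, (hPl x hx).symm⟩)
  have hle : relElem (𝔮 * 𝔯) ≤ (red 𝔮).ker := by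
    refine (Subgroup.normalClosure_mono ?_).trans relElem_le_ker
    exact Set.image_mono fun x hx => Ideal.mul_le_left hx
  let f := QuotientGroup.lift (relElem (𝔮 * 𝔯)) (red 𝔮) hle
  have hf : ∀ x, f (π x) = red 𝔮 x := fun x => rfl
  have hgen : relElem 𝔯 ≤ P.gen.comap π := by
    refine (Subgroup.closure_le _).2 ?_
    intro z hz
    obtain ⟨_, ⟨x, hx, rfl⟩, hz⟩ := Group.mem_conjugatesOfSet_iff.1 hz
    obtain ⟨g, rfl⟩ := isConj_iff.1 hz
    change π (g * upper x * g⁻¹) ∈ P.gen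
    rw [conj_upper]
    have hg := hcol g
    generalize g 0 0 = a at *
    generalize g 1 0 = c at *
    by_cases ha : a ∈ 𝔮
    · rw [hTL a c x hg ha hx]
      exact hgl _ (neg_mem (𝔯.mul_mem_right _ hx))
    · have ha' : Ideal.Quotient.mk 𝔮 a ≠ 0 := by rwa [Ne, Ideal.Quotient.eq_zero_iff_mem]
      obtain ⟨t, ht⟩ : ∃ t, t = s (-Ideal.Quotient.mk 𝔮 c / Ideal.Quotient.mk 𝔮 a) := ⟨_, rfl⟩
      have ht𝔯 : t ∈ 𝔯 := ht ▸ hs𝔯 _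
      have hc : t * a + c ∈ 𝔮 := by
        rw [← Ideal.Quotient.eq_zero_iff_mem, map_add, map_mul, ht, hs, div_mul_cancel₀ _ ha', neg_add_cancel]
      have h2 := mul_transv (lower t) a c x
      simp only [lower00, lower01, lower10, lower11, one_mul, zero_mul, add_zero] at h2
      have h3 : transv a c x = (lower t)⁻¹ * transv a (t * a + c) x * lower t := by
        rw [← h2]; group
      rw [h3, map_mul, map_mul, map_inv, hTU a _ x _ hc hx]
      · exact mul_mem (mul_mem (inv_mem (hgl _ ht𝔯)) (hgu _ (𝔯.mul_mem_right _ hx))) (hgl _ ht𝔯)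
      · rw [add_comm, sup_comm, span_sup_span_add_mul, sup_comm]; exact hg
  have := P.eq_one_of_map_eq_one f (fun x => by
      change f (π _) = _
      rw [hf, red_upper, hs]) (fun x => by
      change f (π _) = _
      rw [hf, red_lower, hs]) (hgen hz) (by rw [hf, hz1])
  exact (QuotientGroup.eq_one_iff _).1 this

lemma mem_relElem_of_squarefree {u : (𝓞 F)ˣ} (hu : ∀ j, 1 ≤ j → u ^ j ≠ 1) {I : Ideal (𝓞 F)}
    (hI0 : I ≠ ⊥) (hI : Squarefree I) {z : SpecialLinearGroup (Fin 2) (𝓞 F)} (hz : z ∈ elem (𝓞 F))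
    (hz1 : red I z = 1) : z ∈ relElem I := by
  induction I using UniqueFactorizationMonoid.induction_on_prime with
  | h₁ => exact absurd rfl hI0
  | h₂ I h =>
    rw [Ideal.isUnit_iff.1 h]
    exact elem_le_relElem_top hz
  | h₃ I P hI' hP ih =>
    have hPI : P ⊔ I = ⊤ := by
      have hP' := Ideal.isPrime_of_prime hP
      have hm : P.IsMaximal := hP'.isMaximal hP.ne_zero
      rw [sup_comm]
      by_contra hcon
      obtain ⟨J, rfl⟩ : P ∣ I := by
        rw [Ideal.dvd_iff_le]
        by_contra h
        exact hcon (by rw [sup_comm]; exact hm.1.2 _ (left_lt_sup.2 h))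
      exact hP.not_isUnit (hI P ⟨J, by rw [mul_assoc]⟩)
    have hred : ∀ J, P * I ≤ J → red J z = 1 := by
      intro J hJ
      rw [red_eq_one_iff] at hz1 ⊢
      exact ⟨hJ hz1.1, hJ hz1.2.1, hJ hz1.2.2.1, hJ hz1.2.2.2⟩
    exact relElem_mul_of_red_eq_one hu (Ideal.isPrime_of_prime hP) hP.ne_zero hI' hPI
      (ih hI' (hI.of_mul_right) (hred I Ideal.mul_le_right)) (hred P Ideal.mul_le_left)

end Congruence

section Symbol

open Matrix

section Ring
variable {R : Type*} [CommRing R]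

lemma exists_row {a b : R} (h : Ideal.span {a} ⊔ Ideal.span {b} = ⊤) :
    ∃ g : SpecialLinearGroup (Fin 2) R, g 0 0 = a ∧ g 0 1 = b := by
  obtain ⟨r, s, h⟩ := Ideal.mem_span_pair.1 (show (1 : R) ∈ Ideal.span {a, b} by
    rw [Ideal.span_insert, h]; trivial)
  exact ⟨⟨!![a, b; -s, r], by rw [det_fin_two_of]; linear_combination h⟩, rfl, rfl⟩

lemma row_sup_eq_top (g : SpecialLinearGroup (Fin 2) R) : Ideal.span {g 0 0} ⊔ Ideal.span {g 0 1} = (⊤ : Ideal R) := by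
  rw [← Ideal.span_insert, Ideal.eq_top_iff_one, Ideal.mem_span_pair]
  exact ⟨g 1 1, -g 1 0, by linear_combination det_eq_one g⟩

variable [hE : (elem R).Normal]

lemma mk_eq_of_row {g h : SpecialLinearGroup (Fin 2) R} (h0 : g 0 0 = h 0 0) (h1 : g 0 1 = h 0 1) :
    (g : SpecialLinearGroup (Fin 2) R ⧸ elem R) = (h : SpecialLinearGroup (Fin 2) R ⧸ elem R) := by
  have key : g * h⁻¹ = lower ((g * h⁻¹) 1 0) := by
    obtain ⟨i0, i1, i2, i3⟩ := inv_entries h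
    have hd := det_eq_one h
    have hg := det_eq_one g
    rw [h0, h1] at hg
    apply sl2_ext <;> simp only [mul00, mul01, mul10, mul11, lower00, lower01, lower10, lower11, i0, i1, i2, i3, h0, h1]
    · linear_combination hd
    · ring
    · linear_combination hg
  rw [← mul_inv_eq_one, ← QuotientGroup.mk_inv, ← QuotientGroup.mk_mul, QuotientGroup.eq_one_iff, key]
  exact lower_mem _

open Classical in
/-- The class modulo elementary matrices of a matrix with first row `(a, b)`. -/
noncomputable def rowClass (a b : R) : SpecialLinearGroup (Fin 2) R ⧸ elem R :=
  if h : Ideal.span {a} ⊔ Ideal.span {b} = ⊤ then ((exists_row h).choose : SpecialLinearGroup (Fin 2) R ⧸ elem R) else 1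

lemma rowClass_eq (g : SpecialLinearGroup (Fin 2) R) : rowClass (g 0 0) (g 0 1) = g := by
  have h := row_sup_eq_top g
  rw [rowClass, dif_pos h]
  exact mk_eq_of_row (exists_row h).choose_spec.1 (exists_row h).choose_spec.2

variable {a b : R}

lemma rowClass_add_right (h : Ideal.span {a} ⊔ Ideal.span {b} = ⊤) (t : R) : rowClass a (b + t * a) = rowClass a b := by
  obtain ⟨g, rfl, rfl⟩ := exists_row h
  have h1 := rowClass_eq (g * upper t)
  simp only [mul00, mul01, upper00, upper01, upper10, upper11, mul_one, mul_zero, add_zero] at h1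
  rw [rowClass_eq, add_comm, mul_comm t, h1, QuotientGroup.mk_mul, (QuotientGroup.eq_one_iff _).2 (upper_mem t), mul_one]

lemma rowClass_add_left (h : Ideal.span {a} ⊔ Ideal.span {b} = ⊤) (t : R) : rowClass (a + t * b) b = rowClass a b := by
  obtain ⟨g, rfl, rfl⟩ := exists_row h
  have h1 := rowClass_eq (g * lower t)
  simp only [mul00, mul01, lower00, lower01, lower10, lower11, mul_one, mul_zero, zero_add] at h1
  rw [rowClass_eq, mul_comm t, h1, QuotientGroup.mk_mul, (QuotientGroup.eq_one_iff _).2 (lower_mem t), mul_one]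

lemma rowClass_swap (h : Ideal.span {a} ⊔ Ideal.span {b} = ⊤) : rowClass b (-a) = rowClass a b := by
  obtain ⟨g, rfl, rfl⟩ := exists_row h
  have h1 := rowClass_eq (g * weyl⁻¹)
  obtain ⟨i0, i1, i2, i3⟩ := inv_entries (weyl : SpecialLinearGroup (Fin 2) R)
  simp only [mul00, mul01, i0, i1, i2, i3, weyl00, weyl01, weyl10, weyl11, mul_one, mul_zero, zero_add,
    add_zero, neg_neg, mul_neg] at h1
  rw [rowClass_eq, h1, QuotientGroup.mk_mul, (QuotientGroup.eq_one_iff _).2 (inv_mem weyl_mem), mul_one]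

lemma rowClass_of_isUnit_left (h : IsUnit a) (b : R) : rowClass a b = 1 := by
  obtain ⟨u, rfl⟩ := h
  have h1 := rowClass_eq (torus u * upper (((u⁻¹ : Rˣ) : R) * b))
  simp only [mul00, mul01, upper00, upper01, upper10, upper11, torus00, torus01, mul_one, mul_zero, add_zero,
    Units.mul_inv_cancel_left] at h1
  rw [h1, QuotientGroup.eq_one_iff]
  exact mul_mem (torus_mem _) (upper_mem _)

lemma rowClass_of_isUnit_right (a : R) (h : IsUnit b) : rowClass a b = 1 := by
  rw [← rowClass_swap (by rw [Ideal.span_singleton_eq_top.2 h, sup_top_eq])]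
  exact rowClass_of_isUnit_left h _

end Ring

section Mult
variable {R : Type*} [CommRing R] [IsDomain R] [hE : (elem R).Normal]

/-- Matrices related by division of the upper right entry by `b`. -/
def related (b : R) : Subgroup (SpecialLinearGroup (Fin 2) R × SpecialLinearGroup (Fin 2) R) where
  carrier := {p | p.1 0 0 = p.2 0 0 ∧ p.1 1 1 = p.2 1 1 ∧ p.2 0 1 = b * p.1 0 1 ∧ p.1 1 0 = b * p.2 1 0}
  one_mem' := by simp
  mul_mem' := by
    rintro ⟨x, x'⟩ ⟨y, y'⟩ ⟨h1, h2, h3, h4⟩ ⟨k1, k2, k3, k4⟩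
    simp only [] at *
    refine ⟨?_, ?_, ?_, ?_⟩ <;> simp only [Prod.mk_mul_mk, mul00, mul01, mul10, mul11]
    · rw [h1, k1, h3, k4]; ring
    · rw [h2, k2, h4, k3]; ring
    · rw [h1, k2, h3, k3]; ring
    · rw [h2, k1, h4, k4]; ring
  inv_mem' := by
    rintro ⟨x, x'⟩ ⟨h1, h2, h3, h4⟩
    simp only [] at *
    obtain ⟨i0, i1, i2, i3⟩ := inv_entries x
    obtain ⟨j0, j1, j2, j3⟩ := inv_entries x'
    refine ⟨?_, ?_, ?_, ?_⟩ <;> simp only [Prod.inv_mk, i0, i1, i2, i3, j0, j1, j2, j3]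
    · exact h2
    · exact h1
    · rw [h3]; ring
    · rw [h4]; ring

lemma mem_related {b : R} {x y : SpecialLinearGroup (Fin 2) R} : (x, y) ∈ related b ↔
    x 0 0 = y 0 0 ∧ x 1 1 = y 1 1 ∧ y 0 1 = b * x 0 1 ∧ x 1 0 = b * y 1 0 := Iff.rfl

lemma eq_of_related {b : R} (hb : b ≠ 0) {x y z : SpecialLinearGroup (Fin 2) R} (hy : (x, y) ∈ related b)
    (hz : (x, z) ∈ related b) : y = z := by
  rw [mem_related] at hy hz
  apply sl2_ext
  · rw [← hy.1, hz.1]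
  · rw [hy.2.2.1, hz.2.2.1]
  · exact mul_left_cancel₀ hb (hy.2.2.2.symm.trans hz.2.2.2)
  · rw [← hy.2.1, hz.2.1]

lemma exists_related_of_mem_relElem (hT : ∀ a c y : R, transv a c y ∈ elem R) {b : R}
    {x : SpecialLinearGroup (Fin 2) R} (hx : x ∈ relElem (Ideal.span {b})) :
    ∃ y ∈ elem R, (x, y) ∈ related b := by
  have h : relElem (Ideal.span {b}) ≤ ((elem R).comap (MonoidHom.snd _ _) ⊓ related b).map (MonoidHom.fst _ _) := by
    refine (Subgroup.closure_le _).2 ?_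
    intro z hz
    obtain ⟨_, ⟨x, hx, rfl⟩, hz⟩ := Group.mem_conjugatesOfSet_iff.1 hz
    obtain ⟨g, rfl⟩ := isConj_iff.1 hz
    obtain ⟨t, rfl⟩ := Ideal.mem_span_singleton'.1 hx
    rw [conj_upper]
    refine ⟨(transv (g 0 0) (g 1 0) (t * b), transv (b * g 0 0) (g 1 0) t), ⟨hT _ _ _, ?_⟩, rfl⟩
    change _ ∈ related b
    rw [mem_related]
    simp only [transv00, transv01, transv10, transv11]
    refine ⟨?_, ?_, ?_, ?_⟩ <;> ring
  obtain ⟨⟨x', y⟩, ⟨hy, hxy⟩, rfl⟩ := h hx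
  exact ⟨y, hy, hxy⟩

lemma rowClass_mul_of_relElem (hT : ∀ a c y : R, transv a c y ∈ elem R) {b : R} (hb : b ≠ 0)
    (hrel : ∀ z ∈ elem R, red (Ideal.span {b}) z = 1 → z ∈ relElem (Ideal.span {b})) {x y : R}
    (hx : Ideal.span {x} ⊔ Ideal.span {b} = ⊤) (hy : Ideal.span {y} ⊔ Ideal.span {b} = ⊤) :
    rowClass (x * y) b = rowClass x b * rowClass y b := by
  have hex : ∀ x, Ideal.span {x} ⊔ Ideal.span {b} = ⊤ → ∃ r s, r * x + s * b = 1 := fun x hx =>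
    Ideal.mem_span_pair.1 (show (1 : R) ∈ Ideal.span {x, b} by rw [Ideal.span_insert, hx]; trivial)
  obtain ⟨x', s, hxs⟩ := hex x hx
  obtain ⟨y', t, hyt⟩ := hex y hy
  let M : ∀ x x' s : R, x' * x + s * b = 1 → SpecialLinearGroup (Fin 2) R := fun x x' s h =>
    ⟨!![x, 1; -(s * b), x'], by rw [det_fin_two_of]; linear_combination h⟩
  let M' : ∀ x x' s : R, x' * x + s * b = 1 → SpecialLinearGroup (Fin 2) R := fun x x' s h =>
    ⟨!![x, b; -s, x'], by rw [det_fin_two_of]; linear_combination h⟩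
  have hM' : ∀ x x' s h, (M' x x' s h : SpecialLinearGroup (Fin 2) R ⧸ elem R) = rowClass x b :=
    fun x x' s h => (rowClass_eq (M' x x' s h)).symm
  have hM : ∀ x x' s h, M x x' s h ∈ elem R := by
    intro x x' s h
    rw [← QuotientGroup.eq_one_iff, ← rowClass_eq]
    exact rowClass_of_isUnit_right _ isUnit_one
  have hMM : ∀ x x' s h, (M x x' s h, M' x x' s h) ∈ related b := by
    intro x x' s h
    rw [mem_related]
    refine ⟨rfl, rfl, (mul_one b).symm, ?_⟩
    change -(s * b) = b * -s
    ring
  obtain ⟨r, hr⟩ : ∃ r, r = s + t - s * t * b := ⟨_, rfl⟩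
  have h3 : x' * y' * (x * y) + r * b = 1 := by rw [hr]; linear_combination y' * y * hxs + (1 - s * b) * hyt
  obtain ⟨p, hp⟩ : ∃ p, p = M x x' s hxs * M y y' t hyt * (M (x * y) (x' * y') r h3)⁻¹ := ⟨_, rfl⟩
  have hpE : p ∈ elem R := hp ▸ mul_mem (mul_mem (hM _ _ _ hxs) (hM _ _ _ hyt)) (inv_mem (hM _ _ _ h3))
  obtain ⟨i0, i1, i2, i3⟩ := inv_entries (M (x * y) (x' * y') r h3)
  have e00 : p 0 0 - 1 ∈ Ideal.span {b} := by
    refine Ideal.mem_span_singleton'.2 ⟨-r - t * (x' * y') + (x + y') * r, ?_⟩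
    rw [hp]
    simp only [mul00, mul01, i0, i2]
    change _ = (x * y + 1 * -(t * b)) * (x' * y') + (x * 1 + 1 * y') * -(-(r * b)) - 1
    linear_combination -h3
  have e10 : p 1 0 ∈ Ideal.span {b} := by
    refine Ideal.mem_span_singleton'.2 ⟨(-s * y - x' * t) * (x' * y') + (x' * y' - s * b) * r, ?_⟩
    rw [hp]
    simp only [mul10, mul11, i0, i2]
    change _ = (-(s * b) * y + x' * -(t * b)) * (x' * y') + (-(s * b) * 1 + x' * y') * -(-(r * b))
    ring
  have e11 : p 1 1 - 1 ∈ Ideal.span {b} := by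
    refine Ideal.mem_span_singleton'.2 ⟨s * y + x' * t - s * (x * y) - r, ?_⟩
    rw [hp]
    simp only [mul10, mul11, i1, i3]
    change _ = (-(s * b) * y + x' * -(t * b)) * -1 + (-(s * b) * 1 + x' * y') * (x * y) - 1
    linear_combination -h3
  have hz : red (Ideal.span {b}) (p * upper (-p 0 1)) = 1 := by
    rw [red_eq_one_iff]
    simp only [mul00, mul01, mul10, mul11, upper00, upper01, upper10, upper11, mul_one, mul_zero, add_zero]
    refine ⟨e00, ?_, e10, ?_⟩
    · have := (Ideal.span {b}).mul_mem_left (-p 0 1) e00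
      convert this using 1
      ring
    · have := add_mem ((Ideal.span {b}).mul_mem_left (-p 0 1) e10) e11
      convert this using 1
      ring
  obtain ⟨w, hw, hzw⟩ := exists_related_of_mem_relElem hT (hrel _ (mul_mem hpE (upper_mem _)) hz)
  have hup : (upper (-p 0 1), upper (b * -p 0 1)) ∈ related b := by
    rw [mem_related]
    simp
  have hrel' := mul_mem (mul_mem (mul_mem (hMM x x' s hxs) (hMM y y' t hyt))
    (inv_mem (hMM (x * y) (x' * y') r h3))) hup
  rw [Prod.inv_mk, Prod.mk_mul_mk, Prod.mk_mul_mk, Prod.mk_mul_mk, ← hp] at hrel'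
  rw [← eq_of_related hb hrel' hzw, Subgroup.mul_mem_cancel_right _ (upper_mem _), ← QuotientGroup.eq_one_iff,
    QuotientGroup.mk_mul, QuotientGroup.mk_mul, QuotientGroup.mk_inv, mul_inv_eq_one, hM' x x' s hxs, hM' y y' t hyt, hM' (x*y) (x'*y') r h3] at hw
  exact hw.symm

end Mult
end Symbol

section Mennicke

open Matrix

variable {F : Type*} [Field F] [NumberField F] [IsTotallyReal F] [hE : (elem (𝓞 F)).Normal]
  {u : (𝓞 F)ˣ} (hu : ∀ j, 1 ≤ j → u ^ j ≠ 1)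
include hu

lemma rowClass_mul_left {x y b : 𝓞 F} (hx : Ideal.span {x} ⊔ Ideal.span {b} = ⊤)
    (hy : Ideal.span {y} ⊔ Ideal.span {b} = ⊤) :
    rowClass (x * y) b = rowClass x b * rowClass y b := by
  have hxy : Ideal.span {x * y} ⊔ Ideal.span {b} = ⊤ := by
    rw [← Ideal.span_singleton_mul_span_singleton]
    exact mul_sup_eq_top hx hy
  by_cases h0 : x * y = 0
  · have hb : IsUnit b := by
      rw [h0, Ideal.span_singleton_zero, bot_sup_eq] at hxy
      exact Ideal.span_singleton_eq_top.1 hxy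
    simp only [rowClass_of_isUnit_right _ hb, mul_one]
  obtain ⟨R, hR⟩ := exists_good_generator (F := F) Nat.prime_two
  obtain ⟨b', I, hb', hI, hI0, -, hsq, -⟩ := hR ⊤ (Ideal.span {x * y}) ⊤ b top_ne_bot (by simpa using h0)
    top_ne_bot (by rw [Ideal.top_mul, sup_comm]; exact hxy)
  rw [Ideal.top_mul] at hb' hI
  obtain ⟨t, ht⟩ := Ideal.mem_span_singleton'.1 hb'
  obtain rfl : b' = b + t * (x * y) := by rw [ht]; ring
  have hb0 : b + t * (x * y) ≠ 0 := by
    intro h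
    rw [h] at hI
    exact hI0 (by rw [← hI]; simp)
  have e1 : b + t * (x * y) = b + t * y * x := by ring
  have e2 : b + t * (x * y) = b + t * x * y := by ring
  have key := rowClass_mul_of_relElem (transv_mem hu) hb0 (x := x) (y := y)
    (fun z hz hz1 => mem_relElem_of_squarefree hu (by rw [hI]; exact hI0) (by rw [hI]; exact hsq) hz hz1)
    (by rw [e1, sup_comm, span_sup_span_add_mul, sup_comm]; exact hx)
    (by rw [e2, sup_comm, span_sup_span_add_mul, sup_comm]; exact hy)
  rw [rowClass_add_right hxy] at key
  rw [key]
  congr 1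
  · rw [e1, rowClass_add_right hx]
  · rw [e2, rowClass_add_right hy]

lemma rowClass_neg_left {a b : 𝓞 F} (h : Ideal.span {a} ⊔ Ideal.span {b} = ⊤) :
    rowClass (-a) b = rowClass a b := by
  have := rowClass_mul_left hu (x := -1) (y := a) (b := b)
    (by rw [Ideal.span_singleton_neg, Ideal.span_singleton_one, top_sup_eq]) h
  rwa [rowClass_of_isUnit_left (a := -1) isUnit_one.neg, one_mul, neg_one_mul] at this

lemma rowClass_symm {a b : 𝓞 F} (h : Ideal.span {a} ⊔ Ideal.span {b} = ⊤) :
    rowClass b a = rowClass a b := by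
  have := rowClass_swap (a := -a) (b := b) (by rwa [Ideal.span_singleton_neg])
  rw [neg_neg] at this
  rw [this, rowClass_neg_left hu h]

lemma rowClass_mul_right {a x y : 𝓞 F} (hx : Ideal.span {a} ⊔ Ideal.span {x} = ⊤)
    (hy : Ideal.span {a} ⊔ Ideal.span {y} = ⊤) :
    rowClass a (x * y) = rowClass a x * rowClass a y := by
  rw [sup_comm] at hx hy
  have hxy : Ideal.span {x * y} ⊔ Ideal.span {a} = ⊤ := by
    rw [← Ideal.span_singleton_mul_span_singleton]
    exact mul_sup_eq_top hx hy
  rw [rowClass_symm hu hxy, rowClass_symm hu hx, rowClass_symm hu hy, rowClass_mul_left hu hx hy]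

lemma quotient_elem_comm (x y : SpecialLinearGroup (Fin 2) (𝓞 F) ⧸ elem (𝓞 F)) : x * y = y * x := by
  obtain ⟨g, rfl⟩ := QuotientGroup.mk_surjective x
  obtain ⟨h, rfl⟩ := QuotientGroup.mk_surjective y
  have hg := row_sup_eq_top g
  have hh := row_sup_eq_top h
  rw [← rowClass_eq g, ← rowClass_eq h]
  generalize g 0 0 = a at *
  generalize g 0 1 = b at *
  generalize h 0 0 = a' at *
  generalize h 0 1 = b' at *
  by_cases hb : b = 0
  · rw [hb, Ideal.span_singleton_zero, sup_bot_eq] at hg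
    rw [rowClass_of_isUnit_left (Ideal.span_singleton_eq_top.1 hg), one_mul, mul_one]
  obtain ⟨s, hs⟩ := exists_add_mul_sup (a := a') (c := b') hh.symm top_ne_bot (K := Ideal.span {b}) (by simpa using hb)
  rw [← rowClass_add_right hh s]
  have hh' : Ideal.span {a'} ⊔ Ideal.span {b' + s * a'} = ⊤ := by
    rw [sup_comm, span_sup_span_add_mul, sup_comm]; exact hh
  generalize b' + s * a' = e at *
  rw [Ideal.top_mul] at hs
  obtain ⟨c, hc1, hc2⟩ := exists_crt hs a' a
  obtain ⟨t, ht⟩ := Ideal.mem_span_singleton'.1 hc1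
  obtain ⟨r, hr⟩ := Ideal.mem_span_singleton'.1 hc2
  have ec1 : c = a' + t * e := by rw [ht]; ring
  have ec2 : c = a + r * b := by rw [hr]; ring
  have h1 := rowClass_add_left hh' t
  have h2 := rowClass_add_left hg r
  rw [← ec1] at h1
  rw [← ec2] at h2
  have k1 : Ideal.span {c} ⊔ Ideal.span {e} = ⊤ := by rw [ec1, span_sup_span_add_mul]; exact hh'
  have k2 : Ideal.span {c} ⊔ Ideal.span {b} = ⊤ := by rw [ec2, span_sup_span_add_mul]; exact hg
  rw [← h1, ← h2, ← rowClass_mul_right hu k2 k1, ← rowClass_mul_right hu k1 k2, mul_comm]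

lemma rowClass_pow_left {a b : 𝓞 F} (h : Ideal.span {a} ⊔ Ideal.span {b} = ⊤) (n : ℕ) :
    Ideal.span {a ^ n} ⊔ Ideal.span {b} = ⊤ ∧ rowClass (a ^ n) b = rowClass a b ^ n := by
  induction n with
  | zero =>
    rw [pow_zero, pow_zero, Ideal.span_singleton_one, top_sup_eq]
    exact ⟨rfl, rowClass_of_isUnit_left isUnit_one _⟩
  | succ n ih =>
    rw [pow_succ, pow_succ, rowClass_mul_left hu ih.1 h, ih.2]
    refine ⟨?_, rfl⟩
    rw [← Ideal.span_singleton_mul_span_singleton]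
    exact mul_sup_eq_top ih.1 h

lemma exists_quotient_elem_pow_eq_one {p : ℕ} (hp : p.Prime) :
    ∃ R, ∀ d : SpecialLinearGroup (Fin 2) (𝓞 F) ⧸ elem (𝓞 F), ∃ M, ¬ p ∣ M ∧ d ^ (p ^ R * M) = 1 := by
  obtain ⟨R, hR⟩ := exists_good_generator (F := F) hp
  refine ⟨R, fun d => ?_⟩
  obtain ⟨g, rfl⟩ := QuotientGroup.mk_surjective d
  have hg := row_sup_eq_top g
  rw [← rowClass_eq g]
  generalize g 0 0 = a at *
  generalize g 0 1 = b at *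
  by_cases h0 : a = 0
  · rw [h0, Ideal.span_singleton_zero, bot_sup_eq] at hg
    rw [rowClass_of_isUnit_right _ (Ideal.span_singleton_eq_top.1 hg)]
    exact ⟨1, hp.one_lt.ne' ∘ Nat.dvd_one.1, one_pow _⟩
  obtain ⟨b', I, hb', hI, hI0, -, hsq, hgood⟩ := hR ⊤ (Ideal.span {a}) ⊤ b top_ne_bot (by simpa using h0)
    top_ne_bot (by rw [Ideal.top_mul, sup_comm]; exact hg)
  rw [Ideal.top_mul] at hb' hI
  obtain ⟨t, ht⟩ := Ideal.mem_span_singleton'.1 hb'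
  obtain rfl : b' = b + t * a := by rw [ht]; ring
  have hg' : Ideal.span {a} ⊔ Ideal.span {b + t * a} = ⊤ := by
    rw [sup_comm, span_sup_span_add_mul, sup_comm]; exact hg
  obtain ⟨M, hM, h⟩ := exists_pow_sub_one_mem hp (hI ▸ hg') hI0 hsq hgood
  refine ⟨M, hM, ?_⟩
  rw [← rowClass_add_right hg t, ← (rowClass_pow_left hu hg' _).2]
  rw [← hI] at h
  obtain ⟨s, hs⟩ := Ideal.mem_span_singleton'.1 h
  have e : a ^ (p ^ R * M) = 1 + s * (b + t * a) := by rw [hs]; ring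
  rw [e, rowClass_add_left (by rw [Ideal.span_singleton_one, top_sup_eq]), rowClass_of_isUnit_left isUnit_one]

omit hu in
lemma exists_linear_ne_zero (K : Type*) {V : Type*} [Field K] [AddCommGroup V] [Module K V] {v : V}
    (hv : v ≠ 0) : ∃ φ : V →+ K, φ v ≠ 0 := by
  by_contra! h
  have key : ∀ φ : V →ₗ[K] K, φ v = 0 := fun φ => h φ.toAddMonoidHom
  exact hv ((Module.forall_dual_apply_eq_zero_iff K v).1 key)

omit hu in
lemma exists_addMonoidHom_ne_zero {V : Type*} [AddCommGroup V] {p : ℕ} [Fact p.Prime]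
    (hV : ∀ x : V, p • x = 0) {v : V} (hv : v ≠ 0) : ∃ φ : V →+ ZMod p, φ v ≠ 0 := by
  let _ : Module (ZMod p) V := AddCommGroup.zmodModule hV
  exact exists_linear_ne_zero (ZMod p) hv

omit [IsTotallyReal F] hu in
lemma exists_hom_ne_one {D : Type*} [CommGroup D] {p : ℕ} (hp : p.Prime) {d : D}
    (hd : ∀ x : D, x ^ p ≠ d) : ∃ f : D →* ℂ, (∀ x, f x ^ p = 1) ∧ f d ≠ 1 := by
  have := Fact.mk hp
  let N : Subgroup D := (powMonoidHom p).range
  have hN : ∀ x : Additive (D ⧸ N), p • x = 0 := fun x => by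
    obtain ⟨x, rfl⟩ := Additive.ofMul.surjective x
    obtain ⟨x, rfl⟩ := QuotientGroup.mk_surjective x
    have : x ^ p ∈ N := ⟨x, rfl⟩
    rw [← ofMul_pow, ← QuotientGroup.mk_pow, (QuotientGroup.eq_one_iff _).2 this, ofMul_one]
  have hd' : Additive.ofMul (d : D ⧸ N) ≠ 0 := by
    rw [Ne, ofMul_eq_zero, QuotientGroup.eq_one_iff]
    rintro ⟨x, hx⟩
    exact hd x hx
  obtain ⟨φ, hφ⟩ := exists_addMonoidHom_ne_zero hN hd'
  let f : D →* ℂ :=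
    { toFun := fun x => ZMod.stdAddChar (φ (Additive.ofMul (x : D ⧸ N)))
      map_one' := by rw [QuotientGroup.mk_one, ofMul_one, map_zero, AddChar.map_zero_eq_one]
      map_mul' := fun x y => by rw [QuotientGroup.mk_mul, ofMul_mul, map_add, AddChar.map_add_eq_mul] }
  refine ⟨f, fun x => ?_, fun h => hφ ?_⟩
  · change ZMod.stdAddChar _ ^ p = 1
    rw [← AddChar.map_nsmul_eq_pow, nsmul_eq_mul, CharP.cast_eq_zero, zero_mul, AddChar.map_zero_eq_one]
  · refine ZMod.injective_stdAddChar ?_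
    rw [AddChar.map_zero_eq_one]
    exact h

/-- A symbol with values in `p`-th roots of unity, as attached to a nontrivial quotient of `SL₂`. -/
structure IsSymbol (p : ℕ) (s : 𝓞 F → 𝓞 F → ℂ) : Prop where
  pow_eq_one : ∀ a b, s a b ^ p = 1
  mul_left : ∀ x y b, Ideal.span {x} ⊔ Ideal.span {b} = ⊤ → Ideal.span {y} ⊔ Ideal.span {b} = ⊤ →
    s (x * y) b = s x b * s y b
  symm : ∀ a b, Ideal.span {a} ⊔ Ideal.span {b} = ⊤ → s b a = s a b
  add_left : ∀ a b t, Ideal.span {a} ⊔ Ideal.span {b} = ⊤ → s (a + t * b) b = s a b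
  of_isUnit : ∀ a b, IsUnit a → s a b = 1
  exists_ne_one : ∃ a b, Ideal.span {a} ⊔ Ideal.span {b} = ⊤ ∧ s a b ≠ 1

lemma exists_isSymbol (h : elem (𝓞 F) ≠ ⊤) : ∃ p : ℕ, p.Prime ∧ ∃ s : 𝓞 F → 𝓞 F → ℂ, IsSymbol p s := by
  let _ : CommGroup (SpecialLinearGroup (Fin 2) (𝓞 F) ⧸ elem (𝓞 F)) :=
    { (inferInstance : Group (SpecialLinearGroup (Fin 2) (𝓞 F) ⧸ elem (𝓞 F))) with
      mul_comm := quotient_elem_comm hu }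
  obtain ⟨g, hg⟩ : ∃ g, g ∉ elem (𝓞 F) := by
    by_contra! h'
    exact h (eq_top_iff.2 fun g _ => h' g)
  have hd : (g : SpecialLinearGroup (Fin 2) (𝓞 F) ⧸ elem (𝓞 F)) ≠ 1 := by
    rwa [Ne, QuotientGroup.eq_one_iff]
  generalize (g : SpecialLinearGroup (Fin 2) (𝓞 F) ⧸ elem (𝓞 F)) = d at hd
  obtain ⟨p, hp, hpd⟩ := Nat.exists_prime_and_dvd (orderOf_eq_one_iff.not.2 hd)
  obtain ⟨R, hR⟩ := exists_quotient_elem_pow_eq_one hu hp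
  obtain ⟨d', hd'⟩ : ∃ d' : SpecialLinearGroup (Fin 2) (𝓞 F) ⧸ elem (𝓞 F), ∀ x, x ^ p ≠ d' := by
    by_contra! hroot
    have hroot' : ∀ n, ∀ y : SpecialLinearGroup (Fin 2) (𝓞 F) ⧸ elem (𝓞 F), ∃ x, x ^ p ^ n = y := by
      intro n
      induction n with
      | zero => exact fun y => ⟨y, by simp⟩
      | succ n ih =>
        intro y
        obtain ⟨z, hz⟩ := hroot y
        obtain ⟨x, hx⟩ := ih z
        exact ⟨x, by rw [pow_succ, pow_mul, hx, hz]⟩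
    obtain ⟨x, hx⟩ := hroot' R d
    obtain ⟨M, hM, hxM⟩ := hR x
    rw [pow_mul, hx] at hxM
    exact hM (hpd.trans (orderOf_dvd_of_pow_eq_one hxM))
  obtain ⟨f, hf, hfd⟩ := exists_hom_ne_one hp hd'
  obtain ⟨g', rfl⟩ := QuotientGroup.mk_surjective d'
  refine ⟨p, hp, fun a b => f (rowClass a b), fun a b => hf _, fun x y b hx hy => ?_, fun a b hab => ?_,
    fun a b t hab => ?_, fun a b ha => ?_, g' 0 0, g' 0 1, row_sup_eq_top g', ?_⟩
  · rw [rowClass_mul_left hu hx hy, ← map_mul]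
  · rw [rowClass_symm hu hab]
  · rw [rowClass_add_left hab]
  · rw [rowClass_of_isUnit_left ha]
    exact map_one f
  · rwa [rowClass_eq]

end Mennicke

section SymbolChar

open IsDedekindDomain nonZeroDivisors

variable {F : Type*} [Field F] [NumberField F] [IsTotallyReal F]
  {p : ℕ} {s : 𝓞 F → 𝓞 F → ℂ} (hs : IsSymbol p s)

lemma sup_span_eq_top_of_sub_mem {I : Ideal (𝓞 F)} {e b : 𝓞 F} (h : e - b ∈ I)
    (hb : I ⊔ Ideal.span {b} = ⊤) : I ⊔ Ideal.span {e} = ⊤ := by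
  refine top_le_iff.1 (hb ▸ sup_le le_sup_left ((Ideal.span_singleton_le_iff_mem _).2 ?_))
  have : b = -(e - b) + e := by ring
  rw [this]
  exact add_mem (Ideal.mem_sup_left (I.neg_mem h)) (Ideal.mem_sup_right (Ideal.mem_span_singleton_self e))

lemma exists_span_eq_mul {I K : Ideal (𝓞 F)} (hI : I ≠ ⊥) (hK : K ≠ ⊥) :
    ∃ (a : 𝓞 F) (J : Ideal (𝓞 F)), a ≠ 0 ∧ Ideal.span {a} = I * J ∧ J ⊔ K = ⊤ := by
  let I' : (Ideal (𝓞 F))⁰ := ⟨I, mem_nonZeroDivisors_iff_ne_zero.2 hI⟩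
  obtain ⟨J, hJ, hJK⟩ := exists_mk0_eq_sup_eq_top (ClassGroup.mk0 I')⁻¹ hK
  obtain ⟨a, ha⟩ := (isPrincipal_mul_iff (I := I') (J := J)).2 (by rw [hJ, inv_inv])
  have ha' : Ideal.span {a} = I * J := ha.symm
  refine ⟨a, J, ?_, ha', hJK⟩
  rintro rfl
  rw [Ideal.span_singleton_zero] at ha'
  exact ideal_mul_ne_bot hI (mem_nonZeroDivisors_iff_ne_zero.1 J.2) ha'.symm

namespace IsSymbol

include hs

lemma congr_left {a a' b : 𝓞 F} (h : Ideal.span {a} ⊔ Ideal.span {b} = ⊤) (h' : a' - a ∈ Ideal.span {b}) :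
    s a' b = s a b := by
  obtain ⟨t, ht⟩ := Ideal.mem_span_singleton'.1 h'
  have : a' = a + t * b := by rw [ht]; ring
  rw [this, hs.add_left a b t h]

lemma congr_right {a b b' : 𝓞 F} (h : Ideal.span {a} ⊔ Ideal.span {b} = ⊤) (h' : b' - b ∈ Ideal.span {a}) :
    s a b' = s a b := by
  have h2 := sup_span_eq_top_of_sub_mem h' h
  rw [sup_comm] at h h2
  rw [hs.symm _ _ h2, hs.symm _ _ h, hs.congr_left h h']

lemma mul_right {a x y : 𝓞 F} (hx : Ideal.span {a} ⊔ Ideal.span {x} = ⊤)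
    (hy : Ideal.span {a} ⊔ Ideal.span {y} = ⊤) : s a (x * y) = s a x * s a y := by
  have hxy : Ideal.span {x * y} ⊔ Ideal.span {a} = ⊤ := by
    rw [← Ideal.span_singleton_mul_span_singleton]
    rw [sup_comm] at hx hy
    exact mul_sup_eq_top hx hy
  rw [sup_comm] at hx hy
  rw [hs.symm _ _ hxy, hs.symm _ _ hx, hs.symm _ _ hy, hs.mul_left _ _ _ hx hy]

lemma of_isUnit_right {a b : 𝓞 F} (hb : IsUnit b) : s a b = 1 := by
  rw [hs.symm b a (by rw [Ideal.span_singleton_eq_top.2 hb, top_sup_eq]), hs.of_isUnit b a hb]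

end IsSymbol

/-- The values on `I` of the ideal character attached to the second argument `b` of a symbol. -/
def SymbolValue (s : 𝓞 F → 𝓞 F → ℂ) (b : 𝓞 F) (I : Ideal (𝓞 F)) (z : ℂ) : Prop :=
  ∃ (a e : 𝓞 F) (J : Ideal (𝓞 F)), a ≠ 0 ∧ Ideal.span {a} = I * J ∧ J ⊔ I = ⊤ ∧ e - b ∈ I ∧ e - 1 ∈ J ∧
    s a e = z

lemma span_sup_span_of_data {a b e : 𝓞 F} {I J : Ideal (𝓞 F)} (ha : Ideal.span {a} = I * J)
    (hI : e - b ∈ I) (hJ : e - 1 ∈ J) (hb : I ⊔ Ideal.span {b} = ⊤) :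
    Ideal.span {a} ⊔ Ideal.span {e} = ⊤ := by
  rw [ha]
  exact mul_sup_eq_top (sup_span_eq_top_of_sub_mem hI hb)
    (sup_span_eq_top_of_sub_mem hJ (by rw [Ideal.span_singleton_one, sup_top_eq]))

lemma ne_bot_of_span_eq_mul {a : 𝓞 F} {I J : Ideal (𝓞 F)} (ha0 : a ≠ 0) (ha : Ideal.span {a} = I * J) :
    I ≠ ⊥ ∧ J ≠ ⊥ := by
  constructor
  · rintro rfl
    rw [Ideal.bot_mul, Ideal.span_singleton_eq_bot] at ha
    exact ha0 ha
  · rintro rfl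
    rw [Ideal.mul_bot, Ideal.span_singleton_eq_bot] at ha
    exact ha0 ha

include hs in
lemma SymbolValue.unique {b : 𝓞 F} {I : Ideal (𝓞 F)} {z z' : ℂ} (hb : I ⊔ Ideal.span {b} = ⊤)
    (h : SymbolValue s b I z) (h' : SymbolValue s b I z') : z = z' := by
  obtain ⟨a, e, J, ha0, ha, hJ, heI, heJ, rfl⟩ := h
  obtain ⟨a', e', J', ha'0, ha', hJ', he'I, he'J, rfl⟩ := h'
  obtain ⟨hI0, hJ0⟩ := ne_bot_of_span_eq_mul ha0 ha
  obtain ⟨g, T, hg0, hg, hT⟩ := exists_span_eq_mul hJ0 hI0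
  have e1 : Ideal.span {a' * g} = Ideal.span {a} * (J' * T) := by
    rw [← Ideal.span_singleton_mul_span_singleton, ha', hg, ha]
    ac_rfl
  obtain ⟨g', hg'⟩ : a ∣ a' * g := by
    rw [← Ideal.mem_span_singleton, ← Ideal.span_singleton_le_iff_mem, e1]
    exact Ideal.mul_le_left
  have e2 : Ideal.span {g'} = J' * T := by
    rw [hg', ← Ideal.span_singleton_mul_span_singleton] at e1
    exact mul_left_cancel₀ (by simpa using ha0) e1
  have hcop : I ⊔ J * (J' * T) = ⊤ := by
    rw [sup_comm]
    exact mul_sup_eq_top hJ (mul_sup_eq_top hJ' hT)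
  obtain ⟨c, hcI, hcJ⟩ := exists_crt hcop b 1
  have aux : ∀ (a e : 𝓞 F) (J : Ideal (𝓞 F)), Ideal.span {a} = I * J → J ⊔ I = ⊤ → e - b ∈ I → e - 1 ∈ J →
      c - 1 ∈ J → s a e = s a c := by
    intro a e J ha hJ heI heJ hcJ
    refine hs.congr_right (span_sup_span_of_data ha hcI hcJ hb) ?_
    rw [ha, mul_eq_inf_of_sup_eq_top (by rwa [sup_comm])]
    exact ⟨by simpa using sub_mem heI hcI, by simpa using sub_mem heJ hcJ⟩
  have aux2 : ∀ g : 𝓞 F, c - 1 ∈ Ideal.span {g} → Ideal.span {g} ⊔ Ideal.span {c} = ⊤ ∧ s g c = 1 := by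
    intro g hg
    have h1 : Ideal.span {g} ⊔ Ideal.span {1} = ⊤ := by rw [Ideal.span_singleton_one, sup_top_eq]
    exact ⟨sup_span_eq_top_of_sub_mem hg h1, by rw [hs.congr_right h1 hg, hs.of_isUnit_right isUnit_one]⟩
  have hc1 : c - 1 ∈ J := Ideal.mul_le_left hcJ
  have hc2 : c - 1 ∈ J' := Ideal.mul_le_left (Ideal.mul_le_right hcJ)
  have hc3 : c - 1 ∈ Ideal.span {g'} := e2 ▸ Ideal.mul_le_right hcJ
  have hc4 : c - 1 ∈ Ideal.span {g} := by
    rw [hg]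
    refine (Ideal.mul_mono_right ?_ : J * (J' * T) ≤ J * T) hcJ
    exact Ideal.mul_le_right
  rw [aux a e J ha hJ heI heJ hc1, aux a' e' J' ha' hJ' he'I he'J hc2]
  have k1 := hs.mul_left a g' c (span_sup_span_of_data ha hcI hc1 hb) (aux2 g' hc3).1
  have k2 := hs.mul_left a' g c (span_sup_span_of_data ha' hcI hc2 hb) (aux2 g hc4).1
  rw [(aux2 g' hc3).2, mul_one] at k1
  rw [(aux2 g hc4).2, mul_one, hg'] at k2
  rw [← k1, k2]

open scoped Classical in
/-- The ideal character attached to the second argument of a symbol. -/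
noncomputable def symbolChar (s : 𝓞 F → 𝓞 F → ℂ) (b : 𝓞 F) (I : Ideal (𝓞 F)) : ℂ :=
  if h : ∃ z, SymbolValue s b I z then h.choose else 1

include hs in
lemma symbolChar_eq {a b e : 𝓞 F} {I J : Ideal (𝓞 F)} (hb : I ⊔ Ideal.span {b} = ⊤) (ha0 : a ≠ 0)
    (ha : Ideal.span {a} = I * J) (hJ : J ⊔ I = ⊤) (heI : e - b ∈ I) (heJ : e - 1 ∈ J) :
    symbolChar s b I = s a e := by
  have h : ∃ z, SymbolValue s b I z := ⟨_, a, e, J, ha0, ha, hJ, heI, heJ, rfl⟩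
  rw [symbolChar, dif_pos h]
  exact SymbolValue.unique hs hb h.choose_spec ⟨a, e, J, ha0, ha, hJ, heI, heJ, rfl⟩

include hs in
lemma symbolChar_pow_eq_one (b : 𝓞 F) (I : Ideal (𝓞 F)) : symbolChar s b I ^ p = 1 := by
  rw [symbolChar]
  split_ifs with h
  · obtain ⟨a, e, J, -, -, -, -, -, h⟩ := h.choose_spec
    rw [← h, hs.pow_eq_one]
  · exact one_pow _

include hs in
lemma symbolChar_span {a b : 𝓞 F} (ha : a ≠ 0) (h : Ideal.span {a} ⊔ Ideal.span {b} = ⊤) :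
    symbolChar s b (Ideal.span {a}) = s a b :=
  symbolChar_eq hs h ha (J := ⊤) (Ideal.mul_top _).symm (by rw [top_sup_eq]) (by simp) trivial

include hs in
lemma symbolChar_mul_left {b : 𝓞 F} {I K : Ideal (𝓞 F)} (hI0 : I ≠ ⊥) (hK0 : K ≠ ⊥)
    (hI : I ⊔ Ideal.span {b} = ⊤) (hK : K ⊔ Ideal.span {b} = ⊤) :
    symbolChar s b (I * K) = symbolChar s b I * symbolChar s b K := by
  have hIK := ideal_mul_ne_bot hI0 hK0
  obtain ⟨a, J, ha0, ha, hJ⟩ := exists_span_eq_mul hI0 hIK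
  obtain ⟨a', J', ha'0, ha', hJ'⟩ := exists_span_eq_mul hK0 hIK
  have hJJ := mul_sup_eq_top hJ hJ'
  obtain ⟨e, heI, heJ⟩ := exists_crt (show I * K ⊔ J * J' = ⊤ by rw [sup_comm]; exact hJJ) b 1
  obtain ⟨hJI, -⟩ := sup_mul_eq_top_iff.1 hJ
  obtain ⟨-, hJK⟩ := sup_mul_eq_top_iff.1 hJ'
  have he1 : e - b ∈ I := Ideal.mul_le_left heI
  have he2 : e - b ∈ K := Ideal.mul_le_right heI
  have he3 : e - 1 ∈ J := Ideal.mul_le_left heJ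
  have he4 : e - 1 ∈ J' := Ideal.mul_le_right heJ
  rw [symbolChar_eq hs hI ha0 ha hJI he1 he3, symbolChar_eq hs hK ha'0 ha' hJK he2 he4,
    symbolChar_eq hs (mul_sup_eq_top hI hK) (mul_ne_zero ha0 ha'0)
      (by rw [← Ideal.span_singleton_mul_span_singleton, ha, ha']; ac_rfl) hJJ heI heJ]
  exact hs.mul_left _ _ _ (span_sup_span_of_data ha he1 he3 hI) (span_sup_span_of_data ha' he2 he4 hK)

include hs in
lemma symbolChar_mul_right {b b' : 𝓞 F} {I : Ideal (𝓞 F)} (hI0 : I ≠ ⊥)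
    (hb : I ⊔ Ideal.span {b} = ⊤) (hb' : I ⊔ Ideal.span {b'} = ⊤) :
    symbolChar s (b * b') I = symbolChar s b I * symbolChar s b' I := by
  obtain ⟨a, J, ha0, ha, hJ⟩ := exists_span_eq_mul hI0 hI0
  obtain ⟨e, heI, heJ⟩ := exists_crt (show I ⊔ J = ⊤ by rwa [sup_comm]) b 1
  obtain ⟨e', he'I, he'J⟩ := exists_crt (show I ⊔ J = ⊤ by rwa [sup_comm]) b' 1
  have hbb : I ⊔ Ideal.span {b * b'} = ⊤ := by
    rw [← Ideal.span_singleton_mul_span_singleton]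
    exact sup_mul_eq_top_iff.2 ⟨hb, hb'⟩
  have h1 : e * e' - b * b' ∈ I := by
    have : e * e' - b * b' = e' * (e - b) + b * (e' - b') := by ring
    rw [this]
    exact add_mem (I.mul_mem_left _ heI) (I.mul_mem_left _ he'I)
  have h2 : e * e' - 1 ∈ J := by
    have : e * e' - 1 = e' * (e - 1) + (e' - 1) := by ring
    rw [this]
    exact add_mem (J.mul_mem_left _ heJ) he'J
  rw [symbolChar_eq hs hb ha0 ha hJ heI heJ, symbolChar_eq hs hb' ha0 ha hJ he'I he'J,
    symbolChar_eq hs hbb ha0 ha hJ h1 h2]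
  exact hs.mul_right (span_sup_span_of_data ha heI heJ hb) (span_sup_span_of_data ha he'I he'J hb')

include hs in
lemma symbolChar_congr {b b' : 𝓞 F} {I : Ideal (𝓞 F)} (hI0 : I ≠ ⊥)
    (hb : I ⊔ Ideal.span {b} = ⊤) (h : b' - b ∈ I) : symbolChar s b' I = symbolChar s b I := by
  obtain ⟨a, J, ha0, ha, hJ⟩ := exists_span_eq_mul hI0 hI0
  obtain ⟨e, heI, heJ⟩ := exists_crt (show I ⊔ J = ⊤ by rwa [sup_comm]) b 1
  rw [symbolChar_eq hs hb ha0 ha hJ heI heJ,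
    symbolChar_eq hs (sup_span_eq_top_of_sub_mem h hb) ha0 ha hJ (e := e) ?_ heJ]
  have : e - b' = (e - b) - (b' - b) := by ring
  rw [this]
  exact sub_mem heI h

include hs in
lemma symbolChar_one {I : Ideal (𝓞 F)} (hI0 : I ≠ ⊥) : symbolChar s 1 I = 1 := by
  obtain ⟨a, J, ha0, ha, hJ⟩ := exists_span_eq_mul hI0 hI0
  rw [symbolChar_eq hs (by rw [Ideal.span_singleton_one, sup_top_eq]) ha0 ha hJ (e := 1) (by simp) (by simp),
    hs.of_isUnit_right isUnit_one]

include hs in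
lemma symbolChar_pow {b : 𝓞 F} {I : Ideal (𝓞 F)} (hI0 : I ≠ ⊥) (hb : I ⊔ Ideal.span {b} = ⊤) (n : ℕ) :
    I ⊔ Ideal.span {b ^ n} = ⊤ ∧ symbolChar s (b ^ n) I = symbolChar s b I ^ n := by
  induction n with
  | zero =>
    rw [pow_zero, pow_zero, symbolChar_one hs hI0, Ideal.span_singleton_one, sup_top_eq]
    exact ⟨rfl, rfl⟩
  | succ n ih =>
    rw [pow_succ, pow_succ, symbolChar_mul_right hs hI0 ih.1 hb, ih.2,
      ← Ideal.span_singleton_mul_span_singleton]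
    exact ⟨sup_mul_eq_top_iff.2 ⟨ih.1, hb⟩, rfl⟩

include hs in
lemma norm_symbolChar (hp : p ≠ 0) (b : 𝓞 F) (I : Ideal (𝓞 F)) : ‖symbolChar s b I‖ = 1 :=
  Complex.norm_eq_one_of_pow_eq_one (symbolChar_pow_eq_one hs b I) hp

include hs in
lemma exists_symbol_rayChar (hp : p ≠ 0) {b : 𝓞 F} (hb0 : b ≠ 0) :
    ∃ χ : Ideal (𝓞 F) →*₀ ℂ, IsRayChar χ (fun _ => 1) (Ideal.span {b}) ∧
      ∀ I, I ≠ ⊥ → I ⊔ Ideal.span {b} = ⊤ → χ I = symbolChar s b I := by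
  refine exists_rayChar (by simpa using hb0) (symbolChar s b)
    (fun I K hI0 hK0 hI hK => symbolChar_mul_left hs hI0 hK0 hI hK)
    (fun I _ _ => norm_symbolChar hs hp b I) isSignLike_one (fun _ _ => by norm_num)
    fun α β hα0 hβ0 hα hβ h => ?_
  rw [symbolChar_span hs hα0 hα, symbolChar_span hs hβ0 hβ, hs.congr_left hβ h]

include hs in
lemma primeBdd_symbolChar (hp : p ≠ 0) {a b : 𝓞 F} (hab : Ideal.span {a} ⊔ Ideal.span {b} = ⊤)
    (hs1 : s a b ≠ 1) :
    PrimeBdd fun q : HeightOneSpectrum (𝓞 F) => (symbolChar s b q.asIdeal).re := by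
  have ha0 : a ≠ 0 := by
    rintro rfl
    rw [Ideal.span_singleton_zero, bot_sup_eq] at hab
    exact hs1 (hs.of_isUnit_right (Ideal.span_singleton_eq_top.1 hab))
  have hb0 : b ≠ 0 := by
    rintro rfl
    rw [Ideal.span_singleton_zero, sup_bot_eq] at hab
    exact hs1 (hs.of_isUnit _ _ (Ideal.span_singleton_eq_top.1 hab))
  obtain ⟨χ, hχ, hχ'⟩ := exists_symbol_rayChar hs hp hb0
  have ha0' : Ideal.span {a} ≠ ⊥ := by simpa using ha0
  have := hχ.primeBdd (Or.inr ⟨rfl, Ideal.span {a}, ha0', hab,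
    by rw [hχ' _ ha0' hab, symbolChar_span hs ha0 hab]; exact hs1⟩)
  refine this.of_le ⟨1, fun q => (Complex.abs_re_le_norm _).trans (norm_symbolChar hs hp _ _).le⟩ _
    (Ideal.finite_factors (I := Ideal.span {b}) (by simpa using hb0)) fun q hq => ?_
  rw [hχ' _ q.ne_bot (HeightOneSpectrum.sup_eq_top q hq)]

end SymbolChar

section SymbolTrivial

open IsDedekindDomain

lemma exists_odd_dirichletCharacter {N : ℕ} [NeZero N] (h : (-1 : ZMod N) ≠ 1) :
    ∃ ω : DirichletCharacter ℂ N, ω.Odd := by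
  obtain ⟨ω, hω⟩ := MulChar.exists_apply_ne_one_of_hasEnoughRootsOfUnity (ZMod N) ℂ h
  refine ⟨ω, ?_⟩
  have : ω (-1) ^ 2 = 1 := by rw [← map_pow]; simp
  exact (sq_eq_one_iff.1 this).resolve_left hω

/-- A modulus for which primes that do not split suitably are detected by an odd character. -/
def oddModulus (p : ℕ) : ℕ := if p = 2 then 4 else p

lemma oddModulus_two : oddModulus 2 = 4 := rfl

lemma oddModulus_of_ne {p : ℕ} (h : p ≠ 2) : oddModulus p = p := if_neg h

lemma oddModulus_ne_zero {p : ℕ} (hp : p.Prime) : oddModulus p ≠ 0 := by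
  rw [oddModulus]
  split_ifs
  exacts [by norm_num, hp.ne_zero]

lemma exists_odd_oddModulus {p : ℕ} (hp : p.Prime) :
    ∃ ω : DirichletCharacter ℂ (oddModulus p), ω.Odd := by
  have : NeZero (oddModulus p) := ⟨oddModulus_ne_zero hp⟩
  refine exists_odd_dirichletCharacter fun h => ?_
  have h2 : ((2 : ℕ) : ZMod (oddModulus p)) = 0 := by
    push_cast
    linear_combination -h
  rw [ZMod.natCast_eq_zero_iff] at h2
  rcases eq_or_ne p 2 with rfl | hp2
  · rw [oddModulus_two] at h2
    omega
  · rw [oddModulus_of_ne hp2] at h2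
    exact hp2 ((Nat.prime_dvd_prime_iff_eq hp Nat.prime_two).1 h2)

variable {F : Type*} [Field F] [NumberField F] [IsTotallyReal F]
  {p : ℕ} {s : 𝓞 F → 𝓞 F → ℂ} (hs : IsSymbol p s)

lemma exists_sq_add_one_mem {P : Ideal (𝓞 F)} (hP : P.IsPrime) (hP0 : P ≠ ⊥)
    (h : Ideal.absNorm P % 4 ≠ 3) : ∃ c : 𝓞 F, c ^ 2 + 1 ∈ P := by
  have hmax := hP.isMaximal hP0
  let _ := Ideal.Quotient.field P
  have : Finite (𝓞 F ⧸ P) := Ring.HasFiniteQuotients.finiteQuotient hP0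
  let _ := Fintype.ofFinite (𝓞 F ⧸ P)
  have hcard : Fintype.card (𝓞 F ⧸ P) = Ideal.absNorm P := by
    rw [Ideal.absNorm_apply, Submodule.cardQuot_apply, Nat.card_eq_fintype_card]
  obtain ⟨r, hr⟩ := FiniteField.isSquare_neg_one_iff.2 (hcard ▸ h)
  obtain ⟨c, rfl⟩ := Ideal.Quotient.mk_surjective r
  refine ⟨c, ?_⟩
  rw [← Ideal.Quotient.eq_zero_iff_mem, map_add, map_pow, map_one, pow_two, ← hr]
  ring

lemma natCast_eq_one_of_dvd {N n : ℕ} (hn : 1 ≤ n) (h : N ∣ n - 1) : (n : ZMod N) = 1 := by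
  rw [← Nat.sub_add_cancel hn, Nat.cast_add, (ZMod.natCast_eq_zero_iff _ _).2 h]
  simp

lemma span_neg_one_sup (I : Ideal (𝓞 F)) : I ⊔ Ideal.span {(-1 : 𝓞 F)} = ⊤ := by
  rw [Ideal.span_singleton_neg, Ideal.span_singleton_one, sup_top_eq]

lemma eq_one_of_pow_sq {z : ℂ} {m : ℕ} (hm : m % 2 = 1) (h2 : z ^ 2 = 1) : z ^ m = z := by
  rw [← Nat.div_add_mod m 2, hm, pow_add, pow_mul, h2, one_pow, one_mul, pow_one]

include hs

lemma symbolChar_neg_one_sq {I : Ideal (𝓞 F)} (hI : I ≠ ⊥) : symbolChar s (-1) I ^ 2 = 1 := by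
  rw [← (symbolChar_pow hs hI (span_neg_one_sup I) 2).2, neg_one_sq, symbolChar_one hs hI]

lemma symbolChar_pow_of_mem {q : Ideal (𝓞 F)} (hq : q ≠ ⊥) {b : 𝓞 F} (hb : q ⊔ Ideal.span {b} = ⊤)
    {n : ℕ} (h : b ^ n - 1 ∈ q) : symbolChar s b q ^ n = 1 := by
  rw [← (symbolChar_pow hs hq hb n).2,
    symbolChar_congr hs hq (by rw [Ideal.span_singleton_one, sup_top_eq]) h, symbolChar_one hs hq]

lemma symbolChar_pow_absNorm_sub_one (q : HeightOneSpectrum (𝓞 F)) {b : 𝓞 F}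
    (hb : q.asIdeal ⊔ Ideal.span {b} = ⊤) : symbolChar s b q.asIdeal ^ (Ideal.absNorm q.asIdeal - 1) = 1 := by
  refine symbolChar_pow_of_mem hs q.ne_bot hb (pow_absNorm_sub_one_sub_one_mem q.isPrime q.ne_bot fun h => ?_)
  rw [sup_eq_left.2 ((Ideal.span_singleton_le_iff_mem _).2 h)] at hb
  exact q.isPrime.ne_top hb

lemma one_sub_mul_one_add_eq_zero (hp : p.Prime) {ω : DirichletCharacter ℂ (oddModulus p)} (hω : ω.Odd)
    (q : HeightOneSpectrum (𝓞 F)) (hq : q.asIdeal ⊔ Ideal.span {(oddModulus p : 𝓞 F)} = ⊤) :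
    (1 - symbolChar s (-1) q.asIdeal) * (1 + ω (Ideal.absNorm q.asIdeal : ℕ)) = 0 := by
  have hsq := symbolChar_neg_one_sq hs q.ne_bot
  rcases eq_or_ne p 2 with rfl | hp2
  · by_cases h3 : Ideal.absNorm q.asIdeal % 4 = 3
    · have h : ((Ideal.absNorm q.asIdeal : ℕ) : ZMod (oddModulus 2)) = -1 := by
        rw [eq_neg_iff_add_eq_zero, ← Nat.cast_one, ← Nat.cast_add, ZMod.natCast_eq_zero_iff,
          oddModulus_two]
        omega
      rw [h, hω, add_neg_cancel, mul_zero]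
    · obtain ⟨c, hc⟩ := exists_sq_add_one_mem q.isPrime q.ne_bot h3
      have hc1 : c ^ 2 - -1 ∈ q.asIdeal := by rwa [sub_neg_eq_add]
      have hc2 := sup_span_eq_top_of_sub_mem hc1 (span_neg_one_sup _)
      have hc3 : q.asIdeal ⊔ Ideal.span {c} = ⊤ := by
        rw [pow_two, ← Ideal.span_singleton_mul_span_singleton] at hc2
        exact (sup_mul_eq_top_iff.1 hc2).1
      rw [← symbolChar_congr hs q.ne_bot (span_neg_one_sup _) hc1, (symbolChar_pow hs q.ne_bot hc3 2).2,
        symbolChar_pow_eq_one hs, sub_self, zero_mul]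
  · have h1 : symbolChar s (-1) q.asIdeal = 1 := by
      rw [← eq_one_of_pow_sq ((hp.eq_two_or_odd).resolve_left hp2) hsq, symbolChar_pow_eq_one hs]
    rw [h1, sub_self, zero_mul]

lemma one_sub_mul_one_sub_mul_eq_zero (hp : p.Prime) (ω : DirichletCharacter ℂ (oddModulus p))
    (q : HeightOneSpectrum (𝓞 F)) (hq : q.asIdeal ⊔ Ideal.span {(oddModulus p : 𝓞 F)} = ⊤)
    {b : 𝓞 F} (hb : q.asIdeal ⊔ Ideal.span {b} = ⊤) :
    (1 - symbolChar s b q.asIdeal) * (1 - ω (Ideal.absNorm q.asIdeal : ℕ)) *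
      (1 + symbolChar s (-1) q.asIdeal) = 0 := by
  have hN : 1 ≤ Ideal.absNorm q.asIdeal := (two_le_absNorm_prime q).trans' one_le_two
  have hpow := symbolChar_pow_absNorm_sub_one hs q hb
  have hp1 := symbolChar_pow_eq_one hs b q.asIdeal
  by_cases hdvd : oddModulus p ∣ Ideal.absNorm q.asIdeal - 1
  · rw [natCast_eq_one_of_dvd hN hdvd, map_one, sub_self, mul_zero, zero_mul]
  rcases eq_or_ne p 2 with rfl | hp2
  · have hodd : Ideal.absNorm q.asIdeal % 2 = 1 := by
      have := coprime_absNorm_of_sup q.ne_bot hq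
      rw [oddModulus_two, show 4 = 2 ^ 2 from rfl, Nat.coprime_pow_right_iff two_pos] at this
      exact Nat.odd_iff.1 (Nat.coprime_two_right.1 this)
    rw [oddModulus_two] at hdvd
    obtain ⟨m, hm, hm2⟩ : ∃ m, Ideal.absNorm q.asIdeal - 1 = m * 2 ∧ m % 2 = 1 :=
      ⟨(Ideal.absNorm q.asIdeal - 1) / 2, by omega, by omega⟩
    have hmem : (b ^ m - 1) * (b ^ m - -1) ∈ q.asIdeal := by
      have := pow_absNorm_sub_one_sub_one_mem q.isPrime q.ne_bot (u := b) fun h => by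
        rw [sup_eq_left.2 ((Ideal.span_singleton_le_iff_mem _).2 h)] at hb
        exact q.isPrime.ne_top hb
      rw [hm, pow_mul] at this
      convert this using 1
      ring
    rcases q.isPrime.mem_or_mem hmem with h | h
    · have := symbolChar_pow_of_mem hs q.ne_bot hb h
      rw [eq_one_of_pow_sq hm2 hp1] at this
      rw [this, sub_self, zero_mul, zero_mul]
    · have h1 := symbolChar_congr hs q.ne_bot (span_neg_one_sup _) h
      rw [(symbolChar_pow hs q.ne_bot hb m).2, eq_one_of_pow_sq hm2 hp1] at h1
      rw [← h1]
      linear_combination -(1 - ω (Ideal.absNorm q.asIdeal : ℕ)) * hp1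
  · rw [oddModulus_of_ne hp2] at hdvd
    have h1 : symbolChar s b q.asIdeal ^ p.gcd (Ideal.absNorm q.asIdeal - 1) = 1 :=
      pow_gcd_eq_one.2 ⟨hp1, hpow⟩
    rw [(hp.coprime_iff_not_dvd.2 hdvd : p.gcd _ = 1), pow_one] at h1
    rw [h1, sub_self, zero_mul, zero_mul]

omit [IsTotallyReal F] [NumberField F] [Field F] hs in
lemma one_le_of_relations {t x y z : ℂ} (ht : t ^ 2 = 1) (hx : ‖x‖ = 1) (hy : ‖y‖ = 1) (hz : ‖z‖ = 1)
    (h : (1 - t) * (1 + z) = 0) (h1 : (1 - x) * (1 - z) * (1 + t) = 0)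
    (h2 : (1 - y) * (1 - z) * (1 + t) = 0) :
    1 ≤ 2 * (x.re + (t * x).re + (y.re + (t * y).re) + ((x * y⁻¹).re + (t * (x * y⁻¹)).re)) +
      (4 * (z.re + (t * z).re) + (t * z).re) := by
  have hsq : ∀ w : ℂ, ‖w‖ = 1 → w.re * w.re + w.im * w.im = 1 := fun w hw => by
    rw [← Complex.normSq_apply, Complex.normSq_eq_norm_sq, hw, one_pow]
  have hx' := hsq x hx
  have hy' := hsq y hy
  have hz' := hsq z hz
  rcases sq_eq_one_iff.1 ht with rfl | rfl
  · rw [show (1 : ℂ) + 1 = 2 by norm_num] at h1 h2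
    by_cases hz1 : z = 1
    · rw [hz1, Complex.inv_eq_conj hy]
      simp only [one_mul, Complex.mul_re, Complex.conj_re, Complex.conj_im, Complex.one_re]
      nlinarith [sq_nonneg (1 + x.re + y.re), sq_nonneg (x.im + y.im)]
    · have hx1 : x = 1 := by
        have : 1 - z ≠ 0 := sub_ne_zero.2 (Ne.symm hz1)
        have h3 : 1 - x = 0 := by simpa [this] using h1
        linear_combination -h3
      have hy1 : y = 1 := by
        have : 1 - z ≠ 0 := sub_ne_zero.2 (Ne.symm hz1)
        have h3 : 1 - y = 0 := by simpa [this] using h2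
        linear_combination -h3
      rw [hx1, hy1]
      norm_num
      nlinarith [sq_nonneg z.im]
  · have hz1 : z = -1 := by linear_combination h / 2
    rw [hz1]
    norm_num

end SymbolTrivial

section NoSymbol

open IsDedekindDomain

variable {F : Type*} [Field F] [NumberField F] [IsTotallyReal F]
  {p : ℕ} {s : 𝓞 F → 𝓞 F → ℂ}

lemma not_isSymbol (hp : p.Prime) (hs : IsSymbol p s) : False := by
  obtain ⟨a, b, hab, hs1⟩ := hs.exists_ne_one
  have hp0 := hp.ne_zero
  have ne_zero : ∀ a b : 𝓞 F, Ideal.span {a} ⊔ Ideal.span {b} = ⊤ → s a b ≠ 1 → a ≠ 0 ∧ b ≠ 0 := by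
    refine fun a b hab hs1 => ⟨?_, ?_⟩
    · rintro rfl
      rw [Ideal.span_singleton_zero, bot_sup_eq] at hab
      exact hs1 (hs.of_isUnit_right (Ideal.span_singleton_eq_top.1 hab))
    · rintro rfl
      rw [Ideal.span_singleton_zero, sup_bot_eq] at hab
      exact hs1 (hs.of_isUnit _ _ (Ideal.span_singleton_eq_top.1 hab))
  obtain ⟨ha0, hb0⟩ := ne_zero a b hab hs1
  obtain ⟨t, ht⟩ := exists_add_mul_sup (a := a) (c := b) hab.symm top_ne_bot (K := Ideal.span {b})
    (by simpa using hb0)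
  obtain ⟨c, hc⟩ : ∃ c, c = b + t * a := ⟨_, rfl⟩
  rw [← hc, Ideal.top_mul] at ht
  have hca : c - b ∈ Ideal.span {a} := Ideal.mem_span_singleton'.2 ⟨t, by rw [hc]; ring⟩
  have hac := sup_span_eq_top_of_sub_mem hca hab
  have hs1' : s a c ≠ 1 := by rwa [hs.congr_right hab hca]
  obtain ⟨-, hc0⟩ := ne_zero a c hac hs1'
  obtain ⟨d, hdb, hdc⟩ := exists_crt (show Ideal.span {b} ⊔ Ideal.span {c} = ⊤ by rwa [sup_comm]) a 1
  have hdb' : Ideal.span {d} ⊔ Ideal.span {b} = ⊤ := by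
    rw [sup_comm] at hab ⊢
    exact sup_span_eq_top_of_sub_mem hdb hab
  have hdc' : Ideal.span {d} ⊔ Ideal.span {c} = ⊤ := by
    rw [sup_comm]
    exact sup_span_eq_top_of_sub_mem hdc (by rw [Ideal.span_singleton_one, sup_top_eq])
  have hsd : s d c = 1 := by
    rw [hs.congr_left (by rw [Ideal.span_singleton_one, top_sup_eq]) hdc, hs.of_isUnit _ _ isUnit_one]
  have hpow : ∀ n : ℕ, Ideal.span {d} ⊔ Ideal.span {c ^ n} = ⊤ ∧ s d (c ^ n) = 1 := by
    intro n
    induction n with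
    | zero =>
      rw [pow_zero, Ideal.span_singleton_one, sup_top_eq]
      exact ⟨rfl, hs.of_isUnit_right isUnit_one⟩
    | succ n ih =>
      rw [pow_succ, hs.mul_right ih.1 hdc', ih.2, hsd, one_mul, ← Ideal.span_singleton_mul_span_singleton]
      exact ⟨sup_mul_eq_top_iff.2 ⟨ih.1, hdc'⟩, rfl⟩
  have hdbc : Ideal.span {d} ⊔ Ideal.span {b * c ^ (p - 1)} = ⊤ := by
    rw [← Ideal.span_singleton_mul_span_singleton]
    exact sup_mul_eq_top_iff.2 ⟨hdb', (hpow _).1⟩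
  have hsdbc : s d (b * c ^ (p - 1)) ≠ 1 := by
    rw [hs.mul_right hdb' (hpow _).1, (hpow _).2, mul_one]
    rw [sup_comm] at hab
    rwa [hs.congr_left (by rwa [sup_comm]) hdb]
  have neg : ∀ a b : 𝓞 F, Ideal.span {a} ⊔ Ideal.span {b} = ⊤ → s a b ≠ 1 →
      PrimeBdd fun q : HeightOneSpectrum (𝓞 F) => (symbolChar s (-1 * b) q.asIdeal).re := by
    intro a b hab h
    refine primeBdd_symbolChar hs hp0 (a := a) ?_ ?_
    · rwa [neg_one_mul, Ideal.span_singleton_neg]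
    · rwa [hs.mul_right (span_neg_one_sup _) hab, hs.of_isUnit_right isUnit_one.neg, one_mul]
  obtain ⟨ω, hω⟩ := exists_odd_oddModulus hp
  obtain ⟨χ, hχ, hχ'⟩ := exists_normChar (F := F) (oddModulus_ne_zero hp) ω (Or.inr ⟨hω, rfl⟩)
  obtain ⟨θ, hθ, hθ'⟩ := exists_symbol_rayChar hs hp0 (b := -1) (by simp)
  have hθχ : PrimeBdd fun q : HeightOneSpectrum (𝓞 F) => ((θ * χ) q.asIdeal).re :=
    (hθ.mul hχ).primeBdd (Or.inl (funext fun x => one_mul _))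
  have h1 := ((primeBdd_symbolChar hs hp0 hab hs1).add (neg a b hab hs1)).add
    (((primeBdd_symbolChar hs hp0 hac hs1').add (neg a c hac hs1')).add
      ((primeBdd_symbolChar hs hp0 hdbc hsdbc).add (neg _ _ hdbc hsdbc)))
  have h2 := ((((hχ.primeBdd (Or.inl rfl)).add hθχ).const_mul (by norm_num : (0 : ℝ) ≤ 4)).add hθχ)
  have h3 := (h1.const_mul (by norm_num : (0 : ℝ) ≤ 2)).add h2
  refine not_primeBdd_one (F := F) (h3.of_le ⟨1, fun q => by simp⟩ _
    (Ideal.finite_factors (I := Ideal.span {b} * (Ideal.span {c} * Ideal.span {(oddModulus p : 𝓞 F)}))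
      (ideal_mul_ne_bot (by simpa using hb0) (ideal_mul_ne_bot (by simpa using hc0) hχ.ne_bot)))
    fun q hq => ?_)
  obtain ⟨hqb, hq⟩ := sup_mul_eq_top_iff.1 (HeightOneSpectrum.sup_eq_top q hq)
  obtain ⟨hqc, hqN⟩ := sup_mul_eq_top_iff.1 hq
  have hq1 := span_neg_one_sup q.asIdeal
  obtain ⟨hqc', hqcp⟩ := symbolChar_pow hs q.ne_bot hqc (p - 1)
  have hqbc : q.asIdeal ⊔ Ideal.span {b * c ^ (p - 1)} = ⊤ := by
    rw [← Ideal.span_singleton_mul_span_singleton]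
    exact sup_mul_eq_top_iff.2 ⟨hqb, hqc'⟩
  have hinv : symbolChar s c q.asIdeal ^ (p - 1) = (symbolChar s c q.asIdeal)⁻¹ := by
    refine eq_inv_of_mul_eq_one_left ?_
    rw [← pow_succ, Nat.sub_add_cancel hp.one_lt.le, symbolChar_pow_eq_one hs]
  have hz : ‖ω (Ideal.absNorm q.asIdeal : ℕ)‖ = 1 := by
    have := DirichletCharacter.unit_norm_eq_one ω
      (ZMod.unitOfCoprime _ (coprime_absNorm_of_sup q.ne_bot hqN))
    simpa using this
  have hm : (θ * χ) q.asIdeal = θ q.asIdeal * χ q.asIdeal := rfl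
  have key := one_le_of_relations (symbolChar_neg_one_sq hs q.ne_bot) (norm_symbolChar hs hp0 b q.asIdeal)
    (norm_symbolChar hs hp0 c q.asIdeal) hz (one_sub_mul_one_add_eq_zero hs hp hω q hqN)
    (one_sub_mul_one_sub_mul_eq_zero hs hp ω q hqN hqb) (one_sub_mul_one_sub_mul_eq_zero hs hp ω q hqN hqc)
  rw [symbolChar_mul_right hs q.ne_bot hq1 hqb, symbolChar_mul_right hs q.ne_bot hq1 hqc,
    symbolChar_mul_right hs q.ne_bot hq1 hqbc, symbolChar_mul_right hs q.ne_bot hqb hqc', hqcp, hinv,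
    hm, hθ' _ q.ne_bot hq1, hχ' _ q.ne_bot hqN]
  linarith

end NoSymbol

section Main

open Matrix

variable {F : Type*} [Field F] [NumberField F]

lemma exists_unit_forall_pow_ne_one [IsTotallyReal F] (h : Module.finrank ℚ F ≠ 1) :
    ∃ u : (𝓞 F)ˣ, ∀ j, 1 ≤ j → u ^ j ≠ 1 := by
  by_contra! hu
  have hrank : Units.rank F = 0 := by
    by_contra h0
    let i : Fin (Units.rank F) := ⟨0, Nat.pos_of_ne_zero h0⟩
    obtain ⟨j, hj, huj⟩ := hu (Units.fundSystem F i)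
    have h1 : Units.logEmbedding F (Additive.ofMul (Units.fundSystem F i)) = 0 :=
      Units.dirichletUnitTheorem.logEmbedding_eq_zero_iff.2
        ((CommGroup.mem_torsion _).2 (isOfFinOrder_iff_pow_eq_one.2 ⟨j, hj, huj⟩))
    rw [Units.logEmbedding_fundSystem] at h1
    exact (Units.basisUnitLattice F).ne_zero i (Subtype.ext h1)
  have h1 := InfinitePlace.card_add_two_mul_card_eq_rank F
  have h2 := InfinitePlace.card_eq_nrRealPlaces_add_nrComplexPlaces F
  rw [IsTotallyReal.nrComplexPlaces_eq_zero] at h1 h2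
  have h3 : Module.finrank ℚ F > 0 := Module.finrank_pos
  rw [Units.rank] at hrank
  omega

lemma int_castRingHom_surjective (h : Module.finrank ℚ F = 1) :
    Function.Surjective (Int.castRingHom (𝓞 F)) := by
  intro x
  obtain ⟨q, hq⟩ := (finrank_eq_one_iff_of_nonzero' (1 : F) one_ne_zero).1 h x
  rw [← Algebra.algebraMap_eq_smul_one] at hq
  have hint : IsIntegral ℤ q := by
    refine (isIntegral_algebraMap_iff (algebraMap ℚ F).injective).1 ?_
    rw [hq]
    exact x.2
  obtain ⟨n, rfl⟩ := IsIntegrallyClosed.isIntegral_iff.1 hint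
  refine ⟨n, RingOfIntegers.ext ?_⟩
  rw [← hq]
  simp

lemma elem_eq_top_of_int_surjective {R : Type*} [CommRing R]
    (h : Function.Surjective (Int.castRingHom R)) (hinj : Function.Injective (Int.castRingHom R)) :
    elem R = ⊤ := by
  refine eq_top_iff.2 fun g _ => ?_
  choose f hf using h
  have hdet : !![f (g 0 0), f (g 0 1); f (g 1 0), f (g 1 1)].det = 1 := by
    apply hinj
    rw [det_fin_two_of, map_sub, map_mul, map_mul, hf, hf, hf, hf, map_one]
    exact det_eq_one g
  have hmap : ∀ (A : SpecialLinearGroup (Fin 2) ℤ) (i j : Fin 2),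
      SpecialLinearGroup.map (Int.castRingHom R) A i j = (A i j : R) := fun _ _ _ => rfl
  obtain ⟨g', hg'⟩ : ∃ g' : SpecialLinearGroup (Fin 2) ℤ, SpecialLinearGroup.map (Int.castRingHom R) g' = g :=
    ⟨⟨_, hdet⟩, sl2_ext (hf _) (hf _) (hf _) (hf _)⟩
  have : Subgroup.closure {ModularGroup.S, ModularGroup.T} ≤
      (elem R).comap (SpecialLinearGroup.map (Int.castRingHom R)) := by
    rw [Subgroup.closure_le]
    rintro _ (rfl | rfl)
    · have : SpecialLinearGroup.map (Int.castRingHom R) ModularGroup.S = weyl⁻¹ := by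
        refine eq_inv_of_mul_eq_one_left (sl2_ext ?_ ?_ ?_ ?_) <;>
          simp only [mul00, mul01, mul10, mul11, hmap] <;> simp [ModularGroup.S, weyl]
      change SpecialLinearGroup.map (Int.castRingHom R) ModularGroup.S ∈ elem R
      rw [this]
      exact inv_mem weyl_mem
    · have : SpecialLinearGroup.map (Int.castRingHom R) ModularGroup.T = upper 1 := by
        refine sl2_ext ?_ ?_ ?_ ?_ <;> rw [hmap] <;> simp [ModularGroup.T]
      change SpecialLinearGroup.map (Int.castRingHom R) ModularGroup.T ∈ elem R
      rw [this]
      exact upper_mem 1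
  rw [SpecialLinearGroup.SL2Z_generators] at this
  exact hg' ▸ this (Subgroup.mem_top g')

lemma elem_eq_top [IsTotallyReal F] : elem (𝓞 F) = ⊤ := by
  by_cases h : Module.finrank ℚ F = 1
  · exact elem_eq_top_of_int_surjective (int_castRingHom_surjective h) (Int.castRingHom (𝓞 F)).injective_int
  obtain ⟨u, hu⟩ := exists_unit_forall_pow_ne_one h
  have := elem_normal hu
  by_contra htop
  obtain ⟨p, hp, s, hs⟩ := exists_isSymbol hu htop
  exact not_isSymbol hp hs

end Main

end NumberField.TotallyRealSL2

/-- For a totally real number field `F`, the group `SL₂(𝓞 F)` is generated by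
the unipotent matrices `(1 a; 0 1)` with `a ∈ 𝓞 F`, the diagonal matrices `(u 0; 0 u⁻¹)` with
`u` a unit of `𝓞 F`, and the inversion matrix `(0 1; -1 0)`. -/
theorem specialLinearGroup_ringOfIntegers_generators
    (F : Type*) [Field F] [NumberField F]
    (hF : ∀ v : InfinitePlace F, v.IsReal) :
    Subgroup.closure
      {A : Matrix.SpecialLinearGroup (Fin 2) (𝓞 F) |
        (∃ a : 𝓞 F, (A : Matrix (Fin 2) (Fin 2) (𝓞 F)) = !![1, a; 0, 1]) ∨
        (∃ u : (𝓞 F)ˣ, (A : Matrix (Fin 2) (Fin 2) (𝓞 F)) =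
          !![(u : 𝓞 F), 0; 0, ((u⁻¹ : (𝓞 F)ˣ) : 𝓞 F)]) ∨
        (A : Matrix (Fin 2) (Fin 2) (𝓞 F)) = !![0, 1; -1, 0]} = ⊤ := by
  have : IsTotallyReal F := ⟨hF⟩
  rw [eq_top_iff, ← NumberField.TotallyRealSL2.elem_eq_top (F := F),
    NumberField.TotallyRealSL2.elem, Subgroup.closure_le]
  rintro A ((⟨a, rfl⟩ | ⟨u, rfl⟩) | rfl)
  · exact Subgroup.subset_closure (Or.inl ⟨a, rfl⟩)
  · exact Subgroup.subset_closure (Or.inr (Or.inl ⟨u, rfl⟩))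
  · exact Subgroup.subset_closure (Or.inr (Or.inr rfl))
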